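/- Let G be the non quasi-split unramified unitary group in four variables over F_0, m ≥ 1, n = 6m−3, Λ = Λ_4, and β = ϖ^{−m}(Y E_23 − ϖ Ȳ E_32) with Y ∈ o_F^×; set J = (1 + 𝔍_+) ∩ G (here J = J_+ since n is odd), Ψ = Ψ_β the character of J given by Ψ(p) = ψ_0(tr_{A/F_0}(β(p−1))), G_E = G ∩ B, and J' = G_E ∩ J. Then there exists a support-preserving *-isomorphism η : H(G_E//J', Ψ) → H(G//J, Ψ); explicitly, η(e_g) = (vol(J'gJ')/vol(JgJ))^{1/2} f_g for g ∈ G_E, where e_g ∈ H(G_E//J', Ψ) has support J'gJ' with e_g(g) = 1 and f_g ∈ H(G//J, Ψ) has support JgJ with f_g(g) = 1. -/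

import Mathlib

/-!
Common framework for formalizing statements from
"Representations of non quasi-split U(4) over a p-adic field I" (M. Miyauchi).

We model the non-archimedean local field `F` with its (possibly trivial) Galois
involution, ring of integers `O`, uniformizer `ϖ`, a finite-dimensional hermitian
space `(V, h)` over `F`, the adjoint involution `σA` on `A = End_F V`, the unitary
group `G = {g ∈ A^× | g σ(g) = 1}` (as a subgroup of `Aˣ`), self-dual lattice
sequences, the filtrations `a_n(Λ)`, the congruence subsets `P_n(Λ)`, skew
(semisimple) strata, characters attached to strata, smooth representations, and
Hecke algebras.
-/

noncomputable section
open scoped Classical Pointwise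

universe u v w

/-- The ambient data: a field `F` with involution `conj` (Galois involution of
`F/F₀`), ring of integers `O` (a valuation subring with uniformizer `ϖ` and finite
residue field), a hermitian space `(V, h)` and the adjoint involution `σA` on
`End_F V` induced by `h`. -/
structure USetting (F : Type u) [Field F] (V : Type v) [AddCommGroup V] [Module F V] where
  /-- the Galois involution `x ↦ x̄` on `F` -/
  conj : F ≃+* F
  conj_invol : ∀ x : F, conj (conj x) = x
  /-- the ring of integers `o_F` -/
  O : Subring F
  /-- a uniformizer `ϖ_F` -/
  ϖ : F
  ϖ_mem : ϖ ∈ O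
  ϖ_ne_zero : ϖ ≠ 0
  ϖ_not_unit : ∀ y ∈ O, ϖ * y ≠ 1
  conj_O : ∀ x ∈ O, conj x ∈ O
  /-- `O` is a valuation ring of `F` -/
  O_val : ∀ x : F, x ≠ 0 → x ∈ O ∨ x⁻¹ ∈ O
  /-- every nonunit of `O` is divisible by `ϖ`: the maximal ideal is `ϖO` -/
  unif : ∀ x ∈ O, (∀ y ∈ O, x * y ≠ 1) → ∃ z ∈ O, x = ϖ * z
  /-- the residue field `o_F/p_F` is finite -/
  res_fin : Finite (O ⧸ (Ideal.span {(⟨ϖ, ϖ_mem⟩ : O)} : Ideal O))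
  /-- the hermitian form `h` on `V` -/
  h : V → V → F
  h_add_left : ∀ u v w : V, h (u + v) w = h u w + h v w
  h_smul_left : ∀ (c : F) (u w : V), h (c • u) w = conj c * h u w
  h_conj_symm : ∀ u w : V, h w u = conj (h u w)
  h_nondeg : ∀ u : V, (∀ w : V, h u w = 0) → u = 0
  /-- the involution on `A = End_F V` induced by `h` -/
  σA : Module.End F V → Module.End F V
  σA_adj : ∀ (X : Module.End F V) (u w : V), h (X u) w = h u (σA X w)
  σA_one : σA 1 = 1
  σA_mul : ∀ X Y, σA (X * Y) = σA Y * σA X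
  σA_add : ∀ X Y, σA (X + Y) = σA X + σA Y
  σA_invol : ∀ X, σA (σA X) = X

namespace USetting

variable {F : Type u} [Field F] {V : Type v} [AddCommGroup V] [Module F V]
variable (S : USetting F V)

/-- the maximal ideal `p_F = ϖ o_F` of `o_F`, as a subset of `F` -/
def pF : Set F := {y : F | ∃ z ∈ S.O, y = S.ϖ * z}

/-- the residue characteristic of `F` -/
def residueChar : ℕ :=
  ringChar (S.O ⧸ (Ideal.span {(⟨S.ϖ, S.ϖ_mem⟩ : S.O)} : Ideal S.O))

/-- An `o_F`-lattice sequence in `V`: a decreasing `ℤ`-indexed family of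
`o_F`-submodules of `V`, periodic with (minimal) period `e` under multiplication
by `ϖ`. -/
structure LatSeq where
  L : ℤ → Set V
  zero_mem : ∀ i, (0 : V) ∈ L i
  add_mem : ∀ i, ∀ v w : V, v ∈ L i → w ∈ L i → v + w ∈ L i
  smul_mem : ∀ i, ∀ c ∈ S.O, ∀ v ∈ L i, c • v ∈ L i
  dec : ∀ i, L (i + 1) ⊆ L i
  e : ℤ
  e_pos : 0 < e
  periodic : ∀ i, L (i + e) = S.ϖ • L i
  e_min : ∀ e' : ℤ, 0 < e' → (∀ i, L (i + e') = S.ϖ • L i) → e ≤ e'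

/-- each member of the sequence is a full `o_F`-lattice in `V`
(finitely generated over `o_F` and spanning `V` over `F`) -/
def IsFull (Λ : S.LatSeq) : Prop :=
  ∀ i : ℤ, Submodule.span F (Λ.L i) = ⊤ ∧
    ∃ s : Finset V, ↑s ⊆ Λ.L i ∧
      ∀ v ∈ Λ.L i, ∃ c : V → F, (∀ w ∈ s, c w ∈ S.O) ∧ v = ∑ w ∈ s, c w • w

/-- the filtration `a_n(Λ)` of `A = End_F V` -/
def aFil (Λ : S.LatSeq) (n : ℤ) : Set (Module.End F V) :=
  {X : Module.End F V | ∀ i : ℤ, ∀ v ∈ Λ.L i, X v ∈ Λ.L (i + n)}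

/-- `A_- = {X ∈ A | X + σ(X) = 0}` -/
def Aminus : Set (Module.End F V) := {X | S.σA X = -X}

/-- the dual lattice `L^# = {v | h(v, L) ⊆ o_F}` -/
def dualLat (L : Set V) : Set V := {v : V | ∀ w ∈ L, S.h v w ∈ S.O}

/-- `Λ` is self-dual with duality invariant `d`: `Λ(i)^# = Λ(d - i)` -/
def selfDualWith (Λ : S.LatSeq) (d : ℤ) : Prop :=
  ∀ i : ℤ, S.dualLat (Λ.L i) = Λ.L (d - i)

def isSelfDual (Λ : S.LatSeq) : Prop := ∃ d : ℤ, S.selfDualWith Λ d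

/-- the unitary group `G = {g ∈ A^× | g σ(g) = 1}` as a subgroup of `Aˣ` -/
def GU : Subgroup (Module.End F V)ˣ where
  carrier := {u : (Module.End F V)ˣ |
    S.σA (u : Module.End F V) = ((u⁻¹ : (Module.End F V)ˣ) : Module.End F V)}
  one_mem' := by simpa using S.σA_one
  mul_mem' := by
    intro a b ha hb
    simp only [Set.mem_setOf_eq] at *
    rw [Units.val_mul, S.σA_mul, ha, hb, mul_inv_rev, Units.val_mul]
  inv_mem' := by
    intro a ha
    simp only [Set.mem_setOf_eq] at *
    rw [← ha, S.σA_invol, inv_inv]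

/-- the underlying endomorphism of an element of `G` -/
def toE (g : S.GU) : Module.End F V := ((g : (Module.End F V)ˣ) : Module.End F V)

/-- `P_k(Λ) = G ∩ (1 + a_k(Λ))` (for `k ≥ 1`) -/
def Pset (Λ : S.LatSeq) (k : ℤ) : Set S.GU := {g : S.GU | S.toE g - 1 ∈ S.aFil Λ k}

/-- `P_0(Λ) = G ∩ a_0(Λ)` -/
def P0set (Λ : S.LatSeq) : Set S.GU := {g : S.GU | S.toE g ∈ S.aFil Λ 0}

/-- `B`, the `A`-centralizer of `β` -/
def Bcent (β : Module.End F V) : Set (Module.End F V) := {X | X * β = β * X}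

/-- `B^⊥`, the orthogonal complement of `B` in `A` w.r.t. the pairing `(x,y) ↦ tr_{A/F}(xy)` -/
def Bperp (β : Module.End F V) : Set (Module.End F V) :=
  {X | ∀ Y ∈ Bcent β, LinearMap.trace F V (X * Y) = 0}

/-- sum of two subsets of `A` -/
def setAdd (s t : Set (Module.End F V)) : Set (Module.End F V) :=
  {z | ∃ x ∈ s, ∃ y ∈ t, z = x + y}

/-- `𝔍 = a'_n ⊕ a^⊥_{[(n+1)/2]}` -/
def frakJ (Λ : S.LatSeq) (n : ℤ) (β : Module.End F V) : Set (Module.End F V) :=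
  setAdd (S.aFil Λ n ∩ Bcent β) (S.aFil Λ ((n + 1) / 2) ∩ Bperp β)

/-- `𝔍₊ = a'_n ⊕ a^⊥_{[n/2]+1}` -/
def frakJplus (Λ : S.LatSeq) (n : ℤ) (β : Module.End F V) : Set (Module.End F V) :=
  setAdd (S.aFil Λ n ∩ Bcent β) (S.aFil Λ (n / 2 + 1) ∩ Bperp β)

/-- `J = (1 + 𝔍) ∩ G` -/
def Jset (Λ : S.LatSeq) (n : ℤ) (β : Module.End F V) : Set S.GU :=
  {g : S.GU | S.toE g - 1 ∈ S.frakJ Λ n β}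

/-- `J₊ = (1 + 𝔍₊) ∩ G` -/
def Jplusset (Λ : S.LatSeq) (n : ℤ) (β : Module.End F V) : Set S.GU :=
  {g : S.GU | S.toE g - 1 ∈ S.frakJplus Λ n β}

/-- `G_E = G ∩ B`, the `G`-centralizer of `β` -/
def GEset (β : Module.End F V) : Set S.GU := {g : S.GU | S.toE g ∈ Bcent β}

/-- the set `J G_E J` -/
def JGEJ (Λ : S.LatSeq) (n : ℤ) (β : Module.End F V) : Set S.GU :=
  {a : S.GU | ∃ j₁ ∈ S.Jset Λ n β, ∃ c ∈ S.GEset β, ∃ j₂ ∈ S.Jset Λ n β, a = j₁ * c * j₂}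

/-- `ν_Λ(X) = k`, i.e. `X ∈ a_k(Λ) \ a_{k+1}(Λ)` -/
def HasVal (Λ : S.LatSeq) (X : Module.End F V) (k : ℤ) : Prop :=
  X ∈ S.aFil Λ k ∧ X ∉ S.aFil Λ (k + 1)

/-- `y_β = ϖ^{n/k} β^{e/k}` where `k = gcd(e(Λ), n)` -/
def ybeta (Λ : S.LatSeq) (n : ℤ) (β : Module.End F V) : Module.End F V :=
  S.ϖ ^ ((n / (Int.gcd Λ.e n : ℤ)).toNat) • β ^ ((Λ.e / (Int.gcd Λ.e n : ℤ)).toNat)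

/-- two polynomials over `F` with integral coefficients are coprime modulo `p_F` -/
def CoprimeModP (f g : Polynomial F) : Prop :=
  ∃ u v : Polynomial F, (∀ i, u.coeff i ∈ S.O) ∧ (∀ i, v.coeff i ∈ S.O) ∧
    ∀ i, (u * f + v * g - 1).coeff i ∈ S.pF

/-- the filtration `a_m(Λ ∩ U)` on `End_F(U)` cut out by a subspace `U ⊆ V` -/
def aFilOn (Λ : S.LatSeq) (U : Submodule F V) (m : ℤ) : Set (Module.End F U) :=
  {X : Module.End F U | ∀ i : ℤ, ∀ v : U, (v : V) ∈ Λ.L i → ((X v : U) : V) ∈ Λ.L (i + m)}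

def HasValOn (Λ : S.LatSeq) (U : Submodule F V) (X : Module.End F U) (k : ℤ) : Prop :=
  X ∈ S.aFilOn Λ U k ∧ X ∉ S.aFilOn Λ U (k + 1)

/-- `x` is integral over `o_F` -/
def IsIntegralO {R : Type*} [Ring R] [Algebra F R] (x : R) : Prop :=
  ∃ p : Polynomial F, p.Monic ∧ (∀ i, p.coeff i ∈ S.O) ∧ Polynomial.aeval x p = 0

/-- `[Λ|U, n, n-1, βU]` is a simple stratum: `E = F[βU]` is a field, `Λ|U` is an
`o_E`-lattice sequence, `ν(βU) = -n`, and `βU` is minimal over `F` (expressed by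
the standard equivalent exactness property of `ad(βU)`, cf. Bushnell–Kutzko
(1.4.9), (1.4.15)). -/
def SimpleOn (Λ : S.LatSeq) (n : ℤ) (U : Submodule F V) (βU : Module.End F U) : Prop :=
  IsField (Algebra.adjoin F ({βU} : Set (Module.End F U))) ∧
  (∀ x : Module.End F U, x ∈ Algebra.adjoin F ({βU} : Set (Module.End F U)) →
      S.IsIntegralO x → ∀ i : ℤ, ∀ v : U, (v : V) ∈ Λ.L i → ((x v : U) : V) ∈ Λ.L i) ∧
  S.HasValOn Λ U βU (-n) ∧
  (∀ m : ℤ, ∀ X ∈ S.aFilOn Λ U m, βU * X - X * βU ∈ S.aFilOn Λ U (m - n + 1) →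
      ∃ Y : Module.End F U, Y * βU = βU * Y ∧ X - Y ∈ S.aFilOn Λ U (m + 1))

/-- `E = F[βU]` is tamely ramified over `F`: the ramification index
`e(E/F) = e(Λ)/g`, where `g` generates the value group `ν_Λ(E^×)`, is prime to
the residue characteristic. -/
def TameOn (Λ : S.LatSeq) (U : Submodule F V) (βU : Module.End F U) : Prop :=
  ∃ g : ℤ, 0 < g ∧
    (∀ x : Module.End F U, x ∈ Algebra.adjoin F ({βU} : Set (Module.End F U)) → x ≠ 0 →
        ∃ m : ℤ, g ∣ m ∧ S.HasValOn Λ U x m) ∧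
    (∃ x : Module.End F U, x ∈ Algebra.adjoin F ({βU} : Set (Module.End F U)) ∧
        S.HasValOn Λ U x g) ∧
    ¬ ((S.residueChar : ℤ) ∣ (Λ.e / g))

/-- restriction of an endomorphism to an invariant subspace -/
def restr (β : Module.End F V) (U : Submodule F V) (hU : ∀ v ∈ U, β v ∈ U) :
    Module.End F U :=
  LinearMap.restrict β hU

lemma pow_inv (β : Module.End F V) (U : Submodule F V) (hU : ∀ v ∈ U, β v ∈ U) :
    ∀ m : ℕ, ∀ v ∈ U, (β ^ m) v ∈ U := by
  intro m
  induction m with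
  | zero => intro v hv; simpa using hv
  | succ t ih =>
      intro v hv
      rw [pow_succ]
      exact ih _ (hU v hv)

lemma ybeta_inv (Λ : S.LatSeq) (n : ℤ) (β : Module.End F V) (U : Submodule F V)
    (hU : ∀ v ∈ U, β v ∈ U) : ∀ v ∈ U, S.ybeta Λ n β v ∈ U := by
  intro v hv
  show (S.ϖ ^ ((n / (Int.gcd Λ.e n : ℤ)).toNat) •
      β ^ ((Λ.e / (Int.gcd Λ.e n : ℤ)).toNat)) v ∈ U
  rw [LinearMap.smul_apply]
  exact U.smul_mem _ (pow_inv β U hU _ v hv)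

variable [FiniteDimensional F V]

/-- `[Λ, n, n-1, β]` is a skew semisimple stratum, split with respect to the
orthogonal `F`-splitting `V = W 0 ⊥ … ⊥ W (k-1)`: `Λ` is a full self-dual
lattice sequence, `β` is skew with `ν_Λ(β) = -n`, the splitting is orthogonal,
compatible with `Λ` and preserved by `β`, each restricted stratum is zero or
simple, no characteristic polynomial of a nonzero component is divisible by `X`
mod `p_F`, and the characteristic polynomials of distinct components are
coprime mod `p_F`. -/
structure IsSkewSS (Λ : S.LatSeq) (n : ℤ) (β : Module.End F V)
    (k : ℕ) (W : Fin k → Submodule F V) : Prop where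
  full : S.IsFull Λ
  selfdual : S.isSelfDual Λ
  n_pos : 0 < n
  skew : β ∈ S.Aminus
  mem : β ∈ S.aFil Λ (-n)
  val : β ∉ S.aFil Λ (1 - n)
  k_pos : 0 < k
  internal : DirectSum.IsInternal W
  orth : ∀ i j, i ≠ j → ∀ v ∈ W i, ∀ w ∈ W j, S.h v w = 0
  lat_compat : ∀ m : ℤ, ∀ f : Fin k → V, (∀ i, f i ∈ W i) →
      ((∑ i, f i) ∈ Λ.L m ↔ ∀ i, f i ∈ Λ.L m)
  β_inv : ∀ i, ∀ v ∈ W i, β v ∈ W i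
  comp : ∀ i, (∀ v ∈ W i, β v = 0) ∨ S.SimpleOn Λ n (W i) (restr β (W i) (β_inv i))
  comp_nondeg : ∀ i, ¬ (∀ v ∈ W i, β v = 0) →
      (LinearMap.charpoly
        (restr (S.ybeta Λ n β) (W i) (S.ybeta_inv Λ n β (W i) (β_inv i)))).coeff 0 ∉ S.pF
  coprime : ∀ i j, i ≠ j →
      S.CoprimeModP
        (LinearMap.charpoly
          (restr (S.ybeta Λ n β) (W i) (S.ybeta_inv Λ n β (W i) (β_inv i))))
        (LinearMap.charpoly
          (restr (S.ybeta Λ n β) (W j) (S.ybeta_inv Λ n β (W j) (β_inv j))))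

/-- the stratum `[Λ, n, n-1, β]` is fundamental: the reduction mod `p_F` of the
characteristic polynomial of `y_β` is not `X^N` -/
def IsFundamental (Λ : S.LatSeq) (n : ℤ) (β : Module.End F V) : Prop :=
  ¬ ∀ i : ℕ, i < Module.finrank F V →
      (LinearMap.charpoly (S.ybeta Λ n β)).coeff i ∈ S.pF

section Char

variable (F₀ : Type w) [Field F₀] [Algebra F₀ F]

/-- `tr_{A/F₀} = tr_{F/F₀} ∘ tr_{A/F}` -/
def trA0 (X : Module.End F V) : F₀ := Algebra.trace F₀ F (LinearMap.trace F V X)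

/-- the character `ψ_β(x) = ψ₀(tr_{A/F₀}(β(x-1)))` -/
def psiCh (ψ₀ : F₀ → ℂ) (β : Module.End F V) (g : S.GU) : ℂ :=
  ψ₀ (trA0 F₀ (β * (S.toE g - 1)))

/-- `ψ₀` is an additive character of `F₀` with conductor `p₀` -/
def IsAddCh (ψ₀ : F₀ → ℂ) : Prop :=
  (∀ x y : F₀, ψ₀ (x + y) = ψ₀ x * ψ₀ y) ∧
  (∀ x : F₀, algebraMap F₀ F x ∈ S.pF → ψ₀ x = 1) ∧
  (∃ x : F₀, algebraMap F₀ F x ∈ S.O ∧ ψ₀ x ≠ 1)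

/-- `F₀` is the fixed field of the involution -/
def FixedField : Prop := ∀ x : F, S.conj x = x ↔ x ∈ (algebraMap F₀ F).range

end Char

section Rep

variable {W : Type*} [AddCommGroup W] [Module ℂ W]

/-- smoothness of a representation of `G` (relative to the lattice sequence `Λ`:
the groups `P_k(Λ)`, `k ≥ 1`, form a basis of neighborhoods of the identity) -/
def SmoothRel (Λ : S.LatSeq) (π : S.GU →* Module.End ℂ W) : Prop :=
  ∀ w : W, ∃ k : ℤ, 1 ≤ k ∧ ∀ g ∈ S.Pset Λ k, π g w = w

/-- smoothness of a representation of `G` -/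
def Smooth (π : S.GU →* Module.End ℂ W) : Prop :=
  ∀ w : W, ∃ Λ : S.LatSeq, S.IsFull Λ ∧ S.isSelfDual Λ ∧
    ∃ k : ℤ, 1 ≤ k ∧ ∀ g ∈ S.Pset Λ k, π g w = w

/-- irreducibility -/
def Irred (π : S.GU →* Module.End ℂ W) : Prop :=
  (∃ w : W, w ≠ 0) ∧
  ∀ U : Submodule ℂ W, (∀ g : S.GU, ∀ w ∈ U, π g w ∈ U) → U = ⊥ ∨ U = ⊤

/-- `π` contains the character `χ` of the subset `K ⊆ G` -/
def ContainsChar (π : S.GU →* Module.End ℂ W) (K : Set S.GU) (χ : S.GU → ℂ) : Prop :=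
  ∃ w : W, w ≠ 0 ∧ ∀ g ∈ K, π g w = χ g • w

/-- `π` has positive level: no nonzero `P_1(Λ)`-fixed vector for any self-dual `Λ` -/
def PositiveLevel (π : S.GU →* Module.End ℂ W) : Prop :=
  ∀ Λ : S.LatSeq, S.IsFull Λ → S.isSelfDual Λ →
    ∀ w : W, (∀ g ∈ S.Pset Λ 1, π g w = w) → w = 0

end Rep

section Hecke

/-- the double coset `KgK` -/
def dCoset (K : Subgroup S.GU) (g : S.GU) : Set S.GU :=
  {a : S.GU | ∃ x ∈ K, ∃ y ∈ K, a = x * g * y}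

/-- the double coset `KgK` for a subset `K` -/
def dCosetSet (K : Set S.GU) (g : S.GU) : Set S.GU :=
  {a : S.GU | ∃ x ∈ K, ∃ y ∈ K, a = x * g * y}

/-- convolution of two functions on `G` relative to the open compact subgroup `K`
(Haar measure normalized by `vol(K) = 1`):
`(f₁ * f₂)(g) = ∑_{xK ∈ G/K} f₁(x) f₂(x⁻¹ g)`. -/
def hConv {M : Type*} [Ring M] (K : Subgroup S.GU) (f₁ f₂ : S.GU → M) : S.GU → M :=
  fun g => ∑ᶠ q : S.GU ⧸ K, f₁ (Quotient.out q) * f₂ ((Quotient.out q)⁻¹ * g)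

/-- `f` belongs to the Hecke algebra `H(G//K, τ)` with support contained in `supp`:
`f(kgk') = τ(k) f(g) τ(k')` for `k, k' ∈ K`, and `f` is compactly supported
(its support meets only finitely many cosets of `K`). -/
def IsHecke {M : Type*} [Ring M] (K : Subgroup S.GU) (supp : Set S.GU)
    (τ : S.GU → M) (f : S.GU → M) : Prop :=
  (∀ k ∈ K, ∀ g : S.GU, ∀ k' ∈ K, f (k * g * k') = τ k * f g * τ k') ∧
  Function.support f ⊆ supp ∧
  ((fun a : S.GU => (QuotientGroup.mk a : S.GU ⧸ K)) '' Function.support f).Finite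

/-- `[KgK : K] = [K : K ∩ gKg⁻¹]`, the number of left cosets of `K` in `KgK` -/
def dcIndex (K : Subgroup S.GU) (g : S.GU) : ℕ :=
  Nat.card ((fun a : S.GU => (QuotientGroup.mk a : S.GU ⧸ K)) '' S.dCoset K g)

end Hecke


section U4

/-! Concrete data for the non quasi-split unramified unitary group in four
variables: `V = F^4`, `h(v,w) = ᵗv̄ H w` with `H = E₁₄ + ϖE₂₂ + E₃₃ + E₄₁`,
the standard lattices `N₀, N₁` and their duals, and the standard self-dual
lattice sequences `Λ₁, …, Λ₅`. -/

variable (T : USetting F (Fin 4 → F))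

/-- the hermitian form of the non quasi-split unramified `U(4)`:
`h(v, w) = ᵗv̄ H w`, `H = E₁₄ + ϖE₂₂ + E₃₃ + E₄₁` -/
def IsU4Form : Prop :=
  ∀ v w : Fin 4 → F, T.h v w =
    T.conj (v 0) * w 3 + T.ϖ * (T.conj (v 1) * w 1) + T.conj (v 2) * w 2 +
      T.conj (v 3) * w 0

/-- `F/F₀` is quadratic unramified with common uniformizer `ϖ`:
`ϖ` is fixed by the involution, and `F = F₀[√ε]` for a non-square unit `ε` of `o₀`. -/
def IsUnramifiedQuadratic : Prop :=
  T.conj T.ϖ = T.ϖ ∧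
  ∃ ε s : F, ε ∈ T.O ∧ (∃ y ∈ T.O, ε * y = 1) ∧ T.conj ε = ε ∧
    (¬ ∃ y : F, T.conj y = y ∧ y ^ 2 = ε) ∧ s ^ 2 = ε ∧ T.conj s = -s

/-- `N₀ = o_F e₁ ⊕ o_F e₂ ⊕ o_F e₃ ⊕ o_F e₄` -/
def N0 : Set (Fin 4 → F) := {v | ∀ j, v j ∈ T.O}

/-- `N₁ = o_F e₁ ⊕ o_F e₂ ⊕ o_F e₃ ⊕ p_F e₄` -/
def N1 : Set (Fin 4 → F) := {v | (∀ j, v j ∈ T.O) ∧ v 3 ∈ T.pF}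

/-- `N₀^# = o_F e₁ ⊕ p_F⁻¹ e₂ ⊕ o_F e₃ ⊕ o_F e₄` -/
def N0s : Set (Fin 4 → F) :=
  {v | v 0 ∈ T.O ∧ T.ϖ * v 1 ∈ T.O ∧ v 2 ∈ T.O ∧ v 3 ∈ T.O}

/-- `N₁^# = p_F⁻¹ e₁ ⊕ p_F⁻¹ e₂ ⊕ o_F e₃ ⊕ o_F e₄` -/
def N1s : Set (Fin 4 → F) :=
  {v | T.ϖ * v 0 ∈ T.O ∧ T.ϖ * v 1 ∈ T.O ∧ v 2 ∈ T.O ∧ v 3 ∈ T.O}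

/-- `Λ₁(2i) = ϖ^i N₀`, `Λ₁(2i+1) = ϖ^{i+1} N₀^#` -/
def IsLam1 (Λ : T.LatSeq) : Prop :=
  Λ.e = 2 ∧ ∀ i : ℤ,
    Λ.L (2*i) = T.ϖ ^ i • T.N0 ∧ Λ.L (2*i+1) = T.ϖ ^ (i+1) • T.N0s

/-- `Λ₂(2i) = ϖ^i N₁`, `Λ₂(2i+1) = ϖ^{i+1} N₁^#` -/
def IsLam2 (Λ : T.LatSeq) : Prop :=
  Λ.e = 2 ∧ ∀ i : ℤ,
    Λ.L (2*i) = T.ϖ ^ i • T.N1 ∧ Λ.L (2*i+1) = T.ϖ ^ (i+1) • T.N1s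

/-- `Λ₃(4i) = ϖ^i N₀`, `Λ₃(4i+1) = ϖ^i N₁`, `Λ₃(4i+2) = ϖ^{i+1} N₁^#`,
`Λ₃(4i+3) = ϖ^{i+1} N₀^#` -/
def IsLam3 (Λ : T.LatSeq) : Prop :=
  Λ.e = 4 ∧ ∀ i : ℤ,
    Λ.L (4*i) = T.ϖ ^ i • T.N0 ∧ Λ.L (4*i+1) = T.ϖ ^ i • T.N1 ∧
    Λ.L (4*i+2) = T.ϖ ^ (i+1) • T.N1s ∧ Λ.L (4*i+3) = T.ϖ ^ (i+1) • T.N0s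

/-- `Λ₄(6i) = Λ₄(6i+1) = ϖ^i N₀`, `Λ₄(6i+2) = ϖ^i N₁`, `Λ₄(6i+3) = ϖ^{i+1} N₁^#`,
`Λ₄(6i+4) = Λ₄(6i+5) = ϖ^{i+1} N₀^#` -/
def IsLam4 (Λ : T.LatSeq) : Prop :=
  Λ.e = 6 ∧ ∀ i : ℤ,
    Λ.L (6*i) = T.ϖ ^ i • T.N0 ∧ Λ.L (6*i+1) = T.ϖ ^ i • T.N0 ∧
    Λ.L (6*i+2) = T.ϖ ^ i • T.N1 ∧ Λ.L (6*i+3) = T.ϖ ^ (i+1) • T.N1s ∧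
    Λ.L (6*i+4) = T.ϖ ^ (i+1) • T.N0s ∧ Λ.L (6*i+5) = T.ϖ ^ (i+1) • T.N0s

/-- `Λ₅(6i-1) = ϖ^i N₀`, `Λ₅(6i) = Λ₅(6i+1) = ϖ^i N₁`,
`Λ₅(6i+2) = Λ₅(6i+3) = ϖ^{i+1} N₁^#`, `Λ₅(6i+4) = ϖ^{i+1} N₀^#` -/
def IsLam5 (Λ : T.LatSeq) : Prop :=
  Λ.e = 6 ∧ ∀ i : ℤ,
    Λ.L (6*i-1) = T.ϖ ^ i • T.N0 ∧ Λ.L (6*i) = T.ϖ ^ i • T.N1 ∧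
    Λ.L (6*i+1) = T.ϖ ^ i • T.N1 ∧ Λ.L (6*i+2) = T.ϖ ^ (i+1) • T.N1s ∧
    Λ.L (6*i+3) = T.ϖ ^ (i+1) • T.N1s ∧ Λ.L (6*i+4) = T.ϖ ^ (i+1) • T.N0s

/-- the matrix of `β = ϖ^{-m}(Y E₂₃ - ϖ Ȳ E₃₂)` -/
def betaMat (m : ℤ) (Y : F) : Matrix (Fin 4) (Fin 4) F :=
  fun i j =>
    if i = 1 ∧ j = 2 then T.ϖ ^ (-m) * Y
    else if i = 2 ∧ j = 1 then -(T.ϖ ^ (1 - m) * T.conj Y) else 0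

/-- the matrix of `s₁ = E₁₄ + E₂₂ + E₃₃ + E₄₁` -/
def s1Mat : Matrix (Fin 4) (Fin 4) F :=
  !![0,0,0,1; 0,1,0,0; 0,0,1,0; 1,0,0,0]

/-- the matrix of `s₂ = ϖ⁻¹E₁₄ + E₂₂ + E₃₃ + ϖE₄₁` -/
def s2Mat : Matrix (Fin 4) (Fin 4) F :=
  !![0,0,0,T.ϖ⁻¹; 0,1,0,0; 0,0,1,0; T.ϖ,0,0,0]

end U4

end USetting

set_option linter.all false


namespace HK
variable {G : Type u} [Group G]

def hc (K : Subgroup G) (f₁ f₂ : G → ℂ) : G → ℂ :=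
  fun g => ∑ᶠ q : G ⧸ K, f₁ (Quotient.out q) * f₂ ((Quotient.out q)⁻¹ * g)

def Eqv (K : Subgroup G) (τ f : G → ℂ) : Prop :=
  ∀ k ∈ K, ∀ g : G, ∀ k' ∈ K, f (k * g * k') = τ k * f g * τ k'

def FinS (K : Subgroup G) (f : G → ℂ) : Prop :=
  ((fun a : G => (QuotientGroup.mk a : G ⧸ K)) '' Function.support f).Finite

def IsH (K : Subgroup G) (supp : Set G) (τ f : G → ℂ) : Prop :=
  Eqv K τ f ∧ Function.support f ⊆ supp ∧ FinS K f

def DC (K : Subgroup G) (g : G) : Set G := {a : G | ∃ x ∈ K, ∃ y ∈ K, a = x * g * y}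

lemma mk_out (K : Subgroup G) (F : G → ℂ) (hF : ∀ x, ∀ k ∈ K, F (x * k) = F x) (x : G) :
    F (Quotient.out (QuotientGroup.mk x : G ⧸ K)) = F x := by
  obtain ⟨k, hk⟩ := QuotientGroup.mk_out_eq_mul K x
  have : Quotient.out (QuotientGroup.mk x : G ⧸ K) = x * k := hk
  rw [this, hF _ _ k.2]

lemma fs_translate (K : Subgroup G) (F : G → ℂ) (hF : ∀ x, ∀ k ∈ K, F (x * k) = F x) (g : G) :
    ∑ᶠ q : G ⧸ K, F (g * Quotient.out q) = ∑ᶠ q : G ⧸ K, F (Quotient.out q) := by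
  rw [← finsum_comp_equiv (MulAction.toPerm g : Equiv.Perm (G ⧸ K))
    (f := fun q => F (Quotient.out q))]
  refine finsum_congr fun q => ?_
  have h1 : (MulAction.toPerm g : Equiv.Perm (G ⧸ K)) q
      = (QuotientGroup.mk (g * Quotient.out q) : G ⧸ K) := by
    conv_lhs => rw [← QuotientGroup.out_eq' q]
    rfl
  rw [h1, mk_out K F hF]

lemma fs_family (K : Subgroup G) (F : G → ℂ) (hF : ∀ x, ∀ k ∈ K, F (x * k) = F x)
    {ι : Type*} [Fintype ι] (x : ι → G)
    (hinj : ∀ i j, (x i)⁻¹ * x j ∈ K → i = j)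
    (hsup : ∀ y, F y ≠ 0 → ∃ i, (x i)⁻¹ * y ∈ K) :
    ∑ᶠ q : G ⧸ K, F (Quotient.out q) = ∑ i, F (x i) := by
  have hi : Function.Injective (fun i => (QuotientGroup.mk (x i) : G ⧸ K)) := by
    intro i j h
    exact hinj i j (QuotientGroup.eq.1 h)
  rw [finsum_eq_sum_of_support_subset (s := Finset.univ.image
    (fun i => (QuotientGroup.mk (x i) : G ⧸ K)))]
  · rw [Finset.sum_image (fun i _ j _ h => hi h)]
    exact Finset.sum_congr rfl fun i _ => mk_out K F hF _
  · intro q hq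
    obtain ⟨i, hi⟩ := hsup _ hq
    simp only [Finset.coe_image, Finset.coe_univ, Set.image_univ, Set.mem_range]
    refine ⟨i, ?_⟩
    rw [← QuotientGroup.out_eq' q]
    exact QuotientGroup.eq.2 hi

/-- right equivariance -/
def REq (K : Subgroup G) (τ f : G → ℂ) : Prop := ∀ g, ∀ k ∈ K, f (g * k) = f g * τ k
def LEq (K : Subgroup G) (τ f : G → ℂ) : Prop := ∀ g, ∀ k ∈ K, f (k * g) = τ k * f g

structure Chi (K : Subgroup G) (τ : G → ℂ) : Prop where
  mul : ∀ j ∈ K, ∀ k ∈ K, τ (j * k) = τ j * τ k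
  norm : ∀ j ∈ K, ‖τ j‖ = 1

namespace Chi
variable {K : Subgroup G} {τ : G → ℂ} (h : Chi K τ)
include h
lemma ne (j : G) (hj : j ∈ K) : τ j ≠ 0 := by
  intro h0; have := h.norm j hj; simp [h0] at this
lemma one : τ 1 = 1 := by
  have h1 := h.mul 1 K.one_mem 1 K.one_mem
  rw [mul_one] at h1
  exact (mul_left_cancel₀ (h.ne 1 K.one_mem) (by rw [mul_one]; exact h1)).symm
lemma inv (j : G) (hj : j ∈ K) : τ j⁻¹ = (τ j)⁻¹ := by
  have := h.mul j hj j⁻¹ (K.inv_mem hj)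
  rw [mul_inv_cancel, h.one] at this
  exact eq_inv_of_mul_eq_one_right this.symm
lemma starinv (j : G) (hj : j ∈ K) : star (τ j⁻¹) = τ j := by
  rw [h.inv j hj, Complex.inv_eq_conj (h.norm j hj)]
  simp
lemma eqv_iff (f : G → ℂ) : Eqv K τ f ↔ LEq K τ f ∧ REq K τ f := by
  constructor
  · intro e
    refine ⟨fun g k hk => ?_, fun g k hk => ?_⟩
    · have := e k hk g 1 K.one_mem
      simpa [h.one] using this
    · have := e 1 K.one_mem g k hk
      simpa [h.one] using this
  · rintro ⟨l, r⟩ k hk g k' hk'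
    rw [r _ _ hk', l _ _ hk]
lemma term_inv {f₁ f₂ : G → ℂ} (h1 : REq K τ f₁) (h2 : LEq K τ f₂) (y : G) :
    ∀ x, ∀ k ∈ K, f₁ (x * k) * f₂ ((x * k)⁻¹ * y) = f₁ x * f₂ (x⁻¹ * y) := by
  intro x k hk
  rw [h1 _ _ hk, mul_inv_rev, mul_assoc k⁻¹, h2 _ _ (K.inv_mem hk), h.inv k hk]
  field_simp [h.ne k hk]
lemma hc_family {f₁ f₂ : G → ℂ} (h1 : REq K τ f₁) (h2 : LEq K τ f₂)
    {ι : Type*} [Fintype ι] (x : ι → G)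
    (hinj : ∀ i j, (x i)⁻¹ * x j ∈ K → i = j)
    (hsup : ∀ y, f₁ y ≠ 0 → ∃ i, (x i)⁻¹ * y ∈ K) (y : G) :
    hc K f₁ f₂ y = ∑ i, f₁ (x i) * f₂ ((x i)⁻¹ * y) :=
  fs_family K (fun x => f₁ x * f₂ (x⁻¹ * y)) (h.term_inv h1 h2 y) x hinj
    (fun z hz => hsup z (left_ne_zero_of_mul hz))
lemma hc_translate {f₁ f₂ : G → ℂ} (h1 : REq K τ f₁) (h2 : LEq K τ f₂) (g y : G) :
    hc K (fun x => f₁ (g⁻¹ * x)) f₂ y = hc K f₁ f₂ (g⁻¹ * y) := by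
  have := fs_translate K (fun x => f₁ x * f₂ (x⁻¹ * (g⁻¹ * y))) (h.term_inv h1 h2 _) g⁻¹
  unfold hc
  rw [← this]
  refine finsum_congr fun q => ?_
  congr 2
  group
end Chi

lemma fin_out {K : Subgroup G} {f : G → ℂ} (hf : FinS K f) (φ : G ⧸ K → ℂ) :
    (Function.support fun q : G ⧸ K => f (Quotient.out q) * φ q).Finite := by
  refine hf.subset ?_
  intro q hq
  refine ⟨Quotient.out q, left_ne_zero_of_mul hq, QuotientGroup.out_eq' q⟩

lemma hc_add {K : Subgroup G} {f f' : G → ℂ} (hf : FinS K f) (hf' : FinS K f') (φ : G → ℂ) :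
    hc K (f + f') φ = hc K f φ + hc K f' φ := by
  funext y
  unfold hc
  simp only [Pi.add_apply, add_mul]
  exact finsum_add_distrib (fin_out hf _) (fin_out hf' _)

lemma hc_smul {K : Subgroup G} (c : ℂ) (f φ : G → ℂ) :
    hc K (c • f) φ = c • hc K f φ := by
  funext y
  unfold hc
  simp only [Pi.smul_apply, smul_eq_mul, mul_assoc]
  by_cases hc : c = 0
  · subst hc; simp
  · exact (smul_finsum c _).symm

lemma FinS.add {K : Subgroup G} {f f' : G → ℂ} (hf : FinS K f) (hf' : FinS K f') :
    FinS K (f + f') := by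
  refine (hf.union hf').subset ?_
  rw [← Set.image_union]
  exact Set.image_mono (Function.support_add f f')
lemma FinS.zero {K : Subgroup G} : FinS K (0 : G → ℂ) := by
  simp [FinS, Function.support_zero]
lemma FinS.sum {K : Subgroup G} {ι : Type*} (s : Finset ι) (f : ι → G → ℂ)
    (hf : ∀ i, FinS K (f i)) : FinS K (∑ i ∈ s, f i) := by
  induction s using Finset.induction_on with
  | empty => simpa using FinS.zero
  | insert a s ha ih => rw [Finset.sum_insert ha]; exact (hf a).add ih
lemma hc_sum {K : Subgroup G} {ι : Type*} (s : Finset ι) (f : ι → G → ℂ)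
    (hf : ∀ i, FinS K (f i)) (φ : G → ℂ) :
    hc K (∑ i ∈ s, f i) φ = ∑ i ∈ s, hc K (f i) φ := by
  induction s using Finset.induction_on with
  | empty =>
    funext y; simp [hc]
  | insert a s ha ih =>
    rw [Finset.sum_insert ha, Finset.sum_insert ha, hc_add (hf a) (FinS.sum s f hf), ih]
lemma FinS.smul {K : Subgroup G} {f : G → ℂ} (c : ℂ) (hf : FinS K f) : FinS K (c • f) :=
  hf.subset (Set.image_mono (Function.support_const_smul_subset c f))
lemma FinS.translate {K : Subgroup G} {f : G → ℂ} (g : G) (hf : FinS K f) :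
    FinS K (fun x => f (g⁻¹ * x)) := by
  refine (hf.image (fun q => g • q)).subset ?_
  rintro _ ⟨x, hx, rfl⟩
  refine ⟨QuotientGroup.mk (g⁻¹ * x), ⟨_, hx, rfl⟩, ?_⟩
  show (QuotientGroup.mk (g * (g⁻¹ * x)) : G ⧸ K) = _
  rw [mul_inv_cancel_left]

/-- `hc` preserves the Hecke algebra -/
lemma IsH.hc {K GE : Subgroup G} {τ f φ : G → ℂ} (hτ : Chi K τ)
    (hf : IsH K GE τ f) (hφ : IsH K GE τ φ) : IsH K GE τ (hc K f φ) := by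
  have ef := (hτ.eqv_iff f).1 hf.1
  have eφ := (hτ.eqv_iff φ).1 hφ.1
  have key : ∀ y, HK.hc K f φ y ≠ 0 → ∃ x, f x ≠ 0 ∧ φ (x⁻¹ * y) ≠ 0 ∧
      x = Quotient.out (QuotientGroup.mk x : G ⧸ K) := by
    intro y hy
    obtain ⟨q, hq⟩ : ∃ q : G ⧸ K, f (Quotient.out q) * φ ((Quotient.out q)⁻¹ * y) ≠ 0 := by
      by_contra hcon
      push Not at hcon
      exact hy (finsum_eq_zero_of_forall_eq_zero hcon)
    refine ⟨Quotient.out q, left_ne_zero_of_mul hq, right_ne_zero_of_mul hq, ?_⟩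
    rw [QuotientGroup.out_eq']
  refine ⟨(hτ.eqv_iff _).2 ⟨?_, ?_⟩, ?_, ?_⟩
  · intro g k hk
    have h1 : (fun x => f (k * x)) = τ k • f := by
      funext x; simp [ef.1 x k hk]
    have h2 := hτ.hc_translate ef.2 eφ.1 k⁻¹ g
    rw [inv_inv, h1, hc_smul] at h2
    exact h2.symm
  · intro g k hk
    unfold HK.hc
    rw [finsum_mul' _ _ (fin_out hf.2.2 _)]
    refine finsum_congr fun q => ?_
    rw [← mul_assoc, eφ.2 _ _ hk, mul_assoc]
  · intro y hy
    obtain ⟨x, h1, h2, -⟩ := key y hy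
    have := GE.mul_mem (hf.2.1 h1) (hφ.2.1 h2)
    simpa using this
  · have hfin := Set.Finite.image2 (fun (p q : G ⧸ K) => (Quotient.out p) • q) hf.2.2 hφ.2.2
    refine hfin.subset ?_
    rintro _ ⟨y, hy, rfl⟩
    obtain ⟨x, h1, h2, h3⟩ := key y hy
    refine ⟨_, ⟨x, h1, rfl⟩, _, ⟨_, h2, rfl⟩, ?_⟩
    show (Quotient.out (QuotientGroup.mk x : G ⧸ K)) • (QuotientGroup.mk (x⁻¹ * y) : G ⧸ K) = _
    rw [← h3]
    show (QuotientGroup.mk (x * (x⁻¹ * y)) : G ⧸ K) = _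
    rw [mul_inv_cancel_left]
end HK

namespace HK

/-- data for the abstract comparison theorem -/
structure HD (G : Type u) [Group G] (ι : Type v) (ι' : Type w) [Fintype ι] [Fintype ι'] where
  GE : Subgroup G
  J : Subgroup G
  K : Subgroup G
  τ : G → ℂ
  wt : G → ℝ
  a : G
  x : ι → G
  x' : ι' → G
  ω : ℂ
  KGE : K ≤ GE
  JK : J ⊓ GE ≤ K
  chi : Chi J τ
  conj : ∀ g ∈ GE, ∀ y, τ (g * y * g⁻¹) = τ y
  Knorm : ∀ k ∈ K, ∀ j ∈ J, k * j * k⁻¹ ∈ J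
  A1 : ∀ g ∈ GE, ∀ g' ∈ GE, ∀ j₁ ∈ J, ∀ j₂ ∈ J, g' = j₁ * g * j₂ →
    ∃ k₁ ∈ J ⊓ GE, ∃ k₂ ∈ J ⊓ GE, g' = k₁ * g * k₂ ∧ τ k₁ * τ k₂ = τ j₁ * τ j₂
  A2 : ∀ y, (¬ ∃ j₁ ∈ J, ∃ g ∈ GE, ∃ j₂ ∈ J, y = j₁ * g * j₂) →
    ∃ j ∈ J, ∃ j' ∈ J, j * y = y * j' ∧ τ j ≠ τ j'
  aGE : a ∈ GE
  ainv : ∃ k ∈ K, ∃ k' ∈ K, a⁻¹ = k * a * k'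
  xmem : ∀ i, ∃ u ∈ J, τ u = 1 ∧ x i = u * a
  xinj : ∀ i j, (x i)⁻¹ * x j ∈ J → i = j
  xsur : ∀ j ∈ J, ∃ i, (x i)⁻¹ * (j * a) ∈ J
  xmem' : ∀ i, ∃ u ∈ J ⊓ GE, τ u = 1 ∧ x' i = u * a
  xinj' : ∀ i j, (x' i)⁻¹ * x' j ∈ J ⊓ GE → i = j
  xsur' : ∀ j ∈ J ⊓ GE, ∃ i, (x' i)⁻¹ * (j * a) ∈ J ⊓ GE
  wpos : ∀ g, 0 < wt g
  wK : ∀ k ∈ K, ∀ g ∈ GE, ∀ k' ∈ K, wt (k * g * k') = wt g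
  winv : ∀ g ∈ GE, wt g⁻¹ = wt g
  wone : wt 1 = 1
  A4 : ∀ e, IsH (J ⊓ GE) GE τ e → ∀ g, e g ≠ 0 → ∃ k ∈ K, ∃ k' ∈ K, ∃ r : ℕ, g = k * a ^ r * k'
  A6 : ∀ φ e, IsH J (⊤ : Subgroup G) τ φ → IsH (J ⊓ GE) GE τ e →
    (∀ y ∈ GE, φ y = wt y * e y) →
    ∀ y ∈ GE, ω * ∑ i, φ ((x i)⁻¹ * y) = wt y * ∑ i, e ((x' i)⁻¹ * y)
  A7a : ∀ r : ℕ, ∀ j ∈ J ⊓ GE, a * j * a ^ r ∈ DC (J ⊓ GE) (a ^ (r + 1))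
  A7b : ∀ r : ℕ, ∀ i, (x' i)⁻¹ * a ^ (r + 1) ∈ DC (J ⊓ GE) (a ^ r) → a⁻¹ * x' i ∈ J ⊓ GE

namespace HD
variable {G : Type u} [Group G] {ι : Type v} {ι' : Type w} [Fintype ι] [Fintype ι']
variable (H : HD G ι ι')

abbrev J' : Subgroup G := H.J ⊓ H.GE
def Dec (y : G) : Prop := ∃ p : G × G × G, p.1 ∈ H.J ∧ p.2.1 ∈ H.GE ∧ p.2.2 ∈ H.J ∧
  y = p.1 * p.2.1 * p.2.2
def lift (c : G → ℂ) : G → ℂ := fun y =>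
  if h : H.Dec y then H.τ h.choose.1 * c h.choose.2.1 * H.τ h.choose.2.2 else 0

lemma chi' : Chi H.J' H.τ :=
  ⟨fun j hj k hk => H.chi.mul j hj.1 k hk.1, fun j hj => H.chi.norm j hj.1⟩

lemma lift_add (c d : G → ℂ) : H.lift (c + d) = H.lift c + H.lift d := by
  funext y
  by_cases h : H.Dec y
  · simp only [lift, Pi.add_apply, dif_pos h]; ring
  · simp only [lift, Pi.add_apply, dif_neg h]; ring
lemma lift_smul (r : ℂ) (c : G → ℂ) : H.lift (r • c) = r • H.lift c := by
  funext y
  by_cases h : H.Dec y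
  · simp only [lift, Pi.smul_apply, dif_pos h, smul_eq_mul]; ring
  · simp only [lift, Pi.smul_apply, dif_neg h, smul_zero]

lemma lift_val (c : G → ℂ) (hc : Eqv H.J' H.τ c) (j₁ g j₂ : G) (h1 : j₁ ∈ H.J) (hg : g ∈ H.GE)
    (h2 : j₂ ∈ H.J) : H.lift c (j₁ * g * j₂) = H.τ j₁ * c g * H.τ j₂ := by
  have h : H.Dec (j₁ * g * j₂) := ⟨(j₁, g, j₂), h1, hg, h2, rfl⟩
  simp only [lift, dif_pos h]
  obtain ⟨a1, a2, a3, a4⟩ := h.choose_spec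
  generalize h.choose = p at *
  obtain ⟨i₁, g', i₂⟩ := p
  simp only at a1 a2 a3 a4 ⊢
  have e1 : g' = (i₁⁻¹ * j₁) * g * (j₂ * i₂⁻¹) := by
    have : i₁ * g' * i₂ = j₁ * g * j₂ := a4.symm
    calc g' = i₁⁻¹ * (i₁ * g' * i₂) * i₂⁻¹ := by group
      _ = _ := by rw [this]; group
  obtain ⟨k₁, m1, k₂, m2, e2, e3⟩ := H.A1 g hg g' a2 _ (H.J.mul_mem (H.J.inv_mem a1) h1) _
    (H.J.mul_mem h2 (H.J.inv_mem a3)) e1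
  rw [e2, hc _ m1 _ _ m2]
  rw [H.chi.mul _ (H.J.inv_mem a1) _ h1, H.chi.mul _ h2 _ (H.J.inv_mem a3), H.chi.inv _ a1,
    H.chi.inv _ a3] at e3
  have n1 := H.chi.ne _ a1
  have n2 := H.chi.ne _ a3
  have e4 : H.τ i₁ * H.τ i₂ * (H.τ k₁ * H.τ k₂) = H.τ j₁ * H.τ j₂ := by
    rw [e3]; field_simp
  linear_combination (c g) * e4

lemma lift_GE (c : G → ℂ) (hc : Eqv H.J' H.τ c) (g : G) (hg : g ∈ H.GE) : H.lift c g = c g := by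
  have := H.lift_val c hc 1 g 1 H.J.one_mem hg H.J.one_mem
  simpa [H.chi.one] using this

lemma lift_ne (c : G → ℂ) (y : G) (hy : H.lift c y ≠ 0) :
    ∃ j₁ ∈ H.J, ∃ g ∈ H.GE, ∃ j₂ ∈ H.J, y = j₁ * g * j₂ ∧ c g ≠ 0 := by
  by_cases h : H.Dec y
  · simp only [lift, dif_pos h] at hy
    obtain ⟨a1, a2, a3, a4⟩ := h.choose_spec
    exact ⟨_, a1, _, a2, _, a3, a4, right_ne_zero_of_mul (left_ne_zero_of_mul hy)⟩
  · simp [lift, dif_neg h] at hy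

lemma eqv_zero (f : G → ℂ) (hf : Eqv H.J H.τ f) (y : G) (hy : f y ≠ 0) :
    ∃ j₁ ∈ H.J, ∃ g ∈ H.GE, ∃ j₂ ∈ H.J, y = j₁ * g * j₂ := by
  by_contra hcon
  obtain ⟨j, hj, j', hj', e, ne⟩ := H.A2 y hcon
  have l := ((H.chi.eqv_iff f).1 hf).1 y j hj
  have r := ((H.chi.eqv_iff f).1 hf).2 y j' hj'
  rw [e, r, mul_comm] at l
  exact ne (mul_right_cancel₀ hy l.symm)

lemma uniq (f f' : G → ℂ) (hf : Eqv H.J H.τ f) (hf' : Eqv H.J H.τ f')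
    (h : ∀ g ∈ H.GE, f g = f' g) : f = f' := by
  funext y
  by_cases hd : ∃ j₁ ∈ H.J, ∃ g ∈ H.GE, ∃ j₂ ∈ H.J, y = j₁ * g * j₂
  · obtain ⟨j₁, h1, g, hg, j₂, h2, rfl⟩ := hd
    rw [hf _ h1 _ _ h2, hf' _ h1 _ _ h2, h g hg]
  · have z1 : f y = 0 := by
      by_contra h0; exact hd (H.eqv_zero f hf y h0)
    have z2 : f' y = 0 := by
      by_contra h0; exact hd (H.eqv_zero f' hf' y h0)
    rw [z1, z2]

lemma lift_eqv (c : G → ℂ) (hc : Eqv H.J' H.τ c) : Eqv H.J H.τ (H.lift c) := by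
  intro k hk y k' hk'
  by_cases hd : H.Dec y
  · obtain ⟨⟨j₁, g, j₂⟩, h1, hg, h2, e⟩ := hd
    simp only at h1 hg h2 e
    subst e
    have : k * (j₁ * g * j₂) * k' = (k * j₁) * g * (j₂ * k') := by group
    rw [this, H.lift_val c hc _ _ _ (H.J.mul_mem hk h1) hg (H.J.mul_mem h2 hk'),
      H.lift_val c hc _ _ _ h1 hg h2, H.chi.mul _ hk _ h1, H.chi.mul _ h2 _ hk']
    ring
  · have hd' : ¬ H.Dec (k * y * k') := by
      rintro ⟨⟨j₁, g, j₂⟩, h1, hg, h2, e⟩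
      simp only at h1 hg h2 e
      refine hd ⟨(k⁻¹ * j₁, g, j₂ * k'⁻¹), H.J.mul_mem (H.J.inv_mem hk) h1, hg,
        H.J.mul_mem h2 (H.J.inv_mem hk'), ?_⟩
      simp only
      calc y = k⁻¹ * (k * y * k') * k'⁻¹ := by group
        _ = _ := by rw [e]; group
    simp [lift, dif_neg hd, dif_neg hd']

/-! finiteness -/
def Fin' (g : G) : Prop := ((fun y : G => (QuotientGroup.mk y : G ⧸ H.J)) '' DC H.J g).Finite

lemma fin_one : H.Fin' 1 := by
  refine (Set.finite_singleton (QuotientGroup.mk 1 : G ⧸ H.J)).subset ?_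
  rintro _ ⟨y, ⟨j, hj, k, hk, rfl⟩, rfl⟩
  refine (QuotientGroup.eq.2 ?_).symm
  simpa using H.J.mul_mem hj hk

lemma fin_K (k g k' : G) (hk : k ∈ H.K) (hk' : k' ∈ H.K) (hg : H.Fin' g) : H.Fin' (k * g * k') := by
  refine (hg.image (fun q => (QuotientGroup.mk (k * Quotient.out q * k') : G ⧸ H.J))).subset ?_
  rintro _ ⟨y, ⟨j₁, h1, j₂, h2, rfl⟩, rfl⟩
  have n1 := H.Knorm k⁻¹ (H.K.inv_mem hk) j₁ h1
  have n2 := H.Knorm k' hk' j₂ h2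
  rw [inv_inv] at n1
  refine ⟨_, ⟨(k⁻¹ * j₁ * k) * g * (k' * j₂ * k'⁻¹), ⟨_, n1, _, n2, rfl⟩, rfl⟩, ?_⟩
  obtain ⟨⟨l, hl⟩, e⟩ := QuotientGroup.mk_out_eq_mul H.J ((k⁻¹ * j₁ * k) * g * (k' * j₂ * k'⁻¹))
  simp only at e ⊢
  rw [e]
  refine QuotientGroup.eq.2 ?_
  have n3 := H.Knorm k'⁻¹ (H.K.inv_mem hk') l⁻¹ (H.J.inv_mem hl)
  convert n3 using 1
  group

lemma fin_a (g : G) (hg : H.Fin' g) : H.Fin' (H.a * g) := by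
  refine ((Set.finite_univ (α := ι)).image2 (fun i (q : G ⧸ H.J) => H.x i • q) hg).subset ?_
  rintro _ ⟨y, ⟨j₁, h1, j₂, h2, rfl⟩, rfl⟩
  obtain ⟨i, hi⟩ := H.xsur j₁ h1
  refine ⟨i, trivial, _, ⟨((H.x i)⁻¹ * (j₁ * H.a)) * g * j₂, ⟨_, hi, _, h2, rfl⟩, rfl⟩, ?_⟩
  show (QuotientGroup.mk (H.x i * _) : G ⧸ H.J) = _
  congr 1
  group

lemma fin_ainv (g : G) (hg : H.Fin' g) : H.Fin' (H.a⁻¹ * g) := by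
  obtain ⟨k, hk, k', hk', e⟩ := H.ainv
  have h1 := H.fin_K k' g 1 hk' H.K.one_mem hg
  have h2 := H.fin_K k _ 1 hk H.K.one_mem (H.fin_a _ h1)
  rw [e]
  convert h2 using 1
  group

lemma fin_KaK (k k' : G) (r : ℕ) (hk : k ∈ H.K) (hk' : k' ∈ H.K) :
    H.Fin' (k * H.a ^ r * k') ∧ H.Fin' (k * H.a ^ r * k')⁻¹ := by
  constructor
  · apply H.fin_K _ _ _ hk hk'
    induction r with
    | zero => simpa using H.fin_one
    | succ r ih => rw [pow_succ']; exact H.fin_a _ ih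
  · have : (k * H.a ^ r * k')⁻¹ = k'⁻¹ * (H.a⁻¹) ^ r * k⁻¹ := by group
    rw [this]
    apply H.fin_K _ _ _ (H.K.inv_mem hk') (H.K.inv_mem hk)
    induction r with
    | zero => simpa using H.fin_one
    | succ r ih => rw [pow_succ']; exact H.fin_ainv _ (ih (by group))

/-- finite mod J plus inside GE gives finite mod J' -/
lemma fin_GE (S : Set G) (hS : S ⊆ H.GE)
    (hf : ((fun y : G => (QuotientGroup.mk y : G ⧸ H.J)) '' S).Finite) :
    ((fun y : G => (QuotientGroup.mk y : G ⧸ H.J')) '' S).Finite := by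
  have hinj : Set.InjOn (Subgroup.quotientMapOfLE (inf_le_left : H.J' ≤ H.J))
      ((fun y : G => (QuotientGroup.mk y : G ⧸ H.J')) '' S) := by
    rintro _ ⟨y, hy, rfl⟩ _ ⟨z, hz, rfl⟩ h
    simp only [Subgroup.quotientMapOfLE_apply_mk] at h
    refine QuotientGroup.eq.2 ⟨QuotientGroup.eq.1 h, ?_⟩
    exact H.GE.mul_mem (H.GE.inv_mem (hS hy)) (hS hz)
  refine Set.Finite.of_finite_image ?_ hinj
  rw [Set.image_image]
  exact hf

/-- finitely many double cosets -/
lemma fin_lift (e : G → ℂ) (he : IsH H.J' H.GE H.τ e) (c : G → ℂ)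
    (hce : ∀ g, c g ≠ 0 → e g ≠ 0) : FinS H.J (H.lift c) := by
  have key : ∀ g, e g ≠ 0 → H.Fin' g := by
    intro g hg
    obtain ⟨k, hk, k', hk', r, rfl⟩ := H.A4 e he g hg
    exact (H.fin_KaK k k' r hk hk').1
  refine (Set.Finite.biUnion he.2.2 (t := fun q =>
    if e (Quotient.out q) ≠ 0 then
      ((fun y : G => (QuotientGroup.mk y : G ⧸ H.J)) '' DC H.J (Quotient.out q)) else ∅) ?_).subset ?_
  · intro q _
    split_ifs with h
    · exact key _ h
    · exact Set.finite_empty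
  · rintro _ ⟨y, hy, rfl⟩
    obtain ⟨j₁, h1, g, hg, j₂, h2, rfl, hcg⟩ := H.lift_ne c y hy
    have heg := hce g hcg
    simp only [Set.mem_iUnion]
    refine ⟨QuotientGroup.mk g, ⟨g, heg, rfl⟩, ?_⟩
    obtain ⟨⟨l, hl⟩, el⟩ := QuotientGroup.mk_out_eq_mul H.J' g
    simp only at el
    have h3 : Quotient.out (QuotientGroup.mk g : G ⧸ H.J') = g * l := el
    rw [if_pos, h3]
    · exact ⟨_, ⟨j₁, h1, l⁻¹ * j₂, H.J.mul_mem (H.J.inv_mem hl.1) h2, rfl⟩, by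
        simp only [mul_assoc, mul_inv_cancel_left]⟩
    · rw [h3, ((H.chi'.eqv_iff e).1 he.1).2 g l hl]
      exact mul_ne_zero heg (H.chi'.ne l hl)

def eta (e : G → ℂ) : G → ℂ := H.lift (fun g => (H.wt g : ℂ) * e g)

abbrev HE (e : G → ℂ) : Prop := IsH H.J' H.GE H.τ e
abbrev HG (f : G → ℂ) : Prop := IsH H.J (⊤ : Subgroup G) H.τ f

lemma we_eqv (e : G → ℂ) (he : H.HE e) : Eqv H.J' H.τ (fun g => (H.wt g : ℂ) * e g) := by
  intro k hk g k' hk'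
  simp only
  rw [he.1 k hk g k' hk']
  by_cases hg : g ∈ H.GE
  · rw [H.wK k (H.JK hk) g hg k' (H.JK hk')]; ring
  · have : e g = 0 := by
      by_contra h; exact hg (he.2.1 h)
    rw [this]; ring

lemma eta_GE (e : G → ℂ) (he : H.HE e) (g : G) (hg : g ∈ H.GE) : H.eta e g = H.wt g * e g :=
  H.lift_GE _ (H.we_eqv e he) g hg
lemma eta_HG (e : G → ℂ) (he : H.HE e) : H.HG (H.eta e) :=
  ⟨H.lift_eqv _ (H.we_eqv e he), fun _ _ => trivial,
    H.fin_lift e he _ (fun _ h => right_ne_zero_of_mul h)⟩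
lemma eta_add (e f : G → ℂ) : H.eta (e + f) = H.eta e + H.eta f := by
  unfold eta
  rw [← lift_add]
  congr 1
  funext g
  simp [mul_add]
lemma eta_smul (c : ℂ) (e : G → ℂ) : H.eta (c • e) = c • H.eta e := by
  unfold eta
  rw [← lift_smul]
  congr 1
  funext g
  simp only [Pi.smul_apply, smul_eq_mul]; ring
lemma eta_supp (e : G → ℂ) (g₀ : G) (h : Function.support e ⊆ DC H.J' g₀) :
    Function.support (H.eta e) ⊆ DC H.J g₀ := by
  intro y hy
  obtain ⟨j₁, h1, g, hg, j₂, h2, rfl, hcg⟩ := H.lift_ne _ y hy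
  obtain ⟨k, hk, k', hk', rfl⟩ := h (right_ne_zero_of_mul hcg)
  exact ⟨_, H.J.mul_mem h1 hk.1, _, H.J.mul_mem hk'.1 h2, by group⟩

lemma wne (g : G) : (H.wt g : ℂ) ≠ 0 := by exact_mod_cast (H.wpos g).ne'
lemma zero_off (e : G → ℂ) (he : H.HE e) (g : G) (hg : g ∉ H.GE) : e g = 0 := by
  by_contra h; exact hg (he.2.1 h)

lemma eta_inj : Set.InjOn H.eta {e | H.HE e} := by
  intro e he f hf h
  funext g
  by_cases hg : g ∈ H.GE
  · have := congrFun h g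
    rw [H.eta_GE e he g hg, H.eta_GE f hf g hg] at this
    exact mul_left_cancel₀ (H.wne g) this
  · rw [H.zero_off e he g hg, H.zero_off f hf g hg]

lemma eta_surj (f : G → ℂ) (hf : H.HG f) : ∃ e, H.HE e ∧ H.eta e = f := by
  let e : G → ℂ := fun g => if g ∈ H.GE then f g / H.wt g else 0
  have he : H.HE e := by
    refine ⟨?_, ?_, ?_⟩
    · intro k hk g k' hk'
      by_cases hg : g ∈ H.GE
      · have h2 : k * g * k' ∈ H.GE := H.GE.mul_mem (H.GE.mul_mem hk.2 hg) hk'.2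
        simp only [e, if_pos hg, if_pos h2]
        rw [hf.1 k hk.1 g k' hk'.1, H.wK k (H.JK hk) g hg k' (H.JK hk')]
        ring
      · have h2 : k * g * k' ∉ H.GE := by
          intro h
          apply hg
          have := H.GE.mul_mem (H.GE.mul_mem (H.GE.inv_mem hk.2) h) (H.GE.inv_mem hk'.2)
          convert this using 1
          group
        simp only [e, if_neg hg, if_neg h2]; ring
    · intro g hg
      by_contra h
      exact hg (if_neg h)
    · apply H.fin_GE
      · intro g hg
        by_contra h
        exact hg (if_neg h)
      · refine hf.2.2.subset (Set.image_mono ?_)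
        intro g hg h0
        apply hg
        simp [e, h0]
  refine ⟨e, he, H.uniq _ _ (H.eta_HG e he).1 hf.1 fun g hg => ?_⟩
  rw [H.eta_GE e he g hg]
  simp only [e, if_pos hg]
  field_simp [H.wne g]

lemma eta_star (e : G → ℂ) (he : H.HE e) (he' : H.HE (fun g => star (e g⁻¹))) :
    H.eta (fun g => star (e g⁻¹)) = fun g => star (H.eta e g⁻¹) := by
  refine H.uniq _ _ (H.eta_HG _ he').1 ?_ fun g hg => ?_
  · intro k hk g k' hk'
    simp only
    have : (k * g * k')⁻¹ = k'⁻¹ * g⁻¹ * k⁻¹ := by group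
    rw [this, (H.eta_HG e he).1 _ (H.J.inv_mem hk') _ _ (H.J.inv_mem hk)]
    rw [star_mul, star_mul, H.chi.starinv k hk, H.chi.starinv k' hk']
    ring
  · rw [H.eta_GE _ he' g hg]
    rw [H.eta_GE e he _ (H.GE.inv_mem hg), H.winv g hg]
    simp

lemma star_HE (e : G → ℂ) (he : H.HE e) : H.HE (fun g => star (e g⁻¹)) := by
  refine ⟨?_, ?_, ?_⟩
  · intro k hk g k' hk'
    simp only
    have : (k * g * k')⁻¹ = k'⁻¹ * g⁻¹ * k⁻¹ := by group
    rw [this, he.1 _ (H.J'.inv_mem hk') _ _ (H.J'.inv_mem hk)]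
    rw [star_mul, star_mul, H.chi'.starinv k hk, H.chi'.starinv k' hk']
    ring
  · intro g hg
    have : e g⁻¹ ≠ 0 := by simpa using hg
    simpa using H.GE.inv_mem (he.2.1 this)
  · have hsub : Function.support (fun g => star (e g⁻¹)) ⊆ H.GE := by
      intro g hg
      have : e g⁻¹ ≠ 0 := by simpa using hg
      simpa using H.GE.inv_mem (he.2.1 this)
    apply H.fin_GE _ hsub
    refine (Set.Finite.biUnion he.2.2 (t := fun q =>
      if e (Quotient.out q) ≠ 0 then
        ((fun y : G => (QuotientGroup.mk y : G ⧸ H.J)) '' DC H.J (Quotient.out q)⁻¹) else ∅)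
        ?_).subset ?_
    · intro q _
      split_ifs with h
      · obtain ⟨k, hk, k', hk', r, hr⟩ := H.A4 e he _ h
        have := (H.fin_KaK k k' r hk hk').2
        rw [← hr] at this
        exact this
      · exact Set.finite_empty
    · rintro _ ⟨y, hy, rfl⟩
      have hey : e y⁻¹ ≠ 0 := by simpa using hy
      simp only [Set.mem_iUnion]
      refine ⟨QuotientGroup.mk y⁻¹, ⟨y⁻¹, hey, rfl⟩, ?_⟩
      obtain ⟨⟨l, hl⟩, el⟩ := QuotientGroup.mk_out_eq_mul H.J' y⁻¹
      simp only at el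
      have h3 : Quotient.out (QuotientGroup.mk y⁻¹ : G ⧸ H.J') = y⁻¹ * l := el
      rw [if_pos, h3]
      · exact ⟨_, ⟨l, hl.1, 1, H.J.one_mem, rfl⟩, by group⟩
      · rw [h3, ((H.chi'.eqv_iff e).1 he.1).2 _ l hl]
        exact mul_ne_zero hey (H.chi'.ne l hl)

end HD
end HK

namespace HK
namespace HD
variable {G : Type u} [Group G] {ι : Type v} {ι' : Type w} [Fintype ι] [Fintype ι']
variable (H : HD G ι ι')

/-- the Hecke function on `J' a J'` -/
def fa' : G → ℂ := fun y =>
  if h : ∃ p : G × G, p.1 ∈ H.J' ∧ p.2 ∈ H.J' ∧ y = p.1 * H.a * p.2 then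
    H.τ h.choose.1 * H.τ h.choose.2 else 0

lemma fa'_val (j₁ j₂ : G) (h1 : j₁ ∈ H.J') (h2 : j₂ ∈ H.J') :
    H.fa' (j₁ * H.a * j₂) = H.τ j₁ * H.τ j₂ := by
  have h : ∃ p : G × G, p.1 ∈ H.J' ∧ p.2 ∈ H.J' ∧ j₁ * H.a * j₂ = p.1 * H.a * p.2 :=
    ⟨(j₁, j₂), h1, h2, rfl⟩
  simp only [fa', dif_pos h]
  obtain ⟨a1, a2, a3⟩ := h.choose_spec
  generalize h.choose = p at *
  obtain ⟨i₁, i₂⟩ := p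
  simp only at a1 a2 a3 ⊢
  have e1 : H.a * (i₂ * j₂⁻¹) * H.a⁻¹ = i₁⁻¹ * j₁ := by
    calc _ = i₁⁻¹ * (i₁ * H.a * i₂) * j₂⁻¹ * H.a⁻¹ := by group
      _ = _ := by rw [← a3]; group
  have e2 := H.conj H.a H.aGE (i₂ * j₂⁻¹)
  rw [e1, H.chi'.mul _ (H.J'.inv_mem a1) _ h1, H.chi'.mul _ a2 _ (H.J'.inv_mem h2),
    H.chi'.inv _ a1, H.chi'.inv _ h2] at e2
  have n1 := H.chi'.ne _ a1
  have n2 := H.chi'.ne _ h2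
  field_simp at e2
  rw [e2]

lemma fa'_ne (y : G) (h : H.fa' y ≠ 0) : ∃ j₁ ∈ H.J', ∃ j₂ ∈ H.J', y = j₁ * H.a * j₂ := by
  by_contra hcon
  apply h
  apply dif_neg
  rintro ⟨p, a1, a2, a3⟩
  exact hcon ⟨_, a1, _, a2, a3⟩

lemma fa'_eqv : Eqv H.J' H.τ H.fa' := by
  intro k hk y k' hk'
  by_cases hy : ∃ j₁ ∈ H.J', ∃ j₂ ∈ H.J', y = j₁ * H.a * j₂
  · obtain ⟨j₁, h1, j₂, h2, rfl⟩ := hy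
    have : k * (j₁ * H.a * j₂) * k' = (k * j₁) * H.a * (j₂ * k') := by group
    rw [this, H.fa'_val _ _ (H.J'.mul_mem hk h1) (H.J'.mul_mem h2 hk'), H.fa'_val _ _ h1 h2,
      H.chi'.mul _ hk _ h1, H.chi'.mul _ h2 _ hk']
    ring
  · have z1 : H.fa' y = 0 := by
      by_contra h0; exact hy (H.fa'_ne y h0)
    have z2 : H.fa' (k * y * k') = 0 := by
      by_contra h0
      obtain ⟨j₁, h1, j₂, h2, e⟩ := H.fa'_ne _ h0
      refine hy ⟨k⁻¹ * j₁, H.J'.mul_mem (H.J'.inv_mem hk) h1, j₂ * k'⁻¹,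
        H.J'.mul_mem h2 (H.J'.inv_mem hk'), ?_⟩
      calc y = k⁻¹ * (k * y * k') * k'⁻¹ := by group
        _ = _ := by rw [e]; group
    rw [z1, z2]; ring

lemma fa'_sup (y : G) (h : H.fa' y ≠ 0) : ∃ i, (H.x' i)⁻¹ * y ∈ H.J' := by
  obtain ⟨j₁, h1, j₂, h2, rfl⟩ := H.fa'_ne y h
  obtain ⟨i, hi⟩ := H.xsur' j₁ h1
  exact ⟨i, by have := H.J'.mul_mem hi h2; convert this using 1; group⟩

lemma fin_of_family {K : Subgroup G} {f : G → ℂ} {κ : Type*} [Fintype κ] (x : κ → G)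
    (h : ∀ y, f y ≠ 0 → ∃ i, (x i)⁻¹ * y ∈ K) : FinS K f := by
  refine (Set.finite_range (fun i => (QuotientGroup.mk (x i) : G ⧸ K))).subset ?_
  rintro _ ⟨y, hy, rfl⟩
  obtain ⟨i, hi⟩ := h y hy
  exact ⟨i, QuotientGroup.eq.2 hi⟩

lemma fa'_HE : H.HE H.fa' := by
  refine ⟨H.fa'_eqv, ?_, fin_of_family H.x' H.fa'_sup⟩
  intro y hy
  obtain ⟨j₁, h1, j₂, h2, rfl⟩ := H.fa'_ne y hy
  exact H.GE.mul_mem (H.GE.mul_mem h1.2 H.aGE) h2.2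

def fa : G → ℂ := H.lift H.fa'

lemma fa_sup (y : G) (h : H.fa y ≠ 0) : ∃ i, (H.x i)⁻¹ * y ∈ H.J := by
  obtain ⟨i₁, m1, g, hg, i₂, m2, rfl, h3⟩ := H.lift_ne _ y h
  obtain ⟨j₁, h1, j₂, h2, rfl⟩ := H.fa'_ne g h3
  obtain ⟨i, hi⟩ := H.xsur (i₁ * j₁) (H.J.mul_mem m1 h1.1)
  refine ⟨i, ?_⟩
  have := H.J.mul_mem hi (H.J.mul_mem h2.1 m2)
  convert this using 1; group

lemma fa_HG : H.HG H.fa := ⟨H.lift_eqv _ H.fa'_eqv, fun _ _ => trivial, fin_of_family H.x H.fa_sup⟩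

def T' (e : G → ℂ) : G → ℂ := ∑ i, fun y => e ((H.x' i)⁻¹ * y)
def TG (e : G → ℂ) : G → ℂ := ∑ i, fun y => e ((H.x i)⁻¹ * y)

lemma T'_apply (e : G → ℂ) (y : G) : H.T' e y = ∑ i, e ((H.x' i)⁻¹ * y) := by
  simp [T', Finset.sum_apply]
lemma TG_apply (e : G → ℂ) (y : G) : H.TG e y = ∑ i, e ((H.x i)⁻¹ * y) := by
  simp [TG, Finset.sum_apply]

lemma T'_HE (e : G → ℂ) (he : H.HE e) : H.HE (H.T' e) := by
  have : H.T' e = hc H.J' H.fa' e := by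
    funext y
    rw [H.chi'.hc_family ((H.chi'.eqv_iff _).1 H.fa'_eqv).2 ((H.chi'.eqv_iff _).1 he.1).1 H.x'
      H.xinj' H.fa'_sup, T'_apply]
    refine Finset.sum_congr rfl fun i _ => ?_
    obtain ⟨u, hu, h1, h2⟩ := H.xmem' i
    have := H.fa'_val u 1 hu H.J'.one_mem
    rw [mul_one, H.chi'.one, h1, ← h2] at this
    rw [this]; ring
  rw [this]
  exact IsH.hc H.chi' H.fa'_HE he

lemma TG_HG (e : G → ℂ) (he : H.HG e) : H.HG (H.TG e) := by
  have : H.TG e = hc H.J H.fa e := by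
    funext y
    rw [H.chi.hc_family ((H.chi.eqv_iff _).1 H.fa_HG.1).2 ((H.chi.eqv_iff _).1 he.1).1 H.x
      H.xinj H.fa_sup, TG_apply]
    refine Finset.sum_congr rfl fun i _ => ?_
    obtain ⟨u, hu, h1, h2⟩ := H.xmem i
    have := H.lift_val H.fa' H.fa'_eqv u H.a 1 hu H.aGE H.J.one_mem
    have h3 := H.fa'_val 1 1 H.J'.one_mem H.J'.one_mem
    rw [one_mul, mul_one, H.chi'.one] at h3
    rw [mul_one, H.chi.one, h1, ← h2, h3] at this
    rw [fa, this]; ring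
  rw [this]
  exact IsH.hc H.chi H.fa_HG he

lemma eta_T (e : G → ℂ) (he : H.HE e) : H.eta (H.T' e) = H.ω • H.TG (H.eta e) := by
  have h1 := H.TG_HG _ (H.eta_HG e he)
  refine H.uniq _ _ (H.eta_HG _ (H.T'_HE e he)).1 ?_ ?_
  · intro k hk g k' hk'
    simp only [Pi.smul_apply, smul_eq_mul]
    rw [h1.1 k hk g k' hk']; ring
  · intro g hg
    rw [H.eta_GE _ (H.T'_HE e he) g hg, T'_apply, Pi.smul_apply, smul_eq_mul, TG_apply]
    exact (H.A6 _ e (H.eta_HG e he) he (H.eta_GE e he) g hg).symm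

/-- left translation -/
def Lt (k : G) (e : G → ℂ) : G → ℂ := fun y => e (k⁻¹ * y)

lemma norm' (k j : G) (hk : k ∈ H.K) (hj : j ∈ H.J') : k * j * k⁻¹ ∈ H.J' :=
  ⟨H.Knorm k hk j hj.1, H.GE.mul_mem (H.GE.mul_mem (H.KGE hk) hj.2) (H.GE.inv_mem (H.KGE hk))⟩

lemma Lt_HE (k : G) (hk : k ∈ H.K) (e : G → ℂ) (he : H.HE e) : H.HE (Lt k e) := by
  refine ⟨?_, ?_, FinS.translate k he.2.2⟩
  · intro j hj y j' hj'
    have n := H.norm' k⁻¹ j (H.K.inv_mem hk) hj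
    have c := H.conj k⁻¹ (H.GE.inv_mem (H.KGE hk)) j
    have : k⁻¹ * (j * y * j') = (k⁻¹ * j * k⁻¹⁻¹) * (k⁻¹ * y) * j' := by group
    simp only [Lt]
    rw [this, he.1 _ n _ _ hj', c]
  · intro y hy
    have := he.2.1 hy
    have h2 := H.GE.mul_mem (H.KGE hk) this
    simpa using h2

lemma Lt_HG (k : G) (hk : k ∈ H.K) (e : G → ℂ) (he : H.HG e) : H.HG (Lt k e) := by
  refine ⟨?_, fun _ _ => trivial, FinS.translate k he.2.2⟩
  intro j hj y j' hj'
  have n := H.Knorm k⁻¹ (H.K.inv_mem hk) j hj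
  have c := H.conj k⁻¹ (H.GE.inv_mem (H.KGE hk)) j
  have : k⁻¹ * (j * y * j') = (k⁻¹ * j * k⁻¹⁻¹) * (k⁻¹ * y) * j' := by group
  simp only [Lt]
  rw [this, he.1 _ n _ _ hj', c]

lemma eta_Lt (k : G) (hk : k ∈ H.K) (e : G → ℂ) (he : H.HE e) : H.eta (Lt k e) = Lt k (H.eta e) := by
  refine H.uniq _ _ (H.eta_HG _ (H.Lt_HE k hk e he)).1 (H.Lt_HG k hk _ (H.eta_HG e he)).1 ?_
  intro g hg
  have hkg := H.GE.mul_mem (H.GE.inv_mem (H.KGE hk)) hg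
  rw [H.eta_GE _ (H.Lt_HE k hk e he) g hg]
  simp only [Lt]
  rw [H.eta_GE e he _ hkg]
  have := H.wK k⁻¹ (H.K.inv_mem hk) g hg 1 H.K.one_mem
  rw [mul_one] at this
  rw [this]

def P (e₁ : G → ℂ) : Prop := H.HE e₁ ∧ ∀ e₂, H.HE e₂ →
  H.eta (hc H.J' e₁ e₂) = hc H.J (H.eta e₁) (H.eta e₂)

lemma P_Lt (k : G) (hk : k ∈ H.K) (e : G → ℂ) (he : H.P e) : H.P (Lt k e) := by
  refine ⟨H.Lt_HE k hk e he.1, fun e₂ h2 => ?_⟩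
  have a1 := (H.chi'.eqv_iff _).1 he.1.1
  have a2 := (H.chi'.eqv_iff _).1 h2.1
  have b1 := (H.chi.eqv_iff _).1 (H.eta_HG e he.1).1
  have b2 := (H.chi.eqv_iff _).1 (H.eta_HG e₂ h2).1
  have h3 : hc H.J' (Lt k e) e₂ = Lt k (hc H.J' e e₂) := by
    funext y; exact H.chi'.hc_translate a1.2 a2.1 k y
  have h4 : hc H.J (Lt k (H.eta e)) (H.eta e₂) = Lt k (hc H.J (H.eta e) (H.eta e₂)) := by
    funext y; exact H.chi.hc_translate b1.2 b2.1 k y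
  rw [h3, H.eta_Lt k hk _ (IsH.hc H.chi' he.1 h2), he.2 e₂ h2, H.eta_Lt k hk _ he.1, h4]

lemma P_T (e : G → ℂ) (he : H.P e) : H.P (H.T' e) := by
  refine ⟨H.T'_HE e he.1, fun e₂ h2 => ?_⟩
  have a1 := (H.chi'.eqv_iff _).1 he.1.1
  have a2 := (H.chi'.eqv_iff _).1 h2.1
  have b1 := (H.chi.eqv_iff _).1 (H.eta_HG e he.1).1
  have b2 := (H.chi.eqv_iff _).1 (H.eta_HG e₂ h2).1
  have h3 : hc H.J' (H.T' e) e₂ = H.T' (hc H.J' e e₂) := by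
    unfold T'
    rw [hc_sum _ _ (fun i => FinS.translate _ he.1.2.2)]
    refine Finset.sum_congr rfl fun i _ => ?_
    funext y; exact H.chi'.hc_translate a1.2 a2.1 _ y
  have h4 : hc H.J (H.TG (H.eta e)) (H.eta e₂) = H.TG (hc H.J (H.eta e) (H.eta e₂)) := by
    unfold TG
    rw [hc_sum _ _ (fun i => FinS.translate _ (H.eta_HG e he.1).2.2)]
    refine Finset.sum_congr rfl fun i _ => ?_
    funext y; exact H.chi.hc_translate b1.2 b2.1 _ y
  rw [h3, H.eta_T _ (IsH.hc H.chi' he.1 h2), he.2 e₂ h2, H.eta_T _ he.1, hc_smul, h4]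

def E1 : G → ℂ := fun y => if y ∈ H.J' then H.τ y else 0

lemma E1_HE : H.HE H.E1 := by
  refine ⟨?_, ?_, fin_of_family (fun _ : Unit => (1 : G)) ?_⟩
  · intro k hk y k' hk'
    by_cases hy : y ∈ H.J'
    · have h2 := H.J'.mul_mem hk hy
      simp only [E1, if_pos hy, if_pos (H.J'.mul_mem h2 hk'), H.chi'.mul _ h2 _ hk',
        H.chi'.mul _ hk _ hy]
    · have : k * y * k' ∉ H.J' := by
        intro h
        apply hy
        have := H.J'.mul_mem (H.J'.mul_mem (H.J'.inv_mem hk) h) (H.J'.inv_mem hk')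
        convert this using 1
        group
      simp only [E1, if_neg hy, if_neg this]; ring
  · intro y hy
    by_contra h
    exact hy (if_neg (fun h' => h h'.2))
  · intro y hy
    refine ⟨(), ?_⟩
    by_contra h
    rw [inv_one, one_mul] at h
    exact hy (if_neg h)

lemma P_E1 : H.P H.E1 := by
  refine ⟨H.E1_HE, fun e₂ h2 => ?_⟩
  have a1 := (H.chi'.eqv_iff _).1 H.E1_HE.1
  have a2 := (H.chi'.eqv_iff _).1 h2.1
  have b1 := (H.chi.eqv_iff _).1 (H.eta_HG _ H.E1_HE).1
  have b2 := (H.chi.eqv_iff _).1 (H.eta_HG e₂ h2).1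
  have v1 : H.E1 1 = 1 := by simp [E1, H.J'.one_mem, H.chi.one]
  have v2 : H.eta H.E1 1 = 1 := by
    rw [H.eta_GE _ H.E1_HE 1 H.GE.one_mem, v1, H.wone]; simp
  have h3 : hc H.J' H.E1 e₂ = e₂ := by
    funext y
    rw [H.chi'.hc_family a1.2 a2.1 (fun _ : Unit => (1 : G)) (fun _ _ _ => rfl)]
    · simp [v1]
    · intro y hy
      refine ⟨(), ?_⟩
      by_contra h
      rw [inv_one, one_mul] at h
      exact hy (if_neg h)
  have h4 : hc H.J (H.eta H.E1) (H.eta e₂) = H.eta e₂ := by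
    funext y
    rw [H.chi.hc_family b1.2 b2.1 (fun _ : Unit => (1 : G)) (fun _ _ _ => rfl)]
    · simp [v2]
    · intro y hy
      refine ⟨(), ?_⟩
      obtain ⟨j₁, m1, g, hg, j₂, m2, rfl, h3⟩ := H.lift_ne _ y hy
      have : g ∈ H.J' := by
        by_contra h
        exact right_ne_zero_of_mul h3 (if_neg h)
      simpa using H.J.mul_mem (H.J.mul_mem m1 this.1) m2
  rw [h3, h4]

lemma P_comb (e f : G → ℂ) (c : ℂ) (he : H.P e) (hf : H.P f) : H.P (e + c • f) := by
  have hf' : H.HE (c • f) := by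
    refine ⟨?_, fun y hy => hf.1.2.1 (right_ne_zero_of_mul hy), hf.1.2.2.smul c⟩
    intro k hk g k' hk'
    simp only [Pi.smul_apply, smul_eq_mul]
    rw [hf.1.1 k hk g k' hk']; ring
  refine ⟨⟨?_, ?_, he.1.2.2.add hf'.2.2⟩, fun e₂ h2 => ?_⟩
  · intro k hk g k' hk'
    simp only [Pi.add_apply]
    rw [he.1.1 k hk g k' hk', hf'.1 k hk g k' hk']; ring
  · intro y hy
    by_contra h
    apply hy
    simp [H.zero_off e he.1 y h, H.zero_off f hf.1 y h]
  · rw [hc_add he.1.2.2 hf'.2.2, eta_add, eta_add, hc_add (H.eta_HG e he.1).2.2 (H.eta_HG _ hf').2.2,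
      he.2 e₂ h2, hc_smul, eta_smul, eta_smul, hf.2 e₂ h2, hc_smul]

lemma T_pow (r : ℕ) : H.P ((H.T')^[r] H.E1) ∧
    Function.support ((H.T')^[r] H.E1) ⊆ DC H.J' (H.a ^ r) ∧ (H.T')^[r] H.E1 (H.a ^ r) ≠ 0 := by
  induction r with
  | zero =>
    refine ⟨H.P_E1, ?_, ?_⟩
    · intro y hy
      refine ⟨y, ?_, 1, H.J'.one_mem, by simp⟩
      by_contra h
      exact hy (if_neg h)
    · simp [E1, H.J'.one_mem, H.chi.one]
  | succ r ih =>
    rw [Function.iterate_succ_apply']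
    generalize (H.T')^[r] H.E1 = f at ih
    obtain ⟨i1, i2, i3⟩ := ih
    refine ⟨H.P_T _ i1, ?_, ?_⟩
    · intro y hy
      rw [Function.mem_support, T'_apply] at hy
      obtain ⟨i, _, hi⟩ := Finset.exists_ne_zero_of_sum_ne_zero hy
      obtain ⟨j₁, h1, j₂, h2, e⟩ := i2 hi
      obtain ⟨u, hu, _, ex⟩ := H.xmem' i
      obtain ⟨k₁, m1, k₂, m2, e'⟩ := H.A7a r j₁ h1
      refine ⟨u * k₁, H.J'.mul_mem hu m1, k₂ * j₂, H.J'.mul_mem m2 h2, ?_⟩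
      have : y = H.x' i * (j₁ * H.a ^ r * j₂) := by rw [← e]; group
      rw [this, ex]
      calc _ = u * (H.a * j₁ * H.a ^ r) * j₂ := by simp only [mul_assoc]
        _ = _ := by rw [e']; simp only [mul_assoc]
    · rw [T'_apply]
      obtain ⟨i, hi⟩ := H.xsur' 1 H.J'.one_mem
      rw [one_mul] at hi
      rw [Finset.sum_eq_single i]
      · have : (H.x' i)⁻¹ * H.a ^ (r + 1) = ((H.x' i)⁻¹ * H.a) * H.a ^ r := by
          rw [pow_succ', mul_assoc]
        rw [this, ((H.chi'.eqv_iff f).1 i1.1.1).1 _ _ hi]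
        exact mul_ne_zero (H.chi'.ne _ hi) i3
      · intro j _ hj
        by_contra h0
        apply hj
        have := H.A7b r j (i2 h0)
        apply H.xinj'
        have h4 := H.J'.inv_mem (H.J'.mul_mem hi this)
        convert h4 using 1
        group
      · simp

lemma exists_P (k k' : G) (r : ℕ) (hk : k ∈ H.K) (hk' : k' ∈ H.K) :
    ∃ f, H.P f ∧ Function.support f ⊆ DC H.J' (k * H.a ^ r * k') ∧ f (k * H.a ^ r * k') ≠ 0 := by
  have hT : ∀ s : ℕ, (H.T')^[s] (fun y => H.E1 (y * k'⁻¹)) = fun y => (H.T')^[s] H.E1 (y * k'⁻¹) := by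
    intro s
    induction s with
    | zero => rfl
    | succ s ih =>
      rw [Function.iterate_succ_apply', Function.iterate_succ_apply', ih]
      funext y
      rw [T'_apply, T'_apply]
      refine Finset.sum_congr rfl fun i _ => ?_
      rw [mul_assoc]
  have hE : (fun y => H.E1 (y * k'⁻¹)) = Lt k' H.E1 := by
    funext y
    have hc' := H.conj k' (H.KGE hk') (k'⁻¹ * y)
    have e : k' * (k'⁻¹ * y) * k'⁻¹ = y * k'⁻¹ := by group
    rw [e] at hc'
    simp only [Lt, E1]
    by_cases h : y * k'⁻¹ ∈ H.J'
    · have h2 := H.norm' k'⁻¹ _ (H.K.inv_mem hk') h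
      have e2 : k'⁻¹ * (y * k'⁻¹) * k'⁻¹⁻¹ = k'⁻¹ * y := by group
      rw [e2] at h2
      rw [if_pos h, if_pos h2, hc']
    · have h2 : k'⁻¹ * y ∉ H.J' := by
        intro h3
        apply h
        have := H.norm' k' _ hk' h3
        rwa [e] at this
      rw [if_neg h, if_neg h2]
  obtain ⟨p1, p2, p3⟩ := H.T_pow r
  have hP : ∀ s : ℕ, H.P ((H.T')^[s] (Lt k' H.E1)) := by
    intro s
    induction s with
    | zero => exact H.P_Lt k' hk' _ H.P_E1
    | succ s ih => rw [Function.iterate_succ_apply']; exact H.P_T _ ih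
  refine ⟨Lt k ((H.T')^[r] (Lt k' H.E1)), H.P_Lt k hk _ (hP r), ?_, ?_⟩
  · intro y hy
    rw [← hE, hT r] at hy
    obtain ⟨j₁, h1, j₂, h2, e⟩ := p2 hy
    have n1 := H.norm' k j₁ hk h1
    have n2 := H.norm' k'⁻¹ j₂ (H.K.inv_mem hk') h2
    refine ⟨_, n1, _, n2, ?_⟩
    have : y = k * (j₁ * H.a ^ r * j₂) * k' := by rw [← e]; group
    rw [this]; group
  · rw [← hE, hT r]
    simp only [Lt]
    convert p3 using 2
    group

lemma P_all : ∀ (N : ℕ) (e : G → ℂ), H.HE e →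
    ((fun y : G => (QuotientGroup.mk y : G ⧸ H.J')) '' Function.support e).ncard = N → H.P e := by
  intro N
  induction N using Nat.strong_induction_on with
  | _ N ih =>
    intro e he hN
    by_cases h0 : ∃ g, e g ≠ 0
    · obtain ⟨g, hg⟩ := h0
      obtain ⟨k, hk, k', hk', r, eg⟩ := H.A4 e he g hg
      obtain ⟨f, f1, f2, f3⟩ := H.exists_P k k' r hk hk'
      rw [← eg] at f2 f3
      set c : ℂ := e g / f g with hcdef
      have heq : e = (e + (-c) • f) + c • f := by funext y; simp
      have hne : (-c) • f = ((-c) • f) := rfl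
      have e'HE : H.HE (e + (-c) • f) := by
        have hf' : H.HE ((-c) • f) := by
          refine ⟨?_, fun y hy => f1.1.2.1 (right_ne_zero_of_mul hy), f1.1.2.2.smul _⟩
          intro k hk g k' hk'
          simp only [Pi.smul_apply, smul_eq_mul]
          rw [f1.1.1 k hk g k' hk']; ring
        refine ⟨?_, ?_, he.2.2.add hf'.2.2⟩
        · intro k hk g k' hk'
          simp only [Pi.add_apply]
          rw [he.1 k hk g k' hk', hf'.1 k hk g k' hk']; ring
        · intro y hy
          by_contra h
          apply hy
          simp [H.zero_off e he y h, H.zero_off f f1.1 y h]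
      have hz : ∀ y ∈ DC H.J' g, (e + (-c) • f) y = 0 := by
        rintro y ⟨j₁, h1, j₂, h2, rfl⟩
        rw [e'HE.1 _ h1 _ _ h2]
        have : (e + (-c) • f) g = 0 := by
          simp only [Pi.add_apply, Pi.smul_apply, smul_eq_mul, hcdef]
          field_simp
          ring
        rw [this]; ring
      have hsub : Function.support (e + (-c) • f) ⊆ Function.support e := by
        intro y hy
        by_contra h
        have hey : e y = 0 := by simpa using h
        have hfy : f y ≠ 0 := by
          intro hf0; apply hy; simp [hey, hf0]
        exact hy (hz y (f2 hfy))
      rw [heq]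
      refine H.P_comb _ _ _ (ih _ ?_ _ e'HE rfl) f1
      rw [← hN]
      refine Set.ncard_lt_ncard ?_ he.2.2
      refine ⟨Set.image_mono hsub, fun hcon => ?_⟩
      obtain ⟨y, hy, hyg⟩ := hcon ⟨g, hg, rfl⟩
      apply hy
      have := QuotientGroup.eq.1 hyg
      apply hz
      refine ⟨1, H.J'.one_mem, _, H.J'.inv_mem this, ?_⟩
      group
    · push Not at h0
      have hz : e = (-1 : ℂ) • H.E1 + (1 : ℂ) • H.E1 := by funext y; simp [h0 y]
      have hz2 : e = H.E1 + (-1 : ℂ) • H.E1 := by funext y; simp [h0 y]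
      rw [hz2]
      exact H.P_comb _ _ _ H.P_E1 H.P_E1

lemma eta_mul (e f : G → ℂ) (he : H.HE e) (hf : H.HE f) :
    H.eta (hc H.J' e f) = hc H.J (H.eta e) (H.eta f) := (H.P_all _ e he rfl).2 f hf

lemma norm_sum {K : Subgroup G} {τ : G → ℂ} (hτ : Chi K τ) (f : G → ℂ) (hf : Eqv K τ f) (g : G)
    (hs : Function.support f ⊆ DC K g) (hfin : FinS K f) (hg : f g ≠ 0) :
    hc K f (fun y => star (f y⁻¹)) 1 =
      ((‖f g‖ ^ 2 * Nat.card ((fun y : G => (QuotientGroup.mk y : G ⧸ K)) '' DC K g) : ℝ) : ℂ) := by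
  have hS : (fun y : G => (QuotientGroup.mk y : G ⧸ K)) '' DC K g =
      (fun y : G => (QuotientGroup.mk y : G ⧸ K)) '' Function.support f := by
    apply le_antisymm
    · apply Set.image_mono
      rintro y ⟨j₁, h1, j₂, h2, rfl⟩
      rw [Function.mem_support, hf _ h1 _ _ h2]
      exact mul_ne_zero (mul_ne_zero (hτ.ne _ h1) hg) (hτ.ne _ h2)
    · exact Set.image_mono hs
  rw [hS]
  have hnorm : ∀ y, f y ≠ 0 → ‖f y‖ = ‖f g‖ := by
    intro y hy
    obtain ⟨j₁, h1, j₂, h2, rfl⟩ := hs hy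
    rw [hf _ h1 _ _ h2]
    simp [hτ.norm _ h1, hτ.norm _ h2]
  unfold hc
  rw [finsum_eq_sum_of_support_subset (s := hfin.toFinset)]
  · rw [Finset.sum_congr rfl (g := fun _ => ((‖f g‖ ^ 2 : ℝ) : ℂ))]
    · rw [Finset.sum_const, Nat.card_eq_card_finite_toFinset hfin]
      simp [mul_comm]
    · intro q hq
      have hq' := hfin.mem_toFinset.1 hq
      obtain ⟨y, hy, rfl⟩ := hq'
      obtain ⟨⟨l, hl⟩, el⟩ := QuotientGroup.mk_out_eq_mul K y
      have h3 : Quotient.out (QuotientGroup.mk y : G ⧸ K) = y * l := el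
      have : f (Quotient.out (QuotientGroup.mk y : G ⧸ K)) ≠ 0 := by
        rw [h3, ((hτ.eqv_iff f).1 hf).2 _ _ hl]
        exact mul_ne_zero hy (hτ.ne _ hl)
      simp only [mul_one, inv_inv]
      rw [← hnorm _ this]
      simp [Complex.mul_conj, Complex.normSq_eq_norm_sq]
  · intro q hq
    refine hfin.mem_toFinset.2 ?_
    exact ⟨Quotient.out q, left_ne_zero_of_mul hq, QuotientGroup.out_eq' q⟩

lemma explicit (g : G) (hg : g ∈ H.GE) (e : G → ℂ) (he : H.HE e)
    (hs : Function.support e ⊆ DC H.J' g) (h1 : e g = 1) (f : G → ℂ) (hf : H.HG f)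
    (hfs : Function.support f ⊆ DC H.J g) (hf1 : f g = 1) :
    H.eta e = (Real.sqrt
      ((Nat.card ((fun y : G => (QuotientGroup.mk y : G ⧸ H.J')) '' DC H.J' g) : ℝ) /
      (Nat.card ((fun y : G => (QuotientGroup.mk y : G ⧸ H.J)) '' DC H.J g) : ℝ)) : ℂ) • f := by
  have hst := H.star_HE e he
  have hm := congrFun (H.eta_mul e _ he hst) 1
  have hv : H.eta e g = H.wt g := by rw [H.eta_GE e he g hg, h1, mul_one]
  rw [H.eta_GE _ (IsH.hc H.chi' he hst) 1 H.GE.one_mem, H.wone, H.eta_star e he hst,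
    norm_sum H.chi' e he.1 g hs he.2.2 (by rw [h1]; exact one_ne_zero),
    norm_sum H.chi _ (H.eta_HG e he).1 g (H.eta_supp e g hs) (H.eta_HG e he).2.2
      (by rw [hv]; exact H.wne g), hv, h1] at hm
  have hm' : (Nat.card ((fun y : G => (QuotientGroup.mk y : G ⧸ H.J')) '' DC H.J' g) : ℝ) =
     (H.wt g) ^ 2 * (Nat.card ((fun y : G => (QuotientGroup.mk y : G ⧸ H.J)) '' DC H.J g) : ℝ) := by
    have := hm
    simp only [norm_one, one_pow, one_mul, Complex.ofReal_one, Complex.norm_real] at this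
    have h2 := Complex.ofReal_injective this
    rw [h2, Real.norm_eq_abs, sq_abs]
  have hfin : H.Fin' g := by
    obtain ⟨k, hk, k', hk', r, eg⟩ := H.A4 e he g (by rw [h1]; exact one_ne_zero)
    rw [eg]
    exact (H.fin_KaK k k' r hk hk').1
  have hpos : (0 : ℝ) < (Nat.card ((fun y : G => (QuotientGroup.mk y : G ⧸ H.J)) '' DC H.J g) : ℝ) := by
    have : Finite ((fun y : G => (QuotientGroup.mk y : G ⧸ H.J)) '' DC H.J g) := hfin
    have : Nonempty ((fun y : G => (QuotientGroup.mk y : G ⧸ H.J)) '' DC H.J g) :=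
      ⟨⟨_, g, ⟨1, H.J.one_mem, 1, H.J.one_mem, by simp⟩, rfl⟩⟩
    exact_mod_cast Nat.card_pos
  rw [hm', mul_div_assoc, div_self hpos.ne', mul_one, Real.sqrt_sq (H.wpos g).le]
  funext y
  by_cases hy : y ∈ DC H.J g
  · obtain ⟨j₁, m1, j₂, m2, rfl⟩ := hy
    rw [(H.eta_HG e he).1 _ m1 _ _ m2, hv, Pi.smul_apply, hf.1 _ m1 _ _ m2, hf1]
    simp only [smul_eq_mul]; ring
  · have z1 : H.eta e y = 0 := by
      by_contra h; exact hy (H.eta_supp e g hs h)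
    have z2 : f y = 0 := by
      by_contra h; exact hy (hfs h)
    rw [z1, Pi.smul_apply, z2, smul_zero]
end HD
end HK

namespace UC

structure CF (F : Type u) [Field F] where
  cj : F ≃+* F
  cj_cj : ∀ x : F, cj (cj x) = x
  O : Subring F
  π : F
  π_mem : π ∈ O
  π_ne : π ≠ 0
  π_nu : ∀ y ∈ O, π * y ≠ 1
  cjO : ∀ x ∈ O, cj x ∈ O
  val : ∀ x : F, x ≠ 0 → x ∈ O ∨ x⁻¹ ∈ O
  unif : ∀ x ∈ O, (∀ y ∈ O, x * y ≠ 1) → ∃ z ∈ O, x = π * z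
  cjπ : cj π = π
  two : (2 : F) ≠ 0
  half : (2 : F)⁻¹ ∈ O
  s : F
  cjs : cj s = -s
  s_ne : s ≠ 0
  s_mem : s ∈ O
  s_inv : s⁻¹ ∈ O

namespace CF
variable {F : Type u} [Field F] (C : CF F)

def P (k : ℤ) : AddSubgroup F where
  carrier := {x | C.π ^ (-k) * x ∈ C.O}
  zero_mem' := by simp [C.O.zero_mem]
  add_mem' := by
    intro a b ha hb
    simp only [Set.mem_setOf_eq] at *
    rw [mul_add]; exact C.O.add_mem ha hb
  neg_mem' := by
    intro a ha
    simp only [Set.mem_setOf_eq] at *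
    rw [mul_neg]; exact C.O.neg_mem ha

variable {C}
lemma P_def {k : ℤ} {x : F} : x ∈ C.P k ↔ C.π ^ (-k) * x ∈ C.O := Iff.rfl
lemma P0 {x : F} : x ∈ C.P 0 ↔ x ∈ C.O := by simp [P_def]
lemma πn {k : ℤ} : C.π ^ k ≠ 0 := zpow_ne_zero _ C.π_ne
lemma mono {i k : ℤ} {x : F} (hx : x ∈ C.P i) (h : k ≤ i) : x ∈ C.P k := by
  rw [P_def] at *
  obtain ⟨n, hn⟩ := Int.eq_ofNat_of_zero_le (sub_nonneg.2 h)
  have : C.π ^ (-k) * x = C.π ^ n * (C.π ^ (-i) * x) := by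
    rw [← mul_assoc, ← zpow_natCast, ← zpow_add₀ C.π_ne, ← hn]; congr 2; ring
  rw [this]
  exact C.O.mul_mem (C.O.pow_mem C.π_mem n) hx
lemma mul {i j k : ℤ} {x y : F} (hx : x ∈ C.P i) (hy : y ∈ C.P j) (h : k ≤ i + j) :
    x * y ∈ C.P k := by
  refine mono ?_ h
  rw [P_def] at *
  have : C.π ^ (-(i + j)) * (x * y) = (C.π ^ (-i) * x) * (C.π ^ (-j) * y) := by
    rw [neg_add, zpow_add₀ C.π_ne]; ring
  rw [this]
  exact C.O.mul_mem hx hy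
lemma ppow (k : ℤ) : C.π ^ k ∈ C.P k := by
  rw [P_def, ← zpow_add₀ C.π_ne]; simp [C.O.one_mem]
lemma p1 : C.π ∈ C.P 1 := by simpa using ppow (C := C) 1
lemma one0 : (1 : F) ∈ C.P 0 := P0.2 C.O.one_mem
lemma two0 : (2 : F)⁻¹ ∈ C.P 0 := P0.2 C.half
lemma cjm {k : ℤ} {x : F} (hx : x ∈ C.P k) : C.cj x ∈ C.P k := by
  rw [P_def] at *
  have := C.cjO _ hx
  rwa [map_mul, map_zpow₀, C.cjπ] at this
lemma cjm_iff {k : ℤ} {x : F} : C.cj x ∈ C.P k ↔ x ∈ C.P k :=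
  ⟨fun h => by simpa [C.cj_cj] using cjm h, cjm⟩
/-- multiplying by powers of π -/
lemma pmul {i k : ℤ} {x : F} : C.π ^ i * x ∈ C.P k ↔ x ∈ C.P (k - i) := by
  rw [P_def, P_def, ← mul_assoc, ← zpow_add₀ C.π_ne]
  have : -k + i = -(k - i) := by ring
  rw [this]
lemma pmul1 {k : ℤ} {x : F} : C.π * x ∈ C.P k ↔ x ∈ C.P (k - 1) := by
  simpa using pmul (C := C) (i := 1) (k := k) (x := x)
lemma inv_of_not {i : ℤ} {x : F} (h : x ∉ C.P (i + 1)) : x⁻¹ ∈ C.P (-i) := by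
  have hx : x ≠ 0 := by rintro rfl; exact h (C.P _).zero_mem
  set y := C.π ^ (-(i + 1)) * x with hy
  have hy0 : y ≠ 0 := mul_ne_zero πn hx
  have hyO : y ∉ C.O := h
  have hyi : y⁻¹ ∈ C.O := (C.val y hy0).resolve_left hyO
  obtain ⟨z, hz, e⟩ := C.unif _ hyi (by
    intro t ht e
    apply hyO
    have : t = y := by field_simp at e; exact e
    rwa [← this])
  rw [P_def]
  have : C.π ^ (-(-i)) * x⁻¹ = z := by
    have h1 : x⁻¹ = C.π ^ (-(i+1)) * y⁻¹ := by
      rw [hy, mul_inv, mul_inv_cancel_left₀ πn]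
    have hp := C.π_ne
    rw [h1, e, ← mul_assoc, ← mul_assoc, ← zpow_add₀ C.π_ne]
    have : C.π ^ (- -i + -(i+1)) = C.π⁻¹ := by
      rw [← zpow_neg_one]; congr 1; ring
    rw [this]; field_simp
  rw [this]; exact hz
lemma one_not : (1 : F) ∉ C.P 1 := by
  intro h
  rw [P_def] at h
  apply C.π_nu _ h
  have := C.π_ne
  simp only [zpow_neg_one]
  field_simp
/-- if `x y` has low valuation -/
lemma not_mem_of_inv {i : ℤ} {x : F} (hx : x ≠ 0) (h : x⁻¹ ∈ C.P (-i)) : x ∉ C.P (i + 1) := by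
  intro h1
  apply one_not (C := C)
  have := mul h h1 (k := 1) (by omega)
  rwa [inv_mul_cancel₀ hx] at this
lemma of_mul {i k : ℤ} {x y : F} (h : x * y ∈ C.P k) (hx : x ∉ C.P (i + 1)) : y ∈ C.P (k - i) := by
  have hx0 : x ≠ 0 := by rintro rfl; exact hx (C.P _).zero_mem
  have := mul (inv_of_not hx) h (k := k - i) (by omega)
  rwa [inv_mul_cancel_left₀ hx0] at this
lemma mul_not {i j : ℤ} {x y : F} (hx : x ∉ C.P (i + 1)) (hy : y ∉ C.P (j + 1)) :
    x * y ∉ C.P (i + j + 1) := by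
  intro h
  apply hy
  have := of_mul h hx
  exact mono this (by omega)
lemma mul2 {k : ℤ} {x : F} : 2 * x ∈ C.P k ↔ x ∈ C.P k := by
  constructor
  · intro h
    have := mul two0 h (k := k) (by omega)
    rwa [inv_mul_cancel_left₀ C.two] at this
  · intro h
    rw [two_mul]; exact (C.P k).add_mem h h
lemma div2 {k : ℤ} {x : F} (h : x ∈ C.P k) : x / 2 ∈ C.P k := by
  rw [div_eq_mul_inv]; exact mul h two0 (by omega)
lemma smem : C.s ∈ C.P 0 := P0.2 C.s_mem

lemma unit_of {x : F} (h : x - 1 ∈ C.P 1) : x ∈ C.P 0 ∧ x⁻¹ ∈ C.P 0 ∧ x ≠ 0 ∧ x ∉ C.P 1 := by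
  have h0 : x ∈ C.P 0 := by
    have := (C.P 0).add_mem (mono h (by omega : (0:ℤ) ≤ 1)) one0
    simpa using this
  have h1 : x ∉ C.P 1 := by
    intro hx
    apply one_not (C := C)
    have := (C.P 1).sub_mem hx h
    simpa using this
  refine ⟨h0, ?_, ?_, h1⟩
  · have := inv_of_not (C := C) (i := 0) (x := x) (by simpa using h1)
    simpa using this
  · rintro rfl; exact h1 (C.P _).zero_mem

/-- norm valuations -/
lemma nrm {i : ℤ} {x : F} (h : x * C.cj x ∈ C.P (2 * i - 1)) : x ∈ C.P i := by
  by_contra hx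
  have h1 : x ∉ C.P (i - 1 + 1) := by simpa using hx
  have h2 : C.cj x ∉ C.P (i - 1 + 1) := by rw [cjm_iff]; exact h1
  exact mul_not h1 h2 (mono h (by omega))

/-- if x has exact val then sums of even/odd norms do not cancel -/
lemma herm {i : ℤ} {v1 v2 : F} (h : C.π * (v1 * C.cj v1) + v2 * C.cj v2 ∈ C.P i) :
    v1 ∈ C.P (i / 2) ∧ v2 ∈ C.P ((i + 1) / 2) := by
  by_cases h0 : v1 = 0
  · subst h0
    refine ⟨(C.P _).zero_mem, nrm (i := (i+1)/2) (mono ?_ (by omega : 2*((i+1)/2) - 1 ≤ i))⟩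
    simpa using h
  -- compare
  by_cases hc : v2 / v1 ∈ C.P 1
  · -- v2 smaller
    have e : C.π * (v1 * C.cj v1) + v2 * C.cj v2
        = C.π * (v1 * C.cj v1) * (1 + (v2 / v1) * C.cj (v2 / v1) * C.π⁻¹) := by
      have := C.π_ne
      have h2 : C.cj v1 ≠ 0 := by simpa using h0
      rw [map_div₀]; field_simp
    have hu : (v2 / v1) * C.cj (v2 / v1) * C.π⁻¹ ∈ C.P 1 := by
      have : C.π⁻¹ ∈ C.P (-1) := by simpa using ppow (C := C) (-1)
      exact mul (mul hc (cjm hc) (k := 2) (by omega)) this (by omega)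
    obtain ⟨u0, u1, u2, u3⟩ := unit_of (C := C)
      (x := 1 + (v2 / v1) * C.cj (v2 / v1) * C.π⁻¹) (by simpa using hu)
    rw [e] at h
    have h3 := mul h u1 (k := i) (by omega)
    rw [mul_inv_cancel_right₀ u2, pmul1] at h3
    have h4 : v1 ∈ C.P (i / 2) := nrm (mono h3 (by omega))
    refine ⟨h4, ?_⟩
    have := mul hc h4 (k := (i+1)/2) (by omega)
    rwa [div_mul_cancel₀ _ h0] at this
  · have h20 : v2 ≠ 0 := by
      rintro rfl; apply hc; simp [(C.P 1).zero_mem]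
    have hc' : v1 / v2 ∈ C.P 0 := by
      have := inv_of_not (C := C) (i := 0) (x := v2 / v1) (by simpa using hc)
      simpa using this
    have e : C.π * (v1 * C.cj v1) + v2 * C.cj v2
        = (v2 * C.cj v2) * (1 + C.π * ((v1 / v2) * C.cj (v1 / v2))) := by
      have h2 : C.cj v2 ≠ 0 := by simpa using h20
      rw [map_div₀]; field_simp; ring
    have hu : C.π * ((v1 / v2) * C.cj (v1 / v2)) ∈ C.P 1 :=
      mul p1 (mul hc' (cjm hc') (k := 0) (by omega)) (by omega)
    obtain ⟨u0, u1, u2, u3⟩ := unit_of (C := C)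
      (x := 1 + C.π * ((v1 / v2) * C.cj (v1 / v2))) (by simpa using hu)
    rw [e] at h
    have h3 := mul h u1 (k := i) (by omega)
    rw [mul_inv_cancel_right₀ u2] at h3
    have h4 : v2 ∈ C.P ((i + 1) / 2) := nrm (mono h3 (by omega))
    refine ⟨?_, h4⟩
    have := mul hc' h4 (k := i/2) (by omega)
    rwa [div_mul_cancel₀ _ h20] at this

/-- D i -/
def D (C : CF F) (i : ℤ) (v1 v2 : F) : Prop := v1 ∈ C.P (i / 2) ∧ v2 ∈ C.P ((i + 1) / 2)
def hh (C : CF F) (v1 v2 w1 w2 : F) : F := C.π * (C.cj v1 * w1) + C.cj v2 * w2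
lemma D.h {i j k : ℤ} {v1 v2 w1 w2 : F} (hv : D C i v1 v2) (hw : D C j w1 w2)
    (h : 2 * k ≤ i + j + 1) : hh C v1 v2 w1 w2 ∈ C.P k := by
  refine (C.P k).add_mem ?_ ?_
  · exact mul p1 (mul (cjm hv.1) hw.1 le_rfl) (by omega)
  · exact mul (cjm hv.2) hw.2 (by omega)
lemma D.of_h {i : ℤ} {v1 v2 : F} (h : hh C v1 v2 v1 v2 ∈ C.P i) : D C i v1 v2 := by
  apply herm
  convert h using 1
  simp only [hh]; ring
lemma D.hself {i : ℤ} {v1 v2 : F} (hv : D C i v1 v2) : hh C v1 v2 v1 v2 ∈ C.P i :=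
  hv.h hv (by omega)
lemma D.mono {i j : ℤ} {v1 v2 : F} (hv : D C i v1 v2) (h : j ≤ i) : D C j v1 v2 :=
  ⟨CF.mono hv.1 (by omega), CF.mono hv.2 (by omega)⟩
lemma D.smul {i k l : ℤ} {c v1 v2 : F} (hc : c ∈ C.P k) (hv : D C i v1 v2) (h : l ≤ i + 2 * k) :
    D C l (c * v1) (c * v2) := ⟨mul hc hv.1 (by omega), mul hc hv.2 (by omega)⟩
lemma D.neg {i : ℤ} {v1 v2 : F} (hv : D C i v1 v2) : D C i (-v1) (-v2) :=
  ⟨(C.P _).neg_mem hv.1, (C.P _).neg_mem hv.2⟩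
lemma D.add {i : ℤ} {v1 v2 w1 w2 : F} (hv : D C i v1 v2) (hw : D C i w1 w2) :
    D C i (v1 + w1) (v2 + w2) := ⟨(C.P _).add_mem hv.1 hw.1, (C.P _).add_mem hv.2 hw.2⟩
lemma hh_cj (v1 v2 w1 w2 : F) : C.cj (hh C v1 v2 w1 w2) = hh C w1 w2 v1 v2 := by
  simp only [hh, map_add, map_mul, C.cjπ, C.cj_cj]; ring
end CF
end UC

namespace UC
open CF

abbrev M4 (F : Type u) := Matrix (Fin 4) (Fin 4) F

def adj {F : Type u} [Field F] (C : CF F) (M : M4 F) : M4 F :=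
  !![C.cj (M 3 3), C.π * C.cj (M 1 3), C.cj (M 2 3), C.cj (M 0 3);
     C.cj (M 3 1) / C.π, C.cj (M 1 1), C.cj (M 2 1) / C.π, C.cj (M 0 1) / C.π;
     C.cj (M 3 2), C.π * C.cj (M 1 2), C.cj (M 2 2), C.cj (M 0 2);
     C.cj (M 3 0), C.π * C.cj (M 1 0), C.cj (M 2 0), C.cj (M 0 0)]

structure JM {F : Type u} [Field F] (C : CF F) (m : ℤ) (M : M4 F) : Prop where
  h00 : M 0 0 - 1 ∈ C.P m
  h03 : M 0 3 ∈ C.P m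
  h30 : M 3 0 ∈ C.P m
  h33 : M 3 3 - 1 ∈ C.P m
  c0 : D C m (M 1 0) (M 2 0)
  c3 : D C m (M 1 3) (M 2 3)
  h01 : M 0 1 ∈ C.P (m / 2 + 1)
  h31 : M 3 1 ∈ C.P (m / 2 + 1)
  h02 : M 0 2 ∈ C.P ((m + 1) / 2)
  h32 : M 3 2 ∈ C.P ((m + 1) / 2)
  tr : M 1 1 + M 2 2 - 2 ∈ C.P m
  df : M 1 1 - M 2 2 ∈ C.P ((m + 1) / 2)
  om : C.π * M 1 2 - M 2 1 ∈ C.P m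
  op : C.π * M 1 2 + M 2 1 ∈ C.P (m / 2 + 1)

structure EM {F : Type u} [Field F] (C : CF F) (M : M4 F) : Prop where
  h01 : M 0 1 = 0
  h02 : M 0 2 = 0
  h10 : M 1 0 = 0
  h20 : M 2 0 = 0
  h13 : M 1 3 = 0
  h23 : M 2 3 = 0
  h31 : M 3 1 = 0
  h32 : M 3 2 = 0
  h22 : M 2 2 = M 1 1
  h21 : M 2 1 = - (C.π * M 1 2)

structure CG (F : Type u) [Field F] (G : Type v) [Group G] extends CF F where
  ψ : F → ℂ
  ψ_add : ∀ x y, ψ (x + y) = ψ x * ψ y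
  ψ_P1 : ∀ x, x ∈ toCF.P 1 → ψ x = 1
  ψ_im : ∀ x, cj x = - x → ψ x = 1
  ψ_r : ∃ r ∈ O, cj r = r ∧ ψ r ≠ 1
  ψ_norm : ∀ x ∈ O, ‖ψ x‖ = 1
  m : ℤ
  hm : 1 ≤ m
  mat : G → M4 F
  mat_mul : ∀ a b, mat (a * b) = mat a * mat b
  mat_one : mat 1 = 1
  mat_inj : ∀ a b, mat a = mat b → a = b
  mat_inv : ∀ a, mat a⁻¹ = adj toCF (mat a)
  mat_sur : ∀ M : M4 F, M * adj toCF M = 1 → ∃ g, mat g = M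
  J : Subgroup G
  GE : Subgroup G
  memJ : ∀ g, g ∈ J ↔ JM toCF m (mat g)
  memE : ∀ g, g ∈ GE ↔ EM toCF (mat g)

namespace CG
variable {F : Type u} [Field F] {G : Type v} [Group G] (U : CG F G)

def el (M : M4 F) : G := if h : M * adj U.toCF M = 1 then (U.mat_sur M h).choose else 1
lemma mat_el {M : M4 F} (h : M * adj U.toCF M = 1) : U.mat (U.el M) = M := by
  rw [el, dif_pos h]; exact (U.mat_sur M h).choose_spec

lemma ext {a b : G} (h : ∀ i j, U.mat a i j = U.mat b i j) : a = b :=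
  U.mat_inj _ _ (by ext i j; exact h i j)
lemma mm (a b : G) (i j : Fin 4) : U.mat (a * b) i j =
    U.mat a i 0 * U.mat b 0 j + U.mat a i 1 * U.mat b 1 j + U.mat a i 2 * U.mat b 2 j
      + U.mat a i 3 * U.mat b 3 j := by
  rw [U.mat_mul, Matrix.mul_apply, Fin.sum_univ_four]
lemma i00 (a : G) : U.mat a⁻¹ 0 0 = U.cj (U.mat a 3 3) := by rw [U.mat_inv]; rfl
lemma i01 (a : G) : U.mat a⁻¹ 0 1 = U.π * U.cj (U.mat a 1 3) := by rw [U.mat_inv]; rfl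
lemma i02 (a : G) : U.mat a⁻¹ 0 2 = U.cj (U.mat a 2 3) := by rw [U.mat_inv]; rfl
lemma i03 (a : G) : U.mat a⁻¹ 0 3 = U.cj (U.mat a 0 3) := by rw [U.mat_inv]; rfl
lemma i10 (a : G) : U.mat a⁻¹ 1 0 = U.cj (U.mat a 3 1) / U.π := by rw [U.mat_inv]; rfl
lemma i11 (a : G) : U.mat a⁻¹ 1 1 = U.cj (U.mat a 1 1) := by rw [U.mat_inv]; rfl
lemma i12 (a : G) : U.mat a⁻¹ 1 2 = U.cj (U.mat a 2 1) / U.π := by rw [U.mat_inv]; rfl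
lemma i13 (a : G) : U.mat a⁻¹ 1 3 = U.cj (U.mat a 0 1) / U.π := by rw [U.mat_inv]; rfl
lemma i20 (a : G) : U.mat a⁻¹ 2 0 = U.cj (U.mat a 3 2) := by rw [U.mat_inv]; rfl
lemma i21 (a : G) : U.mat a⁻¹ 2 1 = U.π * U.cj (U.mat a 1 2) := by rw [U.mat_inv]; rfl
lemma i22 (a : G) : U.mat a⁻¹ 2 2 = U.cj (U.mat a 2 2) := by rw [U.mat_inv]; rfl
lemma i23 (a : G) : U.mat a⁻¹ 2 3 = U.cj (U.mat a 0 2) := by rw [U.mat_inv]; rfl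
lemma i30 (a : G) : U.mat a⁻¹ 3 0 = U.cj (U.mat a 3 0) := by rw [U.mat_inv]; rfl
lemma i31 (a : G) : U.mat a⁻¹ 3 1 = U.π * U.cj (U.mat a 1 0) := by rw [U.mat_inv]; rfl
lemma i32 (a : G) : U.mat a⁻¹ 3 2 = U.cj (U.mat a 2 0) := by rw [U.mat_inv]; rfl
lemma i33 (a : G) : U.mat a⁻¹ 3 3 = U.cj (U.mat a 0 0) := by rw [U.mat_inv]; rfl

lemma one_e (i j : Fin 4) : U.mat 1 i j = if i = j then 1 else 0 := by
  rw [U.mat_one, Matrix.one_apply]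

abbrev hx (v1 v2 w1 w2 : F) : F := hh U.toCF v1 v2 w1 w2
def N (v1 v2 z : F) : Prop := z + U.cj z + hh U.toCF v1 v2 v1 v2 = 0

def nM (v1 v2 z : F) : M4 F :=
  !![1, -(U.π * U.cj v1), -U.cj v2, z; 0,1,0,v1; 0,0,1,v2; 0,0,0,1]
def mM (v1 v2 z : F) : M4 F :=
  !![1,0,0,0; v1,1,0,0; v2,0,1,0; z, -(U.π * U.cj v1), -U.cj v2, 1]
def tM (τ : F) : M4 F := !![τ,0,0,0; 0,1,0,0; 0,0,1,0; 0,0,0,(U.cj τ)⁻¹]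
def sM : M4 F := !![0,0,0,1; 0,1,0,0; 0,0,1,0; 1,0,0,0]
def dM (p q r t : F) : M4 F := !![1,0,0,0; 0,p,q,0; 0,r,t,0; 0,0,0,1]

lemma nM_ok {v1 v2 z : F} (h : U.N v1 v2 z) : U.nM v1 v2 z * adj U.toCF (U.nM v1 v2 z) = 1 := by
  have hp := U.π_ne
  simp only [N, hh] at h
  ext i j
  fin_cases i <;> fin_cases j <;>
    simp [adj, nM, Matrix.mul_apply, Fin.sum_univ_four, U.cj_cj, U.cjπ, Matrix.one_apply] <;>
    first | done | linear_combination h | (field_simp; done) | (field_simp; ring1) | (field_simp; linear_combination h)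
lemma mM_ok {v1 v2 z : F} (h : U.N v1 v2 z) : U.mM v1 v2 z * adj U.toCF (U.mM v1 v2 z) = 1 := by
  have hp := U.π_ne
  simp only [N, hh] at h
  ext i j
  fin_cases i <;> fin_cases j <;>
    simp [adj, mM, Matrix.mul_apply, Fin.sum_univ_four, U.cj_cj, U.cjπ, Matrix.one_apply] <;>
    first | done | linear_combination h | (field_simp; done) | (field_simp; ring1) | (field_simp; linear_combination h)
lemma tM_ok {τ : F} (h : τ ≠ 0) : U.tM τ * adj U.toCF (U.tM τ) = 1 := by
  have hp := U.π_ne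
  have h2 : U.cj τ ≠ 0 := by simpa using h
  ext i j
  fin_cases i <;> fin_cases j <;>
    simp [adj, tM, Matrix.mul_apply, Fin.sum_univ_four, U.cj_cj, U.cjπ, Matrix.one_apply, h, h2]
lemma sM_ok : sM (F := F) * adj U.toCF sM = 1 := by
  ext i j
  fin_cases i <;> fin_cases j <;>
    simp [adj, sM, Matrix.mul_apply, Fin.sum_univ_four, Matrix.one_apply]

def n (v1 v2 z : F) : G := U.el (U.nM v1 v2 z)
def nm (v1 v2 z : F) : G := U.el (U.mM v1 v2 z)
def t (τ : F) : G := U.el (U.tM τ)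
def s1 : G := U.el sM
def dd (p q r t : F) : G := U.el (dM p q r t)

variable {U}
lemma n_mat {v1 v2 z : F} (h : U.N v1 v2 z) : U.mat (U.n v1 v2 z) = U.nM v1 v2 z :=
  U.mat_el (U.nM_ok h)
lemma nm_mat {v1 v2 z : F} (h : U.N v1 v2 z) : U.mat (U.nm v1 v2 z) = U.mM v1 v2 z :=
  U.mat_el (U.mM_ok h)
lemma t_mat {τ : F} (h : τ ≠ 0) : U.mat (U.t τ) = U.tM τ := U.mat_el (U.tM_ok h)
lemma s_mat : U.mat U.s1 = sM := U.mat_el U.sM_ok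

lemma N.add {a1 a2 x b1 b2 y : F} (ha : U.N a1 a2 x) (hb : U.N b1 b2 y) :
    U.N (a1 + b1) (a2 + b2) (x + y - U.hx a1 a2 b1 b2) := by
  simp only [N, hx, hh, map_add, map_sub, map_mul, U.cj_cj, U.cjπ] at *
  linear_combination ha + hb
lemma N.inv {a1 a2 x : F} (ha : U.N a1 a2 x) : U.N (-a1) (-a2) (U.cj x) := by
  simp only [N, hx, hh, map_neg, map_add, map_sub, map_mul, U.cj_cj, U.cjπ] at *
  linear_combination ha
lemma N_zero {z : F} : U.N 0 0 z ↔ U.cj z = - z := by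
  simp only [N, hh]; simp; constructor <;> intro h <;> linear_combination h
lemma cj2 : U.cj 2 = 2 := map_ofNat _ _
lemma N_half (v1 v2 : F) : U.N v1 v2 (-(hh U.toCF v1 v2 v1 v2) / 2) := by
  have := U.two
  simp only [N, map_div₀, map_neg, hh_cj, cj2]; field_simp; ring

lemma n_mul {a1 a2 x b1 b2 y : F} (ha : U.N a1 a2 x) (hb : U.N b1 b2 y) :
    U.n a1 a2 x * U.n b1 b2 y = U.n (a1 + b1) (a2 + b2) (x + y - U.hx a1 a2 b1 b2) := by
  apply U.ext
  intro i j
  rw [U.mm, n_mat ha, n_mat hb, n_mat (ha.add hb)]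
  fin_cases i <;> fin_cases j <;> simp [nM, hh] <;> ring
lemma nm_mul {a1 a2 x b1 b2 y : F} (ha : U.N a1 a2 x) (hb : U.N b1 b2 y) :
    U.nm a1 a2 x * U.nm b1 b2 y = U.nm (a1 + b1) (a2 + b2) (x + y - U.hx a1 a2 b1 b2) := by
  apply U.ext
  intro i j
  rw [U.mm, nm_mat ha, nm_mat hb, nm_mat (ha.add hb)]
  fin_cases i <;> fin_cases j <;> simp [mM, hh] <;> ring
lemma n_inv {a1 a2 x : F} (ha : U.N a1 a2 x) : (U.n a1 a2 x)⁻¹ = U.n (-a1) (-a2) (U.cj x) := by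
  have hp := U.π_ne
  apply U.ext
  intro i j
  rw [U.mat_inv, n_mat ha, n_mat ha.inv]
  fin_cases i <;> fin_cases j <;> simp [nM, adj, hp, U.cjπ, U.cj_cj] <;> field_simp
lemma nm_inv {a1 a2 x : F} (ha : U.N a1 a2 x) : (U.nm a1 a2 x)⁻¹ = U.nm (-a1) (-a2) (U.cj x) := by
  have hp := U.π_ne
  apply U.ext
  intro i j
  rw [U.mat_inv, nm_mat ha, nm_mat ha.inv]
  fin_cases i <;> fin_cases j <;> simp [mM, adj, hp, U.cjπ, U.cj_cj] <;> field_simp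
lemma s1_sq : U.s1 * U.s1 = 1 := by
  apply U.ext; intro i j
  rw [U.mm, U.one_e, s_mat]
  fin_cases i <;> fin_cases j <;> simp [sM]
lemma s1_inv : (U.s1)⁻¹ = U.s1 := inv_eq_of_mul_eq_one_left s1_sq
lemma s1_n {a1 a2 x : F} (ha : U.N a1 a2 x) : U.s1 * U.n a1 a2 x * U.s1 = U.nm a1 a2 x := by
  apply U.ext; intro i j
  simp only [U.mm, s_mat, n_mat ha, nm_mat ha]
  fin_cases i <;> fin_cases j <;> simp [sM, nM, mM]
lemma s1_nm {a1 a2 x : F} (ha : U.N a1 a2 x) : U.s1 * U.nm a1 a2 x * U.s1 = U.n a1 a2 x := by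
  rw [← s1_n ha, mul_assoc, mul_assoc, s1_sq, mul_one, ← mul_assoc, s1_sq, one_mul]
lemma t_mul {a b : F} (ha : a ≠ 0) (hb : b ≠ 0) : U.t a * U.t b = U.t (a * b) := by
  apply U.ext; intro i j
  rw [U.mm, t_mat ha, t_mat hb, t_mat (mul_ne_zero ha hb)]
  fin_cases i <;> fin_cases j <;> simp [tM, mul_comm]
lemma t_one : U.t 1 = 1 := by
  apply U.ext; intro i j
  rw [U.one_e, t_mat one_ne_zero]
  fin_cases i <;> fin_cases j <;> simp [tM]
lemma t_inv {a : F} (ha : a ≠ 0) : (U.t a)⁻¹ = U.t a⁻¹ := by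
  apply inv_eq_of_mul_eq_one_left
  rw [t_mul (inv_ne_zero ha) ha, inv_mul_cancel₀ ha, t_one]
lemma t_pow {a : F} (ha : a ≠ 0) (r : ℕ) : U.t a ^ r = U.t (a ^ r) := by
  induction r with
  | zero => simp [t_one]
  | succ r ih => rw [pow_succ, ih, t_mul (pow_ne_zero _ ha) ha, pow_succ]

lemma N.t {a1 a2 x : F} (τ : F) (ha : U.N a1 a2 x) :
    U.N (U.cj τ * a1) (U.cj τ * a2) (τ * U.cj τ * x) := by
  simp only [N, hh, map_mul, U.cj_cj] at *
  linear_combination (τ * U.cj τ) * ha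
lemma t_n {τ a1 a2 x : F} (ht : τ ≠ 0) (ha : U.N a1 a2 x) :
    U.t τ * U.n a1 a2 x = U.n (U.cj τ * a1) (U.cj τ * a2) (τ * U.cj τ * x) * U.t τ := by
  have h2 : U.cj τ ≠ 0 := by simpa using ht
  apply U.ext; intro i j
  rw [U.mm, U.mm, n_mat ha, n_mat (ha.t τ), t_mat ht]
  fin_cases i <;> fin_cases j <;> simp [tM, nM, U.cj_cj] <;> field_simp
lemma nm_t {τ a1 a2 x : F} (ht : τ ≠ 0) (ha : U.N a1 a2 x) :
    U.nm a1 a2 x * U.t τ = U.t τ * U.nm (τ * a1) (τ * a2) (τ * U.cj τ * x) := by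
  have h2 : U.cj τ ≠ 0 := by simpa using ht
  have ha' : U.N (τ * a1) (τ * a2) (τ * U.cj τ * x) := by
    have := ha.t (U.cj τ); rw [U.cj_cj] at this; rwa [mul_comm τ (U.cj τ)]
  apply U.ext; intro i j
  rw [U.mm, U.mm, nm_mat ha, nm_mat ha', t_mat ht]
  fin_cases i <;> fin_cases j <;> simp [tM, mM, U.cj_cj] <;> field_simp
end CG
end UC

namespace UC
open CF
namespace CF
variable {F : Type u} [Field F] {C : CF F}
lemma om {k : ℤ} {x y : F} (hx : x ∈ C.P 0) (hy : y ∈ C.P k) : x * y ∈ C.P k :=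
  mul hx hy (by omega)
lemma mo {k : ℤ} {x y : F} (hx : x ∈ C.P k) (hy : y ∈ C.P 0) : x * y ∈ C.P k :=
  mul hx hy (by omega)
lemma ad {k : ℤ} {x y : F} (hx : x ∈ C.P k) (hy : y ∈ C.P k) : x + y ∈ C.P k :=
  (C.P k).add_mem hx hy
lemma sb {k : ℤ} {x y : F} (hx : x ∈ C.P k) (hy : y ∈ C.P k) : x - y ∈ C.P k :=
  (C.P k).sub_mem hx hy
lemma ng {k : ℤ} {x : F} (hx : x ∈ C.P k) : - x ∈ C.P k := (C.P k).neg_mem hx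
lemma ng_iff {k : ℤ} {x : F} : - x ∈ C.P k ↔ x ∈ C.P k := (C.P k).neg_mem_iff
end CF
namespace CG
variable {F : Type u} [Field F] {G : Type v} [Group G] {U : CG F G}

variable (U) in
def τ (g : G) : ℂ := (U.ψ (U.π ^ (-U.m) * (U.mat g 2 1 - U.π * U.mat g 1 2)))⁻¹

lemma ψ0 : U.ψ 0 = 1 := U.ψ_P1 0 (U.P 1).zero_mem
lemma ψ_ne (x : F) : U.ψ x ≠ 0 := by
  intro h
  have := U.ψ_add x (-x)
  rw [h, zero_mul, add_neg_cancel, ψ0] at this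
  exact one_ne_zero this

/-- the two norm relations for an element of `GE` -/
lemma e_rel {g : G} (hg : EM U.toCF (U.mat g)) :
    U.mat g 1 1 * U.cj (U.mat g 1 1) + U.π * (U.mat g 1 2 * U.cj (U.mat g 1 2)) = 1 ∧
    U.mat g 1 1 * U.cj (U.mat g 1 2) = U.mat g 1 2 * U.cj (U.mat g 1 1) := by
  have hp := U.π_ne
  have h1 := U.mm g g⁻¹ 1 1
  have h2 := U.mm g g⁻¹ 1 2
  simp only [mul_inv_cancel, U.one_e, U.i01, U.i02, U.i11, U.i12, U.i21, U.i22, U.i31, U.i32,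
    hg.h10, hg.h13, hg.h21, hg.h22, hg.h23, hg.h20] at h1 h2
  simp [U.cjπ] at h1 h2
  constructor
  · linear_combination -h1
  · field_simp at h2
    linear_combination h2

lemma conj_f {g : G} (hg : EM U.toCF (U.mat g)) (y : G) :
    U.mat (g * y * g⁻¹) 2 1 - U.π * U.mat (g * y * g⁻¹) 1 2 = U.mat y 2 1 - U.π * U.mat y 1 2 ∧
    U.mat (g * y * g⁻¹) 1 1 + U.mat (g * y * g⁻¹) 2 2 = U.mat y 1 1 + U.mat y 2 2 := by
  have hp := U.π_ne
  obtain ⟨h1, h2⟩ := e_rel hg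
  simp only [U.mm, U.i01, U.i02, U.i11, U.i12, U.i21, U.i22, U.i31, U.i32,
    hg.h10, hg.h13, hg.h21, hg.h22, hg.h23, hg.h20, map_zero, map_neg, map_mul, U.cjπ]
  set x := U.mat g 1 1
  set z := U.mat g 1 2
  have e : -(U.π * U.cj z) / U.π = - U.cj z := by field_simp
  rw [e]
  constructor
  · linear_combination (U.mat y 2 1 - U.π * U.mat y 1 2) * h1
      + U.π * (U.mat y 1 1 + U.mat y 2 2) * h2
  · linear_combination (U.mat y 1 1 + U.mat y 2 2) * h1
      - (U.mat y 2 1 - U.π * U.mat y 1 2) * h2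
lemma τ_conj {g : G} (hg : g ∈ U.GE) (y : G) : U.τ (g * y * g⁻¹) = U.τ y := by
  rw [τ, (conj_f ((U.memE g).1 hg) y).1, τ]

lemma fO {M : M4 F} (h : JM U.toCF U.m M) : U.π ^ (-U.m) * (M 2 1 - U.π * M 1 2) ∈ U.O := by
  rw [← P_def, ← ng_iff]; simpa using h.om

lemma chi : HK.Chi U.J U.τ where
  norm := by
    intro j hj
    rw [U.memJ] at hj
    rw [τ, norm_inv, U.ψ_norm _ (fO hj), inv_one]
  mul := by
    intro X hX Y hY
    rw [U.memJ] at hX hY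
    rw [τ, τ, τ, ← mul_inv, ← U.ψ_add]
    congr 1
    have key : U.π ^ (-U.m) * (U.mat (X * Y) 2 1 - U.π * U.mat (X * Y) 1 2) -
      (U.π ^ (-U.m) * (U.mat X 2 1 - U.π * U.mat X 1 2) +
        U.π ^ (-U.m) * (U.mat Y 2 1 - U.π * U.mat Y 1 2)) ∈ U.P 1 := by
      rw [← mul_add, ← mul_sub, CF.pmul, ← CF.mul2]
      have hm := U.hm
      have e : 2 * (U.mat (X * Y) 2 1 - U.π * U.mat (X * Y) 1 2 -
        (U.mat X 2 1 - U.π * U.mat X 1 2 + (U.mat Y 2 1 - U.π * U.mat Y 1 2)))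
        = 2 * (U.mat X 2 0 * U.mat Y 0 1 + U.mat X 2 3 * U.mat Y 3 1)
         - 2 * (U.π * (U.mat X 1 0 * U.mat Y 0 2 + U.mat X 1 3 * U.mat Y 3 2))
         - (U.π * U.mat X 1 2 - U.mat X 2 1) * (U.mat Y 1 1 + U.mat Y 2 2 - 2)
         - (U.mat X 1 1 + U.mat X 2 2 - 2) * (U.π * U.mat Y 1 2 - U.mat Y 2 1)
         + (U.π * U.mat X 1 2 + U.mat X 2 1) * (U.mat Y 1 1 - U.mat Y 2 2)
         - (U.mat X 1 1 - U.mat X 2 2) * (U.π * U.mat Y 1 2 + U.mat Y 2 1) := by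
        rw [U.mm, U.mm]; ring
      rw [e]
      refine sb (ad (sb (sb (sb (CF.mul2.2 (ad ?_ ?_)) (CF.mul2.2 (CF.pmul1.2 (ad ?_ ?_)))) ?_) ?_) ?_) ?_
      · exact CF.mul hX.c0.2 hY.h01 (by omega)
      · exact CF.mul hX.c3.2 hY.h31 (by omega)
      · exact CF.mul hX.c0.1 hY.h02 (by omega)
      · exact CF.mul hX.c3.1 hY.h32 (by omega)
      · exact CF.mul hX.om hY.tr (by omega)
      · exact CF.mul hX.tr hY.om (by omega)
      · exact CF.mul hX.op hY.df (by omega)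
      · exact CF.mul hX.df hY.op (by omega)
    have := U.ψ_P1 _ key
    rw [← sub_add_cancel (U.π ^ (-U.m) * (U.mat (X * Y) 2 1 - U.π * U.mat (X * Y) 1 2))
      (U.π ^ (-U.m) * (U.mat X 2 1 - U.π * U.mat X 1 2) +
        U.π ^ (-U.m) * (U.mat Y 2 1 - U.π * U.mat Y 1 2)), U.ψ_add, this, one_mul]

structure KM (C : CF F) (M : M4 F) : Prop where
  h00 : M 0 0 ∈ C.P 0
  h03 : M 0 3 ∈ C.P 0
  h30 : M 3 0 ∈ C.P 0
  h33 : M 3 3 ∈ C.P 0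

variable (U) in
def K : Subgroup G where
  carrier := {g | g ∈ U.GE ∧ KM U.toCF (U.mat g)}
  one_mem' := by
    refine ⟨U.GE.one_mem, ?_⟩
    constructor <;> simp [U.one_e, (U.P 0).zero_mem, one0]
  mul_mem' := by
    rintro a b ⟨ha, ha'⟩ ⟨hb, hb'⟩
    refine ⟨U.GE.mul_mem ha hb, ?_⟩
    rw [U.memE] at ha hb
    constructor <;> simp only [U.mm, ha.h01, ha.h02, ha.h31, ha.h32, zero_mul, add_zero]
    · exact ad (om ha'.h00 hb'.h00) (om ha'.h03 hb'.h30)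
    · exact ad (om ha'.h00 hb'.h03) (om ha'.h03 hb'.h33)
    · exact ad (om ha'.h30 hb'.h00) (om ha'.h33 hb'.h30)
    · exact ad (om ha'.h30 hb'.h03) (om ha'.h33 hb'.h33)
  inv_mem' := by
    rintro a ⟨ha, ha'⟩
    refine ⟨U.GE.inv_mem ha, ?_⟩
    constructor
    · rw [U.i00]; exact cjm ha'.h33
    · rw [U.i03]; exact cjm ha'.h03
    · rw [U.i30]; exact cjm ha'.h30
    · rw [U.i33]; exact cjm ha'.h00
lemma memK {g : G} : g ∈ U.K ↔ g ∈ U.GE ∧ KM U.toCF (U.mat g) := Iff.rfl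

lemma e_int {g : G} (hg : EM U.toCF (U.mat g)) : U.mat g 1 1 ∈ U.P 0 ∧ U.mat g 1 2 ∈ U.P 0 := by
  obtain ⟨h1, -⟩ := e_rel hg
  have := CF.herm (C := U.toCF) (i := 0) (v1 := U.mat g 1 2) (v2 := U.mat g 1 1) (by
    rw [add_comm, h1]; exact one0)
  exact ⟨by simpa using this.2, by simpa using this.1⟩

lemma JK : U.J ⊓ U.GE ≤ U.K := by
  intro g hg
  obtain ⟨h1, h2⟩ := Subgroup.mem_inf.1 hg
  refine ⟨h2, ?_⟩
  have hm := U.hm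
  rw [U.memJ] at h1
  constructor
  · have := ad (CF.mono h1.h00 (by omega : (0:ℤ) ≤ U.m)) one0
    simpa using this
  · exact CF.mono h1.h03 (by omega)
  · exact CF.mono h1.h30 (by omega)
  · have := ad (CF.mono h1.h33 (by omega : (0:ℤ) ≤ U.m)) one0
    simpa using this

lemma Knorm {k j : G} (hk : k ∈ U.K) (hj : j ∈ U.J) : k * j * k⁻¹ ∈ U.J := by
  have hp := U.π_ne
  obtain ⟨hE, hK⟩ := hk
  rw [U.memE] at hE
  obtain ⟨f1, f2⟩ := conj_f hE j
  obtain ⟨i1, i2⟩ := e_int hE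
  rw [U.memJ] at hj
  have hm := U.hm
  have q := U.mm k k⁻¹
  have q00 := q 0 0
  have q03 := q 0 3
  have q30 := q 3 0
  have q33 := q 3 3
  clear q
  have e12 : U.mat k⁻¹ 1 2 = - U.cj (U.mat k 1 2) := by
    rw [U.i12, hE.h21, map_neg, map_mul, U.cjπ]; field_simp
  simp only [mul_inv_cancel, U.one_e, U.i00, U.i03, U.i30, U.i33, hE.h01, hE.h02, hE.h31, hE.h32,
    zero_mul, add_zero] at q00 q03 q30 q33
  simp at q00 q03 q30 q33
  rw [U.memJ]
  have c00 := cjm hK.h00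
  have c03 := cjm hK.h03
  have c30 := cjm hK.h30
  have c33 := cjm hK.h33
  have c11 := cjm i1
  have c12 := cjm i2
  constructor
  · have : U.mat (k * j * k⁻¹) 0 0 - 1 =
        U.mat k 0 0 * ((U.mat j 0 0 - 1) * U.cj (U.mat k 3 3)) + U.mat k 0 0 * (U.mat j 0 3 * U.cj (U.mat k 3 0))
        + U.mat k 0 3 * (U.mat j 3 0 * U.cj (U.mat k 3 3)) + U.mat k 0 3 * ((U.mat j 3 3 - 1) * U.cj (U.mat k 3 0)) := by
      simp only [U.mm, U.i00, U.i10, U.i20, U.i30, hE.h01, hE.h02, hE.h31, hE.h32, map_zero]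
      linear_combination -q00
    rw [this]
    exact ad (ad (ad (om hK.h00 (mo hj.h00 c33)) (om hK.h00 (mo hj.h03 c30)))
      (om hK.h03 (mo hj.h30 c33))) (om hK.h03 (mo hj.h33 c30))
  · have : U.mat (k * j * k⁻¹) 0 3 =
        U.mat k 0 0 * ((U.mat j 0 0 - 1) * U.cj (U.mat k 0 3)) + U.mat k 0 0 * (U.mat j 0 3 * U.cj (U.mat k 0 0))
        + U.mat k 0 3 * (U.mat j 3 0 * U.cj (U.mat k 0 3)) + U.mat k 0 3 * ((U.mat j 3 3 - 1) * U.cj (U.mat k 0 0)) := by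
      simp only [U.mm, U.i03, U.i13, U.i23, U.i33, hE.h01, hE.h02, hE.h31, hE.h32, map_zero]
      linear_combination -q03
    rw [this]
    exact ad (ad (ad (om hK.h00 (mo hj.h00 c03)) (om hK.h00 (mo hj.h03 c00)))
      (om hK.h03 (mo hj.h30 c03))) (om hK.h03 (mo hj.h33 c00))
  · have : U.mat (k * j * k⁻¹) 3 0 =
        U.mat k 3 0 * ((U.mat j 0 0 - 1) * U.cj (U.mat k 3 3)) + U.mat k 3 0 * (U.mat j 0 3 * U.cj (U.mat k 3 0))
        + U.mat k 3 3 * (U.mat j 3 0 * U.cj (U.mat k 3 3)) + U.mat k 3 3 * ((U.mat j 3 3 - 1) * U.cj (U.mat k 3 0)) := by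
      simp only [U.mm, U.i00, U.i10, U.i20, U.i30, hE.h01, hE.h02, hE.h31, hE.h32, map_zero]
      linear_combination -q30
    rw [this]
    exact ad (ad (ad (om hK.h30 (mo hj.h00 c33)) (om hK.h30 (mo hj.h03 c30)))
      (om hK.h33 (mo hj.h30 c33))) (om hK.h33 (mo hj.h33 c30))
  · have : U.mat (k * j * k⁻¹) 3 3 - 1 =
        U.mat k 3 0 * ((U.mat j 0 0 - 1) * U.cj (U.mat k 0 3)) + U.mat k 3 0 * (U.mat j 0 3 * U.cj (U.mat k 0 0))
        + U.mat k 3 3 * (U.mat j 3 0 * U.cj (U.mat k 0 3)) + U.mat k 3 3 * ((U.mat j 3 3 - 1) * U.cj (U.mat k 0 0)) := by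
      simp only [U.mm, U.i03, U.i13, U.i23, U.i33, hE.h01, hE.h02, hE.h31, hE.h32, map_zero]
      linear_combination -q33
    rw [this]
    exact ad (ad (ad (om hK.h30 (mo hj.h00 c03)) (om hK.h30 (mo hj.h03 c00)))
      (om hK.h33 (mo hj.h30 c03))) (om hK.h33 (mo hj.h33 c00))
  · have w0 := U.mm (k * j) k⁻¹
    simp only [D, U.mm, U.i00, U.i10, U.i20, U.i30, hE.h10, hE.h20, hE.h13, hE.h23, hE.h31,
      hE.h32, hE.h21, hE.h22, map_zero, zero_div, mul_zero, zero_mul, add_zero, zero_add]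
    have a := hj.c0
    have b := hj.c3
    have a2 := CF.mono a.2 (by omega : U.m / 2 ≤ (U.m + 1) / 2)
    have b2 := CF.mono b.2 (by omega : U.m / 2 ≤ (U.m + 1) / 2)
    have y : - (U.π * U.mat k 1 2) ∈ U.P 1 := ng (CF.mul p1 i2 (by omega))
    refine ⟨ad (mo (ad (om i1 a.1) (om i2 a2)) c33) (mo (ad (om i1 b.1) (om i2 b2)) c30), ?_⟩
    exact ad (mo (ad (CF.mul y a.1 (by omega)) (om i1 a.2)) c33)
      (mo (ad (CF.mul y b.1 (by omega)) (om i1 b.2)) c30)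
  · simp only [D, U.mm, U.i03, U.i13, U.i23, U.i33, hE.h10, hE.h20, hE.h13, hE.h23, hE.h01,
      hE.h02, hE.h21, hE.h22, map_zero, zero_div, mul_zero, zero_mul, add_zero, zero_add]
    have a := hj.c0
    have b := hj.c3
    have a2 := CF.mono a.2 (by omega : U.m / 2 ≤ (U.m + 1) / 2)
    have b2 := CF.mono b.2 (by omega : U.m / 2 ≤ (U.m + 1) / 2)
    have y : - (U.π * U.mat k 1 2) ∈ U.P 1 := ng (CF.mul p1 i2 (by omega))
    refine ⟨ad (mo (ad (om i1 a.1) (om i2 a2)) c03) (mo (ad (om i1 b.1) (om i2 b2)) c00), ?_⟩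
    exact ad (mo (ad (CF.mul y a.1 (by omega)) (om i1 a.2)) c03)
      (mo (ad (CF.mul y b.1 (by omega)) (om i1 b.2)) c00)
  · simp only [U.mm, U.i01, U.i11, U.i21, U.i31, hE.h13, hE.h10, hE.h01, hE.h02, map_zero, mul_zero,
      zero_mul, add_zero, zero_add]
    have y := CF.mul p1 c12 (by omega : (1:ℤ) ≤ 1 + 0)
    exact ad (mo (ad (om hK.h00 hj.h01) (om hK.h03 hj.h31)) c11)
      (CF.mul (ad (om hK.h00 hj.h02) (om hK.h03 hj.h32)) y (by omega))
  · simp only [U.mm, U.i01, U.i11, U.i21, U.i31, hE.h13, hE.h10, hE.h31, hE.h32, map_zero, mul_zero,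
      zero_mul, add_zero, zero_add]
    have y := CF.mul p1 c12 (by omega : (1:ℤ) ≤ 1 + 0)
    exact ad (mo (ad (om hK.h30 hj.h01) (om hK.h33 hj.h31)) c11)
      (CF.mul (ad (om hK.h30 hj.h02) (om hK.h33 hj.h32)) y (by omega))
  · simp only [U.mm, U.i02, e12, U.i22, U.i32, hE.h23, hE.h20, hE.h01, hE.h02, hE.h22, map_zero, mul_zero,
      zero_mul, add_zero, zero_add]
    exact ad (CF.mul (ad (om hK.h00 hj.h01) (om hK.h03 hj.h31)) (ng c12) (by omega))
      (mo (ad (om hK.h00 hj.h02) (om hK.h03 hj.h32)) c11)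
  · simp only [U.mm, U.i02, e12, U.i22, U.i32, hE.h23, hE.h20, hE.h31, hE.h32, hE.h22, map_zero, mul_zero,
      zero_mul, add_zero, zero_add]
    exact ad (CF.mul (ad (om hK.h30 hj.h01) (om hK.h33 hj.h31)) (ng c12) (by omega))
      (mo (ad (om hK.h30 hj.h02) (om hK.h33 hj.h32)) c11)
  · rw [f2]; exact hj.tr
  · have : U.mat (k * j * k⁻¹) 1 1 - U.mat (k * j * k⁻¹) 2 2 =
      (U.mat k 1 1 * U.cj (U.mat k 1 1) - U.π * (U.mat k 1 2 * U.cj (U.mat k 1 2)))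
        * (U.mat j 1 1 - U.mat j 2 2) + (U.mat k 1 1 * U.cj (U.mat k 1 2) + U.mat k 1 2 * U.cj (U.mat k 1 1))
        * (U.π * U.mat j 1 2 + U.mat j 2 1) := by
      simp only [U.mm, U.i01, U.i02, U.i11, e12, U.i21, U.i22, U.i31, U.i32,
        hE.h10, hE.h13, hE.h21, hE.h22, hE.h23, hE.h20, map_zero]
      ring
    rw [this]
    refine ad (om (sb (om i1 c11) (CF.mul p1 (om i2 c12) (by omega))) hj.df)
      (CF.mul (ad (om i1 c12) (om i2 c11)) hj.op (by omega))
  · have : U.π * U.mat (k * j * k⁻¹) 1 2 - U.mat (k * j * k⁻¹) 2 1 = U.π * U.mat j 1 2 - U.mat j 2 1 := by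
      linear_combination -f1
    rw [this]; exact hj.om
  · have : U.π * U.mat (k * j * k⁻¹) 1 2 + U.mat (k * j * k⁻¹) 2 1 =
      (U.mat k 1 1 * U.cj (U.mat k 1 1) - U.π * (U.mat k 1 2 * U.cj (U.mat k 1 2)))
        * (U.π * U.mat j 1 2 + U.mat j 2 1) - U.π * (U.mat k 1 1 * U.cj (U.mat k 1 2) + U.mat k 1 2 * U.cj (U.mat k 1 1))
        * (U.mat j 1 1 - U.mat j 2 2) := by
      simp only [U.mm, U.i01, U.i02, U.i11, e12, U.i21, U.i22, U.i31, U.i32,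
        hE.h10, hE.h13, hE.h21, hE.h22, hE.h23, hE.h20, map_zero]
      ring
    rw [this]
    refine sb (om (sb (om i1 c11) (CF.mul p1 (om i2 c12) (by omega))) hj.op)
      (CF.mul (CF.mul p1 (ad (om i1 c12) (om i2 c11)) (by omega)) hj.df (by omega : _ ≤ (1:ℤ) + _))
end CG
end UC

namespace UC
open CF
namespace CG
variable {F : Type u} [Field F] {G : Type v} [Group G] {U : CG F G}

lemma τ_of {g : G} (h1 : U.mat g 2 1 = 0) (h2 : U.mat g 1 2 = 0) : U.τ g = 1 := by
  rw [τ, h1, h2]; simp [ψ0]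
lemma τ_n {v1 v2 z : F} (h : U.N v1 v2 z) : U.τ (U.n v1 v2 z) = 1 :=
  τ_of (by rw [n_mat h]; simp [nM]) (by rw [n_mat h]; simp [nM])
lemma τ_nm {v1 v2 z : F} (h : U.N v1 v2 z) : U.τ (U.nm v1 v2 z) = 1 :=
  τ_of (by rw [nm_mat h]; simp [mM]) (by rw [nm_mat h]; simp [mM])
lemma P00 {k : ℤ} : (0 : F) ∈ U.P k := (U.P k).zero_mem
lemma D.m_row {v1 v2 : F} (h : D U.toCF U.m v1 v2) :
    -(U.π * U.cj v1) ∈ U.P (U.m / 2 + 1) ∧ - U.cj v2 ∈ U.P ((U.m + 1) / 2) :=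
  ⟨ng (CF.mul p1 (cjm h.1) (by omega)), ng (cjm h.2)⟩
lemma n_J {v1 v2 z : F} (h : U.N v1 v2 z) (hv : D U.toCF U.m v1 v2) (hz : z ∈ U.P U.m) :
    U.n v1 v2 z ∈ U.J := by
  have := D.m_row hv
  rw [U.memJ, n_mat h]
  constructor <;> simp [nM, P00] <;> first | exact hz | exact hv | (simp [D, P00]; done) | skip
  · simpa using this.1
  · simpa using this.2
  · norm_num [P00]
lemma nm_J {v1 v2 z : F} (h : U.N v1 v2 z) (hv : D U.toCF U.m v1 v2) (hz : z ∈ U.P U.m) :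
    U.nm v1 v2 z ∈ U.J := by
  have := D.m_row hv
  rw [U.memJ, nm_mat h]
  constructor <;> simp [mM, P00] <;> first | exact hz | exact hv | (simp [D, P00]; done) | skip
  · simpa using this.1
  · simpa using this.2
  · norm_num [P00]
lemma n_E {z : F} (h : U.N 0 0 z) : U.n 0 0 z ∈ U.GE := by
  rw [U.memE, n_mat h]; constructor <;> simp [nM]
lemma nm_E {z : F} (h : U.N 0 0 z) : U.nm 0 0 z ∈ U.GE := by
  rw [U.memE, nm_mat h]; constructor <;> simp [mM]
lemma n_K {z : F} (h : U.N 0 0 z) (hz : z ∈ U.P 0) : U.n 0 0 z ∈ U.K := by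
  refine ⟨n_E h, ?_⟩
  rw [n_mat h]; constructor <;> simp [nM, P00, one0, hz]
lemma nm_K {z : F} (h : U.N 0 0 z) (hz : z ∈ U.P 0) : U.nm 0 0 z ∈ U.K := by
  refine ⟨nm_E h, ?_⟩
  rw [nm_mat h]; constructor <;> simp [mM, P00, one0, hz]
lemma t_E {τ : F} (h : τ ≠ 0) : U.t τ ∈ U.GE := by
  rw [U.memE, t_mat h]; constructor <;> simp [tM]
lemma t_K {τ : F} (h : τ ≠ 0) (h1 : τ ∈ U.P 0) (h2 : τ⁻¹ ∈ U.P 0) : U.t τ ∈ U.K := by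
  refine ⟨t_E h, ?_⟩
  rw [t_mat h]; constructor <;> simp [tM, P00, h1]
  rw [← map_inv₀]; exact cjm h2
lemma s_E : U.s1 ∈ U.GE := by
  rw [U.memE, s_mat]; constructor <;> simp [sM]
lemma s_K : U.s1 ∈ U.K := by
  refine ⟨s_E, ?_⟩
  rw [s_mat]; constructor <;> simp [sM, P00, one0]

structure Lv (M : M4 F) : Prop where
  h01 : M 0 1 = 0
  h02 : M 0 2 = 0
  h03 : M 0 3 = 0
  h10 : M 1 0 = 0
  h20 : M 2 0 = 0
  h30 : M 3 0 = 0
  h13 : M 1 3 = 0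
  h23 : M 2 3 = 0
  h31 : M 3 1 = 0
  h32 : M 3 2 = 0

lemma lv_of {l : G} (h03 : U.mat l 0 3 = 0) (h13 : U.mat l 1 3 = 0) (h23 : U.mat l 2 3 = 0)
    (h30 : U.mat l 3 0 = 0) (h31 : U.mat l 3 1 = 0) (h32 : U.mat l 3 2 = 0)
    (h33 : U.mat l 3 3 ≠ 0) : Lv (U.mat l) := by
  have h33' : U.cj (U.mat l 3 3) ≠ 0 := by simpa using h33
  have a := U.mm l⁻¹ l
  have b := U.mm l l⁻¹
  have a1 := a 0 1
  have a2 := a 0 2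
  have b1 := b 1 0
  have b2 := b 2 0
  simp only [inv_mul_cancel, mul_inv_cancel, U.one_e, U.i00, U.i01, U.i02, U.i03, U.i10, U.i20,
    U.i30, h03, h13, h23, h30, h31, h32] at a1 a2 b1 b2
  simp at a1 a2 b1 b2
  have x33 := h33
  exact ⟨by tauto, by tauto, h03, by tauto, by tauto, h30, h13, h23, h31, h32⟩

lemma bigcell (x : G) (h : U.mat x 3 3 ≠ 0) :
    U.N (U.mat x 1 3 / U.mat x 3 3) (U.mat x 2 3 / U.mat x 3 3) (U.mat x 0 3 / U.mat x 3 3) ∧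
    U.N (-U.cj (U.mat x 3 1 / U.mat x 3 3) / U.π) (-U.cj (U.mat x 3 2 / U.mat x 3 3))
      (U.mat x 3 0 / U.mat x 3 3) ∧
    ∃ l, Lv (U.mat l) ∧ U.mat l 3 3 = U.mat x 3 3 ∧
      x = U.n (U.mat x 1 3 / U.mat x 3 3) (U.mat x 2 3 / U.mat x 3 3) (U.mat x 0 3 / U.mat x 3 3)
        * l * U.nm (-U.cj (U.mat x 3 1 / U.mat x 3 3) / U.π) (-U.cj (U.mat x 3 2 / U.mat x 3 3))
      (U.mat x 3 0 / U.mat x 3 3) := by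
  have hp := U.π_ne
  have h' : U.cj (U.mat x 3 3) ≠ 0 := by simpa using h
  have a := U.mm x⁻¹ x 0 3
  have b := U.mm x x⁻¹ 3 0
  simp only [inv_mul_cancel, mul_inv_cancel, U.one_e, U.i00, U.i01, U.i02, U.i03, U.i10, U.i20,
    U.i30] at a b
  simp at a b
  have N1 : U.N (U.mat x 1 3 / U.mat x 3 3) (U.mat x 2 3 / U.mat x 3 3) (U.mat x 0 3 / U.mat x 3 3) := by
    simp only [N, hh, map_div₀]
    field_simp
    linear_combination -a
  have N2 : U.N (-U.cj (U.mat x 3 1 / U.mat x 3 3) / U.π) (-U.cj (U.mat x 3 2 / U.mat x 3 3))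
      (U.mat x 3 0 / U.mat x 3 3) := by
    simp only [N, hh, map_div₀, map_neg, U.cj_cj, U.cjπ]
    field_simp
    field_simp at b
    linear_combination -b
  refine ⟨N1, N2, ?_⟩
  obtain ⟨l, hl⟩ : ∃ l, l = (U.n (U.mat x 1 3 / U.mat x 3 3) (U.mat x 2 3 / U.mat x 3 3) (U.mat x 0 3 / U.mat x 3 3))⁻¹
    * x * (U.nm (-U.cj (U.mat x 3 1 / U.mat x 3 3) / U.π) (-U.cj (U.mat x 3 2 / U.mat x 3 3))
      (U.mat x 3 0 / U.mat x 3 3))⁻¹ := ⟨_, rfl⟩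
  have M1 := n_mat N1.inv
  have M2 := nm_mat N2.inv
  have e := hl
  rw [n_inv N1, nm_inv N2] at e
  have n1 := N1
  have n2 := N2
  simp only [N, hh] at n1 n2
  have e33 : U.mat l 3 3 = U.mat x 3 3 := by
    rw [e]; simp only [U.mm, M1, M2]; simp [nM, mM]
  refine ⟨l, lv_of ?_ ?_ ?_ ?_ ?_ ?_ ?_, e33, ?_⟩
  · rw [e]; simp only [U.mm, M1, M2]; simp [nM, mM]
    field_simp
    linear_combination -a
  · rw [e]; simp only [U.mm, M1, M2]; simp [nM, mM]
    field_simp; ring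
  · rw [e]; simp only [U.mm, M1, M2]; simp [nM, mM]
    field_simp; ring
  · rw [e]; simp only [U.mm, M1, M2]; simp [nM, mM, U.cj_cj, U.cjπ]
    field_simp
    field_simp at b
    linear_combination -b
  · rw [e]; simp only [U.mm, M1, M2]; simp [nM, mM, U.cj_cj, U.cjπ]
    field_simp; ring
  · rw [e]; simp only [U.mm, M1, M2]; simp [nM, mM, U.cj_cj, U.cjπ]
    field_simp; ring
  · rw [e33]; exact h
  · rw [hl]; group

/-- block elements with trivial V_1 part -/
structure Dv (M : M4 F) : Prop extends Lv M where
  h00 : M 0 0 = 1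
  h33 : M 3 3 = 1

lemma lv_00 {l : G} (hl : Lv (U.mat l)) : U.mat l 0 0 * U.cj (U.mat l 3 3) = 1 := by
  have b := U.mm l l⁻¹ 0 0
  simp only [mul_inv_cancel, U.one_e, U.i00, U.i10, U.i20, U.i30, hl.h01, hl.h02, hl.h03] at b
  simp at b
  exact b.symm

lemma lv_split {l : G} (hl : Lv (U.mat l)) : ∃ d, U.mat l 0 0 ≠ 0 ∧
    U.mat l 3 3 = (U.cj (U.mat l 0 0))⁻¹ ∧ Dv (U.mat d) ∧
    l = U.t (U.mat l 0 0) * d ∧ l = d * U.t (U.mat l 0 0) ∧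
    (∀ i j, i ≠ 0 → i ≠ 3 → U.mat d i j = U.mat l i j) := by
  have e := lv_00 hl
  have h0 : U.mat l 0 0 ≠ 0 := by intro h; rw [h, zero_mul] at e; exact zero_ne_one e
  have e2 : U.mat l 3 3 * U.cj (U.mat l 0 0) = 1 := by
    have := congrArg U.cj e
    rw [map_mul, U.cj_cj, map_one] at this
    rw [mul_comm]; exact this
  have e3 : U.mat l 3 3 = (U.cj (U.mat l 0 0))⁻¹ := eq_inv_of_mul_eq_one_left e2
  have hc : U.cj (U.mat l 0 0) ≠ 0 := by simpa using h0
  have hq : ∀ i j, U.mat (U.t (U.mat l 0 0)⁻¹ * l) i j = if i = 0 then (U.mat l 0 0)⁻¹ * U.mat l 0 j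
      else if i = 3 then U.cj (U.mat l 0 0) * U.mat l 3 j else U.mat l i j := by
    intro i j
    rw [U.mm, t_mat (inv_ne_zero h0)]
    fin_cases i <;> simp [tM]
  have hD : Dv (U.mat (U.t (U.mat l 0 0)⁻¹ * l)) := by
    refine ⟨⟨?_, ?_, ?_, ?_, ?_, ?_, ?_, ?_, ?_, ?_⟩, ?_, ?_⟩ <;>
      simp [hq, hl.h01, hl.h02, hl.h03, hl.h10, hl.h20, hl.h30, hl.h13, hl.h23, hl.h31, hl.h32, h0]
    rw [mul_comm]; exact e2
  refine ⟨U.t (U.mat l 0 0)⁻¹ * l, h0, e3, hD, ?_, ?_, ?_⟩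
  · rw [← mul_assoc, t_mul h0 (inv_ne_zero h0), mul_inv_cancel₀ h0, t_one, one_mul]
  · apply U.ext
    intro i j
    rw [U.mm, t_mat h0]
    simp only [hq]
    fin_cases i <;> fin_cases j <;> simp [tM, hl.h01, hl.h02, hl.h03, hl.h10, hl.h20, hl.h30, hl.h13, hl.h23, hl.h31, hl.h32, h0, hc, e3]
  · intro i j h1 h2
    rw [hq, if_neg h1, if_neg h2]

lemma dv_rel {d : G} (hd : Dv (U.mat d)) :
    U.cj (U.mat d 1 1) * U.mat d 1 1 + U.cj (U.mat d 2 1) / U.π * U.mat d 2 1 = 1 ∧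
    U.cj (U.mat d 1 1) * U.mat d 1 2 + U.cj (U.mat d 2 1) / U.π * U.mat d 2 2 = 0 ∧
    U.π * U.cj (U.mat d 1 2) * U.mat d 1 2 + U.cj (U.mat d 2 2) * U.mat d 2 2 = 1 := by
  have a := U.mm d⁻¹ d 1 1
  have b := U.mm d⁻¹ d 1 2
  have c := U.mm d⁻¹ d 2 2
  simp only [inv_mul_cancel, U.one_e, U.i10, U.i20, U.i11, U.i12, U.i13, U.i21, U.i22, U.i23, hd.h01, hd.h02, hd.h31,
    hd.h32] at a b c
  simp at a b c
  exact ⟨a.symm, b.symm, by linear_combination -c⟩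

lemma dv_inv {d : G} (hd : Dv (U.mat d)) : Dv (U.mat d⁻¹) := by
  refine ⟨⟨?_, ?_, ?_, ?_, ?_, ?_, ?_, ?_, ?_, ?_⟩, ?_, ?_⟩ <;>
      simp [U.i00, U.i01, U.i02, U.i03, U.i10, U.i20, U.i30, U.i13, U.i23, U.i31, U.i32, U.i33,
      hd.h01, hd.h02, hd.h03, hd.h10, hd.h20, hd.h30, hd.h13, hd.h23, hd.h31, hd.h32, hd.h00, hd.h33]

lemma dv_hh {d : G} (hd : Dv (U.mat d)) (v1 v2 w1 w2 : F) :
    hh U.toCF (U.mat d 1 1 * v1 + U.mat d 1 2 * v2) (U.mat d 2 1 * v1 + U.mat d 2 2 * v2)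
      (U.mat d 1 1 * w1 + U.mat d 1 2 * w2) (U.mat d 2 1 * w1 + U.mat d 2 2 * w2)
      = hh U.toCF v1 v2 w1 w2 := by
  have hp := U.π_ne
  obtain ⟨a, b, c⟩ := dv_rel hd
  have b' := congrArg U.cj b
  simp only [map_add, map_mul, map_div₀, U.cj_cj, map_zero, U.cjπ] at b'
  field_simp at a b b'
  simp only [hh, map_add, map_mul]
  linear_combination (U.cj v1 * w1) * a + (U.cj v1 * w2) * b + U.cj v2 * w1 * b' + U.cj v2 * w2 * c

lemma dv_D {d : G} (hd : Dv (U.mat d)) {i : ℤ} {v1 v2 : F} (hv : D U.toCF i v1 v2) :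
    D U.toCF i (U.mat d 1 1 * v1 + U.mat d 1 2 * v2) (U.mat d 2 1 * v1 + U.mat d 2 2 * v2) := by
  apply D.of_h
  rw [dv_hh hd]; exact hv.hself

lemma dv_N {d : G} (hd : Dv (U.mat d)) {v1 v2 z : F} (hv : U.N v1 v2 z) :
    U.N (U.mat d 1 1 * v1 + U.mat d 1 2 * v2) (U.mat d 2 1 * v1 + U.mat d 2 2 * v2) z := by
  rw [N, dv_hh hd]; exact hv

lemma dv_nm {d : G} (hd : Dv (U.mat d)) {v1 v2 z : F} (hv : U.N v1 v2 z) :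
    d * U.nm v1 v2 z =
      U.nm (U.mat d 1 1 * v1 + U.mat d 1 2 * v2) (U.mat d 2 1 * v1 + U.mat d 2 2 * v2) z * d := by
  have hp := U.π_ne
  obtain ⟨a, b, c⟩ := dv_rel hd
  have b' := congrArg U.cj b
  simp only [map_add, map_mul, map_div₀, U.cj_cj, map_zero, U.cjπ] at b'
  field_simp at a b b'
  apply U.ext
  intro i j
  rw [U.mm, U.mm, nm_mat hv, nm_mat (dv_N hd hv)]
  fin_cases i <;> fin_cases j <;> simp [mM, hd.h01, hd.h02, hd.h03, hd.h10, hd.h20, hd.h30, hd.h13,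
    hd.h23, hd.h31, hd.h32, hd.h00, hd.h33]
  · linear_combination U.cj v1 * a + U.cj v2 * b'
  · linear_combination U.cj v1 * b + U.cj v2 * c

lemma dv_comm_s {d : G} (hd : Dv (U.mat d)) : U.s1 * d = d * U.s1 := by
  apply U.ext
  intro i j
  rw [U.mm, U.mm, s_mat]
  fin_cases i <;> fin_cases j <;> simp [sM, hd.h01, hd.h02, hd.h03, hd.h10, hd.h20, hd.h30, hd.h13,
    hd.h23, hd.h31, hd.h32, hd.h00, hd.h33]
lemma dv_n {d : G} (hd : Dv (U.mat d)) {v1 v2 z : F} (hv : U.N v1 v2 z) :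
    d * U.n v1 v2 z =
      U.n (U.mat d 1 1 * v1 + U.mat d 1 2 * v2) (U.mat d 2 1 * v1 + U.mat d 2 2 * v2) z * d := by
  rw [← s1_nm hv, ← s1_nm (dv_N hd hv), ← mul_assoc, ← mul_assoc, ← dv_comm_s hd, mul_assoc U.s1 d,
    dv_nm hd hv]
  simp only [mul_assoc]
  rw [dv_comm_s hd]
lemma dv_comm_t {d : G} (hd : Dv (U.mat d)) {τ : F} (hτ : τ ≠ 0) : U.t τ * d = d * U.t τ := by
  apply U.ext
  intro i j
  rw [U.mm, U.mm, t_mat hτ]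
  fin_cases i <;> fin_cases j <;> simp [tM, hd.h01, hd.h02, hd.h03, hd.h10, hd.h20, hd.h30, hd.h13,
    hd.h23, hd.h31, hd.h32, hd.h00, hd.h33]
lemma dv_K {d : G} (hd : Dv (U.mat d)) (h : d ∈ U.GE) : d ∈ U.K :=
  ⟨h, by rw [hd.h00]; exact one0, by rw [hd.h03]; exact P00, by rw [hd.h30]; exact P00,
    by rw [hd.h33]; exact one0⟩

/-- Iwahori factorisation of J -/
lemma iwJ {x : G} (hx : x ∈ U.J) : ∃ v1 v2 z l u1 u2 y, U.N v1 v2 z ∧ U.N u1 u2 y ∧ Lv (U.mat l) ∧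
    D U.toCF U.m v1 v2 ∧ D U.toCF U.m u1 u2 ∧ z ∈ U.P U.m ∧ y ∈ U.P U.m ∧ l ∈ U.J ∧
    x = U.n v1 v2 z * l * U.nm u1 u2 y ∧
    z = U.mat x 0 3 / U.mat x 3 3 := by
  have hm := U.hm
  have hx' := (U.memJ x).1 hx
  obtain ⟨k0, k1, k2, k3⟩ := CF.unit_of (CF.mono hx'.h33 hm)
  obtain ⟨N1, N2, l, hl, -, e⟩ := bigcell x k2
  have hv : D U.toCF U.m (U.mat x 1 3 / U.mat x 3 3) (U.mat x 2 3 / U.mat x 3 3) := by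
    rw [div_eq_mul_inv, div_eq_mul_inv]; exact ⟨mo hx'.c3.1 k1, mo hx'.c3.2 k1⟩
  have hz : (U.mat x 0 3 / U.mat x 3 3) ∈ U.P U.m := by
    rw [div_eq_mul_inv]; exact mo hx'.h03 k1
  have hy : (U.mat x 3 0 / U.mat x 3 3) ∈ U.P U.m := by
    rw [div_eq_mul_inv]; exact mo hx'.h30 k1
  have hu : D U.toCF U.m (-U.cj (U.mat x 3 1 / U.mat x 3 3) / U.π)
      (-U.cj (U.mat x 3 2 / U.mat x 3 3)) := by
    constructor
    · have : U.π⁻¹ ∈ U.P (-1) := by simpa using ppow (C := U.toCF) (-1)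
      rw [div_eq_mul_inv, div_eq_mul_inv]
      exact CF.mul (ng (cjm (mo hx'.h31 k1))) this (by omega)
    · rw [div_eq_mul_inv]; exact ng (cjm (mo hx'.h32 k1))
  refine ⟨_, _, _, l, _, _, _, N1, N2, hl, hv, hu, hz, hy, ?_, e, rfl⟩
  have a := n_J N1 hv hz
  have b := nm_J N2 hu hy
  have : l = (U.n (U.mat x 1 3 / U.mat x 3 3) (U.mat x 2 3 / U.mat x 3 3) (U.mat x 0 3 / U.mat x 3 3))⁻¹
    * x * (U.nm (-U.cj (U.mat x 3 1 / U.mat x 3 3) / U.π) (-U.cj (U.mat x 3 2 / U.mat x 3 3))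
      (U.mat x 3 0 / U.mat x 3 3))⁻¹ := by
    rw [eq_mul_inv_iff_mul_eq, eq_inv_mul_iff_mul_eq, ← mul_assoc]; exact e.symm
  rw [this]
  exact U.J.mul_mem (U.J.mul_mem (U.J.inv_mem a) hx) (U.J.inv_mem b)
end CG
end UC

namespace UC
open CF
namespace CF
variable {F : Type u} [Field F] {C : CF F}
lemma inv1 {x : F} (hx : x⁻¹ ∉ C.P 0) : x ∈ C.P 1 := by
  have := inv_of_not (C := C) (i := -1) (x := x⁻¹) (by simpa using hx)
  simpa using this
lemma inv0 {x : F} (hx : x ∉ C.P 1) : x⁻¹ ∈ C.P 0 := by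
  have := inv_of_not (C := C) (i := 0) (x := x) (by simpa using hx)
  simpa using this
def Mx (C : CF F) (a b : F) : Prop := b ≠ 0 ∧ a / b ∈ C.P 0
lemma Mx.tr {a b c : F} (h : Mx C a b) (h' : Mx C b c) : Mx C a c := by
  refine ⟨h'.1, ?_⟩
  have := om h.2 h'.2
  rwa [div_mul_div_cancel₀ h.1] at this
lemma mx2 {a b : F} (h : a ≠ 0 ∨ b ≠ 0) : Mx C a b ∨ Mx C b a := by
  by_cases hb : b = 0
  · right; subst hb; simp at h; exact ⟨h, by simp [(C.P 0).zero_mem]⟩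
  by_cases hc : a / b ∈ C.P 0
  · exact Or.inl ⟨hb, hc⟩
  · right
    have ha : a ≠ 0 := by rintro rfl; simp [(C.P 0).zero_mem] at hc
    refine ⟨ha, ?_⟩
    have := inv1 (C := C) (x := b / a) (by rwa [inv_div])
    exact mono this (by omega)
lemma mx2' {a b : F} (h : a ≠ 0) (hb : b ≠ 0) : Mx C a b ∨ Mx C b a := mx2 (Or.inl h)
lemma mxr {a : F} (h : a ≠ 0) : Mx C a a := ⟨h, by rw [div_self h]; exact one0⟩
lemma mx0 {b : F} (h : b ≠ 0) : Mx C 0 b := ⟨h, by simp [(C.P 0).zero_mem]⟩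
lemma mx4 {a b c d : F} (h : a ≠ 0 ∨ b ≠ 0 ∨ c ≠ 0 ∨ d ≠ 0) :
    (Mx C b a ∧ Mx C c a ∧ Mx C d a) ∨ (Mx C a b ∧ Mx C c b ∧ Mx C d b) ∨
    (Mx C a c ∧ Mx C b c ∧ Mx C d c) ∨ (Mx C a d ∧ Mx C b d ∧ Mx C c d) := by
  by_cases h1 : a ≠ 0 ∨ b ≠ 0
  · by_cases h2 : c ≠ 0 ∨ d ≠ 0
    · rcases mx2 (C := C) h1 with x | x <;> rcases mx2 (C := C) h2 with y | y <;>
        rcases mx2' (C := C) x.1 y.1 with z | z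
      · exact Or.inr (Or.inr (Or.inr ⟨x.tr z, z, y⟩))
      · exact Or.inr (Or.inl ⟨x, y.tr z, z⟩)
      · exact Or.inr (Or.inr (Or.inl ⟨x.tr z, z, y⟩))
      · exact Or.inr (Or.inl ⟨x, z, y.tr z⟩)
      · exact Or.inr (Or.inr (Or.inr ⟨z, x.tr z, y⟩))
      · exact Or.inl ⟨x, y.tr z, z⟩
      · exact Or.inr (Or.inr (Or.inl ⟨z, x.tr z, y⟩))
      · exact Or.inl ⟨x, z, y.tr z⟩
    · push Not at h2
      obtain ⟨rfl, rfl⟩ := h2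
      rcases mx2 (C := C) h1 with x | x <;> have := mx0 (C := C) x.1 <;> tauto
  · push Not at h1
    obtain ⟨rfl, rfl⟩ := h1
    simp at h
    rcases mx2 (C := C) h with x | x <;> have := mx0 (C := C) x.1 <;> tauto
lemma aniso {v1 v2 : F} (h : hh C v1 v2 v1 v2 = 0) : v1 = 0 ∧ v2 = 0 := by
  by_cases h1 : v1 = 0
  · subst h1; simp [hh] at h; simpa using h
  · exfalso
    have h1' : C.cj v1 ≠ 0 := by simpa using h1
    have : hh C 1 (v2 / v1) 1 (v2 / v1) = 0 := by
      simp only [hh, map_div₀, map_one] at *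
      field_simp
      linear_combination h
    have := (D.of_h (C := C) (i := 2) (by rw [this]; exact (C.P 2).zero_mem)).1
    exact one_not (C := C) this
end CF
namespace CG
variable {F : Type u} [Field F] {G : Type v} [Group G] {U : CG F G}

lemma rel_col (x : G) (j : Fin 4) (hj : j = 0 ∨ j = 3) :
    U.cj (U.mat x 3 j) * U.mat x 0 j + hh U.toCF (U.mat x 1 j) (U.mat x 2 j) (U.mat x 1 j) (U.mat x 2 j)
      + U.cj (U.mat x 0 j) * U.mat x 3 j = 0 := by
  have a := U.mm x⁻¹ x 0 3
  have b := U.mm x⁻¹ x 3 0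
  simp only [inv_mul_cancel, U.one_e, U.i00, U.i01, U.i02, U.i03, U.i30, U.i31, U.i32, U.i33] at a b
  simp at a b
  rcases hj with rfl | rfl
  · simp only [hh]; linear_combination -b
  · simp only [hh]; linear_combination -a
lemma rel_33 (x : G) : U.cj (U.mat x 3 0) * U.mat x 0 3 +
    hh U.toCF (U.mat x 1 0) (U.mat x 2 0) (U.mat x 1 3) (U.mat x 2 3)
      + U.cj (U.mat x 0 0) * U.mat x 3 3 = 1 := by
  have a := U.mm x⁻¹ x 3 3
  simp only [inv_mul_cancel, U.one_e, U.i00, U.i01, U.i02, U.i03, U.i30, U.i31, U.i32, U.i33] at a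
  simp at a
  simp only [hh]; linear_combination -a
lemma V1_ne (x : G) : U.mat x 0 0 ≠ 0 ∨ U.mat x 0 3 ≠ 0 ∨ U.mat x 3 0 ≠ 0 ∨ U.mat x 3 3 ≠ 0 := by
  by_contra h
  push Not at h
  obtain ⟨h1, h2, h3, h4⟩ := h
  have a := rel_col (U := U) x 0 (Or.inl rfl)
  have b := rel_33 (U := U) x
  rw [h1, h3] at a
  simp at a
  obtain ⟨c, d⟩ := aniso a
  rw [h1, h2, h3, h4, c, d] at b
  simp [hh] at b
lemma u33 {x : G} (h0 : Mx U.toCF (U.mat x 0 0) (U.mat x 3 3)) (h1 : Mx U.toCF (U.mat x 0 3) (U.mat x 3 3))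
    (h2 : Mx U.toCF (U.mat x 3 0) (U.mat x 3 3)) : (U.mat x 3 3)⁻¹ ∈ U.P 0 := by
  by_contra h
  have h := inv1 h
  have g : ∀ a, Mx U.toCF a (U.mat x 3 3) → a ∈ U.P 1 := by
    intro a ha
    have := om ha.2 h
    rwa [div_mul_cancel₀ _ ha.1] at this
  have e0 := g _ h0
  have e1 := g _ h1
  have e2 := g _ h2
  have a := rel_col (U := U) x 0 (Or.inl rfl)
  have b := rel_col (U := U) x 3 (Or.inr rfl)
  have c := rel_33 (U := U) x
  have d0 : D U.toCF 2 (U.mat x 1 0) (U.mat x 2 0) := by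
    apply D.of_h
    have : hh U.toCF (U.mat x 1 0) (U.mat x 2 0) (U.mat x 1 0) (U.mat x 2 0) =
      -(U.cj (U.mat x 3 0) * U.mat x 0 0 + U.cj (U.mat x 0 0) * U.mat x 3 0) := by
      linear_combination a
    rw [this]
    exact ng (ad (CF.mul (cjm e2) e0 (by omega)) (CF.mul (cjm e0) e2 (by omega)))
  have d3 : D U.toCF 2 (U.mat x 1 3) (U.mat x 2 3) := by
    apply D.of_h
    have : hh U.toCF (U.mat x 1 3) (U.mat x 2 3) (U.mat x 1 3) (U.mat x 2 3) =
      -(U.cj (U.mat x 3 3) * U.mat x 0 3 + U.cj (U.mat x 0 3) * U.mat x 3 3) := by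
      linear_combination b
    rw [this]
    exact ng (ad (CF.mul (cjm h) e1 (by omega)) (CF.mul (cjm e1) h (by omega)))
  apply one_not (C := U.toCF)
  rw [← c]
  exact ad (ad (CF.mul (cjm e2) e1 (by omega)) (d0.h d3 (by omega))) (CF.mul (cjm e0) h (by omega))

lemma cell {x : G} (h0 : Mx U.toCF (U.mat x 0 0) (U.mat x 3 3)) (h1 : Mx U.toCF (U.mat x 0 3) (U.mat x 3 3))
    (h2 : Mx U.toCF (U.mat x 3 0) (U.mat x 3 3)) : ∃ v1 v2 z τ d u1 u2 y, U.N v1 v2 z ∧ U.N u1 u2 y ∧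
    Dv (U.mat d) ∧ τ ≠ 0 ∧ τ ∈ U.P 0 ∧ D U.toCF 0 v1 v2 ∧ D U.toCF 0 u1 u2 ∧ z ∈ U.P 0 ∧ y ∈ U.P 0 ∧
    x = U.n v1 v2 z * (U.t τ * d) * U.nm u1 u2 y ∧
    (x ∈ U.GE → v1 = 0 ∧ v2 = 0 ∧ u1 = 0 ∧ u2 = 0) := by
  obtain ⟨N1, N2, l, hl, e, he⟩ := bigcell x h0.1
  obtain ⟨d, hd0, hd1, hd2, hd3, -, -⟩ := lv_split hl
  have k := u33 h0 h1 h2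
  have hτ : U.mat l 0 0 ∈ U.P 0 := by
    have : U.mat l 0 0 = U.cj (U.mat x 3 3)⁻¹ := by
      rw [← e, hd1]; simp [U.cj_cj]
    rw [this]; exact cjm k
  have hD : ∀ a b c, U.N a b c → c ∈ U.P 0 → D U.toCF 0 a b := by
    intro a b c h hc
    apply D.of_h
    have : hh U.toCF a b a b = -(c + U.cj c) := by rw [N] at h; linear_combination h
    rw [this]; exact ng (ad hc (cjm hc))
  rw [hd3] at he
  refine ⟨_, _, _, _, d, _, _, _, N1, N2, hd2, hd0, hτ, hD _ _ _ N1 h1.2, hD _ _ _ N2 h2.2, h1.2, h2.2, he, ?_⟩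
  intro hx
  rw [U.memE] at hx
  simp [hx.h13, hx.h23, hx.h31, hx.h32]

def W (k : G) : Prop := k = 1 ∨ k = U.s1
lemma W.K {k : G} (h : U.W k) : k ∈ U.K := by
  rcases h with rfl | rfl
  · exact U.K.one_mem
  · exact s_K
lemma W.sq {k : G} (h : U.W k) : k * k = 1 := by
  rcases h with rfl | rfl
  · simp
  · exact s1_sq
lemma W.inv {k : G} (h : U.W k) : k⁻¹ = k := inv_eq_of_mul_eq_one_left h.sq
lemma sl (x : G) : U.mat (U.s1 * x) 0 0 = U.mat x 3 0 ∧ U.mat (U.s1 * x) 0 3 = U.mat x 3 3 ∧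
    U.mat (U.s1 * x) 3 0 = U.mat x 0 0 ∧ U.mat (U.s1 * x) 3 3 = U.mat x 0 3 := by
  simp only [U.mm, s_mat]; simp [sM]
lemma sr (x : G) : U.mat (x * U.s1) 0 0 = U.mat x 0 3 ∧ U.mat (x * U.s1) 0 3 = U.mat x 0 0 ∧
    U.mat (x * U.s1) 3 0 = U.mat x 3 3 ∧ U.mat (x * U.s1) 3 3 = U.mat x 3 0 := by
  simp only [U.mm, s_mat]; simp [sM]
lemma dec (x : G) : ∃ k k', U.W k ∧ U.W k' ∧
    ∃ v1 v2 z τ d u1 u2 y, U.N v1 v2 z ∧ U.N u1 u2 y ∧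
    Dv (U.mat d) ∧ τ ≠ 0 ∧ τ ∈ U.P 0 ∧ D U.toCF 0 v1 v2 ∧ D U.toCF 0 u1 u2 ∧ z ∈ U.P 0 ∧ y ∈ U.P 0 ∧
    k * x * k' = U.n v1 v2 z * (U.t τ * d) * U.nm u1 u2 y ∧
    (k * x * k' ∈ U.GE → v1 = 0 ∧ v2 = 0 ∧ u1 = 0 ∧ u2 = 0) := by
  rcases mx4 (C := U.toCF) (V1_ne (U := U) x) with h | h | h | h
  · refine ⟨U.s1, U.s1, Or.inr rfl, Or.inr rfl, cell ?_ ?_ ?_⟩ <;>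
      simp only [sr, sl] <;> tauto
  · refine ⟨U.s1, 1, Or.inr rfl, Or.inl rfl, cell ?_ ?_ ?_⟩ <;>
      simp only [sr, sl, mul_one] <;> tauto
  · refine ⟨1, U.s1, Or.inl rfl, Or.inr rfl, cell ?_ ?_ ?_⟩ <;>
      simp only [sr, sl, one_mul] <;> tauto
  · refine ⟨1, 1, Or.inl rfl, Or.inl rfl, cell ?_ ?_ ?_⟩ <;>
      simp only [mul_one, one_mul] <;> tauto

lemma dE {n t d nn : G} (hn : n ∈ U.GE) (ht : t ∈ U.GE) (hnn : nn ∈ U.GE) (h : n * (t * d) * nn ∈ U.GE) :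
    d ∈ U.GE := by
  have : d = t⁻¹ * n⁻¹ * (n * (t * d) * nn) * nn⁻¹ := by group
  rw [this]
  exact U.GE.mul_mem (U.GE.mul_mem (U.GE.mul_mem (U.GE.inv_mem ht) (U.GE.inv_mem hn)) h) (U.GE.inv_mem hnn)

lemma cartan {x : G} (hx : x ∈ U.GE) : ∃ k ∈ U.K, ∃ k' ∈ U.K, ∃ τ, τ ≠ 0 ∧ τ ∈ U.P 0 ∧
    x = k * U.t τ * k' := by
  obtain ⟨k, k', hk, hk', v1, v2, z, τ, d, u1, u2, y, N1, N2, hd, h0, h1, -, -, hz, hy, e, h⟩ := dec (U := U) x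
  have hE : k * x * k' ∈ U.GE := U.GE.mul_mem (U.GE.mul_mem hk.K.1 hx) hk'.K.1
  obtain ⟨rfl, rfl, rfl, rfl⟩ := h hE
  have a := n_K N1 hz
  have b := nm_K N2 hy
  rw [e] at hE
  have c := dv_K hd (dE a.1 (t_E h0) b.1 hE)
  refine ⟨k * U.n 0 0 z, U.K.mul_mem hk.K a, d * U.nm 0 0 y * k', U.K.mul_mem (U.K.mul_mem c b) hk'.K, τ, h0, h1, ?_⟩
  have : x = k⁻¹ * (k * x * k') * k'⁻¹ := by group
  rw [this, e, hk.inv, hk'.inv]; group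

lemma iwa {x : G} (hx : x ∈ U.GE) : ∃ b τ, U.N 0 0 b ∧ τ ≠ 0 ∧ ∃ k ∈ U.K, x = U.n 0 0 b * U.t τ * k := by
  have ne : U.mat x 3 0 ≠ 0 ∨ U.mat x 3 3 ≠ 0 := by
    by_contra h
    push Not at h
    have a := rel_33 (U := U) x
    have := (U.memE x).1 hx
    rw [h.1, h.2, this.h10, this.h20] at a
    simp [hh] at a
  obtain ⟨w, hw, hm⟩ : ∃ w, U.W w ∧ Mx U.toCF (U.mat (x * w) 3 0) (U.mat (x * w) 3 3) := by
    rcases mx2 (C := U.toCF) ne with h | h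
    · exact ⟨1, Or.inl rfl, by simpa using h⟩
    · exact ⟨U.s1, Or.inr rfl, by simpa [sr] using h⟩
  obtain ⟨N1, N2, l, hl, e, he⟩ := bigcell (x * w) hm.1
  obtain ⟨d, hd0, hd1, hd2, hd3, -, -⟩ := lv_split hl
  have hE : x * w ∈ U.GE := U.GE.mul_mem hx hw.K.1
  have hE' := (U.memE _).1 hE
  rw [hE'.h13, hE'.h23, zero_div] at N1
  rw [hE'.h31, hE'.h32, zero_div] at N2
  simp only [map_zero, neg_zero, zero_div] at N2
  have h2 := he
  rw [hE'.h31, hE'.h32, hE'.h13, hE'.h23] at he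
  simp only [map_zero, neg_zero, zero_div] at he
  rw [hd3] at he
  have b := nm_K N2 hm.2
  have c := dv_K hd2 (dE (n_E N1) (t_E hd0) b.1 (he ▸ hE))
  refine ⟨_, _, N1, hd0, d * U.nm 0 0 (U.mat (x * w) 3 0 / U.mat (x * w) 3 3) * w,
    U.K.mul_mem (U.K.mul_mem c b) hw.K, ?_⟩
  have : x = (x * w) * w⁻¹ := by group
  rw [hw.inv] at this
  calc x = (x * w) * w := this
    _ = (_) * w := congrArg (· * w) he
    _ = _ := by group
end CG
end UC

namespace UC
open CF
namespace CG
variable {F : Type u} [Field F] {G : Type v} [Group G] {U : CG F G}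

lemma lv_33 {l : G} (hl : Lv (U.mat l)) : U.mat l 3 3 ≠ 0 := by
  intro h
  have := lv_00 hl
  rw [h] at this; simp at this
lemma cellE {v1 v2 z u1 u2 y : F} {l : G} (N1 : U.N v1 v2 z) (N2 : U.N u1 u2 y) (hl : Lv (U.mat l))
    (h : U.n v1 v2 z * l * U.nm u1 u2 y ∈ U.GE) : v1 = 0 ∧ v2 = 0 ∧ u1 = 0 ∧ u2 = 0 := by
  have h33 := lv_33 hl
  have hp := U.π_ne
  rw [U.memE] at h
  have a := h.h13
  have b := h.h23
  have c := h.h31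
  have d := h.h32
  simp only [U.mm, n_mat N1, nm_mat N2] at a b c d
  simp [nM, mM, hl.h01, hl.h02, hl.h03, hl.h10, hl.h20, hl.h30, hl.h13, hl.h23, hl.h31, hl.h32, h33, hp] at a b c d
  exact ⟨a, b, c, d⟩
lemma t_comm_lv {l : G} {τ : F} (hτ : τ ≠ 0) (hl : Lv (U.mat l)) : U.t τ * l = l * U.t τ := by
  obtain ⟨d, hd0, hd1, hd2, hd3, -, -⟩ := lv_split hl
  rw [hd3, ← mul_assoc, t_mul hτ hd0, mul_assoc (U.t _) d, ← dv_comm_t hd2 hτ, ← mul_assoc, t_mul hd0 hτ, mul_comm τ]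
lemma N.t' {a1 a2 x : F} (τ : F) (ha : U.N a1 a2 x) :
    U.N (τ * a1) (τ * a2) (τ * U.cj τ * x) := by
  have := ha.t (U.cj τ); rw [U.cj_cj] at this; rwa [mul_comm τ (U.cj τ)]
lemma tnJ {τ v1 v2 z : F} (h1 : τ ∈ U.P 0) (h : U.N v1 v2 z) (hv : D U.toCF U.m v1 v2)
    (hz : z ∈ U.P U.m) : U.n (U.cj τ * v1) (U.cj τ * v2) (τ * U.cj τ * z) ∈ U.J :=
  n_J (h.t τ) (D.smul (cjm h1) hv (by omega)) (om (om h1 (cjm h1)) hz)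
lemma tnmJ {τ v1 v2 z : F} (h1 : τ ∈ U.P 0) (h : U.N v1 v2 z) (hv : D U.toCF U.m v1 v2)
    (hz : z ∈ U.P U.m) : U.nm (τ * v1) (τ * v2) (τ * U.cj τ * z) ∈ U.J :=
  nm_J (h.t' τ) (D.smul h1 hv (by omega)) (om (om h1 (cjm h1)) hz)

lemma A1t {τ : F} (h0 : τ ≠ 0) (h1 : τ ∈ U.P 0) {g' j₁ j₂ : G} (hg' : g' ∈ U.GE) (hj₁ : j₁ ∈ U.J)
    (hj₂ : j₂ ∈ U.J) (e : g' = j₁ * U.t τ * j₂) :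
    ∃ k₁ ∈ U.J ⊓ U.GE, ∃ k₂ ∈ U.J ⊓ U.GE, g' = k₁ * U.t τ * k₂ ∧ U.τ k₁ * U.τ k₂ = U.τ j₁ * U.τ j₂ := by
  obtain ⟨v1, v2, z, l, u1, u2, y, N1, N2, hl, dv, du, hz, hy, hlJ, e2, -⟩ := iwJ hj₂
  have a1 := tnJ h1 N1 dv hz
  obtain ⟨v1', v2', z', l', u1', u2', y', N1', N2', hl', dv', du', hz', hy', hlJ', e', -⟩ :=
    iwJ (U.J.mul_mem (U.J.mul_mem hj₁ a1) hlJ)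
  have a2 := tnmJ h1 N2' du' hy'
  have N3 := (N2'.t' τ).add N2
  have e3 := nm_mul (N2'.t' τ) N2
  have key : g' = U.n v1' v2' z' * (l' * U.t τ) * U.nm (τ * u1' + u1) (τ * u2' + u2)
      (τ * U.cj τ * y' + y - U.hx (τ * u1') (τ * u2') u1 u2) := by
    rw [← e3, e, e2]
    calc j₁ * U.t τ * (U.n v1 v2 z * l * U.nm u1 u2 y) = j₁ * (U.t τ * U.n v1 v2 z) * l * U.nm u1 u2 y := by group
      _ = j₁ * U.n (U.cj τ * v1) (U.cj τ * v2) (τ * U.cj τ * z) * (U.t τ * l) * U.nm u1 u2 y := by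
        rw [t_n h0 N1]; group
      _ = (j₁ * U.n (U.cj τ * v1) (U.cj τ * v2) (τ * U.cj τ * z) * l) * U.t τ * U.nm u1 u2 y := by
        rw [t_comm_lv h0 hl]; group
      _ = U.n v1' v2' z' * l' * (U.nm u1' u2' y' * U.t τ) * U.nm u1 u2 y := by rw [e']; group
      _ = _ := by rw [nm_t h0 N2']; group
  have hL : Lv (U.mat (l' * U.t τ)) := by
    constructor <;> simp only [U.mm, t_mat h0] <;> simp [tM, hl'.h01, hl'.h02, hl'.h03, hl'.h10, hl'.h20, hl'.h30, hl'.h13, hl'.h23, hl'.h31, hl'.h32]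
  rw [key] at hg'
  obtain ⟨q1, q2, q3, q4⟩ := cellE N1' N3 hL hg'
  have e1 : U.n v1' v2' z' ∈ U.GE := by
    rw [q1, q2] at N1' ⊢; exact n_E N1'
  have e4 : U.nm (τ * u1' + u1) (τ * u2' + u2)
      (τ * U.cj τ * y' + y - U.hx (τ * u1') (τ * u2') u1 u2) ∈ U.GE := by
    have N3' := N3
    rw [q3, q4] at N3' ⊢; exact nm_E N3'
  have e5 : l' ∈ U.GE := by
    have : l' = (U.n v1' v2' z')⁻¹ * (U.n v1' v2' z' * (l' * U.t τ) * U.nm (τ * u1' + u1) (τ * u2' + u2)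
      (τ * U.cj τ * y' + y - U.hx (τ * u1') (τ * u2') u1 u2)) * (U.nm (τ * u1' + u1) (τ * u2' + u2)
      (τ * U.cj τ * y' + y - U.hx (τ * u1') (τ * u2') u1 u2))⁻¹ * (U.t τ)⁻¹ := by group
    rw [this]
    exact U.GE.mul_mem (U.GE.mul_mem (U.GE.mul_mem (U.GE.inv_mem e1) hg') (U.GE.inv_mem e4)) (U.GE.inv_mem (t_E h0))
  have b1 := n_J N1' dv' hz'
  have b2 := nm_J N2 du hy
  have b3 := nm_J N2' du' hy'
  have b4 := n_J N1 dv hz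
  refine ⟨U.n v1' v2' z' * l', ⟨U.J.mul_mem b1 hlJ', U.GE.mul_mem e1 e5⟩, _, ⟨?_, e4⟩, ?_, ?_⟩
  · rw [← e3]; exact U.J.mul_mem a2 b2
  · rw [key]; group
  · have c1 := congrArg U.τ e'
    rw [chi.mul _ (U.J.mul_mem hj₁ a1) _ hlJ, chi.mul _ hj₁ _ a1, chi.mul _ (U.J.mul_mem b1 hlJ') _ b3,
      chi.mul _ b1 _ hlJ', τ_n (N1.t τ), τ_n N1', τ_nm N2'] at c1
    have c2 := congrArg U.τ e2
    rw [chi.mul _ (U.J.mul_mem b4 hlJ) _ b2, chi.mul _ b4 _ hlJ, τ_n N1, τ_nm N2] at c2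
    rw [chi.mul _ b1 _ hlJ', τ_n N1', τ_nm N3, c2]
    linear_combination -c1

lemma kE {k j : G} (hk : k ∈ U.K) (hj : j ∈ U.J ⊓ U.GE) : k * j * k⁻¹ ∈ U.J ⊓ U.GE :=
  ⟨Knorm hk hj.1, U.GE.mul_mem (U.GE.mul_mem hk.1 hj.2) (U.GE.inv_mem hk.1)⟩

lemma A1 : ∀ g ∈ U.GE, ∀ g' ∈ U.GE, ∀ j₁ ∈ U.J, ∀ j₂ ∈ U.J, g' = j₁ * g * j₂ →
    ∃ k₁ ∈ U.J ⊓ U.GE, ∃ k₂ ∈ U.J ⊓ U.GE, g' = k₁ * g * k₂ ∧ U.τ k₁ * U.τ k₂ = U.τ j₁ * U.τ j₂ := by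
  intro g hg g' hg' j₁ hj₁ j₂ hj₂ e
  obtain ⟨k, hk, k', hk', τ, h0, h1, eg⟩ := cartan hg
  have A := Knorm (U.K.inv_mem hk) hj₁
  have B := Knorm hk' hj₂
  rw [inv_inv] at A
  have hE : k⁻¹ * g' * k'⁻¹ ∈ U.GE :=
    U.GE.mul_mem (U.GE.mul_mem (U.GE.inv_mem hk.1) hg') (U.GE.inv_mem hk'.1)
  obtain ⟨a, ha, b, hb, e1, e2⟩ := A1t h0 h1 hE A B (by rw [e, eg]; group)
  refine ⟨k * a * k⁻¹, kE hk ha, k'⁻¹ * b * k', by simpa using kE (U.K.inv_mem hk') hb, ?_, ?_⟩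
  · have : g' = k * (k⁻¹ * g' * k'⁻¹) * k' := by group
    rw [this, e1, eg]; group
  · have r1 := τ_conj hk.1 a
    have r2 := τ_conj (U.GE.inv_mem hk'.1) b
    have r3 := τ_conj (U.GE.inv_mem hk.1) j₁
    have r4 := τ_conj hk'.1 j₂
    rw [inv_inv] at r2 r3
    rw [r3, r4] at e2
    rw [r1, r2, e2]
end CG
end UC

namespace UC
open CF
namespace CG
variable {F : Type u} [Field F] {G : Type v} [Group G] {U : CG F G}

/-- entries of `n(v,z) nm(u,y) n(V,Z)⁻¹` -/
structure Ent (U : CG F G) (v1 v2 z u1 u2 y V1 V2 Z : F) (M : M4 F) : Prop where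
  e00 : M 0 0 = 1 - U.hx v1 v2 u1 u2 + y * z
  e10 : M 1 0 = u1 + y * v1
  e20 : M 2 0 = u2 + y * v2
  e30 : M 3 0 = y
  e01 : M 0 1 = U.π * (- U.cj v1 - z * U.cj u1 + U.cj V1 * (1 - U.hx v1 v2 u1 u2 + y * z))
  e02 : M 0 2 = - U.cj v2 - z * U.cj u2 + U.cj V2 * (1 - U.hx v1 v2 u1 u2 + y * z)
  e11 : M 1 1 = 1 + U.π * (- U.cj u1 * v1 + U.cj V1 * (u1 + y * v1))
  e21 : M 2 1 = U.π * (- U.cj u1 * v2 + U.cj V1 * (u2 + y * v2))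
  e12 : M 1 2 = - U.cj u2 * v1 + U.cj V2 * (u1 + y * v1)
  e22 : M 2 2 = 1 - U.cj u2 * v2 + U.cj V2 * (u2 + y * v2)
  e31 : M 3 1 = U.π * (- U.cj u1 + y * U.cj V1)
  e32 : M 3 2 = - U.cj u2 + y * U.cj V2
  e03 : M 0 3 = z + U.hx v1 v2 V1 V2 + z * U.hx u1 u2 V1 V2 + U.cj Z * (1 - U.hx v1 v2 u1 u2 + y * z)
  e13 : M 1 3 = v1 - V1 + U.hx u1 u2 V1 V2 * v1 + U.cj Z * (u1 + y * v1)
  e23 : M 2 3 = v2 - V2 + U.hx u1 u2 V1 V2 * v2 + U.cj Z * (u2 + y * v2)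
  e33 : M 3 3 = 1 + U.hx u1 u2 V1 V2 + U.cj Z * y

lemma ent {v1 v2 z u1 u2 y V1 V2 Z : F} (h1 : U.N v1 v2 z) (h2 : U.N u1 u2 y) (h3 : U.N V1 V2 Z) :
    Ent U v1 v2 z u1 u2 y V1 V2 Z (U.mat (U.n v1 v2 z * U.nm u1 u2 y * (U.n V1 V2 Z)⁻¹)) := by
  rw [n_inv h3]
  constructor <;> simp only [U.mm, n_mat h1, nm_mat h2, n_mat h3.inv] <;>
    simp [nM, mM, hh, U.cj_cj] <;> ring

/-- Good / OK -/
def Good (y : G) : Prop := ∃ j ∈ U.J, ∃ j' ∈ U.J, j * y = y * j' ∧ U.τ j ≠ U.τ j'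
def OK (y : G) : Prop := (∃ j₁ ∈ U.J, ∃ g ∈ U.GE, ∃ j₂ ∈ U.J, y = j₁ * g * j₂) ∨ U.Good y

lemma τ_conjJ {k j : G} (hk : k ∈ U.J) (hj : j ∈ U.J) : U.τ (k * j * k⁻¹) = U.τ j := by
  have h := chi.mul _ (U.J.mul_mem hk hj) _ (U.J.inv_mem hk)
  have h1 := chi.mul _ hk _ (U.J.inv_mem hk)
  have h2 : U.τ (1 : G) = 1 := τ_of (by simp [U.one_e]) (by simp [U.one_e])
  rw [mul_inv_cancel, h2] at h1
  rw [h, chi.mul _ hk _ hj]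
  linear_combination (- U.τ j) * h1
lemma OK.inv {y : G} (h : U.OK y⁻¹) : U.OK y := by
  rcases h with ⟨a, ha, g, hg, b, hb, e⟩ | ⟨a, ha, b, hb, e, ne⟩
  · refine Or.inl ⟨b⁻¹, U.J.inv_mem hb, g⁻¹, U.GE.inv_mem hg, a⁻¹, U.J.inv_mem ha, ?_⟩
    rw [← inv_inv y, e]; group
  · refine Or.inr ⟨b, hb, a, ha, ?_, ne.symm⟩
    have : y * (a * y⁻¹) * y = y * (y⁻¹ * b) * y := by rw [e]
    simpa [mul_assoc] using this.symm
lemma OK.l {k y : G} (hn : ∀ j ∈ U.J, k⁻¹ * j * k ∈ U.J ∧ U.τ (k⁻¹ * j * k) = U.τ j)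
    (hg : k ∈ U.J ∨ k ∈ U.GE) (h : U.OK (k * y)) : U.OK y := by
  rcases h with ⟨a, ha, g, hg', b, hb, e⟩ | ⟨a, ha, b, hb, e, ne⟩
  · have e' : y = k⁻¹ * (a * g * b) := by rw [← e]; group
    rcases hg with hg | hg
    · exact Or.inl ⟨k⁻¹ * a, U.J.mul_mem (U.J.inv_mem hg) ha, g, hg', b, hb, by rw [e']; group⟩
    · exact Or.inl ⟨k⁻¹ * a * k, (hn a ha).1, k⁻¹ * g, U.GE.mul_mem (U.GE.inv_mem hg) hg', b, hb, by rw [e']; group⟩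
  · refine Or.inr ⟨k⁻¹ * a * k, (hn a ha).1, b, hb, ?_, by rw [(hn a ha).2]; exact ne⟩
    have : k⁻¹ * (a * (k * y)) = k⁻¹ * (k * y * b) := by rw [e]
    simpa [mul_assoc] using this
lemma OK.Kl {k y : G} (hk : k ∈ U.K) (h : U.OK (k * y)) : U.OK y := by
  refine OK.l (fun j hj => ⟨?_, ?_⟩) (Or.inr hk.1) h
  · simpa using Knorm (U.K.inv_mem hk) hj
  · simpa using τ_conj (U.GE.inv_mem hk.1) j
lemma OK.Jl {k y : G} (hk : k ∈ U.J) (h : U.OK (k * y)) : U.OK y := by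
  refine OK.l (fun j hj => ⟨?_, ?_⟩) (Or.inl hk) h
  · exact U.J.mul_mem (U.J.mul_mem (U.J.inv_mem hk) hj) hk
  · simpa using τ_conjJ (U.J.inv_mem hk) hj
lemma OK.inv' {y : G} (h : U.OK y) : U.OK y⁻¹ := OK.inv (by rwa [inv_inv])
lemma OK.Kr {k y : G} (hk : k ∈ U.K) (h : U.OK (y * k)) : U.OK y := by
  apply OK.inv
  apply OK.Kl (U.K.inv_mem hk)
  rw [← mul_inv_rev]; exact h.inv'
lemma OK.Jr {k y : G} (hk : k ∈ U.J) (h : U.OK (y * k)) : U.OK y := by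
  apply OK.inv
  apply OK.Jl (U.J.inv_mem hk)
  rw [← mul_inv_rev]; exact h.inv'

variable (U) in
def nh (v1 v2 : F) : G := U.n v1 v2 (-(hh U.toCF v1 v2 v1 v2) / 2)
variable (U) in
def nmh (v1 v2 : F) : G := U.nm v1 v2 (-(hh U.toCF v1 v2 v1 v2) / 2)

lemma lemI_core {i : ℤ} {v1 v2 w1 w2 r : F} (hi : 0 ≤ i) (him : i < U.m) (hv : D U.toCF i v1 v2)
    (hw : D U.toCF (2 * U.m - 1 - i) w1 w2)
    (hr : -U.cj w1 * v2 + U.cj v1 * w2 + U.cj w2 * v1 - U.cj v2 * w1 = U.π ^ (U.m - 1) * r)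
    (hψ : U.ψ r ≠ 1) :
    U.nh v1 v2 * U.nmh w1 w2 * (U.nh v1 v2)⁻¹ ∈ U.J ∧
    U.τ (U.nh v1 v2 * U.nmh w1 w2 * (U.nh v1 v2)⁻¹) ≠ 1 := by
  have N1 := N_half (U := U) v1 v2
  have N2 := N_half (U := U) w1 w2
  have hp := U.π_ne
  have hz := div2 (C := U.toCF) (ng hv.hself)
  have hy := div2 (C := U.toCF) (ng hw.hself)
  have zr : U.cj (-(hh U.toCF v1 v2 v1 v2) / 2) = -(hh U.toCF v1 v2 v1 v2) / 2 := by
    simp only [map_div₀, map_neg, hh_cj, cj2]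
  have yr : U.cj (-(hh U.toCF w1 w2 w1 w2) / 2) = -(hh U.toCF w1 w2 w1 w2) / 2 := by
    simp only [map_div₀, map_neg, hh_cj, cj2]
  have E := ent N1 N2 N1
  simp only [nh, nmh]
  generalize U.n v1 v2 _ * U.nm w1 w2 _ * _⁻¹ = j at E
  rw [N] at N1
  generalize -(hh U.toCF v1 v2 v1 v2) / 2 = z at *
  generalize -(hh U.toCF w1 w2 w1 w2) / 2 = y at *
  rw [zr] at N1
  have hvw : U.hx v1 v2 w1 w2 ∈ U.P U.m := hv.h hw (by omega)
  have hwv : U.hx w1 w2 v1 v2 ∈ U.P U.m := hw.h hv (by omega)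
  have hA : y * z - U.hx v1 v2 w1 w2 ∈ U.P U.m := sb (CF.mul hy hz (by omega)) hvw
  have hym : y ∈ U.P U.m := CF.mono hy (by omega)
  have hp1 := p1 (C := U.toCF)
  have d11 : U.π * (- U.cj w1 * v1 + U.cj v1 * (w1 + y * v1)) ∈ U.P U.m := by
    refine CF.mul hp1 (ad (k := U.m - 1) (CF.mul (ng (cjm hw.1)) hv.1 (by omega))
      (CF.mul (cjm hv.1) (ad (k := (2 * U.m - 1 - i)/2) hw.1 (CF.mul hy hv.1 (by omega))) (by omega))) (by omega)
  have d22 : - U.cj w2 * v2 + U.cj v2 * (w2 + y * v2) ∈ U.P U.m := by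
    refine (ad (CF.mul (ng (cjm hw.2)) hv.2 (by omega))
      (CF.mul (cjm hv.2) (ad (k := (2 * U.m - 1 - i + 1)/2) hw.2 (CF.mul hy hv.2 (by omega))) (by omega)))
  have d21 : U.π * (- U.cj w1 * v2 + U.cj v1 * (w2 + y * v2)) ∈ U.P U.m := by
    refine CF.mul hp1 (ad (k := U.m - 1) (CF.mul (ng (cjm hw.1)) hv.2 (by omega))
      (CF.mul (cjm hv.1) (ad (k := (2 * U.m - 1 - i + 1)/2) hw.2 (CF.mul hy hv.2 (by omega))) (by omega))) (by omega)
  have d12 : U.π * (- U.cj w2 * v1 + U.cj v2 * (w1 + y * v1)) ∈ U.P U.m := by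
    refine CF.mul hp1 (ad (k := U.m - 1) (CF.mul (ng (cjm hw.2)) hv.1 (by omega))
      (CF.mul (cjm hv.2) (ad (k := (2 * U.m - 1 - i)/2) hw.1 (CF.mul hy hv.1 (by omega))) (by omega))) (by omega)
  constructor
  · rw [U.memJ]
    constructor
    · rw [E.e00]; convert hA using 1; ring
    · rw [E.e03, zr]
      have : z + U.hx v1 v2 v1 v2 + z * U.hx w1 w2 v1 v2 + z * (1 - U.hx v1 v2 w1 w2 + y * z)
        = z * (U.hx w1 w2 v1 v2) + z * (y * z - U.hx v1 v2 w1 w2) := by rw [hx]; linear_combination N1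
      rw [this]; exact ad (CF.mul hz hwv (by omega)) (CF.mul hz hA (by omega))
    · rw [E.e30]; exact hym
    · rw [E.e33, zr]
      have : 1 + U.hx w1 w2 v1 v2 + z * y - 1 = U.hx w1 w2 v1 v2 + z * y := by ring
      rw [this]; exact ad hwv (CF.mul hz hym (by omega))
    · rw [E.e10, E.e20]
      exact D.add (hw.mono (by omega)) (D.smul hy hv (by omega))
    · rw [E.e13, E.e23, zr]
      have := D.add (D.smul (l := U.m) hwv hv (by omega)) (D.smul (l := U.m) hz
        (D.add (hw.mono (by omega : U.m ≤ _)) (D.smul (l := U.m) hy hv (by omega))) (by omega))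
      simpa using this
    · rw [E.e01]
      refine CF.mul hp1 (y := _) (j := U.m / 2) ?_ (by omega)
      have : - U.cj v1 - z * U.cj w1 + U.cj v1 * (1 - U.hx v1 v2 w1 w2 + y * z) =
        U.cj v1 * (y * z - U.hx v1 v2 w1 w2) - z * U.cj w1 := by ring
      rw [this]
      exact sb (CF.mul (cjm hv.1) hA (by omega)) (CF.mul hz (cjm hw.1) (by omega))
    · rw [E.e31]
      exact CF.mul hp1 (y := _) (j := U.m / 2) (ad (ng (CF.mono (cjm hw.1) (by omega))) (CF.mul hy (cjm hv.1) (by omega))) (by omega)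
    · rw [E.e02]
      have : - U.cj v2 - z * U.cj w2 + U.cj v2 * (1 - U.hx v1 v2 w1 w2 + y * z) =
        U.cj v2 * (y * z - U.hx v1 v2 w1 w2) - z * U.cj w2 := by ring
      rw [this]
      exact sb (CF.mul (cjm hv.2) hA (by omega)) (CF.mul hz (cjm hw.2) (by omega))
    · rw [E.e32]
      exact (ad (ng (CF.mono (cjm hw.2) (by omega))) (CF.mul hy (cjm hv.2) (by omega)))
    · rw [E.e11, E.e22]; convert ad d11 d22 using 1; ring
    · rw [E.e11, E.e22]; convert CF.mono (sb d11 d22) (by omega : (U.m + 1) / 2 ≤ _) using 1; ring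
    · rw [E.e12, E.e21]; exact sb d12 d21
    · rw [E.e12, E.e21]; exact CF.mono (ad d12 d21) (by omega)
  · rw [τ, E.e12, E.e21, Ne, inv_eq_one]
    have : U.π ^ (-U.m) * (U.π * (- U.cj w1 * v2 + U.cj v1 * (w2 + y * v2)) -
      U.π * (- U.cj w2 * v1 + U.cj v2 * (w1 + y * v1))) = r + U.π ^ (1 - U.m) * (y * (U.cj v1 * v2 - U.cj v2 * v1)) := by
      have e1 : U.π ^ (1 - U.m) * U.π ^ (U.m - 1) = 1 := by
        rw [← zpow_add₀ hp]; simp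
      have e2 : U.π ^ (-U.m) * U.π = U.π ^ (1 - U.m) := by
        rw [← zpow_add_one₀ hp]; congr 1; ring
      linear_combination (-U.cj w1 * v2 + U.cj v1 * w2 + U.cj w2 * v1 - U.cj v2 * w1
        + y * (U.cj v1 * v2 - U.cj v2 * v1)) * e2 + U.π ^ (1 - U.m) * hr + r * e1
    rw [this, U.ψ_add, U.ψ_im (U.π ^ (1 - U.m) * _), mul_one]
    · exact hψ
    · simp only [map_mul, map_sub, map_zpow₀, U.cjπ, U.cj_cj, yr]; ring

lemma lemI {i : ℤ} {v1 v2 u1 u2 τ : F} {d : G} (hi : 0 ≤ i) (him : i < U.m) (hv : D U.toCF i v1 v2)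
    (hv' : ¬ D U.toCF (i + 1) v1 v2) (hu : D U.toCF i u1 u2) (hd : Dv (U.mat d)) (h0 : τ ≠ 0)
    (hτ : τ ∈ U.P 0) :
    U.Good (U.nh v1 v2 * (U.t τ * d) * U.nmh u1 u2) := by
  obtain ⟨r, hrO, hrr, hψ⟩ := U.ψ_r
  rw [← P0 (C := U.toCF)] at hrO
  obtain ⟨w1, w2, hw, hr⟩ : ∃ w1 w2, D U.toCF (2 * U.m - 1 - i) w1 w2 ∧
      -U.cj w1 * v2 + U.cj v1 * w2 + U.cj w2 * v1 - U.cj v2 * w1 = U.π ^ (U.m - 1) * r := by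
    have h2 := U.two
    rcases Int.even_or_odd' i with ⟨a, rfl | rfl⟩
    · have k : v2 ∉ U.P (a + 1) := fun k => hv' ⟨CF.mono hv.1 (by omega), CF.mono k (by omega)⟩
      have k0 : v2 ≠ 0 := by rintro rfl; exact k P00
      have k0' : U.cj v2 ≠ 0 := by simpa using k0
      refine ⟨-(U.π ^ (U.m - 1) * (r / 2) * U.cj v2⁻¹), 0, ⟨?_, P00⟩, ?_⟩
      · exact ng (CF.mul (CF.mul (ppow _) (div2 hrO) le_rfl) (cjm (inv_of_not k)) (by omega))
      · simp only [map_neg, map_mul, map_zpow₀, map_div₀, map_inv₀, U.cjπ, U.cj_cj, hrr, map_zero, cj2]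
        field_simp; ring
    · have k : v1 ∉ U.P (a + 1) := fun k => hv' ⟨CF.mono k (by omega), CF.mono hv.2 (by omega)⟩
      have k0 : v1 ≠ 0 := by rintro rfl; exact k P00
      have k0' : U.cj v1 ≠ 0 := by simpa using k0
      refine ⟨0, (U.π ^ (U.m - 1) * (r / 2) * U.cj v1⁻¹), ⟨P00, ?_⟩, ?_⟩
      · exact (CF.mul (CF.mul (ppow _) (div2 hrO) le_rfl) (cjm (inv_of_not k)) (by omega))
      · simp only [map_neg, map_mul, map_zpow₀, map_div₀, map_inv₀, U.cjπ, U.cj_cj, hrr, map_zero, cj2]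
        field_simp; ring
  obtain ⟨c1, c2⟩ := lemI_core hi him hv hw hr hψ
  have hd' := dv_inv hd
  have N2 := N_half (U := U) w1 w2
  have Nu := N_half (U := U) u1 u2
  have N3 := dv_N hd' (N2.t' τ)
  have D3 := dv_D hd' (D.smul hτ hw (l := 2 * U.m - 1 - i) (by omega))
  have hy : τ * U.cj τ * (-(hh U.toCF w1 w2 w1 w2) / 2) ∈ U.P U.m :=
    om (om hτ (cjm hτ)) (CF.mono (div2 (ng hw.hself)) (by omega))
  have e4 := dv_nm hd' (N2.t' τ)
  generalize U.mat d⁻¹ 1 1 * (τ * w1) + U.mat d⁻¹ 1 2 * (τ * w2) = a1 at *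
  generalize U.mat d⁻¹ 2 1 * (τ * w1) + U.mat d⁻¹ 2 2 * (τ * w2) = a2 at *
  have e5 : U.nmh w1 w2 * (U.t τ * d) = (U.t τ * d) * U.nm a1 a2 (τ * U.cj τ * (-(hh U.toCF w1 w2 w1 w2) / 2)) := by
    rw [nmh, ← mul_assoc, nm_t h0 N2]
    generalize U.nm (τ * w1) (τ * w2) _ = X at e4 ⊢
    generalize U.nm a1 a2 _ = Y at e4 ⊢
    have : X * d = d * Y := by
      calc X * d = d * (d⁻¹ * X) * d := by group
        _ = _ := by rw [e4]; group
    rw [mul_assoc, this, mul_assoc]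
  generalize τ * U.cj τ * (-(hh U.toCF w1 w2 w1 w2) / 2) = y at *
  have e6 : (U.nmh u1 u2)⁻¹ * U.nm a1 a2 y * U.nmh u1 u2 ∈ U.J ∧ U.τ ((U.nmh u1 u2)⁻¹ * U.nm a1 a2 y * U.nmh u1 u2) = 1 := by
    rw [nmh, nm_inv Nu, nm_mul Nu.inv N3, nm_mul (Nu.inv.add N3) Nu]
    refine ⟨nm_J ((Nu.inv.add N3).add Nu) ?_ ?_, τ_nm ((Nu.inv.add N3).add Nu)⟩
    · simpa using D3.mono (by omega)
    · have q1 : U.hx u1 u2 a1 a2 ∈ U.P U.m := hu.h D3 (by omega)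
      have q2 : U.hx a1 a2 u1 u2 ∈ U.P U.m := D3.h hu (by omega)
      have : U.cj (-(hh U.toCF u1 u2 u1 u2) / 2) + y - U.hx (-u1) (-u2) a1 a2 + (-(hh U.toCF u1 u2 u1 u2) / 2) -
        U.hx (-u1 + a1) (-u2 + a2) u1 u2 = y + U.hx u1 u2 a1 a2 - U.hx a1 a2 u1 u2 := by
        have h2 := U.two
        simp only [map_div₀, map_neg, hh_cj, cj2]
        simp only [hx, hh, map_add, map_neg]; field_simp; ring
      rw [this]
      exact sb (ad hy q1) q2
  refine ⟨_, c1, _, e6.1, ?_, by rw [e6.2]; exact c2⟩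
  calc U.nh v1 v2 * U.nmh w1 w2 * (U.nh v1 v2)⁻¹ * (U.nh v1 v2 * (U.t τ * d) * U.nmh u1 u2)
      = U.nh v1 v2 * (U.nmh w1 w2 * (U.t τ * d)) * U.nmh u1 u2 := by group
    _ = _ := by rw [e5]; group
end CG
end UC

namespace UC
open CF
namespace CG
variable {F : Type u} [Field F] {G : Type v} [Group G] {U : CG F G}

lemma dd_mat {p q s t : F} (h1 : p * U.cj p + U.π * (q * U.cj q) = 1) (h2 : p * U.cj s + q * U.cj t = 0)
    (h3 : U.π * (s * U.cj s) + t * U.cj t = 1) :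
    U.mat (U.dd p q (U.π * s) t) = dM p q (U.π * s) t := by
  apply U.mat_el
  have hp := U.π_ne
  have h2' := congrArg U.cj h2
  simp only [map_add, map_mul, U.cj_cj, map_zero] at h2'
  ext i j
  fin_cases i <;> fin_cases j <;>
    simp [adj, dM, Matrix.mul_apply, Fin.sum_univ_four, Matrix.one_apply, U.cjπ]
  · linear_combination h1
  · field_simp; linear_combination h2
  · linear_combination U.π * h2'
  · field_simp; linear_combination h3
lemma dd_Dv {d : G} {p q s t : F} (h : U.mat d = dM p q s t) : Dv (U.mat d) := by
  rw [h]; refine ⟨⟨?_, ?_, ?_, ?_, ?_, ?_, ?_, ?_, ?_, ?_⟩, ?_, ?_⟩ <;> simp [dM]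
lemma dv_J {d : G} (hd : Dv (U.mat d)) (tr : U.mat d 1 1 + U.mat d 2 2 - 2 ∈ U.P U.m)
    (df : U.mat d 1 1 - U.mat d 2 2 ∈ U.P ((U.m + 1) / 2))
    (om : U.π * U.mat d 1 2 - U.mat d 2 1 ∈ U.P U.m)
    (op : U.π * U.mat d 1 2 + U.mat d 2 1 ∈ U.P (U.m / 2 + 1)) : d ∈ U.J := by
  rw [U.memJ]
  refine ⟨?_, ?_, ?_, ?_, ?_, ?_, ?_, ?_, ?_, ?_, tr, df, om, op⟩ <;>
  simp [hd.h01, hd.h02, hd.h03, hd.h10, hd.h20, hd.h30, hd.h13,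
    hd.h23, hd.h31, hd.h32, hd.h00, hd.h33, P00, D]

/-- relations for a Dv element -/
structure DR (U : CG F G) (d : G) (p q s t : F) : Prop where
  hd : Dv (U.mat d)
  e11 : U.mat d 1 1 = p
  e12 : U.mat d 1 2 = q
  e21 : U.mat d 2 1 = U.π * s
  e22 : U.mat d 2 2 = t
  r11 : p * U.cj p + U.π * (q * U.cj q) = 1
  r12 : p * U.cj s + q * U.cj t = 0
  r22 : U.π * (s * U.cj s) + t * U.cj t = 1
  ip : p ∈ U.P 0
  iq : q ∈ U.P 0
  is : s ∈ U.P 0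
  it : t ∈ U.P 0
lemma dr {d : G} (hd : Dv (U.mat d)) : ∃ p q s t, DR U d p q s t := by
  have hp := U.π_ne
  have a := U.mm d d⁻¹ 1 1
  have b := U.mm d d⁻¹ 1 2
  have c := U.mm d d⁻¹ 2 2
  simp only [mul_inv_cancel, U.one_e, U.i01, U.i02, U.i31, U.i32, U.i11, U.i12, U.i21, U.i22, hd.h10, hd.h20, hd.h13,
    hd.h23] at a b c
  simp at a b c
  have A : U.mat d 1 1 * U.cj (U.mat d 1 1) + U.π * (U.mat d 1 2 * U.cj (U.mat d 1 2)) = 1 := by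
    linear_combination -a
  have C : U.π * ((U.mat d 2 1 / U.π) * U.cj (U.mat d 2 1 / U.π)) + U.mat d 2 2 * U.cj (U.mat d 2 2) = 1 := by
    rw [map_div₀, U.cjπ]; field_simp; field_simp at c; linear_combination -c
  have i1 := herm (C := U.toCF) (i := 0) (v1 := U.mat d 1 2) (v2 := U.mat d 1 1) (by rw [add_comm, A]; exact one0)
  have i2 := herm (C := U.toCF) (i := 0) (v1 := U.mat d 2 1 / U.π) (v2 := U.mat d 2 2) (by rw [C]; exact one0)
  refine ⟨U.mat d 1 1, U.mat d 1 2, U.mat d 2 1 / U.π, U.mat d 2 2, hd, rfl, rfl, ?_, rfl, A, ?_, C, i1.2, i1.1, i2.1, i2.2⟩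
  · field_simp
  · rw [map_div₀, U.cjπ]; linear_combination -b

lemma levi_test {d : G} {p q s t τ a b c r : F} (hd : DR U d p q s t) (h0 : τ ≠ 0)
    (ha : a ∈ U.P ((U.m + 1) / 2)) (hb : b ∈ U.P (U.m / 2)) (hc : c ∈ U.P (U.m / 2))
    (sa : U.cj a = -a) (sc : U.cj c = -b) (sb' : U.cj b = -c)
    (h1 : U.π * (c - b) ∈ U.P U.m)
    (h2 : 2 * (U.π * (p * U.cj q - q * U.cj p)) * a + U.π * ((p * U.cj t - U.π * (q * U.cj s)) * c
      + (U.π * (s * U.cj q) - t * U.cj p) * b) - U.π * (c - b) - U.π ^ U.m * r / 2 ∈ U.P (U.m + 1))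
    (hrO : r ∈ U.P 0) (hψ : U.ψ r ≠ 1) : U.Good (U.t τ * d) := by
  have hm := U.hm
  have hp := U.π_ne
  have htwo := U.two
  obtain ⟨ν, hν⟩ : ∃ ν, ν = a * a + U.π * (b * c) := ⟨_, rfl⟩
  have νm : ν ∈ U.P U.m := by
    rw [hν]; exact ad (CF.mul ha ha (by omega)) (CF.mul p1 (CF.mul hb hc le_rfl) (by omega))
  have νr : U.cj ν = ν := by
    rw [hν]; simp only [map_add, map_mul, sa, sb', sc, U.cjπ]; ring
  obtain ⟨-, k1, k2, -⟩ := unit_of (C := U.toCF) (x := 1 - ν) (by simpa using CF.mono νm hm)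
  obtain ⟨κ, hκ⟩ : ∃ κ, κ = (1 - ν)⁻¹ := ⟨_, rfl⟩
  have κr : U.cj κ = κ := by rw [hκ]; simp [νr]
  have κe : κ * (1 - ν) = 1 := by rw [hκ]; exact inv_mul_cancel₀ k2
  have κ0 : κ ∈ U.P 0 := by rw [hκ]; exact k1
  have J1 : ((1 + ν) ^ 2 - 4 * ν) * κ ^ 2 = 1 := by
    have : ((1 + ν) ^ 2 - 4 * ν) * κ ^ 2 = (κ * (1 - ν)) ^ 2 := by ring
    rw [this, κe]; norm_num
  obtain ⟨j, hj⟩ : ∃ j, U.mat j = dM (κ * (1 + ν + 2 * a)) (κ * (2 * b)) (U.π * (κ * (2 * c))) (κ * (1 + ν - 2 * a)) := by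
    refine ⟨_, dd_mat ?_ ?_ ?_⟩
    · simp only [map_add, map_sub, map_mul, map_one, κr, νr, sa, sb', sc, cj2]
      linear_combination J1 - 4 * κ ^ 2 * (-hν)
    · simp only [map_add, map_sub, map_mul, map_one, κr, νr, sa, sb', sc, cj2]
      ring
    · simp only [map_add, map_sub, map_mul, map_one, κr, νr, sa, sb', sc, cj2]
      linear_combination J1 - 4 * κ ^ 2 * (-hν)
  have jD := dd_Dv hj
  have m11 : U.mat j 1 1 = κ * (1 + ν + 2 * a) := by rw [hj]; rfl
  have m12 : U.mat j 1 2 = κ * (2 * b) := by rw [hj]; rfl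
  have m21 : U.mat j 2 1 = U.π * (κ * (2 * c)) := by rw [hj]; rfl
  have m22 : U.mat j 2 2 = κ * (1 + ν - 2 * a) := by rw [hj]; rfl
  have T4 : κ * (4 * ν) ∈ U.P U.m := by
    have : (4 : F) * ν = 2 * (2 * ν) := by ring
    rw [this]; exact om κ0 (mul2.2 (mul2.2 νm))
  have trj : κ * (1 + ν) * 2 - 2 = κ * (4 * ν) := by linear_combination (2 : F) * κe
  have P2 : (2 : F) ∈ U.P 0 := by have := mul2 (C := U.toCF) (k := 0) (x := 1); rw [mul_one] at this; exact this.2 one0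
  have jJ : j ∈ U.J := by
    apply dv_J jD
    · rw [m11, m22]; convert T4 using 1; linear_combination trj
    · rw [m11, m22]
      have : κ * (1 + ν + 2 * a) - κ * (1 + ν - 2 * a) = κ * (2 * (2 * a)) := by ring
      rw [this]; exact om κ0 (mul2.2 (mul2.2 ha))
    · rw [m12, m21]
      have : U.π * (κ * (2 * b)) - U.π * (κ * (2 * c)) = - (κ * (2 * (U.π * (c - b)))) := by ring
      rw [this]; exact ng (om κ0 (mul2.2 h1))
    · rw [m12, m21]
      have : U.π * (κ * (2 * b)) + U.π * (κ * (2 * c)) = κ * (2 * (U.π * (b + c))) := by ring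
      rw [this]; exact (om κ0 (mul2.2 (CF.mul p1 (ad hb hc) (by omega))))
  have hdi := dv_inv hd.hd
  have dj : ∀ i k, U.mat (d⁻¹ * j * d) i k = _ := fun i k => by rw [U.mm, U.mm, U.mm, U.mm, U.mm]
  have q12 := hd.r12
  have q12' := congrArg U.cj hd.r12
  simp only [map_add, map_mul, U.cj_cj, map_zero] at q12'
  have cp := cjm hd.ip
  have cq := cjm hd.iq
  have cs := cjm hd.is
  have ct := cjm hd.it
  have D11 : U.mat (d⁻¹ * j * d) 1 1 = κ * ((1 + ν) * (p * U.cj p + U.π * (s * U.cj s)) + 2 * ((U.cj p * a + U.π * (U.cj s * c)) * p + U.π * ((U.cj p * b - U.cj s * a) * s))) := by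
    simp only [U.mm, hdi.h10, hdi.h13, hd.hd.h01, hd.hd.h31, jD.h10, jD.h20, jD.h13, jD.h23, U.i11, U.i12, hd.e11, hd.e12, hd.e21, hd.e22, m11, m12, m21, m22, map_mul, U.cjπ]
    field_simp; ring
  have D12 : U.mat (d⁻¹ * j * d) 1 2 = κ * ((1 + ν) * (q * U.cj p + t * U.cj s) + 2 * ((U.cj p * a + U.π * (U.cj s * c)) * q + (U.cj p * b - U.cj s * a) * t)) := by
    simp only [U.mm, hdi.h10, hdi.h13, hd.hd.h02, hd.hd.h32, jD.h10, jD.h20, jD.h13, jD.h23, U.i11, U.i12, hd.e11, hd.e12, hd.e21, hd.e22, m11, m12, m21, m22, map_mul, U.cjπ]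
    field_simp; ring
  have D21 : U.mat (d⁻¹ * j * d) 2 1 = U.π * (κ * ((1 + ν) * (p * U.cj q + s * U.cj t) + 2 * ((U.cj q * a + U.cj t * c) * p + (U.π * (U.cj q * b) - U.cj t * a) * s))) := by
    simp only [U.mm, hdi.h20, hdi.h23, hd.hd.h01, hd.hd.h31, jD.h10, jD.h20, jD.h13, jD.h23, U.i21, U.i22, hd.e11, hd.e12, hd.e21, hd.e22, m11, m12, m21, m22, map_mul, U.cjπ]
    ring
  have D22 : U.mat (d⁻¹ * j * d) 2 2 = κ * ((1 + ν) * (U.π * (q * U.cj q) + t * U.cj t) + 2 * (U.π * ((U.cj q * a + U.cj t * c) * q) + (U.π * (U.cj q * b) - U.cj t * a) * t)) := by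
    simp only [U.mm, hdi.h20, hdi.h23, hd.hd.h02, hd.hd.h32, jD.h10, jD.h20, jD.h13, jD.h23, U.i21, U.i22, hd.e11, hd.e12, hd.e21, hd.e22, m11, m12, m21, m22, map_mul, U.cjπ]
    ring
  -- relations for d⁻¹ d
  obtain ⟨w1, w2, w3⟩ := dv_rel hd.hd
  rw [hd.e11, hd.e12, hd.e21, hd.e22] at *
  simp only [map_mul, U.cjπ] at w1 w2 w3
  have w1' : p * U.cj p + U.π * (s * U.cj s) = 1 := by rw [← w1]; field_simp
  have w2' : q * U.cj p + t * U.cj s = 0 := by rw [← w2]; field_simp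
  have w3' : U.π * (q * U.cj q) + t * U.cj t = 1 := by rw [← w3]; ring
  have w4' : p * U.cj q + s * U.cj t = 0 := by
    have := congrArg U.cj w2'
    simp only [map_add, map_mul, U.cj_cj, map_zero] at this
    linear_combination this
  rw [w1'] at D11
  rw [w2'] at D12
  rw [w3'] at D22
  rw [w4'] at D21
  have jD' : Dv (U.mat (d⁻¹ * j * d)) := by
    refine ⟨⟨?_, ?_, ?_, ?_, ?_, ?_, ?_, ?_, ?_, ?_⟩, ?_, ?_⟩ <;> rw [U.mm, U.mm, U.mm, U.mm, U.mm] <;>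
      simp [hdi.h01, hdi.h02, hdi.h03, hdi.h10, hdi.h20, hdi.h30, hdi.h13, hdi.h23, hdi.h31, hdi.h32, hdi.h00, hdi.h33,
        hd.hd.h01, hd.hd.h02, hd.hd.h03, hd.hd.h10, hd.hd.h20, hd.hd.h30, hd.hd.h13, hd.hd.h23, hd.hd.h31, hd.hd.h32, hd.hd.h00, hd.hd.h33,
        jD.h01, jD.h02, jD.h03, jD.h10, jD.h20, jD.h30, jD.h13, jD.h23, jD.h31, jD.h32, jD.h00, jD.h33]
  -- f(j') and f(j)
  have key : U.mat (d⁻¹ * j * d) 2 1 - U.π * U.mat (d⁻¹ * j * d) 1 2 =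
      κ * (2 * (2 * (U.π * (p * U.cj q - q * U.cj p)) * a + U.π * ((p * U.cj t - U.π * (q * U.cj s)) * c
      + (U.π * (s * U.cj q) - t * U.cj p) * b))) := by
    rw [D21, D12]
    linear_combination (2 * κ * U.π * a) * w2' - (2 * κ * U.π * a) * w4'
  have fm : 2 * (U.π * (p * U.cj q - q * U.cj p)) * a + U.π * ((p * U.cj t - U.π * (q * U.cj s)) * c
      + (U.π * (s * U.cj q) - t * U.cj p) * b) ∈ U.P U.m := by
    have x1 : U.π ^ U.m * r / 2 ∈ U.P U.m := div2 (CF.mul (ppow _) hrO (by omega))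
    have := ad (ad (CF.mono h2 (by omega : U.m ≤ U.m + 1)) x1) h1
    convert this using 1; ring
  have j'J : d⁻¹ * j * d ∈ U.J := by
    apply dv_J jD'
    · rw [D11, D22]; convert T4 using 1
      have w5 : p * U.cj p + U.π * (q * U.cj q) = 1 := hd.r11
      have w6 : U.π * (s * U.cj s) + t * U.cj t = 1 := hd.r22
      linear_combination trj + 2 * κ * a * w5 - 2 * κ * a * w6 + 2 * κ * U.π * b * q12' + 2 * κ * U.π * c * q12
    · rw [D11, D22]
      have : κ * ((1 + ν) * 1 + 2 * ((U.cj p * a + U.π * (U.cj s * c)) * p + U.π * ((U.cj p * b - U.cj s * a) * s))) -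
        κ * ((1 + ν) * 1 + 2 * (U.π * ((U.cj q * a + U.cj t * c) * q) + (U.π * (U.cj q * b) - U.cj t * a) * t)) =
        κ * (2 * (((U.cj p * p - U.π * (U.cj s * s) - U.π * (U.cj q * q) + U.cj t * t) * a) +
          (U.π * c * (U.cj s * p - U.cj t * q) + U.π * b * (U.cj p * s - U.cj q * t)))) := by ring
      rw [this]
      have pp : U.π ∈ U.P 0 := CF.mono p1 (by omega)
      exact om κ0 (mul2.2 (ad (om (ad (sb (sb (om cp hd.ip) (om pp (om cs hd.is))) (om pp (om cq hd.iq))) (om ct hd.it)) ha)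
        (CF.mono (ad (mo (CF.mul p1 hc le_rfl) (sb (om cs hd.ip) (om ct hd.iq))) (mo (CF.mul p1 hb le_rfl) (sb (om cp hd.is) (om cq hd.it)))) (by omega))))
    · have : U.π * U.mat (d⁻¹ * j * d) 1 2 - U.mat (d⁻¹ * j * d) 2 1 = -(U.mat (d⁻¹ * j * d) 2 1 - U.π * U.mat (d⁻¹ * j * d) 1 2) := by ring
      rw [this, key]
      exact ng (om κ0 (mul2.2 fm))
    · rw [D12, D21]
      have : U.π * (κ * ((1 + ν) * 0 + 2 * ((U.cj p * a + U.π * (U.cj s * c)) * q + (U.cj p * b - U.cj s * a) * t))) + 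
        U.π * (κ * ((1 + ν) * 0 + 2 * ((U.cj q * a + U.cj t * c) * p + (U.π * (U.cj q * b) - U.cj t * a) * s))) =
        U.π * (κ * (2 * ((U.cj p * q - U.cj s * t + U.cj q * p - U.cj t * s) * a + (U.π * (U.cj s * q) + U.cj t * p) * c + (U.cj p * t + U.π * (U.cj q * s)) * b))) := by ring
      rw [this]
      have pp : U.π ∈ U.P 0 := CF.mono p1 (by omega)
      refine CF.mul p1 (j := U.m / 2) (om κ0 (mul2.2 ?_)) (by omega)
      exact ad (ad (om (sb (ad (sb (om cp hd.iq) (om cs hd.it)) (om cq hd.ip)) (om ct hd.is)) (CF.mono ha (by omega)))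
        (om (ad (om pp (om cs hd.iq)) (om ct hd.ip)) hc)) (om (ad (om cp hd.it) (om pp (om cq hd.is))) hb)
  refine ⟨j, jJ, d⁻¹ * j * d, j'J, ?_, ?_⟩
  · rw [← mul_assoc, ← dv_comm_t jD h0]; group
  · intro e
    rw [CG.τ, CG.τ, inv_inj] at e
    rw [key, m12, m21] at e
    apply hψ
    generalize hQ : 2 * (U.π * (p * U.cj q - q * U.cj p)) * a + U.π * ((p * U.cj t - U.π * (q * U.cj s)) * c
      + (U.π * (s * U.cj q) - t * U.cj p) * b) = Q at *
    have z1 : U.π ^ (-U.m) * (κ * (2 * Q)) = U.π ^ (-U.m) * (U.π * (κ * (2 * c)) - U.π * (κ * (2 * b))) + 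
        (r + (U.π ^ (-U.m) * (κ * (2 * (Q - U.π * (c - b) - U.π ^ U.m * r / 2))) + κ * ν * r)) := by
      have e1 : U.π ^ (-U.m) * U.π ^ U.m = 1 := by rw [← zpow_add₀ hp]; simp
      clear h2 fm
      generalize U.π ^ (-U.m) = P1 at e1 ⊢
      generalize U.π ^ U.m = P2 at e1 ⊢
      have : κ * (2 * (Q - U.π * (c - b) - P2 * r / 2)) = κ * (2 * (Q - U.π * (c - b))) - κ * (P2 * r) := by field_simp
      rw [this]
      linear_combination r * κe + κ * r * e1
    rw [z1, U.ψ_add, U.ψ_add, U.ψ_P1 (U.π ^ (-U.m) * _ + _), mul_one] at e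
    · exact mul_left_cancel₀ (ψ_ne _) ((mul_one _).trans e).symm
    · refine ad (CF.mul (ppow (-U.m)) (om κ0 (mul2.2 h2)) (by omega)) (mo (om κ0 (CF.mono νm hm)) hrO)
end CG
end UC

namespace UC
open CF
namespace CG
variable {F : Type u} [Field F] {G : Type v} [Group G] {U : CG F G}

lemma levi_split {d : G} {p q s t : F} (hd : DR U d p q s t) (h1 : p - t ∈ U.P ((U.m + 1) / 2))
    (h2 : q + s ∈ U.P (U.m / 2)) : ∃ e ∈ U.GE, Dv (U.mat e) ∧ e⁻¹ * d ∈ U.J := by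
  have hm := U.hm
  have hp := U.π_ne
  have htwo := U.two
  obtain ⟨x, hx⟩ : ∃ x, x = (p + t) / 2 := ⟨_, rfl⟩
  obtain ⟨y, hy⟩ : ∃ y, y = (q - s) / 2 := ⟨_, rfl⟩
  obtain ⟨a, ha⟩ : ∃ a, a = (p - t) / 2 := ⟨_, rfl⟩
  obtain ⟨b, hb⟩ : ∃ b, b = (q + s) / 2 := ⟨_, rfl⟩
  have ep : p = x + a := by rw [hx, ha]; field_simp; ring
  have et : t = x - a := by rw [hx, ha]; field_simp; ring
  have eq : q = y + b := by rw [hy, hb]; field_simp; ring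
  have es : s = b - y := by rw [hy, hb]; field_simp; ring
  have x0 : x ∈ U.P 0 := by rw [hx]; exact div2 (ad hd.ip hd.it)
  have y0 : y ∈ U.P 0 := by rw [hy]; exact div2 (sb hd.iq hd.is)
  have am : a ∈ U.P ((U.m + 1) / 2) := by rw [ha]; exact div2 h1
  have bm : b ∈ U.P (U.m / 2) := by rw [hb]; exact div2 h2
  have r11 := hd.r11
  have r12 := hd.r12
  have r22 := hd.r22
  have w2 := (dv_rel hd.hd).2.1
  rw [hd.e11, hd.e12, hd.e21, hd.e22] at w2
  simp only [map_mul, U.cjπ] at w2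
  have w2' : q * U.cj p + t * U.cj s = 0 := by rw [← w2]; field_simp
  clear hx hy ha hb
  subst ep et eq es
  simp only [map_add, map_sub] at r11 r12 r22 w2'
  have T : U.cj y * x - U.cj x * y = 0 := by
    have k1 : 2 * (y * U.cj x - x * U.cj y + b * U.cj x + x * U.cj b) = 0 := by linear_combination r12 + w2'
    have k2 := (mul_eq_zero.1 k1).resolve_left htwo
    have k3 := congrArg U.cj k2
    simp only [map_add, map_sub, map_mul, U.cj_cj, map_zero] at k3
    have : 2 * (U.cj y * x - U.cj x * y) = 0 := by linear_combination k3 - k2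
    exact (mul_eq_zero.1 this).resolve_left htwo
  obtain ⟨ρ, hρ⟩ : ∃ ρ, ρ = x * U.cj x + U.π * (y * U.cj y) - 1 := ⟨_, rfl⟩
  have ρm : ρ ∈ U.P U.m := by
    have : ρ = -(a * U.cj a + U.π * (b * U.cj b)) := by
      rw [hρ]
      have : 2 * (x * U.cj x + U.π * (y * U.cj y) - 1 + (a * U.cj a + U.π * (b * U.cj b))) = 0 := by
        linear_combination r11 + r22
      linear_combination (mul_eq_zero.1 this).resolve_left htwo
    rw [this]
    exact ng (ad (CF.mul am (cjm am) (by omega)) (CF.mul p1 (CF.mul bm (cjm bm) le_rfl) (by omega)))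
  obtain ⟨ς, hς, cς, nς⟩ : ∃ ς : F, ς * ς = 1 ∧ U.cj ς = ς ∧ ς + x ∉ U.P 1 := by
    by_cases h : 1 + x ∈ U.P 1
    · refine ⟨-1, by ring, by simp, fun h' => one_not (C := U.toCF) (mul2.1 ?_)⟩
      have := sb h h'
      convert this using 1; ring
    · exact ⟨1, by ring, by simp, h⟩
  obtain ⟨c, hc⟩ : ∃ c, c = ς + x := ⟨_, rfl⟩
  have ς0 : ς ∈ U.P 0 := by
    by_contra h
    have := mul_not (C := U.toCF) (i := -1) (j := -1) (x := ς) (y := ς) (by simpa using h) (by simpa using h)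
    rw [hς] at this
    exact this (CF.mono one0 (by omega))
  have c0 : c ∈ U.P 0 := by rw [hc]; exact ad ς0 x0
  rw [← hc] at nς
  obtain ⟨Δ, hΔ⟩ : ∃ Δ, Δ = c ^ 2 + U.π * y ^ 2 := ⟨_, rfl⟩
  have nΔ : Δ ∉ U.P 1 := by
    intro h
    have k : U.π * y ^ 2 ∈ U.P 1 := mo p1 (by rw [pow_two]; exact om y0 y0)
    have := sb h k
    rw [hΔ, add_sub_cancel_right, pow_two] at this
    exact mul_not (C := U.toCF) (i := 0) (j := 0) (by simpa using nς) (by simpa using nς) (by simpa using this)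
  have Δ0 : Δ ≠ 0 := fun h => nΔ (by rw [h]; exact P00)
  have Δi := inv0 nΔ
  have Δ0' : U.cj Δ ≠ 0 := by simpa using Δ0
  have hΔ' : U.cj Δ = U.cj c ^ 2 + U.π * U.cj y ^ 2 := by rw [hΔ]; simp [U.cjπ]
  have hc' : U.cj c = ς + U.cj x := by rw [hc]; simp [cς]
  obtain ⟨α, hα⟩ : ∃ α, α = ς * (c * U.cj c - U.π * (y * U.cj y)) / U.cj Δ := ⟨_, rfl⟩
  obtain ⟨κ, hκ⟩ : ∃ κ, κ = ς * (c * U.cj y + y * U.cj c) / U.cj Δ := ⟨_, rfl⟩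
  have hα' : U.cj α = ς * (c * U.cj c - U.π * (y * U.cj y)) / Δ := by
    rw [hα]; simp only [map_div₀, map_mul, map_sub, U.cj_cj, cς, U.cjπ]; congr 1; ring
  have hκ' : U.cj κ = ς * (c * U.cj y + y * U.cj c) / Δ := by
    rw [hκ]; simp only [map_div₀, map_mul, map_add, U.cj_cj, cς]; congr 1; ring
  have R1 : α * U.cj α + U.π * (κ * U.cj κ) = 1 := by
    rw [hα', hκ', hα, hκ]; field_simp; rw [hΔ', hΔ]
    linear_combination ((c ^ 2 + U.π * y ^ 2) * (U.cj c ^ 2 + U.π * U.cj y ^ 2)) * hς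
  have R2 : α * U.cj (-κ) + κ * U.cj α = 0 := by
    rw [map_neg, hα', hκ', hα, hκ]; field_simp; ring
  have em := dd_mat (U := U) (p := α) (q := κ) (s := -κ) (t := α) R1 R2 (by rw [← R1]; simp; ring)
  obtain ⟨e, he⟩ : ∃ e, e = U.dd α κ (U.π * (-κ)) α := ⟨_, rfl⟩
  rw [← he] at em
  have eD := dd_Dv em
  have eiD := dv_inv eD
  have α0 : U.cj α ∈ U.P 0 := by
    rw [hα', div_eq_mul_inv]
    exact om (om ς0 (sb (om c0 (cjm c0)) (CF.mono (mo p1 (om y0 (cjm y0))) (by omega)))) Δi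
  have κ0 : U.cj κ ∈ U.P 0 := by
    rw [hκ', div_eq_mul_inv]
    exact om (om ς0 (ad (om c0 (cjm y0)) (om y0 (cjm c0)))) Δi
  have I1 : U.cj α * x + U.π * (U.cj κ * y) - 1 = ς * c * ρ / Δ := by
    rw [hα', hκ']; field_simp
    rw [hρ, hΔ, hc', hc]
    linear_combination (ς * x + x ^ 2 + U.π * y ^ 2) * hς - ς * U.π * y * T
  have I2 : U.cj α * y - U.cj κ * x = - (ς * y * ρ / Δ) := by
    rw [hα', hκ']; field_simp
    rw [hρ, hc', hc]
    linear_combination (ς * y) * hς - ς * (ς + x) * T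
  refine ⟨e, ?_, eD, ?_⟩
  · rw [U.memE, em]; constructor <;> simp [dM]
  have dD : Dv (U.mat (e⁻¹ * d)) := by
    refine ⟨⟨?_, ?_, ?_, ?_, ?_, ?_, ?_, ?_, ?_, ?_⟩, ?_, ?_⟩ <;> rw [U.mm] <;>
      simp [eiD.h01, eiD.h02, eiD.h03, eiD.h10, eiD.h20, eiD.h30, eiD.h13, eiD.h23, eiD.h31, eiD.h32, eiD.h00, eiD.h33,
        hd.hd.h01, hd.hd.h02, hd.hd.h03, hd.hd.h10, hd.hd.h20, hd.hd.h30, hd.hd.h13, hd.hd.h23, hd.hd.h31, hd.hd.h32, hd.hd.h00, hd.hd.h33]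
  have e11 : U.mat e 1 1 = α := by rw [em]; rfl
  have e12 : U.mat e 1 2 = κ := by rw [em]; rfl
  have e21 : U.mat e 2 1 = U.π * (-κ) := by rw [em]; rfl
  have e22 : U.mat e 2 2 = α := by rw [em]; rfl
  have m11 : U.mat (e⁻¹ * d) 1 1 = U.cj α * (x + a) - U.cj κ * (U.π * (b - y)) := by
    simp only [U.mm, eiD.h10, eiD.h13, U.i11, U.i12, e11, e21, hd.e11, hd.e21, map_mul, map_neg, U.cjπ]
    field_simp; ring
  have m12 : U.mat (e⁻¹ * d) 1 2 = U.cj α * (y + b) - U.cj κ * (x - a) := by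
    simp only [U.mm, eiD.h10, eiD.h13, U.i11, U.i12, e11, e21, hd.e12, hd.e22, map_mul, map_neg, U.cjπ]
    field_simp; ring
  have m21 : U.mat (e⁻¹ * d) 2 1 = U.π * (U.cj κ * (x + a) + U.cj α * (b - y)) := by
    simp only [U.mm, eiD.h20, eiD.h23, U.i21, U.i22, e12, e22, hd.e11, hd.e21, map_mul, map_neg, U.cjπ]
    ring
  have m22 : U.mat (e⁻¹ * d) 2 2 = U.π * (U.cj κ * (y + b)) + U.cj α * (x - a) := by
    simp only [U.mm, eiD.h20, eiD.h23, U.i21, U.i22, e12, e22, hd.e12, hd.e22, map_mul, map_neg, U.cjπ]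
    ring
  apply dv_J dD
  · rw [m11, m22]
    have : U.cj α * (x + a) - U.cj κ * (U.π * (b - y)) + (U.π * (U.cj κ * (y + b)) + U.cj α * (x - a)) - 2 =
      2 * (ς * c * ρ / Δ) := by rw [← I1]; ring
    rw [this, div_eq_mul_inv]
    exact mul2.2 (mo (om (om ς0 c0) ρm) Δi)
  · rw [m11, m22]
    have : U.cj α * (x + a) - U.cj κ * (U.π * (b - y)) - (U.π * (U.cj κ * (y + b)) + U.cj α * (x - a)) =
      2 * (U.cj α * a - U.cj κ * (U.π * b)) := by ring
    rw [this]
    exact mul2.2 (sb (om α0 am) (om κ0 (CF.mul p1 bm (by omega))))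
  · rw [m12, m21]
    have : U.π * (U.cj α * (y + b) - U.cj κ * (x - a)) - U.π * (U.cj κ * (x + a) + U.cj α * (b - y)) =
      2 * (U.π * (-(ς * y * ρ / Δ))) := by rw [← I2]; ring
    rw [this, div_eq_mul_inv]
    exact mul2.2 (om (CF.mono p1 (by omega)) (ng (mo (om (om ς0 y0) ρm) Δi)))
  · rw [m12, m21]
    have : U.π * (U.cj α * (y + b) - U.cj κ * (x - a)) + U.π * (U.cj κ * (x + a) + U.cj α * (b - y)) =
      2 * (U.π * (U.cj α * b + U.cj κ * a)) := by ring
    rw [this]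
    exact mul2.2 (CF.mul p1 (ad (om α0 bm) (om κ0 (CF.mono am (by omega)))) (by omega))
end CG
end UC

namespace UC
open CF
namespace CG
variable {F : Type u} [Field F] {G : Type v} [Group G] {U : CG F G}

lemma levi_OK {d : G} {τ : F} (hdv : Dv (U.mat d)) (h0 : τ ≠ 0) : U.OK (U.t τ * d) := by
  have hm := U.hm
  have hp := U.π_ne
  have htwo := U.two
  have h4 : (4 : F) ≠ 0 := by
    have : (4 : F) = 2 * 2 := by norm_num
    rw [this]; exact mul_ne_zero htwo htwo
  have c4 : U.cj 4 = 4 := map_ofNat _ _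
  have c8 : U.cj 8 = 8 := map_ofNat _ _
  obtain ⟨r, hrO, hrr, hψ⟩ := U.ψ_r
  have hr0 : r ∈ U.P 0 := P0.2 hrO
  obtain ⟨p, q, s, t, hd⟩ := dr hdv
  have T := fun a b c => levi_test (a := a) (b := b) (c := c) (r := r) hd h0
  obtain ⟨A, hA⟩ : ∃ A, A = U.π * (p * U.cj q - q * U.cj p) := ⟨_, rfl⟩
  obtain ⟨B, hB⟩ : ∃ B, B = p * U.cj t - U.π * (q * U.cj s) := ⟨_, rfl⟩
  obtain ⟨C, hC⟩ : ∃ C, C = U.π * (s * U.cj q) - t * U.cj p := ⟨_, rfl⟩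
  have cA : U.cj A = -A := by rw [hA]; simp only [map_mul, map_sub, U.cj_cj, U.cjπ]; ring
  have cB : U.cj (B + C) = -(B + C) := by rw [hB, hC]; simp only [map_mul, map_sub, map_add, U.cj_cj, U.cjπ]; ring
  have iB : B ∈ U.P 0 := by
    rw [hB]; exact sb (om hd.ip (cjm hd.it)) (CF.mono (mo p1 (om hd.iq (cjm hd.is))) (by omega))
  rw [← hA, ← hB, ← hC] at T
  have div4 : ∀ {k : ℤ} {x : F}, x ∈ U.P k → x / 4 ∈ U.P k := by
    intro k x h
    have : x / 4 = x / 2 / 2 := by rw [div_div]; norm_num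
    rw [this]; exact div2 (div2 h)
  have cpi : ∀ k : ℤ, U.cj (U.π ^ k) = U.π ^ k := fun k => by rw [map_zpow₀, U.cjπ]
  by_cases h1 : A ∈ U.P (U.m / 2 + 1)
  swap
  · right
    have A0 : A ≠ 0 := fun h => h1 (by rw [h]; exact P00)
    have iA := inv_of_not h1
    refine T (U.π ^ U.m * r * A⁻¹ / 4) 0 0 (div4 (CF.mul (mo (ppow _) hr0) iA (by omega))) P00 P00 ?_ (by simp) (by simp) (by simp [P00]) ?_ hr0 hψ
    · simp only [map_div₀, map_mul, cpi, hrr, map_inv₀, cA, c4]; rw [inv_neg]; ring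
    · convert P00 (U := U) using 1
      field_simp; ring
  by_cases h2 : B + C ∈ U.P ((U.m + 1) / 2)
  swap
  · right
    have B0 : B + C ≠ 0 := fun h => h2 (by rw [h]; exact P00)
    have iB' := inv_of_not (i := (U.m + 1) / 2 - 1) (x := B + C) (by simpa using h2)
    have P := div2 (CF.mul (k := U.m / 2) (mo (ppow (U.m - 1)) hr0) iB' (by omega))
    have cy : U.cj (U.π ^ (U.m - 1) * r * (B + C)⁻¹ / 2) = -(U.π ^ (U.m - 1) * r * (B + C)⁻¹ / 2) := by
      simp only [map_div₀, map_mul, cpi, hrr, map_inv₀, cB, cj2]; rw [inv_neg]; ring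
    refine T 0 (U.π ^ (U.m - 1) * r * (B + C)⁻¹ / 2) (U.π ^ (U.m - 1) * r * (B + C)⁻¹ / 2) P00 P P (by simp) cy cy (by simp [P00]) ?_ hr0 hψ
    convert P00 (U := U) using 1
    have : U.π ^ U.m = U.π ^ (U.m - 1) * U.π := by rw [← zpow_add_one₀ hp]; simp
    rw [this]
    generalize U.π ^ (U.m - 1) = X
    have e : (B + C) * (B + C)⁻¹ = 1 := mul_inv_cancel₀ B0
    generalize (B + C)⁻¹ = Y at e
    linear_combination (U.π * X * r / 2) * e
  by_cases h3 : 1 + B ∈ U.P 1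
  · right
    have y0 : U.π ^ (U.m - 1) * r / 2 / 4 ∈ U.P (U.m - 1) := div4 (div2 (mo (ppow _) hr0))
    have y1 := CF.mono y0 (show U.m / 2 ≤ U.m - 1 by omega)
    have cy : U.cj (U.π ^ (U.m - 1) * r / 2 / 4) = U.π ^ (U.m - 1) * r / 2 / 4 := by
      simp only [map_div₀, map_mul, cpi, hrr, cj2, c4]
    have ey : U.π ^ U.m * r / 2 = U.π * (4 * (U.π ^ (U.m - 1) * r / 2 / 4)) := by
      have : U.π ^ U.m = U.π ^ (U.m - 1) * U.π := by rw [← zpow_add_one₀ hp]; simp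
      rw [this]; field_simp
    refine T 0 (U.π ^ (U.m - 1) * r / 2 / 4) (-(U.π ^ (U.m - 1) * r / 2 / 4)) P00 y1 (ng y1) (by simp) (by rw [map_neg, cy]) (by rw [cy]; ring) ?_ ?_ hr0 hψ
    · generalize U.π ^ (U.m - 1) * r / 2 / 4 = Y at *
      have : U.π * (-Y - Y) = -(2 * (U.π * Y)) := by ring
      rw [this]; exact ng (mul2.2 (CF.mul p1 y0 (by omega)))
    · rw [ey]
      generalize U.π ^ (U.m - 1) * r / 2 / 4 = Y at *
      have : 2 * A * 0 + U.π * (B * -Y + C * Y) - U.π * (-Y - Y) - U.π * (4 * Y) = (U.π * Y) * ((B + C) - 2 * (1 + B)) := by ring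
      rw [this]
      exact CF.mul (CF.mul p1 y0 le_rfl) (sb (CF.mono h2 (by omega : (1:ℤ) ≤ _)) (mul2.2 h3)) (by omega)
  · obtain ⟨w1, w2, w3⟩ := dv_rel hd.hd
    rw [hd.e11, hd.e12, hd.e21, hd.e22] at *
    simp only [map_mul, U.cjπ] at w1 w2 w3
    have w1' : p * U.cj p + U.π * (s * U.cj s) = 1 := by rw [← w1]; field_simp
    have w2' : q * U.cj p + t * U.cj s = 0 := by rw [← w2]; field_simp
    have w3' : U.π * (q * U.cj q) + t * U.cj t = 1 := by rw [← w3]; ring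
    have w4' : p * U.cj q + s * U.cj t = 0 := by
      have := congrArg U.cj w2'
      simp only [map_add, map_mul, U.cj_cj, map_zero] at this
      linear_combination this
    have k1 : A * p + U.π * B * s = - (U.π * q) := by
      rw [hA, hB]; linear_combination U.π * p * w4' - U.π * q * w1'
    have k2 : A * q + B * t = p := by
      rw [hA, hB]; linear_combination p * w3' - U.π * q * w2'
    have k3 : B * C * U.π = -U.π - A ^ 2 := by
      have z1 : C * p - A * s = - t := by
        rw [hA, hC]; linear_combination -t * w1' + U.π * s * w2'
      have z2 : U.π * C * q - A * t = U.π * s := by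
        rw [hA, hC]; linear_combination U.π * s * w3' - U.π * t * w4'
      have y1 : (B * C * U.π + U.π + A ^ 2) * p = 0 := by
        linear_combination A * k1 + U.π * B * z1 - U.π * k2
      have y2 : (B * C * U.π + U.π + A ^ 2) * q = 0 := by
        linear_combination A * k2 + B * z2 + k1
      have y3 : (B * C * U.π + U.π + A ^ 2) * (p * U.cj p + U.π * (q * U.cj q)) = 0 := by
        linear_combination U.cj p * y1 + U.π * U.cj q * y2
      rw [hd.r11] at y3
      linear_combination y3
    obtain ⟨A', hA'⟩ : ∃ A', A' = p * U.cj q - q * U.cj p := ⟨_, rfl⟩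
    rw [← hA'] at hA
    have iA' : A' ∈ U.P (U.m / 2) := by
      rw [hA, pmul1] at h1; simpa using h1
    have k4 : B * C = -1 - U.π * A' ^ 2 := by
      apply mul_right_cancel₀ hp; rw [k3, hA]; ring
    have b1 : B - 1 ∈ U.P ((U.m + 1) / 2) := by
      have e : (1 + B) * (B - 1) = B * (B + C) + U.π * A' ^ 2 := by linear_combination -k4
      have := of_mul (C := U.toCF) (i := 0) (k := (U.m + 1) / 2) (x := 1 + B) (y := B - 1) (by
        rw [e]; exact ad (om iB h2) (CF.mul p1 (by rw [pow_two]; exact CF.mul iA' iA' le_rfl) (by omega))) (by simpa using h3)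
      simpa using this
    obtain ⟨e, hE, eD, hJ⟩ := levi_split hd (by
      have : p - t = A * q + (B - 1) * t := by linear_combination -k2
      rw [this]; exact ad (mo (CF.mono h1 (by omega)) hd.iq) (mo b1 hd.it)) (by
      have : q + s = -(A' * p) - (B - 1) * s := by
        apply mul_left_cancel₀ hp; rw [hA] at k1; linear_combination k1
      rw [this]; exact sb (ng (mo iA' hd.ip)) (mo (CF.mono b1 (by omega)) hd.is))
    refine Or.inl ⟨1, U.J.one_mem, U.t τ * e, U.GE.mul_mem (t_E h0) hE, e⁻¹ * d, hJ, ?_⟩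
    group

lemma nh_inv (v1 v2 : F) : (U.nh v1 v2)⁻¹ = U.nh (-v1) (-v2) := by
  rw [nh, n_inv (N_half _ _), nh]
  congr 1
  simp only [map_div₀, map_neg, cj2, hh_cj]
  simp [hh]
lemma s1_nh (v1 v2 : F) : U.s1 * U.nh v1 v2 * U.s1 = U.nmh v1 v2 := s1_n (N_half _ _)
lemma s1_nmh (v1 v2 : F) : U.s1 * U.nmh v1 v2 * U.s1 = U.nh v1 v2 := s1_nm (N_half _ _)
lemma nmh_inv (v1 v2 : F) : (U.nmh v1 v2)⁻¹ = U.nmh (-v1) (-v2) := by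
  rw [← s1_nh, ← s1_nh, ← nh_inv]; simp [mul_assoc, s1_inv]
lemma s1_t {τ : F} (h : τ ≠ 0) : U.s1 * U.t τ * U.s1 = U.t (U.cj τ)⁻¹ := by
  have h' : (U.cj τ)⁻¹ ≠ 0 := by simpa using h
  apply U.ext
  intro i j
  simp only [U.mm, s_mat, t_mat h, t_mat h']
  fin_cases i <;> fin_cases j <;> simp [sM, tM, U.cj_cj]

lemma OKn (k : ℕ) : ∀ {v1 v2 u1 u2 τ : F} {d : G}, (k : ℤ) ≤ U.m → D U.toCF (U.m - k) v1 v2 → D U.toCF (U.m - k) u1 u2 →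
    Dv (U.mat d) → τ ≠ 0 → τ ∈ U.P 0 → U.OK (U.nh v1 v2 * (U.t τ * d) * U.nmh u1 u2) := by
  induction k with
  | zero =>
    intro v1 v2 u1 u2 τ d hk hv hu hd h0 h1
    simp at hv hu
    have j1 : U.nh v1 v2 ∈ U.J := n_J (N_half _ _) hv (div2 (ng hv.hself))
    have j2 : U.nmh u1 u2 ∈ U.J := nm_J (N_half _ _) hu (div2 (ng hu.hself))
    apply OK.Jl (U.J.inv_mem j1)
    apply OK.Jr (U.J.inv_mem j2)
    convert levi_OK hd h0 using 1
    group
  | succ k ih =>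
    intro v1 v2 u1 u2 τ d hk hv hu hd h0 h1
    have e : U.m - ((k + 1 : ℕ) : ℤ) + 1 = U.m - k := by push_cast; ring
    push_cast at hk
    by_cases c1 : D U.toCF (U.m - k) v1 v2
    swap
    · exact Or.inr (lemI (by push_cast; omega) (by push_cast; omega) hv (by rwa [e]) hu hd h0 h1)
    by_cases c2 : D U.toCF (U.m - k) u1 u2
    swap
    · apply OK.inv
      apply OK.Kl (k := U.s1) s_K
      apply OK.Kr (k := U.s1) s_K
      have : U.s1 * (U.nh v1 v2 * (U.t τ * d) * U.nmh u1 u2)⁻¹ * U.s1 =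
          U.nh (-u1) (-u2) * (U.t (U.cj τ) * d⁻¹) * U.nmh (-v1) (-v2) := by
        have e1 : U.s1 * U.nmh (-u1) (-u2) = U.nh (-u1) (-u2) * U.s1 := by
          rw [← s1_nmh, mul_assoc _ U.s1 U.s1, s1_sq, mul_one]
        have e2 : U.s1 * d⁻¹ = d⁻¹ * U.s1 := dv_comm_s (dv_inv hd)
        have e3 : U.s1 * U.t τ⁻¹ = U.t (U.cj τ) * U.s1 := by
          have := s1_t (U := U) (inv_ne_zero h0)
          rw [map_inv₀, inv_inv] at this
          rw [← this, mul_assoc _ U.s1 U.s1, s1_sq, mul_one]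
        have e4 : U.s1 * U.nh (-v1) (-v2) * U.s1 = U.nmh (-v1) (-v2) := s1_nh _ _
        have e5 : U.t (U.cj τ) * d⁻¹ = d⁻¹ * U.t (U.cj τ) := dv_comm_t (dv_inv hd) (by simpa using h0)
        rw [mul_inv_rev, mul_inv_rev, mul_inv_rev, nmh_inv, nh_inv, t_inv h0, ← mul_assoc, ← mul_assoc, ← mul_assoc, e1,
          mul_assoc _ U.s1, e2, ← mul_assoc, mul_assoc _ U.s1, e3, ← e4, e5]
        simp only [mul_assoc]
      rw [this]
      exact Or.inr (lemI (i := U.m - ((k + 1 : ℕ) : ℤ)) (by push_cast; omega) (by push_cast; omega) hu.neg (by rw [e]; intro h; exact c2 (by simpa using h.neg)) hv.neg (dv_inv hd) (by simpa using h0) (cjm h1))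
    · exact ih (by omega) c1 c2 hd h0 h1

lemma add_halves' (h : (2:F) ≠ 0) (x : F) : x / 2 + x / 2 = x := by field_simp; ring
lemma n_split {v1 v2 z : F} (h : U.N v1 v2 z) : U.N 0 0 (z + hh U.toCF v1 v2 v1 v2 / 2) ∧
    U.n v1 v2 z = U.n 0 0 (z + hh U.toCF v1 v2 v1 v2 / 2) * U.nh v1 v2 := by
  have htwo := U.two
  have N0 : U.N 0 0 (z + hh U.toCF v1 v2 v1 v2 / 2) := by
    rw [N_zero]; rw [N] at h
    simp only [map_add, map_div₀, cj2, hh_cj]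
    have : hh U.toCF v1 v2 v1 v2 = hh U.toCF v1 v2 v1 v2 / 2 + hh U.toCF v1 v2 v1 v2 / 2 := (add_halves' U.two _).symm
    linear_combination h - this
  refine ⟨N0, ?_⟩
  rw [nh, n_mul N0 (N_half _ _)]
  congr 1 <;> simp [hh]
  ring

lemma A2 (y : G) (h : ¬ ∃ j₁ ∈ U.J, ∃ g ∈ U.GE, ∃ j₂ ∈ U.J, y = j₁ * g * j₂) :
    ∃ j ∈ U.J, ∃ j' ∈ U.J, j * y = y * j' ∧ U.τ j ≠ U.τ j' := by
  have hm := U.hm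
  suffices U.OK y from this.resolve_left h
  obtain ⟨k, k', hk, hk', v1, v2, z, τ, d, u1, u2, w, N1, N2, hd, h0, h1, dv, du, hz, hy, e, -⟩ := dec (U := U) y
  apply OK.Kl hk.K
  apply OK.Kr hk'.K
  rw [e]
  obtain ⟨M1, f1⟩ := n_split N1
  obtain ⟨M2, f2⟩ := n_split N2.inv
  have f2' : U.nm u1 u2 w = U.nmh u1 u2 * (U.nm 0 0 (U.cj w + hh U.toCF (-u1) (-u2) (-u1) (-u2) / 2))⁻¹ := by
    have := congrArg (fun x => (U.s1 * x * U.s1)⁻¹) f2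
    rw [s1_n N2.inv, ← nm_inv N2, inv_inv] at this
    rw [this, ← s1_n M2]
    have e4 : U.s1 * U.nh (-u1) (-u2) * U.s1 = (U.nmh u1 u2)⁻¹ := by rw [s1_nh, nmh_inv]
    rw [← inv_inv (U.nmh u1 u2), ← e4, ← mul_inv_rev]
    congr 1
    have := s1_sq (U := U)
    simp only [mul_assoc]
    rw [← mul_assoc U.s1 U.s1, this, one_mul]
  rw [f1, f2']
  apply OK.Kl (U.K.inv_mem (n_K M1 (ad hz (div2 dv.hself))))
  apply OK.Kr (nm_K M2 (ad (cjm hy) (div2 du.neg.hself)))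
  obtain ⟨mn, hmn⟩ := Int.eq_ofNat_of_zero_le (show 0 ≤ U.m by omega)
  convert OKn (U := U) mn (by omega) (by simpa [hmn] using dv) (by simpa [hmn] using du) hd h0 h1 using 1
  group
end CG
end UC

namespace UC
open CF
namespace CG
variable {F : Type u} [Field F] {G : Type v} [Group G] {U : CG F G}

lemma base0 {k l : ℤ} {V1 V2 Z z : F} (hk : U.m ≤ k + l) (hl : 0 ≤ l) (hV : D U.toCF k V1 V2)
    (hZ0 : Z ≠ 0) (hz0 : z ≠ 0) (sZ : U.cj Z = -Z) (ez : z = Z - hh U.toCF V1 V2 V1 V2 / 2)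
    (hZ : Z⁻¹ ∈ U.P l) (hz : z⁻¹ ∈ U.P l) :
    ∃ j ∈ U.J, U.τ j = 1 ∧ ∃ u1 u2 y, U.N u1 u2 y ∧ D U.toCF U.m u1 u2 ∧ y ∈ U.P U.m ∧
      j * U.n V1 V2 z = U.n 0 0 Z * U.nm u1 u2 y := by
  have h2 := U.two
  have hb0 : U.cj z ≠ 0 := by simpa using hz0
  have hbr : U.cj (hh U.toCF V1 V2 V1 V2) = hh U.toCF V1 V2 V1 V2 := hh_cj _ _ _ _
  have hH := hV.hself
  have zb : U.cj z = -Z - hh U.toCF V1 V2 V1 V2 / 2 := by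
    rw [ez, map_sub, map_div₀, hbr, sZ, cj2]
  have hrel : z + U.cj z + hh U.toCF V1 V2 V1 V2 = 0 := by
    rw [zb, ez]; linear_combination add_halves' h2 (hh U.toCF V1 V2 V1 V2) * (-1)
  have hdiff : Z - z = hh U.toCF V1 V2 V1 V2 / 2 := by rw [ez]; ring
  have N1 : U.N 0 0 Z := N_zero.2 sZ
  have N3 : U.N V1 V2 z := hrel
  have uh : hh U.toCF (V1 / U.cj z) (V2 / U.cj z) V1 V2 = hh U.toCF V1 V2 V1 V2 / z := by
    simp only [hh, map_div₀, U.cj_cj]; field_simp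
  have N2 : U.N (V1 / U.cj z) (V2 / U.cj z) (1 / z - 1 / Z) := by
    have : hh U.toCF (V1 / U.cj z) (V2 / U.cj z) (V1 / U.cj z) (V2 / U.cj z) =
      hh U.toCF V1 V2 V1 V2 / (z * U.cj z) := by
      simp only [hh, map_div₀, U.cj_cj]; field_simp
    rw [N, this, map_sub, map_div₀, map_div₀, sZ, map_one]
    field_simp
    linear_combination Z * hrel
  have hzb : (U.cj z)⁻¹ ∈ U.P l := by rw [← map_inv₀]; exact cjm hz
  have hu : D U.toCF (k + 2 * l) (V1 / U.cj z) (V2 / U.cj z) := by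
    have := D.smul (l := k + 2 * l) hzb hV le_rfl
    simpa only [div_eq_mul_inv, mul_comm] using this
  have hHz : hh U.toCF V1 V2 V1 V2 / z ∈ U.P U.m := by
    rw [div_eq_mul_inv]; exact CF.mul hH hz hk
  have hHZ : hh U.toCF V1 V2 V1 V2 / Z ∈ U.P U.m := by
    rw [div_eq_mul_inv]; exact CF.mul hH hZ hk
  have hy : 1 / z - 1 / Z ∈ U.P U.m := by
    have : 1 / z - 1 / Z = (hh U.toCF V1 V2 V1 V2 / z) * Z⁻¹ / 2 := by
      field_simp; linear_combination 2 * hdiff + add_halves' h2 (hh U.toCF V1 V2 V1 V2)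
    rw [this]; exact div2 (CF.mul hHz hZ (by omega))
  refine ⟨U.n 0 0 Z * U.nm (V1 / U.cj z) (V2 / U.cj z) (1 / z - 1 / Z) * (U.n V1 V2 z)⁻¹, ?_, ?_,
    _, _, _, N2, hu.mono (by omega), hy, by group⟩
  all_goals
    have E := ent N1 N2 N3
    generalize U.n 0 0 Z * U.nm (V1 / U.cj z) (V2 / U.cj z) (1 / z - 1 / Z) * (U.n V1 V2 z)⁻¹ = j at E
    have q11 : U.π * (U.cj V1 * (V1 / U.cj z)) ∈ U.P U.m := by
      rw [div_eq_mul_inv]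
      exact CF.mul p1 (CF.mul (cjm hV.1) (CF.mul hV.1 hzb le_rfl) le_rfl) (by omega)
    have q22 : (U.cj V2 * (V2 / U.cj z)) ∈ U.P U.m := by
      rw [div_eq_mul_inv]
      exact (CF.mul (cjm hV.2) (CF.mul hV.2 hzb le_rfl) (by omega))
    have q21 : U.π * (U.cj V1 * (V2 / U.cj z)) ∈ U.P (U.m + 1) := by
      rw [div_eq_mul_inv]
      exact CF.mul p1 (CF.mul (cjm hV.1) (CF.mul hV.2 hzb le_rfl) le_rfl) (by omega)
    have q12 : U.π * (U.cj V2 * (V1 / U.cj z)) ∈ U.P (U.m + 1) := by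
      rw [div_eq_mul_inv]
      exact CF.mul p1 (CF.mul (cjm hV.2) (CF.mul hV.1 hzb le_rfl) le_rfl) (by omega)
  · rw [U.memJ]
    have e12 : U.mat j 1 2 = U.cj V2 * (V1 / U.cj z) := by rw [E.e12]; ring
    have e21 : U.mat j 2 1 = U.π * (U.cj V1 * (V2 / U.cj z)) := by rw [E.e21]; ring
    constructor
    · rw [E.e00]
      convert div2 hHz using 1
      simp only [hh, map_zero]; simp only [hh] at hdiff; field_simp
      linear_combination U.cj z * (2 * hdiff + add_halves' h2 (U.π * (U.cj V1 * V1) + U.cj V2 * V2))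
    · rw [E.e03]
      convert (U.P U.m).zero_mem using 1
      simp only [hx, uh]
      simp only [hh, map_zero] at hrel ⊢
      field_simp
      linear_combination Z * hrel
    · rw [E.e30]; exact hy
    · rw [E.e33]
      convert div2 hHZ using 1
      simp only [hx, uh]
      field_simp
      have : U.cj z = - z - hh U.toCF V1 V2 V1 V2 := by linear_combination hrel
      rw [this, ez]
      field_simp; ring
    · rw [E.e10, E.e20]; simpa using hu.mono (by omega)
    · rw [E.e13, E.e23]
      have : D U.toCF U.m 0 0 := ⟨P00, P00⟩
      convert this using 1 <;> field_simp <;> ring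
    · rw [E.e01]; convert (U.P _).zero_mem using 1
      simp [hh, U.cj_cj]; right; field_simp; ring
    · rw [E.e31]
      have : U.π * (-U.cj (V1 / U.cj z) + (1 / z - 1 / Z) * U.cj V1) = -(U.π * (U.cj V1 * Z⁻¹)) := by
        rw [map_div₀, U.cj_cj]; field_simp; ring
      rw [this]; exact ng (CF.mul p1 (CF.mul (cjm hV.1) hZ le_rfl) (by omega))
    · rw [E.e02]; convert (U.P _).zero_mem using 1
      simp [hh, U.cj_cj];  field_simp; ring
    · rw [E.e32]
      have : (-U.cj (V2 / U.cj z) + (1 / z - 1 / Z) * U.cj V2) = -((U.cj V2 * Z⁻¹)) := by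
        rw [map_div₀, U.cj_cj]; field_simp; ring
      rw [this]; exact ng ((CF.mul (cjm hV.2) hZ (by omega)))
    · rw [E.e11, E.e22]; convert ad q11 q22 using 1; simp; ring
    · rw [E.e11, E.e22]; convert CF.mono (sb q11 q22) (by have := U.hm; omega : (U.m+1)/2 ≤ _) using 1; simp
    · rw [e12, e21]; exact CF.mono (sb q12 q21) (by omega)
    · rw [e12, e21]; exact CF.mono (ad q12 q21) (by have := U.hm; omega)
  · have e12 : U.mat j 1 2 = U.cj V2 * (V1 / U.cj z) := by rw [E.e12]; ring
    have e21 : U.mat j 2 1 = U.π * (U.cj V1 * (V2 / U.cj z)) := by rw [E.e21]; ring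
    rw [CG.τ, U.ψ_P1, inv_one]
    rw [pmul, e12, e21]
    exact CF.mono (sb q21 q12) (by omega)

lemma lemS {v1 v2 u1 u2 z : F} (o1 : v1 = 0 ∨ v2 = 0) (o2 : u1 = 0 ∨ u2 = 0) (o3 : v1 = 0 ∨ u1 = 0)
    (o4 : v2 = 0 ∨ u2 = 0) (hv : D U.toCF (U.m - 2) v1 v2) (hu : D U.toCF (U.m + 1) u1 u2)
    (h12 : U.cj v1 * u2 ∈ U.P (U.m - 1)) (h21 : U.cj v2 * u1 ∈ U.P (U.m - 1)) (hz : z ∈ U.P (-1))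
    (Nv : U.N v1 v2 z) :
    ∃ j ∈ U.J, U.τ j = (U.ψ (U.π ^ (1 - U.m) * (U.cj v1 * u2 + v1 * U.cj u2 - (v2 * U.cj u1 + U.cj v2 * u1))))⁻¹ ∧
     ∃ y, U.N u1 u2 y ∧ D U.toCF U.m u1 u2 ∧ y ∈ U.P U.m ∧
      U.N (v1 + U.cj z * u1) (v2 + U.cj z * u2) (z - z * U.cj z * hh U.toCF u1 u2 u1 u2 / 2) ∧
      j * U.n (v1 + U.cj z * u1) (v2 + U.cj z * u2) (z - z * U.cj z * hh U.toCF u1 u2 u1 u2 / 2)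
        = U.n v1 v2 z * U.nm u1 u2 y := by
  have h2 := U.two
  have hm := U.hm
  have hp1 := p1 (C := U.toCF)
  have N2 := N_half (U := U) u1 u2
  have hy := div2 (C := U.toCF) (ng hu.hself)
  have yr : U.cj (-(hh U.toCF u1 u2 u1 u2) / 2) = -(hh U.toCF u1 u2 u1 u2) / 2 := by
    simp only [map_div₀, map_neg, hh_cj, cj2]
  have eZ : z - z * U.cj z * hh U.toCF u1 u2 u1 u2 / 2 = z + z * U.cj z * (-(hh U.toCF u1 u2 u1 u2) / 2) := by ring
  have hhy : hh U.toCF u1 u2 u1 u2 = -2 * (-(hh U.toCF u1 u2 u1 u2) / 2) := by field_simp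
  have p11 : U.cj v1 * u1 = 0 := by rcases o3 with h | h <;> simp [h]
  have p11' : U.cj u1 * v1 = 0 := by rcases o3 with h | h <;> simp [h]
  have p22 : U.cj v2 * u2 = 0 := by rcases o4 with h | h <;> simp [h]
  have p22' : U.cj u2 * v2 = 0 := by rcases o4 with h | h <;> simp [h]
  have pv : U.cj v1 * v2 = 0 := by rcases o1 with h | h <;> simp [h]
  have pv' : U.cj v2 * v1 = 0 := by rcases o1 with h | h <;> simp [h]
  have pu : U.cj u1 * u2 = 0 := by rcases o2 with h | h <;> simp [h]
  have pu' : U.cj u2 * u1 = 0 := by rcases o2 with h | h <;> simp [h]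
  rw [eZ]
  generalize hye : -(hh U.toCF u1 u2 u1 u2) / 2 = y at *
  have N1 := Nv
  rw [N] at Nv
  have hvV : hh U.toCF v1 v2 (v1 + U.cj z * u1) (v2 + U.cj z * u2) = hh U.toCF v1 v2 v1 v2 := by
    simp only [hh]; linear_combination U.cj z * (U.π * p11 + p22)
  have huV : hh U.toCF u1 u2 (v1 + U.cj z * u1) (v2 + U.cj z * u2) = -2 * y * U.cj z := by
    have : hh U.toCF u1 u2 (v1 + U.cj z * u1) (v2 + U.cj z * u2) = U.cj z * hh U.toCF u1 u2 u1 u2 := by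
      simp only [hh]; linear_combination (U.π * p11' + p22')
    rw [this, hhy]; ring
  have hvu : hh U.toCF v1 v2 u1 u2 = 0 := by simp only [hh]; linear_combination U.π * p11 + p22
  have N3 : U.N (v1 + U.cj z * u1) (v2 + U.cj z * u2) (z + z * U.cj z * y) := by
    have hVV : hh U.toCF (v1 + U.cj z * u1) (v2 + U.cj z * u2) (v1 + U.cj z * u1) (v2 + U.cj z * u2)
      = hh U.toCF v1 v2 v1 v2 + z * U.cj z * hh U.toCF u1 u2 u1 u2 := by
      simp only [hh, map_add, map_mul, U.cj_cj]
      linear_combination U.cj z * (U.π * p11 + p22) + z * (U.π * p11' + p22')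
    rw [N, hVV, hhy, map_add, map_mul, map_mul, U.cj_cj, yr]; linear_combination Nv
  have E := ent N1 N2 N3
  have hyz : y * z ∈ U.P U.m := CF.mul hy hz (by omega)
  have hyzb : y * U.cj z ∈ U.P U.m := CF.mul hy (cjm hz) (by omega)
  have hym : y ∈ U.P U.m := CF.mono hy (by omega)
  have hzu : D U.toCF (U.m - 1) (U.cj z * u1) (U.cj z * u2) := D.smul (cjm hz) hu (by omega)
  have hV : D U.toCF (U.m - 2) (v1 + U.cj z * u1) (v2 + U.cj z * u2) := D.add hv (hzu.mono (by omega))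
  have eh : 1 - U.hx v1 v2 u1 u2 + y * z = 1 + y * z := by rw [hx, hvu]; ring
  have d11 : U.π * (- U.cj u1 * v1 + U.cj (v1 + U.cj z * u1) * (u1 + y * v1)) ∈ U.P U.m := by
    have : U.π * (- U.cj u1 * v1 + U.cj (v1 + U.cj z * u1) * (u1 + y * v1)) =
      U.π * (z * (U.cj u1 * u1) + y * (U.cj v1 * v1)) := by
      rw [map_add, map_mul, U.cj_cj]
      linear_combination U.π * ((z * y - 1) * p11' + p11)
    rw [this]
    refine CF.mul hp1 (y := _) (j := U.m - 1) (ad ?_ ?_) (by omega)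
    · exact CF.mul hz (CF.mul (cjm hu.1) hu.1 le_rfl) (by omega)
    · exact CF.mul hy (CF.mul (cjm hv.1) hv.1 le_rfl) (by omega)
  have d22 : - U.cj u2 * v2 + U.cj (v2 + U.cj z * u2) * (u2 + y * v2) ∈ U.P U.m := by
    have : (- U.cj u2 * v2 + U.cj (v2 + U.cj z * u2) * (u2 + y * v2)) =
      (z * (U.cj u2 * u2) + y * (U.cj v2 * v2)) := by
      rw [map_add, map_mul, U.cj_cj]
      linear_combination ((z * y - 1) * p22' + p22)
    rw [this]
    refine (ad ?_ ?_)
    · exact CF.mul hz (CF.mul (cjm hu.2) hu.2 le_rfl) (by omega)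
    · exact CF.mul hy (CF.mul (cjm hv.2) hv.2 le_rfl) (by omega)
  have h12' : v1 * U.cj u2 ∈ U.P (U.m - 1) := by simpa [U.cj_cj] using cjm h12
  have h21' : v2 * U.cj u1 ∈ U.P (U.m - 1) := by simpa [U.cj_cj] using cjm h21
  have hzy : z * y ∈ U.P U.m := by rw [mul_comm]; exact hyz
  have e21 : U.π * (- U.cj u1 * v2 + U.cj (v1 + U.cj z * u1) * (u2 + y * v2)) =
      U.π * (U.cj v1 * u2 - v2 * U.cj u1) + U.π * (z * y * (v2 * U.cj u1)) := by
    rw [map_add, map_mul, U.cj_cj]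
    linear_combination U.π * (y * pv + z * pu)
  have e12 : U.π * (- U.cj u2 * v1 + U.cj (v2 + U.cj z * u2) * (u1 + y * v1)) =
      U.π * (U.cj v2 * u1 - v1 * U.cj u2) + U.π * (z * y * (v1 * U.cj u2)) := by
    rw [map_add, map_mul, U.cj_cj]
    linear_combination U.π * (y * pv' + z * pu')
  have r21 : U.π * (z * y * (v2 * U.cj u1)) ∈ U.P (U.m + 1) :=
    CF.mul hp1 (CF.mul hzy h21' le_rfl) (by omega)
  have r12 : U.π * (z * y * (v1 * U.cj u2)) ∈ U.P (U.m + 1) :=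
    CF.mul hp1 (CF.mul hzy h12' le_rfl) (by omega)
  have d21 : U.π * (- U.cj u1 * v2 + U.cj (v1 + U.cj z * u1) * (u2 + y * v2)) ∈ U.P U.m := by
    rw [e21]; exact ad (CF.mul hp1 (sb h12 h21') (by omega)) (CF.mono r21 (by omega))
  have d12 : U.π * (- U.cj u2 * v1 + U.cj (v2 + U.cj z * u2) * (u1 + y * v1)) ∈ U.P U.m := by
    rw [e12]; exact ad (CF.mul hp1 (sb h21 h12') (by omega)) (CF.mono r12 (by omega))
  refine ⟨U.n v1 v2 z * U.nm u1 u2 y * (U.n (v1 + U.cj z * u1) (v2 + U.cj z * u2) (z + z * U.cj z * y))⁻¹, ?_, ?_,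
    y, N2, hu.mono (by omega), hym, N3, inv_mul_cancel_right _ _⟩
  all_goals
    generalize U.n v1 v2 z * U.nm u1 u2 y * (U.n (v1 + U.cj z * u1) (v2 + U.cj z * u2) (z + z * U.cj z * y))⁻¹ = j at E
  · have cZ : U.cj (z + z * U.cj z * y) = U.cj z + z * U.cj z * y := by
      simp only [map_add, map_mul, U.cj_cj, yr]; ring
    rw [U.memJ]
    constructor
    · rw [E.e00, eh]; simpa using hyz
    · rw [E.e03, eh, cZ, hx, hx, hvV, huV]
      have : z + U.hh v1 v2 v1 v2 + z * (-2 * y * U.cj z) + (U.cj z + z * U.cj z * y) * (1 + y * z) =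
         z * (y * z) * (y * U.cj z) := by linear_combination Nv
      rw [this]; exact CF.mul (CF.mul hz hyz le_rfl) hyzb (by omega)
    · rw [E.e30]; exact hym
    · rw [E.e33, cZ, hx, huV]
      have : 1 + -2 * y * U.cj z + (U.cj z + z * U.cj z * y) * y - 1 = (y * z) * (y * U.cj z) - y * U.cj z := by ring
      rw [this]; exact sb (CF.mul hyz hyzb (by omega)) hyzb
    · rw [E.e10, E.e20]
      exact D.add (hu.mono (by omega)) (D.smul hy hv (by omega))
    · rw [E.e13, E.e23, cZ, hx, huV]
      have := D.smul (l := U.m) hyzb (D.add (D.add hv.neg (D.smul (l := U.m - 2) hz hu (by omega)))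
         (D.smul (l := U.m - 2) hyz hv (by omega))) (by omega)
      convert this using 1 <;> ring
    · rw [E.e01, eh]
      have : U.π * (-U.cj v1 - z * U.cj u1 + U.cj (v1 + U.cj z * u1) * (1 + y * z)) =
        U.π * (y * z * U.cj (v1 + U.cj z * u1)) := by rw [map_add, map_mul, U.cj_cj]; ring
      rw [this]; exact CF.mul hp1 (CF.mul hyz (cjm hV.1) le_rfl) (by omega)
    · rw [E.e31]
      exact CF.mul hp1 (y := _) (j := U.m / 2) (ad (ng (CF.mono (cjm hu.1) (by omega))) (CF.mul hy (cjm hV.1) (by omega))) (by omega)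
    · rw [E.e02, eh]
      have : (-U.cj v2 - z * U.cj u2 + U.cj (v2 + U.cj z * u2) * (1 + y * z)) =
        (y * z * U.cj (v2 + U.cj z * u2)) := by rw [map_add, map_mul, U.cj_cj]; ring
      rw [this]; exact (CF.mul hyz (cjm hV.2) (by omega))
    · rw [E.e32]
      exact (ad (ng (CF.mono (cjm hu.2) (by omega))) (CF.mul hy (cjm hV.2) (by omega)))
    · rw [E.e11, E.e22]; convert ad d11 d22 using 1; ring
    · rw [E.e11, E.e22]; convert CF.mono (sb d11 d22) (by omega : (U.m + 1) / 2 ≤ _) using 1; ring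
    · rw [E.e12, E.e21]; exact sb d12 d21
    · rw [E.e12, E.e21]; exact CF.mono (ad d12 d21) (by omega)
  · have ee : U.π ^ (-U.m) * (U.mat j 2 1 - U.π * U.mat j 1 2) =
      U.π ^ (1 - U.m) * (U.cj v1 * u2 + v1 * U.cj u2 - (v2 * U.cj u1 + U.cj v2 * u1)) +
      U.π ^ (-U.m) * (U.π * (z * y * (v2 * U.cj u1)) - U.π * (z * y * (v1 * U.cj u2))) := by
      rw [E.e21, E.e12, e21, e12, sub_eq_add_neg 1 U.m, zpow_add₀ U.π_ne, zpow_one]; ring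
    rw [CG.τ, ee, U.ψ_add, U.ψ_P1 (U.π ^ (-U.m) * _), mul_one]
    rw [pmul]; exact CF.mono (sb r21 r12) (by omega)
end CG
end UC

namespace UC
open CF
namespace CG
variable {F : Type u} [Field F] {G : Type v} [Group G] {U : CG F G}

lemma n_J_iff {v1 v2 z : F} (h : U.N v1 v2 z) : U.n v1 v2 z ∈ U.J ↔ D U.toCF U.m v1 v2 ∧ z ∈ U.P U.m := by
  constructor
  · intro hj
    rw [U.memJ, n_mat h] at hj
    exact ⟨by simpa [nM] using hj.c3, by simpa [nM] using hj.h03⟩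
  · rintro ⟨a, b⟩; exact n_J h a b

variable (U) in
def ns (v1 v2 z : F) : G := U.n v1 v2 (z - hh U.toCF v1 v2 v1 v2 / 2)
lemma ns_N {v1 v2 z : F} (h : U.cj z = -z) : U.N v1 v2 (z - hh U.toCF v1 v2 v1 v2 / 2) := by
  rw [N, map_sub, map_div₀, hh_cj, h, cj2]
  linear_combination -add_halves' U.two (hh U.toCF v1 v2 v1 v2)
lemma ns0 (z : F) : U.ns 0 0 z = U.n 0 0 z := by simp [ns, hh]
lemma ns_inv {v1 v2 z : F} (h : U.cj z = -z) : (U.ns v1 v2 z)⁻¹ = U.ns (-v1) (-v2) (-z) := by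
  rw [ns, n_inv (ns_N h), ns, map_sub, map_div₀, hh_cj, h, cj2]
  congr 1; simp only [hh, map_neg]; ring
lemma sk_neg {z : F} (h : U.cj z = -z) : U.cj (-z) = - -z := by rw [map_neg, h]
lemma ns_mul0 {v1 v2 z b : F} (h : U.cj z = -z) (hb : U.cj b = -b) :
    U.ns v1 v2 z * U.n 0 0 b = U.ns v1 v2 (z + b) := by
  rw [ns, n_mul (ns_N h) (N_zero.2 hb), ns]
  congr 1 <;> simp [hh]; ring
lemma n_0_ns {v1 v2 z : F} (h : U.cj z = -z) : U.ns v1 v2 z = U.n 0 0 z * U.nh v1 v2 := by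
  rw [nh, n_mul (N_zero.2 h) (N_half _ _), ns]
  congr 1 <;> simp [hh]; ring
lemma t_ns {τ v1 v2 z : F} (ht : τ ≠ 0) (h : U.cj z = -z) :
    U.t τ * U.ns v1 v2 z = U.ns (U.cj τ * v1) (U.cj τ * v2) (τ * U.cj τ * z) * U.t τ := by
  rw [ns, t_n ht (ns_N h), ns]
  congr 2; simp only [hh, map_mul, U.cj_cj]; ring
lemma sk_t {τ z : F} (h : U.cj z = -z) : U.cj (τ * U.cj τ * z) = -(τ * U.cj τ * z) := by
  rw [map_mul, map_mul, U.cj_cj, h]; ring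

structure Fam (U : CG F G) (R Z : Type*) where
  rep : R → F
  o : R
  rep_o : rep o = 0
  rep_mem : ∀ i, rep i ∈ U.P 0
  rep_inj : ∀ i j, rep j - rep i ∈ U.P 1 → i = j
  rep_sur : ∀ x ∈ U.P 0, ∃ i, x - rep i ∈ U.P 1
  zr : Z → F
  zr_sk : ∀ q, U.cj (zr q) = - zr q
  zr_mem : ∀ q, zr q ∈ U.P U.m
  zr_inj : ∀ p q, zr q - zr p ∈ U.P (U.m + 2) → p = q
  zr_sur : ∀ x ∈ U.P U.m, U.cj x = -x → ∃ q, x - zr q ∈ U.P (U.m + 2)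

variable {R Z : Type*} (A : Fam U R Z)
variable (U) in
abbrev ga : G := U.t U.π
lemma ga_inv : (U.ga)⁻¹ = U.t U.π⁻¹ := t_inv U.π_ne

namespace Fam
def w1 (c : R) : F := U.π ^ (U.m / 2) * A.rep c
def w2 (c : R) : F := U.π ^ ((U.m + 1) / 2) * A.rep c
lemma w_D (c c' : R) : D U.toCF U.m (A.w1 c) (A.w2 c') :=
  ⟨CF.mul (ppow _) (A.rep_mem _) (by omega), CF.mul (ppow _) (A.rep_mem _) (by omega)⟩
def x (i : R × R × Z) : G := U.ns (A.w1 i.1) (A.w2 i.2.1) (A.zr i.2.2) * U.ga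
def x' (q : Z) : G := U.n 0 0 (A.zr q) * U.ga

lemma uJ (i : R × R × Z) : U.ns (A.w1 i.1) (A.w2 i.2.1) (A.zr i.2.2) ∈ U.J :=
  n_J (ns_N (A.zr_sk _)) (A.w_D _ _) (sb (A.zr_mem _) (div2 (A.w_D _ _).hself))
lemma uE (q : Z) : U.n 0 0 (A.zr q) ∈ U.J ⊓ U.GE :=
  ⟨n_J (N_zero.2 (A.zr_sk _)) ⟨P00, P00⟩ (A.zr_mem _), n_E (N_zero.2 (A.zr_sk _))⟩

lemma tin {v1 v2 z : F} (h : U.N v1 v2 z) : (U.ga)⁻¹ * U.n v1 v2 z * U.ga =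
    U.n (U.π⁻¹ * v1) (U.π⁻¹ * v2) (U.π⁻¹ * U.π⁻¹ * z) := by
  rw [ga_inv, t_n (inv_ne_zero U.π_ne) h, ← ga_inv, inv_mul_cancel_right, map_inv₀, U.cjπ]
lemma tin_N {v1 v2 z : F} (h : U.N v1 v2 z) : U.N (U.π⁻¹ * v1) (U.π⁻¹ * v2) (U.π⁻¹ * U.π⁻¹ * z) := by
  have := h.t U.π⁻¹; rwa [map_inv₀, U.cjπ] at this
lemma pi1 {k : ℤ} {x : F} : U.π⁻¹ * x ∈ U.P k ↔ x ∈ U.P (k + 1) := by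
  have := pmul (C := U.toCF) (i := -1) (k := k) (x := x)
  simpa using this
lemma pi2 {k : ℤ} {x : F} : U.π⁻¹ * U.π⁻¹ * x ∈ U.P k ↔ x ∈ U.P (k + 2) := by
  rw [mul_assoc, pi1, pi1]; ring_nf
lemma D_pi {v1 v2 : F} : D U.toCF U.m (U.π⁻¹ * v1) (U.π⁻¹ * v2) ↔ D U.toCF (U.m + 2) v1 v2 := by
  simp only [D, pi1]
  have e1 : (U.m + 2) / 2 = U.m / 2 + 1 := by omega
  have e2 : (U.m + 2 + 1) / 2 = (U.m + 1) / 2 + 1 := by omega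
  rw [e1, e2]

lemma xinj (i j : R × R × Z) (h : (A.x i)⁻¹ * A.x j ∈ U.J) : i = j := by
  obtain ⟨c1, c2, p⟩ := i
  obtain ⟨d1, d2, q⟩ := j
  have si := A.zr_sk p
  have sj := A.zr_sk q
  have Ni := ns_N (v1 := A.w1 c1) (v2 := A.w2 c2) si
  have Nj := ns_N (v1 := A.w1 d1) (v2 := A.w2 d2) sj
  have e : (A.x (c1,c2,p))⁻¹ * A.x (d1,d2,q) = (U.ga)⁻¹ * ((U.ns (A.w1 c1) (A.w2 c2) (A.zr p))⁻¹
    * U.ns (A.w1 d1) (A.w2 d2) (A.zr q)) * U.ga := by simp only [x, mul_inv_rev, mul_assoc]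
  rw [e, ns, ns, n_inv Ni, n_mul Ni.inv Nj, tin (Ni.inv.add Nj), n_J_iff (tin_N (Ni.inv.add Nj)), D_pi, pi2] at h
  have h1 : c1 = d1 := by
    apply A.rep_inj
    have := h.1.1
    rw [neg_add_eq_sub, w1, w1, ← mul_sub, pmul] at this
    exact CF.mono this (by omega)
  have h2 : c2 = d2 := by
    apply A.rep_inj
    have := h.1.2
    rw [neg_add_eq_sub, w2, w2, ← mul_sub, pmul] at this
    exact CF.mono this (by omega)
  subst h1 h2
  have h3 : p = q := by
    apply A.zr_inj
    convert h.2 using 1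
    rw [map_sub, map_div₀, hh_cj, si, cj2, hx]
    simp only [hh, map_neg]
    linear_combination add_halves' U.two (U.π * (U.cj (A.w1 c1) * A.w1 c1) + U.cj (A.w2 c2) * A.w2 c2)
  rw [h3]
lemma xinj' (p q : Z) (h : (A.x' p)⁻¹ * A.x' q ∈ U.J ⊓ U.GE) : p = q := by
  have := A.xinj (A.o, A.o, p) (A.o, A.o, q) (by
    simp only [x, w1, w2, A.rep_o, mul_zero, ns0]; exact h.1)
  simpa using this
lemma nmpi {u1 u2 y : F} (Nu : U.N u1 u2 y) (hu : D U.toCF U.m u1 u2) (hy : y ∈ U.P U.m) :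
    (U.ga)⁻¹ * U.nm u1 u2 y * U.ga ∈ U.J := by
  rw [mul_assoc, nm_t U.π_ne Nu, inv_mul_cancel_left]
  exact tnmJ (CF.mono p1 (by omega)) Nu hu hy
lemma xsur (j : G) (hj : j ∈ U.J) : ∃ i, (A.x i)⁻¹ * (j * U.ga) ∈ U.J := by
  obtain ⟨v1, v2, z, l, u1, u2, y, N1, N2, hl, hv, hu, hz, hy, hlJ, rfl, -⟩ := iwJ hj
  obtain ⟨c1, h1⟩ := A.rep_sur (U.π ^ (-(U.m / 2)) * v1) (by rw [pmul]; exact CF.mono hv.1 (by omega))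
  obtain ⟨c2, h2⟩ := A.rep_sur (U.π ^ (-((U.m + 1) / 2)) * v2) (by rw [pmul]; exact CF.mono hv.2 (by omega))
  have hd : D U.toCF (U.m + 2) (-A.w1 c1 + v1) (-A.w2 c2 + v2) := by
    constructor
    · have : -A.w1 c1 + v1 = U.π ^ (U.m / 2) * (U.π ^ (-(U.m / 2)) * v1 - A.rep c1) := by
        rw [mul_sub, ← mul_assoc, ← zpow_add₀ U.π_ne, w1]; simp; ring
      rw [this, pmul]; exact CF.mono h1 (by omega)
    · have : -A.w2 c2 + v2 = U.π ^ ((U.m+1) / 2) * (U.π ^ (-((U.m+1) / 2)) * v2 - A.rep c2) := by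
        rw [mul_sub, ← mul_assoc, ← zpow_add₀ U.π_ne, w2]; simp; ring
      rw [this, pmul]; exact CF.mono h2 (by omega)
  set H := hh U.toCF (A.w1 c1) (A.w2 c2) (A.w1 c1) (A.w2 c2) with hH
  set B := z - H / 2 + hh U.toCF (A.w1 c1) (A.w2 c2) v1 v2 with hB
  have hBm : B ∈ U.P U.m := ad (sb hz (div2 (A.w_D _ _).hself)) ((A.w_D _ _).h hv (by omega))
  obtain ⟨q, hq⟩ := A.zr_sur ((B - U.cj B) / 2) (div2 (sb hBm (cjm hBm))) (by
    rw [map_div₀, map_sub, U.cj_cj, cj2]; ring)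
  refine ⟨(c1, c2, q), ?_⟩
  have sq := A.zr_sk q
  have Nq := ns_N (v1 := A.w1 c1) (v2 := A.w2 c2) sq
  have e : (A.x (c1,c2,q))⁻¹ * (U.n v1 v2 z * l * U.nm u1 u2 y * U.ga) =
    ((U.ga)⁻¹ * ((U.ns (A.w1 c1) (A.w2 c2) (A.zr q))⁻¹ * U.n v1 v2 z) * U.ga) * ((U.ga)⁻¹ * l * U.ga) *
      ((U.ga)⁻¹ * U.nm u1 u2 y * U.ga) := by
    simp only [x]; generalize U.ga = g; group
  rw [e]
  refine U.J.mul_mem (U.J.mul_mem ?_ ?_) (nmpi N2 hu hy)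
  · have N3 := Nq.inv.add N1
    rw [ns, n_inv Nq, n_mul Nq.inv N1, tin N3, n_J_iff (tin_N N3), D_pi, pi2]
    refine ⟨hd, ?_⟩
    have e2 : U.cj (A.zr q - H / 2) + z - U.hx (-A.w1 c1) (-A.w2 c2) v1 v2 = B - A.zr q := by
      have hb : U.cj H = H := hh_cj _ _ _ _
      rw [map_sub, map_div₀, hb, sq, cj2, hx, hB]; simp only [hh, map_neg]; ring
    rw [e2] at N3 ⊢
    have e3 : B - A.zr q = ((B - U.cj B) / 2 - A.zr q) + (B + U.cj B) / 2 := by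
      linear_combination - add_halves' U.two B
    rw [e3]
    refine ad hq (div2 ?_)
    rw [N, map_sub, sq] at N3
    have : B + U.cj B = - hh U.toCF (-A.w1 c1 + v1) (-A.w2 c2 + v2) (-A.w1 c1 + v1) (-A.w2 c2 + v2) := by
      linear_combination N3
    rw [this]; exact ng hd.hself
  · rw [mul_assoc, ← t_comm_lv U.π_ne hl, inv_mul_cancel_left]; exact hlJ
lemma xsur' (j : G) (hj : j ∈ U.J ⊓ U.GE) : ∃ q, (A.x' q)⁻¹ * (j * U.ga) ∈ U.J ⊓ U.GE := by
  obtain ⟨v1, v2, z, l, u1, u2, y, N1, N2, hl, hv, hu, hz, hy, hlJ, hjj, -⟩ := iwJ hj.1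
  have hE := hj.2
  rw [hjj] at hE
  obtain ⟨rfl, rfl, rfl, rfl⟩ := cellE N1 N2 hl hE
  have sz := N_zero.1 N1
  obtain ⟨q, hq⟩ := A.zr_sur z hz sz
  have sq := A.zr_sk q
  refine ⟨q, ?_, ?_⟩
  swap
  · exact U.GE.mul_mem (U.GE.inv_mem (U.GE.mul_mem (A.uE q).2 (t_E U.π_ne))) (U.GE.mul_mem hj.2 (t_E U.π_ne))
  have e : (A.x' q)⁻¹ * (U.n 0 0 z * l * U.nm 0 0 y * U.ga) =
    ((U.ga)⁻¹ * ((U.n 0 0 (A.zr q))⁻¹ * U.n 0 0 z) * U.ga) * ((U.ga)⁻¹ * l * U.ga) *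
      ((U.ga)⁻¹ * U.nm 0 0 y * U.ga) := by
    simp only [x']; generalize U.ga = g; group
  rw [hjj, e]
  have Nq := N_zero.2 sq
  refine U.J.mul_mem (U.J.mul_mem ?_ ?_) (nmpi N2 hu hy)
  · have N3 := Nq.inv.add N1
    rw [n_inv Nq, n_mul Nq.inv N1, tin N3, n_J_iff (tin_N N3), D_pi, pi2]
    refine ⟨by simp [D, P00], ?_⟩
    convert hq using 1
    rw [sq]; simp [hh]; ring
  · rw [mul_assoc, ← t_comm_lv U.π_ne hl, inv_mul_cancel_left]; exact hlJ
end Fam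
end CG
end UC

namespace UC
open CF
namespace CG
variable {F : Type u} [Field F] {G : Type v} [Group G] {U : CG F G}

lemma ga_pow (r : ℕ) : U.ga ^ r = U.t (U.π ^ r) := t_pow U.π_ne r
lemma ga_E : U.ga ∈ U.GE := t_E U.π_ne
lemma cl {j : G} (hj : j ∈ U.J ⊓ U.GE) : ∃ z l y, U.N 0 0 z ∧ U.N 0 0 y ∧ Lv (U.mat l) ∧ z ∈ U.P U.m ∧
    y ∈ U.P U.m ∧ l ∈ U.J ⊓ U.GE ∧ j = U.n 0 0 z * l * U.nm 0 0 y := by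
  obtain ⟨v1, v2, z, l, u1, u2, y, N1, N2, hl, hv, hu, hz, hy, hlJ, hjj, -⟩ := iwJ hj.1
  have hE := hj.2
  rw [hjj] at hE
  obtain ⟨rfl, rfl, rfl, rfl⟩ := cellE N1 N2 hl hE
  refine ⟨z, l, y, N1, N2, hl, hz, hy, ⟨hlJ, ?_⟩, hjj⟩
  have : l = (U.n 0 0 z)⁻¹ * (U.n 0 0 z * l * U.nm 0 0 y) * (U.nm 0 0 y)⁻¹ := by group
  rw [this]
  exact U.GE.mul_mem (U.GE.mul_mem (U.GE.inv_mem (n_E N1)) hE) (U.GE.inv_mem (nm_E N2))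
lemma A7a (r : ℕ) (j : G) (hj : j ∈ U.J ⊓ U.GE) : U.ga * j * U.ga ^ r ∈ HK.DC (U.J ⊓ U.GE) (U.ga ^ (r + 1)) := by
  obtain ⟨z, l, y, N1, N2, hl, hz, hy, hlJ, rfl⟩ := cl hj
  have hp := p1 (C := U.toCF)
  have hpr : U.π ^ r ∈ U.P 0 := by
    have := CF.mono (ppow (C := U.toCF) (r : ℤ)) (by omega : (0:ℤ) ≤ r)
    simpa using this
  have n0 : D U.toCF U.m 0 0 := ⟨P00, P00⟩
  refine ⟨U.n (U.cj U.π * 0) (U.cj U.π * 0) (U.π * U.cj U.π * z) * l, ?_,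
    U.nm (U.π ^ r * 0) (U.π ^ r * 0) (U.π ^ r * U.cj (U.π ^ r) * y), ?_, ?_⟩
  · refine Subgroup.mul_mem _ ⟨tnJ (CF.mono hp (by omega)) N1 n0 hz, ?_⟩ hlJ
    have := N1.t U.π
    simp only [mul_zero] at this ⊢
    exact n_E this
  · refine ⟨tnmJ hpr N2 n0 hy, ?_⟩
    have := N2.t' (U.π ^ r)
    simp only [mul_zero] at this ⊢
    exact nm_E this
  · have e1 := t_n U.π_ne N1
    have e2 := t_comm_lv U.π_ne hl
    have e3 := nm_t (τ := U.π ^ r) (pow_ne_zero r U.π_ne) N2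
    rw [← ga_pow] at e3
    rw [pow_succ']
    calc U.ga * (U.n 0 0 z * l * U.nm 0 0 y) * U.ga ^ r = (U.ga * U.n 0 0 z) * l * (U.nm 0 0 y * U.ga ^ r) := by
          simp only [mul_assoc]
      _ = _ := by
          rw [e1, e3]; simp only [mul_assoc]; rw [← mul_assoc l (U.t U.π), ← e2]; simp only [mul_assoc]
lemma A7b {R Z : Type*} (A : Fam U R Z) (r : ℕ) (q : Z)
    (h : (A.x' q)⁻¹ * U.ga ^ (r + 1) ∈ HK.DC (U.J ⊓ U.GE) (U.ga ^ r)) : (U.ga)⁻¹ * A.x' q ∈ U.J ⊓ U.GE := by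
  obtain ⟨p, hp, p', hp', e⟩ := h
  have hN := N_zero.2 (A.zr_sk q)
  have hpi := U.π_ne
  have E : (U.ga)⁻¹ * A.x' q ∈ U.GE :=
    U.GE.mul_mem (U.GE.inv_mem ga_E) (U.GE.mul_mem (n_E hN) ga_E)
  refine ⟨?_, E⟩
  have e1 : (U.ga)⁻¹ * A.x' q = U.n 0 0 (U.π⁻¹ * U.π⁻¹ * A.zr q) := by
    rw [Fam.x', ← mul_assoc, Fam.tin hN]; simp
  have N2 : U.N 0 0 (U.π⁻¹ * U.π⁻¹ * A.zr q) := by simpa using Fam.tin_N hN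
  have e2 : (A.x' q)⁻¹ * U.ga ^ (r + 1) = (U.n 0 0 (U.π⁻¹ * U.π⁻¹ * A.zr q))⁻¹ * U.ga ^ r := by
    rw [← e1, pow_succ']; group
  rw [e1]
  refine n_J N2 ⟨P00, P00⟩ ?_
  rw [e2] at e
  generalize hc : U.π⁻¹ * U.π⁻¹ * A.zr q = c at *
  have sc := N_zero.1 N2
  have hE' := (U.memE _).1 hp.2
  have hE'' := (U.memE _).1 hp'.2
  have hJ' := (U.memJ _).1 hp.1
  have hJ'' := (U.memJ _).1 hp'.1
  have f := congrArg (fun g => U.mat g 0 3) e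
  have hpr : U.π ^ r ≠ 0 := pow_ne_zero r hpi
  simp only [n_inv N2, U.mm, n_mat N2.inv, ga_pow, t_mat hpr] at f
  simp [nM, tM, hE'.h01, hE'.h02, sc, U.cjπ] at f
  have hpr0 : U.π ^ r ∈ U.P 0 := by
    have := CF.mono (ppow (C := U.toCF) (r : ℤ)) (by omega : (0:ℤ) ≤ r)
    simpa using this
  have hc2 : c = -(U.mat p 0 0 * (U.π ^ r * U.π ^ r) * U.mat p' 0 3 + U.mat p 0 3 * U.mat p' 3 3) := by
    field_simp at f; linear_combination -f
  have hm := U.hm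
  have a1 : U.mat p 0 0 ∈ U.P 0 := (unit_of (CF.mono hJ'.h00 hm)).1
  have a2 : U.mat p' 3 3 ∈ U.P 0 := (unit_of (CF.mono hJ''.h33 hm)).1
  rw [hc2]
  exact ng (ad (om (om a1 (om hpr0 hpr0)) hJ''.h03) (mo hJ'.h03 a2))
lemma ainv : ∃ k ∈ U.K, ∃ k' ∈ U.K, (U.ga)⁻¹ = k * U.ga * k' :=
  ⟨U.s1, s_K, U.s1, s_K, by rw [s1_t U.π_ne, U.cjπ, ga_inv]⟩

lemma A4 (e : G → ℂ) (he : HK.IsH (U.J ⊓ U.GE) U.GE U.τ e) (g : G) (hg : e g ≠ 0) :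
    ∃ k ∈ U.K, ∃ k' ∈ U.K, ∃ r : ℕ, g = k * U.ga ^ r * k' := by
  obtain ⟨he1, he2, he3⟩ := he
  have hgE : g ∈ U.GE := he2 hg
  obtain ⟨k, hk, k', hk', τ, h0, hτ, rfl⟩ := cartan hgE
  by_cases hr : ∃ r : ℕ, τ ∉ U.P (r : ℤ)
  · have hr' := Nat.find_spec hr
    have hmin := fun n => Nat.find_min hr (m := n)
    generalize Nat.find hr = N at *
    obtain _ | r := N
    · exact absurd hτ (by simpa using hr')
    have h1 : τ ∈ U.P (r : ℤ) := by simpa using hmin r (by omega)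
    have h2 : τ ∉ U.P ((r : ℤ) + 1) := by push_cast at hr'; exact hr'
    have hpr : U.π ^ r ≠ 0 := pow_ne_zero r U.π_ne
    have hε : τ / U.π ^ r ≠ 0 := div_ne_zero h0 hpr
    have m1 : τ / U.π ^ r ∈ U.P 0 := by
      have := (pmul (C := U.toCF) (i := -(r:ℤ)) (k := 0) (x := τ)).2 (by simpa using h1)
      rw [zpow_neg, zpow_natCast] at this
      rwa [div_eq_inv_mul]
    have m2 : (τ / U.π ^ r)⁻¹ ∈ U.P 0 := by
      have := CF.mul (ppow (C := U.toCF) (r:ℤ)) (inv_of_not h2) (k := 0) (by omega)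
      rw [zpow_natCast] at this
      rwa [inv_div, div_eq_mul_inv]
    refine ⟨k, hk, U.t (τ / U.π ^ r) * k', U.K.mul_mem (t_K hε m1 m2) hk', r, ?_⟩
    have : U.t τ = U.t (U.π ^ r) * U.t (τ / U.π ^ r) := by rw [t_mul hpr hε, mul_div_cancel₀ _ hpr]
    rw [ga_pow, this]; simp only [mul_assoc]
  · exfalso
    push Not at hr
    have hall : ∀ N : ℕ, τ ∈ U.P (N : ℤ) := hr
    set c : ℕ → F := fun i => U.s * U.π ^ (U.m + i) with hc
    have sc : ∀ i, U.cj (c i) = - c i := fun i => by simp [hc, U.cjs, U.cjπ]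
    have cm : ∀ i, c i ∈ U.P U.m := fun i => CF.mul smem (ppow _) (by omega)
    have jE : ∀ i, k * U.n 0 0 (c i) * k⁻¹ ∈ U.J ⊓ U.GE := fun i =>
      kE hk ⟨n_J (N_zero.2 (sc i)) ⟨P00, P00⟩ (cm i), n_E (N_zero.2 (sc i))⟩
    refine Set.infinite_of_injective_forall_mem (f := fun i : ℕ =>
      (QuotientGroup.mk (k * U.n 0 0 (c i) * k⁻¹ * (k * U.t τ * k')) : G ⧸ (U.J ⊓ U.GE))) ?_ ?_ he3
    · have key : ∀ i l : ℕ, i < l → (QuotientGroup.mk (k * U.n 0 0 (c i) * k⁻¹ * (k * U.t τ * k')) : G ⧸ (U.J ⊓ U.GE))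
         ≠ QuotientGroup.mk (k * U.n 0 0 (c l) * k⁻¹ * (k * U.t τ * k')) := by
        intro i l hil heq
        rw [QuotientGroup.eq] at heq
        have h1 : _ ∈ U.J := (kE hk' heq).1
        have Ni := N_zero.2 (sc i)
        have Nl := N_zero.2 (sc l)
        have N3 := Ni.inv.add Nl
        have e1 : k' * ((k * U.n 0 0 (c i) * k⁻¹ * (k * U.t τ * k'))⁻¹ * (k * U.n 0 0 (c l) * k⁻¹ * (k * U.t τ * k'))) * k'⁻¹
          = (U.t τ)⁻¹ * ((U.n 0 0 (c i))⁻¹ * U.n 0 0 (c l)) * U.t τ := by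
          generalize U.n 0 0 (c i) = a; generalize U.n 0 0 (c l) = b; generalize U.t τ = d; group
        have hi0 := inv_ne_zero h0
        rw [e1, n_inv Ni, n_mul Ni.inv Nl, t_inv h0, t_n hi0 N3, ← t_inv h0, inv_mul_cancel_right,
          n_J_iff (N3.t _)] at h1
        have h2 := h1.2
        have e2 : U.cj (c i) + c l - U.hx (-0) (-0) 0 0 = c l - c i := by rw [sc, hx]; simp [hh]; ring
        rw [e2] at h2
        have h3 := CF.mul (CF.mul (hall (i + 1)) (cjm (hall 0)) le_rfl) h2 (k := U.m + i + 1) (by push_cast; omega)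
        have hcj : U.cj τ ≠ 0 := by simpa using h0
        have e3 : τ * U.cj τ * (τ⁻¹ * U.cj τ⁻¹ * (c l - c i)) = c l - c i := by
          rw [map_inv₀]; field_simp
        rw [e3] at h3
        have h4 : c l ∈ U.P (U.m + i + 1) := CF.mul smem (ppow _) (by omega)
        have h5 : c i ∈ U.P (U.m + i + 1) := by simpa using sb h4 h3
        have h6 := CF.mul (P0.2 U.s_inv) h5 (k := U.m + i + 1) (by omega)
        rw [hc] at h6; simp only [inv_mul_cancel_left₀ U.s_ne] at h6
        rw [← mul_one (U.π ^ _), pmul] at h6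
        exact one_not (C := U.toCF) (CF.mono h6 (by omega))
      intro i l heq
      rcases lt_trichotomy i l with h | h | h
      · exact absurd heq (key i l h)
      · exact h
      · exact absurd heq.symm (key l i h)
    · intro i
      refine ⟨_, ?_, rfl⟩
      have := he1 _ (jE i) (k * U.t τ * k') 1 (Subgroup.one_mem _)
      rw [mul_one] at this
      rw [Function.mem_support, this]
      exact mul_ne_zero (mul_ne_zero (inv_ne_zero (ψ_ne _)) hg) (inv_ne_zero (ψ_ne _))
end CG
end UC

namespace UC
open CF
namespace CG
variable {F : Type u} [Field F] {G : Type v} [Group G] {U : CG F G}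

lemma τ_one : U.τ 1 = 1 := τ_of (by rw [U.one_e]; simp) (by rw [U.one_e]; simp)
section
variable {φ : G → ℂ} (hφ : HK.Eqv U.J U.τ φ)
lemma eL {φ : G → ℂ} (hφ : HK.Eqv U.J U.τ φ) {j : G} (hj : j ∈ U.J) (g : G) : φ (j * g) = U.τ j * φ g := by
  have := hφ j hj g 1 U.J.one_mem
  rwa [mul_one, τ_one, mul_one] at this
lemma eR {φ : G → ℂ} (hφ : HK.Eqv U.J U.τ φ) {j : G} (hj : j ∈ U.J) (g : G) : φ (g * j) = φ g * U.τ j := by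
  have := hφ 1 U.J.one_mem g j hj
  rwa [one_mul, τ_one, one_mul] at this
lemma good0 {φ : G → ℂ} (hφ : HK.Eqv U.J U.τ φ) {y : G} (h : U.Good y) : φ y = 0 := by
  obtain ⟨j, hj, j', hj', e, hne⟩ := h
  have h1 := eL hφ hj y
  rw [e, eR hφ hj'] at h1
  by_contra h0
  exact hne (mul_right_cancel₀ h0 (by linear_combination -h1))
lemma goodK {k y : G} (hk : k ∈ U.K) (h : U.Good y) : U.Good (k * y) := by
  obtain ⟨j, hj, j', hj', e, hne⟩ := h
  refine ⟨k * j * k⁻¹, Knorm hk hj, j', hj', ?_, ?_⟩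
  · have : k * j * k⁻¹ * (k * y) = k * (j * y) := by group
    rw [this, e, mul_assoc]
  · rwa [τ_conj (memK.1 hk).1]

lemma nmR {φ : G → ℂ} (hφ : HK.Eqv U.J U.τ φ) {T u1 u2 y : F} (g : G) (hT0 : T ≠ 0) (hT : T ∈ U.P 0)
    (Nu : U.N u1 u2 y) (hu : D U.toCF U.m u1 u2) (hy : y ∈ U.P U.m) :
    φ (g * U.nm u1 u2 y * U.t T) = φ (g * U.t T) := by
  rw [mul_assoc, nm_t hT0 Nu, ← mul_assoc, eR hφ (tnmJ hT Nu hu hy), τ_nm (Nu.t' T), mul_one]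

lemma fib_base {φ : G → ℂ} (hφ : HK.Eqv U.J U.τ φ) {k l : ℤ} {V1 V2 Z T : F} (hT0 : T ≠ 0) (hT : T ∈ U.P 0)
    (hk : U.m ≤ k + l) (hl : 0 ≤ l) (hV : D U.toCF k V1 V2) (sZ : U.cj Z = -Z) (hZ : Z ∉ U.P (-l + 1)) :
    φ (U.ns V1 V2 Z * U.t T) = φ (U.n 0 0 Z * U.t T) := by
  have hz : Z - hh U.toCF V1 V2 V1 V2 / 2 ∉ U.P (-l + 1) := by
    intro h
    have h1 := sb h (cjm h)
    rw [map_sub, map_div₀, hh_cj, cj2, sZ] at h1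
    apply hZ
    rw [← mul2]; convert h1 using 1; ring
  have hZ0 : Z ≠ 0 := by rintro rfl; exact hZ P00
  have hz0 : Z - hh U.toCF V1 V2 V1 V2 / 2 ≠ 0 := by intro h; rw [h] at hz; exact hz P00
  obtain ⟨j, hj, hτ, u1, u2, y, Nu, hu, hy, e⟩ := base0 hk hl hV hZ0 hz0 sZ rfl
    (by simpa using inv_of_not hZ) (by simpa using inv_of_not hz)
  rw [← nmR hφ (U.n 0 0 Z) hT0 hT Nu hu hy, ← e, mul_assoc, eL hφ hj, hτ, one_mul, ns]

lemma csum {R Z : Type*} [Fintype R] (A : Fam U R Z) (f : F → ℂ) (hf : ∀ x y, f (x + y) = f x * f y)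
    (h1 : ∀ x ∈ U.P 1, f x = 1) (c : F) (hc : c ∈ U.P 0) (hc1 : f c ≠ 1) : ∑ i, f (A.rep i) = 0 := by
  choose σ hσ using fun i => A.rep_sur (A.rep i + c) (ad (A.rep_mem i) hc)
  have inj : Function.Injective σ := by
    intro i j h
    apply A.rep_inj
    have a := hσ i
    have b := hσ j
    rw [h] at a
    convert sb b a using 1; ring
  have bij := Finite.injective_iff_bijective.1 inj
  have h2 : ∀ i, f (A.rep (σ i)) = f (A.rep i) * f c := by
    intro i
    have : f (A.rep i + c) = f (A.rep (σ i)) := by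
      have := hf (A.rep (σ i)) (A.rep i + c - A.rep (σ i))
      rw [h1 _ (hσ i), mul_one] at this
      rw [← this]; congr 1; ring
    rw [← this, hf]
  have h3 : ∑ i, f (A.rep i) = (∑ i, f (A.rep i)) * f c := by
    rw [Finset.sum_mul, ← Finset.sum_congr rfl (fun i _ => h2 i)]
    exact (bij.sum_comp (fun i => f (A.rep i))).symm
  by_contra h0
  exact hc1 (mul_left_cancel₀ h0 (by linear_combination -h3))

structure Par (U : CG F G) (v1 v2 e1 e2 : F) : Prop where
  o1 : v1 = 0 ∨ v2 = 0
  o2 : e1 = 0 ∨ e2 = 0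
  o3 : v1 = 0 ∨ e1 = 0
  o4 : v2 = 0 ∨ e2 = 0
  hv : D U.toCF (U.m - 2) v1 v2
  he : D U.toCF (U.m - 1) e1 e2
  hB : U.cj v1 * e2 - U.cj v2 * e1 ∉ U.P (U.m - 1)

lemma Par.no {v1 v2 e1 e2 : F} (h : Par U v1 v2 e1 e2) {c : F} (hc : c ∈ U.P 0) :
    ¬ D U.toCF (U.m - 1) (v1 + c * e1) (v2 + c * e2) := by
  intro hd
  have h1 := D.add hd (D.smul (l := U.m - 1) hc h.he (by omega)).neg
  simp only [add_neg_cancel_right] at h1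
  exact h.hB (sb (CF.mul (cjm h1.1) h.he.2 (by omega)) (CF.mul (cjm h1.2) h.he.1 (by omega)))

lemma Par.ssum {φ : G → ℂ} (hφ : HK.Eqv U.J U.τ φ) {R Z : Type*} [Fintype R] (A : Fam U R Z) {v1 v2 e1 e2 X z T : F}
    (h : Par U v1 v2 e1 e2) (hT0 : T ≠ 0) (hT : T ∈ U.P 0) (sX : U.cj X = -X)
    (ez : z = X - hh U.toCF v1 v2 v1 v2 / 2) (hz : z ∈ U.P (-1)) (hz' : z ∉ U.P 0) :
    ∑ c, φ (U.ns (v1 + A.rep c * e1) (v2 + A.rep c * e2) X * U.t T) = 0 := by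
  have hz0 : z ≠ 0 := by rintro rfl; exact hz' P00
  have hb0 : U.cj z ≠ 0 := by simpa using hz0
  have hzi : z⁻¹ ∈ U.P 1 := by simpa using inv_of_not (i := -1) (by simpa using hz')
  have hzbi : (U.cj z)⁻¹ ∈ U.P 1 := by rw [← map_inv₀]; exact cjm hzi
  set B := U.cj v1 * e2 - U.cj v2 * e1 with hB
  have hBm : B ∈ U.P (U.m - 2) := sb (CF.mul (cjm h.hv.1) h.he.2 (by omega)) (CF.mul (cjm h.hv.2) h.he.1 (by omega))
  have hB0 : B ≠ 0 := fun h0 => h.hB (by rw [← hB, h0]; exact P00)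
  have hBi : B⁻¹ ∈ U.P (-(U.m - 2)) := inv_of_not (by have := h.hB; rw [← hB] at this; convert this using 2; ring)
  set f : F → ℂ := fun c => U.ψ (U.π ^ (1 - U.m) * (B * c / U.cj z + U.cj (B * c / U.cj z))) with hf
  have key : ∀ c ∈ U.P 0, φ (U.ns (v1 + c * e1) (v2 + c * e2) X * U.t T) = f c * φ (U.ns v1 v2 X * U.t T) := by
    intro c hc
    have hu : D U.toCF (U.m + 1) (c / U.cj z * e1) (c / U.cj z * e2) := by
      refine D.smul (k := 1) ?_ h.he (by omega)
      rw [div_eq_mul_inv]; exact om hc hzbi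
    have hcz : c / U.cj z ∈ U.P 1 := by rw [div_eq_mul_inv]; exact om hc hzbi
    have Nv : U.N v1 v2 z := by rw [ez]; exact ns_N sX
    obtain ⟨j, hj, hτ, y, Nu, hu', hy, N3, e⟩ := lemS (v1 := v1) (v2 := v2) (u1 := c / U.cj z * e1) (u2 := c / U.cj z * e2)
      (z := z) h.o1 (by rcases h.o2 with h | h <;> simp [h]) (by rcases h.o3 with h | h <;> simp [h])
      (by rcases h.o4 with h | h <;> simp [h]) h.hv hu
      (CF.mul (cjm h.hv.1) (CF.mul hcz h.he.2 le_rfl) (by omega))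
      (CF.mul (cjm h.hv.2) (CF.mul hcz h.he.1 le_rfl) (by omega)) hz Nv
    have e1' : v1 + U.cj z * (c / U.cj z * e1) = v1 + c * e1 := by field_simp
    have e2' : v2 + U.cj z * (c / U.cj z * e2) = v2 + c * e2 := by field_simp
    have hcr1 : U.cj v1 * e1 = 0 := by rcases h.o3 with h | h <;> simp [h]
    have hcr2 : U.cj v2 * e2 = 0 := by rcases h.o4 with h | h <;> simp [h]
    have hcr3 : U.cj e1 * v1 = 0 := by rcases h.o3 with h | h <;> simp [h]
    have hcr4 : U.cj e2 * v2 = 0 := by rcases h.o4 with h | h <;> simp [h]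
    have e3 : z - z * U.cj z * hh U.toCF (c / U.cj z * e1) (c / U.cj z * e2) (c / U.cj z * e1) (c / U.cj z * e2) / 2 =
       X - hh U.toCF (v1 + c * e1) (v2 + c * e2) (v1 + c * e1) (v2 + c * e2) / 2 := by
      have : z * U.cj z * hh U.toCF (c / U.cj z * e1) (c / U.cj z * e2) (c / U.cj z * e1) (c / U.cj z * e2)
         = c * U.cj c * hh U.toCF e1 e2 e1 e2 := by
        simp only [hh, map_mul, map_div₀, U.cj_cj]; field_simp
      rw [this, ez]
      have : hh U.toCF (v1 + c * e1) (v2 + c * e2) (v1 + c * e1) (v2 + c * e2) =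
        hh U.toCF v1 v2 v1 v2 + c * U.cj c * hh U.toCF e1 e2 e1 e2 := by
        simp only [hh, map_mul, map_add]
        linear_combination c * U.π * hcr1 + c * hcr2 + U.cj c * U.π * hcr3 + U.cj c * hcr4
      rw [this]; ring
    rw [e1', e2', e3] at e
    have h5 := nmR hφ (U.n v1 v2 z) hT0 hT Nu hu' hy
    rw [← e, mul_assoc, eL hφ hj, hτ] at h5
    have h6 : U.ψ (U.π ^ (1 - U.m) * (U.cj v1 * (c / U.cj z * e2) + v1 * U.cj (c / U.cj z * e2) -
        (v2 * U.cj (c / U.cj z * e1) + U.cj v2 * (c / U.cj z * e1)))) = f c := by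
      rw [hf, hB]; simp only []
      congr 2
      simp only [map_mul, map_sub, map_div₀, U.cj_cj]; ring
    rw [h6] at h5
    have hfc : f c ≠ 0 := ψ_ne _
    rw [ns, ns, ← ez, ← h5, mul_inv_cancel_left₀ hfc]
  rw [Finset.sum_congr rfl (fun c _ => key _ (A.rep_mem c)), ← Finset.sum_mul]
  obtain ⟨r, hr, hrr, hrψ⟩ := U.ψ_r
  rw [csum A f ?_ ?_ (U.cj z * B⁻¹ * (U.π ^ (U.m - 1) * (r / 2))) ?_ ?_, zero_mul]
  · intro x y
    rw [hf]; simp only []; rw [← U.ψ_add]; congr 1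
    simp only [map_mul, map_add, map_div₀, U.cj_cj]; ring
  · intro x hx
    apply U.ψ_P1
    rw [pmul]
    have : B * x / U.cj z ∈ U.P U.m := by
      rw [div_eq_mul_inv]; exact CF.mul (CF.mul hBm hx le_rfl) hzbi (by omega)
    exact CF.mono (ad this (cjm this)) (by omega)
  · exact CF.mul (CF.mul (cjm hz) hBi le_rfl) (CF.mul (ppow _) (div2 (P0.2 hr)) le_rfl) (by omega)
  · have h2 := U.two
    have : B * (U.cj z * B⁻¹ * (U.π ^ (U.m - 1) * (r / 2))) / U.cj z = U.π ^ (U.m - 1) * (r / 2) := by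
      field_simp
    rw [hf]; simp only []
    rw [this, map_mul, map_zpow₀, U.cjπ, map_div₀, hrr, cj2, ← mul_add, add_halves' h2, ← mul_assoc,
      ← zpow_add₀ U.π_ne]
    simpa using hrψ

lemma lemI0 {φ : G → ℂ} (hφ : HK.Eqv U.J U.τ φ) {i : ℤ} {v1 v2 X T : F} (hi : 0 ≤ i) (him : i < U.m)
    (hv : D U.toCF i v1 v2) (hv' : ¬ D U.toCF (i + 1) v1 v2) (hT0 : T ≠ 0) (hT : T ∈ U.P 0) (sX : U.cj X = -X)
    (hX : X ∈ U.P 0) : φ (U.ns v1 v2 X * U.t T) = 0 := by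
  apply good0 hφ
  rw [n_0_ns sX, mul_assoc]
  apply goodK (n_K (N_zero.2 sX) hX)
  have h1 : Dv (U.mat (1 : G)) := by
    have l : Lv (U.mat (1:G)) := lv_of (by simp [U.one_e]) (by simp [U.one_e]) (by simp [U.one_e]) (by simp [U.one_e])
      (by simp [U.one_e]) (by simp [U.one_e]) (by simp [U.one_e])
    exact { l with h00 := by simp [U.one_e], h33 := by simp [U.one_e] }
  have := lemI (u1 := 0) (u2 := 0) hi him hv hv' ⟨P00, P00⟩ h1 hT0 hT
  have e : U.nmh (0:F) 0 = 1 := by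
    have hN := N_half (U := U) 0 0
    apply U.ext; intro i j
    rw [nmh, nm_mat hN, U.one_e]
    fin_cases i <;> fin_cases j <;> simp [mM, hh]
  rwa [e, mul_one, mul_one] at this

lemma Par.fib {φ : G → ℂ} (hφ : HK.Eqv U.J U.τ φ) {R Z : Type*} [Fintype R] (A : Fam U R Z) {v1 v2 e1 e2 X T : F}
    (h : Par U v1 v2 e1 e2) (hT0 : T ≠ 0) (hT : T ∈ U.P 0) (sX : U.cj X = -X) (hX : X ∈ U.P (-1)) :
    ∑ c, φ (U.ns (v1 + A.rep c * e1) (v2 + A.rep c * e2) X * U.t T) = 0 := by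
  have hm := U.hm
  have hz : X - hh U.toCF v1 v2 v1 v2 / 2 ∈ U.P (-1) := sb hX (CF.mono (div2 h.hv.hself) (by omega))
  have hrel : (X - hh U.toCF v1 v2 v1 v2 / 2) - U.cj (X - hh U.toCF v1 v2 v1 v2 / 2) = 2 * X := by
    rw [map_sub, map_div₀, hh_cj, cj2, sX]; ring
  have hrel2 : (X - hh U.toCF v1 v2 v1 v2 / 2) + U.cj (X - hh U.toCF v1 v2 v1 v2 / 2) = - hh U.toCF v1 v2 v1 v2 := by
    rw [map_sub, map_div₀, hh_cj, cj2, sX]; linear_combination - add_halves' U.two (hh U.toCF v1 v2 v1 v2)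
  by_cases hX0 : X ∈ U.P 0
  · by_cases hm2 : 2 ≤ U.m
    · apply Finset.sum_eq_zero
      intro c _
      refine lemI0 hφ (i := U.m - 2) (by omega) (by omega) (D.add h.hv (D.smul (A.rep_mem c) h.he (by omega))) ?_ hT0 hT sX hX0
      have := h.no (A.rep_mem c)
      rwa [show U.m - 2 + 1 = U.m - 1 by ring]
    · refine h.ssum hφ A hT0 hT sX rfl hz ?_
      intro h0
      have h1 := ad h0 (cjm h0)
      rw [hrel2, ng_iff] at h1
      have h2 := D.of_h h1
      have := h.no (c := 0) P00
      apply this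
      have : U.m = 1 := by omega
      rw [this]; simpa using h2
  · refine h.ssum hφ A hT0 hT sX rfl hz ?_
    intro h0
    have h1 := sb h0 (cjm h0)
    rw [hrel, mul2] at h1
    exact hX0 h1
end
end CG
end UC

namespace UC
open CF
namespace CG
variable {F : Type u} [Field F] {G : Type v} [Group G] {U : CG F G}

variable (U) in
def Blk (r : ℕ) (g : G) : Prop := U.mat g 0 0 ∈ U.P (-r) ∧ U.mat g 0 3 ∈ U.P (-r) ∧ U.mat g 3 0 ∈ U.P (-r) ∧
  U.mat g 3 3 ∈ U.P (-r)
variable (U) in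
def wt (Q : ℕ) (g : G) : ℝ := ((Q : ℝ)⁻¹) ^ (sInf {r : ℕ | U.Blk r g})

lemma wpos {Q : ℕ} (hQ : 0 < Q) (g : G) : 0 < U.wt Q g := by
  have : (0:ℝ) < Q := by exact_mod_cast hQ
  exact pow_pos (inv_pos.2 this) _
lemma wt_congr {Q : ℕ} {g g' : G} (h : ∀ r, U.Blk r g ↔ U.Blk r g') : U.wt Q g = U.wt Q g' := by
  simp only [wt, h]
lemma wt_shift {Q : ℕ} {x y : G} (h : ∀ r : ℕ, U.Blk (r + 1) x ↔ U.Blk r y) (h0 : ¬ U.Blk 0 x)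
    (hne : ∃ r, U.Blk r x) : U.wt Q x = (Q:ℝ)⁻¹ * U.wt Q y := by
  have hy : ∃ r, U.Blk r y := by
    obtain ⟨r, hr⟩ := hne
    cases r with
    | zero => exact absurd hr h0
    | succ r => exact ⟨r, (h r).1 hr⟩
  have e : sInf {r : ℕ | U.Blk r x} = sInf {r : ℕ | U.Blk r y} + 1 := by
    apply le_antisymm
    · apply Nat.sInf_le
      exact (h _).2 (Nat.sInf_mem (s := {r : ℕ | U.Blk r y}) hy)
    · have h2 := Nat.sInf_mem (s := {r : ℕ | U.Blk r x}) hne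
      generalize sInf {r : ℕ | U.Blk r x} = p at h2
      cases p with
      | zero => exact absurd h2 h0
      | succ r => exact Nat.succ_le_succ (Nat.sInf_le ((h r).1 h2))
  rw [wt, e, pow_succ', wt]
lemma blkL {k g : G} {r : ℕ} (hk : k ∈ U.K) (h : U.Blk r g) : U.Blk r (k * g) := by
  obtain ⟨e, k⟩ := hk
  rw [U.memE] at e
  obtain ⟨a, b, c, d⟩ := h
  refine ⟨?_, ?_, ?_, ?_⟩ <;> rw [U.mm] <;> simp only [e.h01, e.h02, e.h31, e.h32, zero_mul, add_zero]
  · exact ad (CF.mul k.h00 a (by omega)) (CF.mul k.h03 c (by omega))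
  · exact ad (CF.mul k.h00 b (by omega)) (CF.mul k.h03 d (by omega))
  · exact ad (CF.mul k.h30 a (by omega)) (CF.mul k.h33 c (by omega))
  · exact ad (CF.mul k.h30 b (by omega)) (CF.mul k.h33 d (by omega))
lemma blkR {k g : G} {r : ℕ} (hk : k ∈ U.K) (h : U.Blk r g) : U.Blk r (g * k) := by
  obtain ⟨e, k⟩ := hk
  rw [U.memE] at e
  obtain ⟨a, b, c, d⟩ := h
  refine ⟨?_, ?_, ?_, ?_⟩ <;> rw [U.mm] <;> simp only [e.h10, e.h20, e.h13, e.h23, mul_zero, add_zero]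
  · exact ad (CF.mul a k.h00 (by omega)) (CF.mul b k.h30 (by omega))
  · exact ad (CF.mul a k.h03 (by omega)) (CF.mul b k.h33 (by omega))
  · exact ad (CF.mul c k.h00 (by omega)) (CF.mul d k.h30 (by omega))
  · exact ad (CF.mul c k.h03 (by omega)) (CF.mul d k.h33 (by omega))
lemma blkL_iff {k g : G} {r : ℕ} (hk : k ∈ U.K) : U.Blk r (k * g) ↔ U.Blk r g :=
  ⟨fun h => by simpa using blkL (U.K.inv_mem hk) h, blkL hk⟩
lemma blkR_iff {k g : G} {r : ℕ} (hk : k ∈ U.K) : U.Blk r (g * k) ↔ U.Blk r g :=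
  ⟨fun h => by simpa using blkR (U.K.inv_mem hk) h, blkR hk⟩
lemma blk_inv {g : G} {r : ℕ} : U.Blk r g⁻¹ ↔ U.Blk r g := by
  simp only [Blk, U.i00, U.i03, U.i30, U.i33, cjm_iff]; tauto
lemma wK {Q : ℕ} {k g k' : G} (hk : k ∈ U.K) (hk' : k' ∈ U.K) : U.wt Q (k * g * k') = U.wt Q g :=
  wt_congr fun r => by rw [blkR_iff hk', blkL_iff hk]
lemma winv {Q : ℕ} {g : G} : U.wt Q g⁻¹ = U.wt Q g := wt_congr fun r => blk_inv
lemma wone {Q : ℕ} : U.wt Q 1 = 1 := by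
  have : sInf {r : ℕ | U.Blk r 1} = 0 := by
    apply Nat.eq_zero_of_le_zero
    apply Nat.sInf_le
    simp [Blk, U.one_e, one0, P00]
  rw [wt, this, pow_zero]

lemma blk_nt {Z T : F} {r : ℕ} (hT : T ≠ 0) (sZ : U.cj Z = -Z) : U.Blk r (U.n 0 0 Z * U.t T) ↔
    T ∈ U.P (-r) ∧ Z * (U.cj T)⁻¹ ∈ U.P (-r) ∧ (U.cj T)⁻¹ ∈ U.P (-r) := by
  have M1 := U.n_mat (N_zero.2 sZ)
  have M2 := U.t_mat hT
  simp only [Blk, U.mm, M1, M2]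
  simp [nM, tM, P00]
lemma blk_nt' {Z T : F} {r : ℕ} (hT : T ≠ 0) (sZ : U.cj Z = -Z) : U.Blk r (U.n 0 0 (U.π * U.π * Z) * U.t (U.π * T)) ↔
    T ∈ U.P (-r - 1) ∧ Z * (U.cj T)⁻¹ ∈ U.P (-r - 1) ∧ (U.cj T)⁻¹ ∈ U.P (-r + 1) := by
  have hp := U.π_ne
  have hT' : U.cj T ≠ 0 := by simpa using hT
  rw [blk_nt (mul_ne_zero hp hT) (by rw [map_mul, map_mul, sZ, U.cjπ]; ring), map_mul, U.cjπ, pmul1]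
  have e : U.π * U.π * Z * (U.π * U.cj T)⁻¹ = U.π * (Z * (U.cj T)⁻¹) := by field_simp
  have e2 : (U.π * U.cj T)⁻¹ = U.π⁻¹ * (U.cj T)⁻¹ := by field_simp
  rw [e, pmul1, e2, Fam.pi1]

section core
variable {φ : G → ℂ} {R Z : Type*} [Fintype R] (A : Fam U R Z)

lemma unitT {T : F} {i : ℤ} (hT0 : T ≠ 0) (hT : T ∈ U.P 0) (h : (U.cj T)⁻¹ ∈ U.P i) : i ≤ 0 := by
  by_contra hi
  have := CF.mul (cjm hT) h (k := 1) (by omega)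
  rw [mul_inv_cancel₀ (by simpa using hT0)] at this
  exact one_not this

/-- all values in the fibre agree when `T` is not integral -/
lemma fib_neg (hφ : HK.Eqv U.J U.τ φ) {V1 V2 Z T : F} (hT0 : T ≠ 0) (hT : T ∉ U.P 0) (sZ : U.cj Z = -Z)
    (hV : D U.toCF (U.m - 2) V1 V2) : φ (U.ns V1 V2 Z * U.t T) = φ (U.n 0 0 Z * U.t T) := by
  have hT' : U.cj T ≠ 0 := by simpa using hT0
  have hTi : (U.cj T)⁻¹ ∈ U.P 1 := by
    rw [← map_inv₀]; refine cjm ?_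
    simpa using inv_of_not (C := U.toCF) (i := -1) (x := T) (by simpa using hT)
  have hD : D U.toCF U.m ((U.cj T)⁻¹ * V1) ((U.cj T)⁻¹ * V2) := D.smul hTi hV (by omega)
  have e : U.ns V1 V2 Z * U.t T = U.n 0 0 Z * U.t T * U.n ((U.cj T)⁻¹ * V1) ((U.cj T)⁻¹ * V2)
      (0 - hh U.toCF ((U.cj T)⁻¹ * V1) ((U.cj T)⁻¹ * V2) ((U.cj T)⁻¹ * V1) ((U.cj T)⁻¹ * V2) / 2) := by
    have h1 := t_ns (U := U) (v1 := (U.cj T)⁻¹ * V1) (v2 := (U.cj T)⁻¹ * V2) (z := 0) hT0 (by simp)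
    rw [mul_inv_cancel_left₀ hT', mul_inv_cancel_left₀ hT', mul_zero] at h1
    have h2 : U.ns V1 V2 Z = U.n 0 0 Z * U.ns V1 V2 0 := by
      rw [n_0_ns sZ, n_0_ns (z := (0:F)) (by simp)]
      congr 1
      have : U.n (0:F) 0 0 = 1 := by
        apply U.ext; intro i j
        rw [n_mat (N_zero.2 (by simp)), U.one_e]
        fin_cases i <;> fin_cases j <;> simp [nM]
      rw [this, one_mul]
    rw [h2, mul_assoc, ← h1, ← mul_assoc, ns]
  have hN := ns_N (U := U) (v1 := (U.cj T)⁻¹ * V1) (v2 := (U.cj T)⁻¹ * V2) (z := 0) (by simp)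
  rw [e, eR hφ (n_J hN hD (sb P00 (div2 hD.hself))), τ_n hN, mul_one]

lemma rep_ne {c : R} (h : c ≠ A.o) : A.rep c ∉ U.P 1 := by
  intro h1
  apply h
  symm; apply A.rep_inj
  rwa [A.rep_o, sub_zero]

lemma V_D (c c' : R) : D U.toCF (U.m - 2) (-(U.π⁻¹ * A.w1 c)) (-(U.π⁻¹ * A.w2 c')) := by
  apply D.neg
  have := A.w_D c c'
  refine ⟨Fam.pi1.2 (CF.mono this.1 (by omega)), Fam.pi1.2 (CF.mono this.2 (by omega))⟩

lemma sum1 {f : R → ℂ} (h : ∀ c, c ≠ A.o → f c = 0) : ∑ c, f c = f A.o := by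
  rw [Finset.sum_eq_single A.o (fun b _ hb => h b hb) (by simp)]

/-- integral `T`, `Z ∈ P(-1)` : sum reduces to a one-dimensional sum over D(m-1) -/
lemma core2 (hφ : HK.Eqv U.J U.τ φ) {Z T : F} (hT0 : T ≠ 0) (hT : T ∈ U.P 0) (sZ : U.cj Z = -Z) (hZ : Z ∈ U.P (-1)) :
    ∃ e1 e2 : F, D U.toCF (U.m - 1) e1 e2 ∧ (∀ c ∉ U.P 1, ¬ D U.toCF U.m (c * e1) (c * e2)) ∧
    ∑ c : R × R, φ (U.ns (-(U.π⁻¹ * A.w1 c.1)) (-(U.π⁻¹ * A.w2 c.2)) Z * U.t T) =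
    ∑ c : R, φ (U.ns (A.rep c * e1) (A.rep c * e2) Z * U.t T) := by
  rw [Fintype.sum_prod_type]
  have hp := U.π_ne
  have pw : ∀ k : ℤ, U.π⁻¹ * U.π ^ k = U.π ^ (k - 1) := fun k => by
    rw [zpow_sub₀ hp, zpow_one]; field_simp
  have np : ∀ (k : ℤ) (x : F), x ∉ U.P 1 → U.π ^ k * x ∉ U.P (k + 1) := by
    intro k x hx h
    rw [pmul] at h; apply hx; convert h using 2; ring
  rcases Int.even_or_odd U.m with hev | hod
  · have e : ∃ k, U.m = 2 * k := by obtain ⟨k, hk⟩ := hev; exact ⟨k, by omega⟩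
    obtain ⟨k, hk⟩ := e
    have d1 : U.m / 2 = k := by omega
    have d2 : (U.m + 1) / 2 = k := by omega
    refine ⟨-(U.π ^ (k - 1)), 0, ⟨ng (CF.mono (ppow _) (by omega)), P00⟩, ?_, ?_⟩
    · intro c hc h
      have := h.1
      rw [d1, mul_neg, ng_iff, mul_comm] at this
      exact np (k - 1) _ hc (by simpa using this)
    · rw [Finset.sum_comm, sum1 A (f := fun y => ∑ x, _)]
      · refine Finset.sum_congr rfl fun c _ => ?_
        simp only [Fam.w1, Fam.w2, A.rep_o, d1, mul_zero, neg_zero, ← pw k]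
        congr 3; ring
      · intro c hc
        have hP : Par U 0 (-(U.π ^ (k - 1) * A.rep c)) (-(U.π ^ (k - 1))) 0 := by
          refine ⟨.inl rfl, .inr rfl, .inl rfl, .inr rfl, ⟨P00, ng (CF.mul (ppow _) (A.rep_mem c) (by omega))⟩,
            ⟨ng (CF.mono (ppow _) (by omega)), P00⟩, ?_⟩
          intro h
          have e : U.cj 0 * 0 - U.cj (-(U.π ^ (k - 1) * A.rep c)) * -(U.π ^ (k - 1)) =
            - (U.π ^ (k - 1) * (U.π ^ (k - 1) * U.cj (A.rep c))) := by
            simp only [map_neg, map_mul, map_zpow₀, U.cjπ]; ring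
          rw [e, ng_iff, pmul, pmul, cjm_iff] at h
          exact rep_ne A hc (by convert h using 2; omega)
        have := hP.fib hφ A hT0 hT sZ hZ
        rw [← this]
        refine Finset.sum_congr rfl fun c' _ => ?_
        simp only [Fam.w1, Fam.w2, d1, d2, mul_zero, add_zero, zero_add, ← pw k]
        congr 3 <;> ring
  · obtain ⟨k, hk⟩ := hod
    have d1 : U.m / 2 = k := by omega
    have d2 : (U.m + 1) / 2 = k + 1 := by omega
    refine ⟨0, -(U.π ^ k), ⟨P00, ng (CF.mono (ppow _) (by omega))⟩, ?_, ?_⟩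
    · intro c hc h
      have := h.2
      rw [d2, mul_neg, ng_iff, mul_comm] at this
      exact np _ _ hc this
    · have pk : U.π⁻¹ * U.π ^ (k + 1) = U.π ^ k := by rw [pw]; congr 1; ring
      rw [sum1 A (f := fun y => ∑ x, _)]
      · refine Finset.sum_congr rfl fun c _ => ?_
        simp only [Fam.w1, Fam.w2, A.rep_o, d2, mul_zero, neg_zero, ← pk]
        congr 3; ring
      · intro c hc
        have hP : Par U (-(U.π ^ (k - 1) * A.rep c)) 0 0 (-(U.π ^ k)) := by
          refine ⟨.inr rfl, .inl rfl, .inr rfl, .inl rfl, ⟨ng (CF.mul (ppow _) (A.rep_mem c) (by omega)), P00⟩,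
            ⟨P00, ng (CF.mono (ppow _) (by omega))⟩, ?_⟩
          intro h
          have e : U.cj (-(U.π ^ (k - 1) * A.rep c)) * -(U.π ^ k) - U.cj 0 * 0 =
            (U.π ^ (k - 1) * (U.π ^ k * U.cj (A.rep c))) := by
            simp only [map_neg, map_mul, map_zpow₀, U.cjπ, map_zero]; ring
          rw [e, pmul, pmul, cjm_iff] at h
          exact rep_ne A hc (by convert h using 2; omega)
        have := hP.fib hφ A hT0 hT sZ hZ
        rw [← this]
        refine Finset.sum_congr rfl fun c' _ => ?_
        simp only [Fam.w1, Fam.w2, d1, d2, mul_zero, add_zero, zero_add, ← pw k, ← pk]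
        congr 3 <;> ring

lemma core (hφ : HK.Eqv U.J U.τ φ) {Z T : F} {ez : ℂ} (hT0 : T ≠ 0) (sZ : U.cj Z = -Z)
    (he : φ (U.n 0 0 Z * U.t T) = U.wt (Fintype.card R) (U.n 0 0 Z * U.t T) * ez)
    (hS : ez ≠ 0 → ∃ r, U.Blk r (U.n 0 0 Z * U.t T)) :
    ∑ c : R × R, φ (U.ns (-(U.π⁻¹ * A.w1 c.1)) (-(U.π⁻¹ * A.w2 c.2)) Z * U.t T) =
      (Fintype.card R : ℂ) * (U.wt (Fintype.card R) (U.n 0 0 (U.π * U.π * Z) * U.t (U.π * T)) * ez) := by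
  have hQ : (Fintype.card R : ℝ) ≠ 0 := by
    have : 0 < Fintype.card R := Fintype.card_pos_iff.2 ⟨A.o⟩
    exact_mod_cast this.ne'
  have hm := U.hm
  have hT' : U.cj T ≠ 0 := by simpa using hT0
  -- reduction on ez
  have const : (∀ V1 V2, D U.toCF (U.m - 2) V1 V2 → φ (U.ns V1 V2 Z * U.t T) = φ (U.n 0 0 Z * U.t T)) →
      (∀ r : ℕ, U.Blk (r + 1) (U.n 0 0 Z * U.t T) ↔ U.Blk r (U.n 0 0 (U.π * U.π * Z) * U.t (U.π * T))) →
      ¬ U.Blk 0 (U.n 0 0 Z * U.t T) → 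
      ∑ c : R × R, φ (U.ns (-(U.π⁻¹ * A.w1 c.1)) (-(U.π⁻¹ * A.w2 c.2)) Z * U.t T) =
      (Fintype.card R : ℂ) * (U.wt (Fintype.card R) (U.n 0 0 (U.π * U.π * Z) * U.t (U.π * T)) * ez) := by
    intro h1 h2 h3
    rw [Finset.sum_congr rfl (fun c _ => h1 _ _ (V_D A c.1 c.2)), Finset.sum_const, he]
    by_cases h0 : ez = 0
    · simp [h0]
    rw [wt_shift h2 h3 (hS h0)]
    have hQ' : (Fintype.card R : ℂ) ≠ 0 := by exact_mod_cast hQ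
    simp only [Finset.card_univ, Fintype.card_prod, nsmul_eq_mul]
    push_cast; field_simp
  by_cases hT : T ∈ U.P 0
  swap
  · refine const (fun V1 V2 hV => fib_neg hφ hT0 hT sZ hV) (fun r => ?_) ?_
    · have hTi : (U.cj T)⁻¹ ∈ U.P 1 := by
        rw [← map_inv₀]; refine cjm ?_
        simpa using inv_of_not (C := U.toCF) (i := -1) (x := T) (by simpa using hT)
      rw [blk_nt hT0 sZ, blk_nt' hT0 sZ]
      push_cast
      rw [neg_add']
      have : (U.cj T)⁻¹ ∈ U.P (-r - 1) := CF.mono hTi (by omega)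
      have : (U.cj T)⁻¹ ∈ U.P (-r + 1) := CF.mono hTi (by omega)
      tauto
    · rw [blk_nt hT0 sZ]; simp [hT]
  have hTr : ∀ i : ℤ, i ≤ 0 → T ∈ U.P i := fun i hi => CF.mono hT hi
  by_cases hZ1 : Z ∈ U.P (-1)
  swap
  · refine const (fun V1 V2 hV => fib_base hφ (l := 2) hT0 hT (by omega) (by omega) hV sZ (by simpa using hZ1)) (fun r => ?_) ?_
    · rw [blk_nt hT0 sZ, blk_nt' hT0 sZ]
      push_cast
      rw [neg_add']
      have h1 := hTr (-r - 1) (by omega)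
      constructor
      · rintro ⟨-, b, c⟩
        refine ⟨h1, b, ?_⟩
        have := of_mul (i := -2) b (by simpa using hZ1)
        exact CF.mono this (by omega)
      · rintro ⟨-, b, c⟩
        exact ⟨h1, b, CF.mono c (by omega)⟩
    · rw [blk_nt hT0 sZ]
      rintro ⟨-, b, -⟩
      have := of_mul (i := -2) b (by simpa using hZ1)
      have := unitT hT0 hT this
      norm_num at this
  obtain ⟨e1, e2, hD, hnD, hs⟩ := core2 A hφ hT0 hT sZ hZ1
  rw [hs]
  by_cases hZ0 : Z ∈ U.P 0
  swap
  · have h1 : ∀ c, φ (U.ns (A.rep c * e1) (A.rep c * e2) Z * U.t T) = φ (U.n 0 0 Z * U.t T) := fun c =>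
      fib_base hφ (l := 1) (k := U.m - 1) hT0 hT (by omega) (by omega) (D.smul (A.rep_mem c) hD (by omega)) sZ (by simpa using hZ0)
    rw [Finset.sum_congr rfl (fun c _ => h1 c), Finset.sum_const, he]
    have : U.wt (Fintype.card R) (U.n 0 0 Z * U.t T) =
        U.wt (Fintype.card R) (U.n 0 0 (U.π * U.π * Z) * U.t (U.π * T)) := by
      apply wt_congr
      intro r
      rw [blk_nt hT0 sZ, blk_nt' hT0 sZ]
      constructor
      · rintro ⟨-, b, c⟩
        exact ⟨hTr _ (by omega), CF.mono b (by omega), CF.mono (of_mul (i := -1) b (by simpa using hZ0)) (by omega)⟩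
      · rintro ⟨-, b, c⟩
        exact ⟨hTr _ (by omega), CF.mul hZ1 c (by omega), CF.mono c (by omega)⟩
    rw [this]
    simp
  · rw [sum1 A]
    · rw [A.rep_o, zero_mul, zero_mul, ns0, he]
      by_cases h0 : ez = 0
      · simp [h0]
      have hb : ∀ r : ℕ, U.Blk (r + 1) (U.n 0 0 (U.π * U.π * Z) * U.t (U.π * T)) ↔ U.Blk r (U.n 0 0 Z * U.t T) := by
        intro r
        rw [blk_nt hT0 sZ, blk_nt' hT0 sZ]
        push_cast
        constructor
        · rintro ⟨-, b, c⟩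
          have c' : (U.cj T)⁻¹ ∈ U.P (-r) := CF.mono c (by omega)
          exact ⟨hTr _ (by omega), CF.mul hZ0 c' (by omega), c'⟩
        · rintro ⟨-, b, c⟩
          exact ⟨hTr _ (by omega), CF.mono b (by omega), CF.mono c (by omega)⟩
      have hb0 : ¬ U.Blk 0 (U.n 0 0 (U.π * U.π * Z) * U.t (U.π * T)) := by
        rw [blk_nt' hT0 sZ]
        rintro ⟨-, -, c⟩
        have := unitT hT0 hT c
        norm_num at this
      obtain ⟨r, hr⟩ := hS h0
      rw [wt_shift hb hb0 ⟨r + 1, (hb r).2 hr⟩]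
      have hQ' : (Fintype.card R : ℂ) ≠ 0 := by exact_mod_cast hQ
      push_cast; field_simp
    · intro c hc
      refine lemI0 hφ (i := U.m - 1) (by omega) (by omega) (D.smul (A.rep_mem c) hD (by omega)) ?_ hT0 hT sZ hZ0
      have := hnD _ (rep_ne A hc)
      rwa [show U.m - 1 + 1 = U.m by ring]
end core
end CG
end UC

namespace UC
open CF
namespace CG
variable {F : Type u} [Field F] {G : Type v} [Group G] {U : CG F G}
section A6
variable {R Z : Type*} [Fintype R] [Fintype Z] (A : Fam U R Z)

lemma eqvK {φ : G → ℂ} (hφ : HK.Eqv U.J U.τ φ) {k : G} (hk : k ∈ U.K) : HK.Eqv U.J U.τ (fun g => φ (g * k)) := by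
  intro j hj g j' hj'
  have h1 := Knorm (U.K.inv_mem hk) hj'
  have e : j * g * j' * k = j * (g * k) * (k⁻¹ * j' * k⁻¹⁻¹) := by group
  simp only []
  rw [e, hφ j hj _ _ h1, τ_conj (U.GE.inv_mem hk.1)]

lemma blk_ga (r : ℕ) : U.Blk r (U.ga ^ r) := by
  have M := U.t_mat (pow_ne_zero r U.π_ne)
  rw [ga_pow]
  simp only [Blk, M]
  simp only [tM]
  refine ⟨?_, ?_, ?_, ?_⟩
  · simp
    have := CF.mono (ppow (C := U.toCF) (r : ℤ)) (by omega : (-r:ℤ) ≤ r)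
    simpa using this
  · simp [P00]
  · simp [P00]
  · simp [U.cjπ]
    have := ppow (C := U.toCF) (-r : ℤ)
    simpa using this

lemma A6 (φ e : G → ℂ) (hφ : HK.IsH U.J (⊤ : Subgroup G) U.τ φ) (he : HK.IsH (U.J ⊓ U.GE) U.GE U.τ e)
    (h : ∀ y ∈ U.GE, φ y = U.wt (Fintype.card R) y * e y) (y : G) (hy : y ∈ U.GE) :
    (Fintype.card R : ℂ)⁻¹ * ∑ i, φ ((A.x i)⁻¹ * y) = U.wt (Fintype.card R) y * ∑ i, e ((A.x' i)⁻¹ * y) := by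
  obtain ⟨b, τ, Nb, hτ, k, hk, rfl⟩ := iwa hy
  have sb := N_zero.1 Nb
  have hp := U.π_ne
  have hQ : (Fintype.card R : ℂ) ≠ 0 := by
    have : 0 < Fintype.card R := Fintype.card_pos_iff.2 ⟨A.o⟩
    exact_mod_cast this.ne'
  set T := U.π⁻¹ * τ with hTdef
  have hT0 : T ≠ 0 := mul_ne_zero (inv_ne_zero hp) hτ
  have sk1 : ∀ q, U.cj (b - A.zr q) = -(b - A.zr q) := fun q => by rw [map_sub, sb, A.zr_sk]; ring
  have skZ : ∀ q, U.cj (U.π⁻¹ * U.π⁻¹ * (b - A.zr q)) = -(U.π⁻¹ * U.π⁻¹ * (b - A.zr q)) := fun q => by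
    rw [map_mul, sk1, map_mul, map_inv₀, U.cjπ]; ring
  have gt : (U.ga)⁻¹ * U.t τ = U.t T := by rw [ga_inv, t_mul (inv_ne_zero hp) hτ]
  have main : ∀ v1 v2 q, (U.ns v1 v2 (A.zr q) * U.ga)⁻¹ * (U.n 0 0 b * U.t τ * k) =
      U.ns (-(U.π⁻¹ * v1)) (-(U.π⁻¹ * v2)) (U.π⁻¹ * U.π⁻¹ * (b - A.zr q)) * U.t T * k := by
    intro v1 v2 q
    have h1 := t_ns (U := U) (v1 := -v1) (v2 := -v2) (inv_ne_zero hp) (sk1 q)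
    rw [map_inv₀, U.cjπ, ← ga_inv] at h1
    rw [mul_inv_rev, ns_inv (A.zr_sk q), ← gt]
    have h2 := ns_mul0 (U := U) (v1 := -v1) (v2 := -v2) (sk_neg (A.zr_sk q)) sb
    rw [show -A.zr q + b = b - A.zr q by ring] at h2
    rw [← h2] at h1
    simp only [mul_neg] at h1
    calc _ = (U.ga)⁻¹ * (U.ns (-v1) (-v2) (-A.zr q) * U.n 0 0 b) * U.t τ * k := by simp only [mul_assoc]
      _ = _ := by rw [h1]; simp only [mul_assoc]
  have main' : ∀ q, (A.x' q)⁻¹ * (U.n 0 0 b * U.t τ * k) =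
      U.n 0 0 (U.π⁻¹ * U.π⁻¹ * (b - A.zr q)) * U.t T * k := by
    intro q
    have := main 0 0 q
    simp only [mul_zero, neg_zero, ns0] at this
    exact this
  have key : ∀ q, ∑ c : R × R, φ ((A.x (c.1, c.2, q))⁻¹ * (U.n 0 0 b * U.t τ * k)) =
      (Fintype.card R : ℂ) * (U.wt (Fintype.card R) (U.n 0 0 b * U.t τ * k) *
        e ((A.x' q)⁻¹ * (U.n 0 0 b * U.t τ * k))) := by
    intro q
    have hc := core (φ := fun g => φ (g * k)) A (eqvK hφ.1 hk) (T := T)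
      (ez := e ((A.x' q)⁻¹ * (U.n 0 0 b * U.t τ * k))) hT0 (skZ q) ?_ ?_
    · simp only [Fam.x, main]
      rw [hc]
      congr 3
      have e1 : U.π * U.π * (U.π⁻¹ * U.π⁻¹ * (b - A.zr q)) = b - A.zr q := by field_simp
      have e2 : U.π * T = τ := by rw [hTdef]; field_simp
      rw [e1, e2]
      have e3 : U.n 0 0 (b - A.zr q) = U.n 0 0 (- A.zr q) * U.n 0 0 b := by
        rw [← ns0 (-A.zr q), ns_mul0 (sk_neg (A.zr_sk q)) sb, ns0]; congr 1; ring
      rw [e3]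
      have kz : U.n 0 0 (-A.zr q) ∈ U.K := n_K (N_zero.2 (sk_neg (A.zr_sk q)))
        (CF.mono (ng (A.zr_mem q)) (by have := U.hm; omega))
      have := wK (U := U) (Q := Fintype.card R) (g := U.n 0 0 b * U.t τ) kz U.K.one_mem
      rw [mul_one] at this
      rw [mul_assoc, this]
      have := wK (U := U) (Q := Fintype.card R) (g := U.n 0 0 b * U.t τ) U.K.one_mem hk
      rw [one_mul] at this
      rw [this]
    · rw [main']
      show φ _ = _
      rw [h _ (U.GE.mul_mem (U.GE.mul_mem (n_E (N_zero.2 (skZ q))) (t_E hT0)) hk.1)]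
      have := wK (U := U) (Q := Fintype.card R) (g := U.n 0 0 (U.π⁻¹ * U.π⁻¹ * (b - A.zr q)) * U.t T) U.K.one_mem hk
      rw [one_mul] at this
      rw [this]
    · intro hne
      rw [main'] at hne
      obtain ⟨k1, hk1, k2, hk2, r, er⟩ := A4 e he _ hne
      refine ⟨r, (blkR_iff hk).1 ?_⟩
      rw [er, blkR_iff hk2, blkL_iff hk1]
      exact blk_ga r
  have hsum : ∑ i, φ ((A.x i)⁻¹ * (U.n 0 0 b * U.t τ * k)) =
      ∑ q, ∑ c : R × R, φ ((A.x (c.1, c.2, q))⁻¹ * (U.n 0 0 b * U.t τ * k)) := by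
    rw [← (Equiv.prodAssoc R R Z).sum_comp, Fintype.sum_prod_type, Finset.sum_comm]
    rfl
  rw [hsum, Finset.sum_congr rfl (fun q _ => key q), ← Finset.mul_sum, inv_mul_cancel_left₀ hQ, Finset.mul_sum]
end A6

section
variable {R Z : Type*} [Fintype R] [Fintype Z]
def HDof (A : Fam U R Z) : HK.HD G (R × R × Z) Z where
  GE := U.GE
  J := U.J
  K := U.K
  τ := U.τ
  wt := U.wt (Fintype.card R)
  a := U.ga
  x := A.x
  x' := A.x'
  ω := (Fintype.card R : ℂ)⁻¹
  KGE := fun _ h => h.1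
  JK := JK
  chi := chi
  conj := fun g hg y => τ_conj hg y
  Knorm := fun k hk j hj => Knorm hk hj
  A1 := A1
  A2 := A2
  aGE := ga_E
  ainv := ainv
  xmem := fun i => ⟨_, A.uJ i, τ_n (ns_N (A.zr_sk _)), rfl⟩
  xinj := A.xinj
  xsur := A.xsur
  xmem' := fun i => ⟨_, A.uE i, τ_n (N_zero.2 (A.zr_sk _)), rfl⟩
  xinj' := A.xinj'
  xsur' := A.xsur'
  wpos := wpos (Fintype.card_pos_iff.2 ⟨A.o⟩)
  wK := fun k hk g _ k' hk' => wK hk hk'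
  winv := fun g _ => winv
  wone := wone
  A4 := A4
  A6 := fun φ e hφ he h y hy => A6 A φ e hφ he h y hy
  A7a := A7a
  A7b := fun r i h => A7b A r i h
end

lemma finq {B C : AddSubgroup F} {S : Type*} [Finite S] (f : S → F) (h : ∀ x ∈ B, ∃ s, x - f s ∈ C) :
    Finite (B ⧸ C.addSubgroupOf B) := by
  choose g hg using h
  have : Function.Injective (fun q : B ⧸ C.addSubgroupOf B => g _ q.out.2) := by
    intro p q hpq
    simp only [] at hpq
    have h1 := hg _ p.out.2
    have h2 := hg _ q.out.2
    rw [hpq] at h1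
    have := C.sub_mem h2 h1
    rw [sub_sub_sub_cancel_right] at this
    rw [← p.out_eq, ← q.out_eq, QuotientAddGroup.eq]
    rw [AddSubgroup.mem_addSubgroupOf]
    convert this using 1
    simp; ring
  exact Finite.of_injective _ this

variable (U) in
def skG (k : ℤ) : AddSubgroup F where
  carrier := {x | x ∈ U.P k ∧ U.cj x = -x}
  zero_mem' := ⟨P00, by simp⟩
  add_mem' := fun ⟨a, b⟩ ⟨c, d⟩ => ⟨ad a c, by rw [map_add, b, d]; ring⟩
  neg_mem' := fun ⟨a, b⟩ => ⟨ng a, by rw [map_neg, b]⟩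

variable (U) in
abbrev RT := U.P 0 ⧸ (U.P 1).addSubgroupOf (U.P 0)
variable (U) in
abbrev ZT := U.skG U.m ⧸ (U.P (U.m + 2)).addSubgroupOf (U.skG U.m)

lemma out_sub {B C : AddSubgroup F} (x : B) : (x : F) - ((QuotientAddGroup.mk x : B ⧸ C.addSubgroupOf B).out : F) ∈ C := by
  have h : (QuotientAddGroup.mk ((QuotientAddGroup.mk x : B ⧸ C.addSubgroupOf B).out) : B ⧸ C.addSubgroupOf B) = QuotientAddGroup.mk x := Quotient.out_eq _
  rw [QuotientAddGroup.eq, AddSubgroup.mem_addSubgroupOf] at h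
  convert h using 1
  simp; ring
lemma out_inj {B C : AddSubgroup F} (p q : B ⧸ C.addSubgroupOf B) (h : (q.out : F) - p.out ∈ C) : p = q := by
  rw [← p.out_eq, ← q.out_eq, QuotientAddGroup.eq, AddSubgroup.mem_addSubgroupOf]
  convert h using 1
  simp; ring
lemma rsub (c : U.RT) : ((if c = 0 then 0 else c.out : U.P 0) : F) - c.out ∈ U.P 1 := by
  split_ifs with h
  · have := out_sub (C := U.P 1) (0 : U.P 0)
    rw [h]; exact this
  · simp [P00]
variable (U) in
def famOf : Fam U U.RT U.ZT where
  rep := fun c => ((if c = 0 then 0 else c.out : U.P 0) : F)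
  o := 0
  rep_o := by simp
  rep_mem := fun i => SetLike.coe_mem _
  rep_inj := by
    intro i j h
    apply out_inj
    have := ad (sb h (rsub j)) (rsub i)
    convert this using 1; ring
  rep_sur := by
    intro x hx
    refine ⟨QuotientAddGroup.mk ⟨x, hx⟩, ?_⟩
    have h1 := out_sub (C := U.P 1) (⟨x, hx⟩ : U.P 0)
    have h2 := rsub (QuotientAddGroup.mk (⟨x, hx⟩ : U.P 0) : U.RT)
    have := sb h1 h2
    convert this using 1; simp
  zr := fun q => (q.out : F)
  zr_sk := fun q => q.out.2.2
  zr_mem := fun q => q.out.2.1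
  zr_inj := fun p q h => out_inj p q h
  zr_sur := fun x hx hs => ⟨QuotientAddGroup.mk ⟨x, hx, hs⟩, out_sub (B := U.skG U.m) ⟨x, hx, hs⟩⟩

lemma finR {S : Type*} [Finite S] (f : S → F) (h : ∀ x ∈ U.P 0, ∃ s, x - f s ∈ U.P 1) : Finite U.RT := finq f h
lemma finZ {S : Type*} [Finite S] (f : S → F) (h : ∀ x ∈ U.P 0, ∃ s, x - f s ∈ U.P 1) : Finite U.ZT := by
  refine finq (S := S × S) (fun s => U.π ^ U.m * (f s.1 + U.π * f s.2)) ?_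
  rintro x ⟨hx, -⟩
  have hp := U.π_ne
  have hpm : U.π ^ U.m ≠ 0 := πn
  have h1 : U.π ^ (-U.m) * x ∈ U.P 0 := by rw [pmul]; convert hx using 2; ring
  obtain ⟨s, hs⟩ := h _ h1
  have h2 : U.π⁻¹ * (U.π ^ (-U.m) * x - f s) ∈ U.P 0 := by rw [Fam.pi1]; simpa using hs
  obtain ⟨s', hs'⟩ := h _ h2
  refine ⟨(s, s'), ?_⟩
  have e : x - U.π ^ U.m * (f s + U.π * f s') = U.π ^ U.m * (U.π * (U.π⁻¹ * (U.π ^ (-U.m) * x - f s) - f s')) := by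
    rw [zpow_neg]; field_simp; ring
  simp only []
  rw [e, pmul, pmul1]
  exact CF.mono hs' (by omega)
end CG
end UC

namespace UT
open UC UC.CF USetting
variable {F : Type u} [Field F] {T : USetting F (Fin 4 → F)}

lemma two_unit (hodd : ¬ (2 ∣ T.residueChar)) : ∃ y ∈ T.O, (2 : F) * y = 1 := by
  by_contra h
  push Not at h
  obtain ⟨z, hz, e⟩ := T.unif 2 (ofNat_mem T.O 2) h
  set I : Ideal T.O := Ideal.span {(⟨T.ϖ, T.ϖ_mem⟩ : T.O)} with hI
  have h2 : ((2 : ℕ) : T.O ⧸ I) = 0 := by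
    have : Ideal.Quotient.mk I (2 : T.O) = 0 := by
      rw [Ideal.Quotient.eq_zero_iff_mem, hI, Ideal.mem_span_singleton]
      refine ⟨⟨z, hz⟩, ?_⟩
      exact Subtype.ext e
    rw [map_ofNat] at this
    exact_mod_cast this
  have h3 : T.residueChar ∣ 2 := ringChar.dvd h2
  rcases (Nat.dvd_prime Nat.prime_two).1 h3 with h4 | h4
  · have h5 : ((1 : ℕ) : T.O ⧸ I) = 0 := by
      have := ringChar.Nat.cast_ringChar (R := T.O ⧸ I)
      have e1 : ringChar (T.O ⧸ I) = 1 := h4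
      rwa [e1] at this
    have h6 : Ideal.Quotient.mk I (1 : T.O) = 0 := by simpa using h5
    rw [Ideal.Quotient.eq_zero_iff_mem, hI, Ideal.mem_span_singleton] at h6
    obtain ⟨y, hy⟩ := h6
    exact T.ϖ_not_unit y y.2 (by simpa using (congrArg Subtype.val hy).symm)
  · exact hodd (by rw [h4])

def mu (T : USetting F (Fin 4 → F)) (Y : F) : F := Y * T.conj Y

variable (hodd : ¬ (2 ∣ T.residueChar)) (hunram : T.IsUnramifiedQuadratic) {Y : F}
  (hY : Y ∈ T.O) (hYu : ∃ z ∈ T.O, Y * z = 1)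

lemma Yne (hYu : ∃ z ∈ T.O, Y * z = 1) : Y ≠ 0 := by
  rintro rfl; obtain ⟨z, -, h⟩ := hYu; simp at h
lemma Yinv (hYu : ∃ z ∈ T.O, Y * z = 1) : Y⁻¹ ∈ T.O := by
  obtain ⟨z, hz, h⟩ := hYu
  rwa [← eq_inv_of_mul_eq_one_right h]
lemma cYne (hYu : ∃ z ∈ T.O, Y * z = 1) : T.conj Y ≠ 0 := by simpa using Yne hYu
lemma mu_ne (hYu : ∃ z ∈ T.O, Y * z = 1) : mu T Y ≠ 0 := mul_ne_zero (Yne hYu) (cYne hYu)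
lemma mu_mem (hY : Y ∈ T.O) : mu T Y ∈ T.O := T.O.mul_mem hY (T.conj_O _ hY)
lemma mu_inv (hYu : ∃ z ∈ T.O, Y * z = 1) : (mu T Y)⁻¹ ∈ T.O := by
  rw [mu, mul_inv, ← map_inv₀]
  exact T.O.mul_mem (Yinv hYu) (T.conj_O _ (Yinv hYu))
lemma mu_cj : T.conj (mu T Y) = mu T Y := by rw [mu, map_mul, T.conj_invol, mul_comm]
lemma zmem {x : F} (h : x ∈ T.O) (h' : x⁻¹ ∈ T.O) (k : ℤ) : x ^ k ∈ T.O := by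
  rcases Int.eq_nat_or_neg k with ⟨n, rfl | rfl⟩
  · rw [zpow_natCast]; exact T.O.pow_mem h n
  · rw [zpow_neg, zpow_natCast, ← inv_pow]; exact T.O.pow_mem h' n

def cf (hodd : ¬ (2 ∣ T.residueChar)) (hunram : T.IsUnramifiedQuadratic) {Y : F}
  (hY : Y ∈ T.O) (hYu : ∃ z ∈ T.O, Y * z = 1) : CF F where
  cj := T.conj
  cj_cj := T.conj_invol
  O := T.O
  π := T.ϖ * mu T Y
  π_mem := T.O.mul_mem T.ϖ_mem (mu_mem hY)
  π_ne := mul_ne_zero T.ϖ_ne_zero (mu_ne hYu)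
  π_nu := fun y hy h => T.ϖ_not_unit (mu T Y * y) (T.O.mul_mem (mu_mem hY) hy) (by rw [← h]; ring)
  cjO := T.conj_O
  val := T.O_val
  unif := fun x hx h => by
    obtain ⟨z, hz, e⟩ := T.unif x hx h
    refine ⟨(mu T Y)⁻¹ * z, T.O.mul_mem (mu_inv hYu) hz, ?_⟩
    have := mu_ne hYu
    rw [e]; field_simp
  cjπ := by rw [map_mul, hunram.1, mu_cj]
  two := by rintro h; obtain ⟨y, -, e⟩ := two_unit hodd; rw [h] at e; simp at e
  half := by obtain ⟨y, hy, e⟩ := two_unit hodd; rwa [← eq_inv_of_mul_eq_one_right e]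
  s := hunram.2.choose_spec.choose
  cjs := hunram.2.choose_spec.choose_spec.2.2.2.2.2
  s_ne := by
    obtain ⟨h1, ⟨y, hy, h2⟩, h3, h4, h5, h6⟩ := hunram.2.choose_spec.choose_spec
    intro h
    rw [h] at h5
    rw [← h5] at h2
    simp at h2
  s_mem := by
    obtain ⟨h1, ⟨y, hy, h2⟩, h3, h4, h5, h6⟩ := hunram.2.choose_spec.choose_spec
    generalize hunram.2.choose_spec.choose = s at *
    generalize hunram.2.choose = ε at *
    by_cases h : s = 0
    · rw [h]; exact T.O.zero_mem
    rcases T.O_val s h with h | h'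
    · exact h
    · have : s = s⁻¹ * ε := by rw [← h5]; field_simp
      rw [this]; exact T.O.mul_mem h' h1
  s_inv := by
    obtain ⟨h1, ⟨y, hy, h2⟩, h3, h4, h5, h6⟩ := hunram.2.choose_spec.choose_spec
    generalize hunram.2.choose_spec.choose = s at *
    generalize hunram.2.choose = ε at *
    by_cases h : s = 0
    · rw [h, inv_zero]; exact T.O.zero_mem
    rcases T.O_val s h with h' | h'
    · have : s⁻¹ = s * y := by
        rw [inv_eq_iff_eq_inv, eq_comm]; apply inv_eq_of_mul_eq_one_right; rw [← h2, ← h5]; ring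
      rw [this]; exact T.O.mul_mem h' hy
    · exact h'

lemma P_iff (k : ℤ) (x : F) : x ∈ (cf hodd hunram hY hYu).P k ↔ T.ϖ ^ (-k) * x ∈ T.O := by
  rw [P_def]
  show (T.ϖ * mu T Y) ^ (-k) * x ∈ T.O ↔ _
  rw [mul_zpow]
  have h0 : mu T Y ≠ 0 := mu_ne hYu
  have h1 := zmem (mu_mem hY) (mu_inv hYu) (-k)
  have h2 := zmem (mu_mem hY) (mu_inv hYu) k
  constructor
  · intro h
    have := T.O.mul_mem h h2
    convert this using 1
    rw [zpow_neg (mu T Y)]; field_simp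
  · intro h
    have := T.O.mul_mem h h1
    convert this using 1
    ring

section tr
variable (F₀ : Type w) [Field F₀] [Algebra F₀ F] [FiniteDimensional F₀ F]
    (hfix : T.FixedField F₀) (hdeg : Module.finrank F₀ F = 2)
include hodd hfix hdeg
lemma trace_eq (x : F) : algebraMap F₀ F (Algebra.trace F₀ F x) = x + T.conj x := by
  have two : (2:F) ≠ 0 := by rintro h; obtain ⟨y, -, e⟩ := two_unit hodd; rw [h] at e; simp at e
  let c : F ≃ₐ[F₀] F := AlgEquiv.ofRingEquiv (f := T.conj) (fun r => (hfix _).2 ⟨r, rfl⟩)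
  have h1 : Algebra.trace F₀ F (T.conj x) = Algebra.trace F₀ F x := Algebra.trace_eq_of_algEquiv c x
  obtain ⟨a, ha⟩ := (hfix (x + T.conj x)).1 (by rw [map_add, T.conj_invol, add_comm])
  have h2 : Algebra.trace F₀ F (x + T.conj x) = 2 * a := by
    rw [← ha, Algebra.trace_algebraMap, hdeg, two_nsmul, two_mul]
  rw [map_add, h1, ← two_mul] at h2
  have two' : (2:F₀) ≠ 0 := by
    intro h; apply two
    have := congrArg (algebraMap F₀ F) h
    rwa [map_ofNat, map_zero] at this
  rw [mul_left_cancel₀ two' h2, ha]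
end tr
end UT

namespace UT
open UC UC.CF USetting
variable {F : Type u} [Field F] {T : USetting F (Fin 4 → F)}

def sc (Y : F) : Fin 4 → F := ![1, Y, 1, 1]
def mt (Y : F) (X : Module.End F (Fin 4 → F)) : M4 F :=
  fun i j => (sc Y i)⁻¹ * LinearMap.toMatrix' X i j * sc Y j
def tm (Y : F) (M : M4 F) : Module.End F (Fin 4 → F) :=
  Matrix.toLin' (fun i j => sc Y i * M i j * (sc Y j)⁻¹ : M4 F)

variable {Y : F} (h0 : Y ≠ 0)
include h0
lemma sc_ne (i : Fin 4) : sc Y i ≠ 0 := by fin_cases i <;> simp [sc, h0]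
lemma mt_tm (M : M4 F) : mt Y (tm Y M) = M := by
  ext i j
  have := sc_ne h0 i
  have := sc_ne h0 j
  have e : LinearMap.toMatrix' (tm Y M) = (fun i j => sc Y i * M i j * (sc Y j)⁻¹ : M4 F) := LinearMap.toMatrix'_toLin' _
  simp only [mt, e]
  field_simp
lemma mt_inj {X Z : Module.End F (Fin 4 → F)} (h : mt Y X = mt Y Z) : X = Z := by
  apply LinearMap.toMatrix'.injective
  ext i j
  have h1 := sc_ne h0 i
  have h2 := sc_ne h0 j
  have := congrFun (congrFun h i) j
  simp only [mt] at this
  exact mul_left_cancel₀ (inv_ne_zero h1) (mul_right_cancel₀ h2 this)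
lemma mt_mul (X Z : Module.End F (Fin 4 → F)) : mt Y (X * Z) = mt Y X * mt Y Z := by
  ext i j
  rw [Matrix.mul_apply]
  simp only [mt, Module.End.mul_eq_comp, LinearMap.toMatrix'_comp, Matrix.mul_apply, Finset.mul_sum, Finset.sum_mul]
  refine Finset.sum_congr rfl fun k _ => ?_
  have := sc_ne h0 k
  field_simp
lemma mt_one : mt Y 1 = 1 := by
  ext i j
  have := sc_ne h0 i
  simp only [mt, Module.End.one_eq_id, LinearMap.toMatrix'_id, Matrix.one_apply]
  split_ifs with h
  · rw [h] at this ⊢; field_simp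
  · simp
omit h0 in
lemma mt_add (X Z : Module.End F (Fin 4 → F)) : mt Y (X + Z) = mt Y X + mt Y Z := by
  ext i j; simp [mt]; ring
omit h0 in
lemma mt_sub (X Z : Module.End F (Fin 4 → F)) : mt Y (X - Z) = mt Y X - mt Y Z := by
  ext i j; simp [mt]; ring
lemma mt_tr (X : Module.End F (Fin 4 → F)) : LinearMap.trace F _ X = (mt Y X).trace := by
  rw [LinearMap.trace_eq_matrix_trace F (Pi.basisFun F (Fin 4))]
  show (LinearMap.toMatrix' X).trace = _
  refine Finset.sum_congr rfl fun i _ => ?_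
  have := sc_ne h0 i
  simp [mt, Matrix.diag]
  field_simp
omit h0

lemma sig (hform : T.IsU4Form) (hodd) (hunram) (hY : Y ∈ T.O) (hYu) (X : Module.End F (Fin 4 → F)) :
    mt Y (T.σA X) = adj (cf (T := T) hodd hunram hY hYu) (mt Y X) := by
  have h0 := Yne hYu
  have h1 := cYne hYu
  have hp := T.ϖ_ne_zero
  have E : ∀ (k j : Fin 4), T.h (Pi.single k 1) (T.σA X (Pi.single j 1)) = T.h (X (Pi.single k 1)) (Pi.single j 1) :=
    fun k j => (T.σA_adj X _ _).symm
  simp only [hform _ _] at E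
  have A : ∀ (X : Module.End F (Fin 4 → F)) i j, LinearMap.toMatrix' X i j = X (Pi.single j 1) i := by
    intro X i j; rw [LinearMap.toMatrix'_apply]
  have e3 := E 3; have e1 := E 1; have e2 := E 2; have e0 := E 0
  simp at e3 e1 e2 e0
  ext i j
  fin_cases i <;> fin_cases j <;>
  simp [mt, adj, A, sc, cf, mu, e3, e1, e2, e0] 
  all_goals try field_simp
  · rw [mul_comm, e1]; simp
  · apply mul_left_cancel₀ hp; rw [e1]; simp
  · rw [mul_comm, e1]; simp
  · rw [mul_comm, e1]; simp

lemma mt_beta (hunram : T.IsUnramifiedQuadratic) (hYu : ∃ z ∈ T.O, Y * z = 1) (m : ℤ) :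
    mt Y (Matrix.toLin' (T.betaMat m Y)) = !![0,0,0,0; 0,0,T.ϖ ^ (-m),0; 0,-(T.ϖ ^ (-m) * (T.ϖ * mu T Y)),0,0; 0,0,0,0] := by
  have h0 := Yne hYu
  have hp := T.ϖ_ne_zero
  ext i j
  fin_cases i <;> fin_cases j <;> simp [mt, sc, betaMat, mu]
  · field_simp
  · rw [sub_eq_add_neg, zpow_add₀ hp, zpow_one, zpow_neg]; field_simp

lemma cent_iff (hodd) (hunram) (hY : Y ∈ T.O) (hYu) (m : ℤ) (X : Module.End F (Fin 4 → F)) :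
    X ∈ Bcent (Matrix.toLin' (T.betaMat m Y)) ↔ EM (cf (T := T) hodd hunram hY hYu) (mt Y X) := by
  have h0 := Yne hYu
  have hp : T.ϖ ^ (-m) ≠ 0 := zpow_ne_zero _ T.ϖ_ne_zero
  have hq := mul_ne_zero T.ϖ_ne_zero (mu_ne hYu)
  have h1 : X ∈ Bcent (Matrix.toLin' (T.betaMat m Y)) ↔
      mt Y X * mt Y (Matrix.toLin' (T.betaMat m Y)) = mt Y (Matrix.toLin' (T.betaMat m Y)) * mt Y X := by
    rw [← mt_mul h0, ← mt_mul h0]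
    exact ⟨fun h => congrArg _ h, fun h => mt_inj h0 h⟩
  rw [h1, mt_beta hunram hYu]
  have pp : (cf hodd hunram hY hYu).π = T.ϖ * mu T Y := rfl
  generalize T.ϖ * mu T Y = q at *
  generalize T.ϖ ^ (-m) = p at *
  generalize mt Y X = M
  constructor
  · intro h
    have e := fun i j => congrFun (congrFun h i) j
    simp only [Matrix.mul_apply, Fin.sum_univ_four] at e
    have e01 := e 0 1; have e02 := e 0 2; have e10 := e 1 0; have e20 := e 2 0
    have e13 := e 1 3; have e23 := e 2 3; have e31 := e 3 1; have e32 := e 3 2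
    have e11 := e 1 1; have e12 := e 1 2
    simp [hp, hq] at e01 e02 e10 e20 e13 e23 e31 e32 e11 e12
    refine ⟨e02, e01, e20, e10, e23, e13, e32, e31, ?_, ?_⟩
    · apply mul_left_cancel₀ hp; rw [← e12]; ring
    · rw [pp]; apply mul_left_cancel₀ hp; rw [← e11]; ring
  · rintro ⟨a1, a2, a3, a4, a5, a6, a7, a8, a9, a10⟩
    rw [pp] at a10
    ext i j
    rw [Matrix.mul_apply, Matrix.mul_apply, Fin.sum_univ_four, Fin.sum_univ_four]
    fin_cases i <;> fin_cases j <;> simp [a1, a2, a3, a4, a5, a6, a7, a8, a9, a10] <;> ring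

structure BP (C : CF F) (M : M4 F) : Prop where
  b00 : M 0 0 = 0
  b03 : M 0 3 = 0
  b30 : M 3 0 = 0
  b33 : M 3 3 = 0
  b22 : M 2 2 = - M 1 1
  b21 : M 2 1 = C.π * M 1 2

lemma perp_iff (hodd) (hunram) (hY : Y ∈ T.O) (hYu) (m : ℤ) (X : Module.End F (Fin 4 → F)) :
    X ∈ Bperp (Matrix.toLin' (T.betaMat m Y)) ↔ BP (cf (T := T) hodd hunram hY hYu) (mt Y X) := by
  have h0 := Yne hYu
  have h1 : X ∈ Bperp (Matrix.toLin' (T.betaMat m Y)) ↔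
      ∀ M, EM (cf (T := T) hodd hunram hY hYu) M → (mt Y X * M).trace = 0 := by
    constructor
    · intro h M hM
      have := h (tm Y M) ((cent_iff hodd hunram hY hYu m _).2 (by rwa [mt_tm h0]))
      rwa [mt_tr h0, mt_mul h0, mt_tm h0] at this
    · intro h Z hZ
      rw [mt_tr h0, mt_mul h0]
      exact h _ ((cent_iff hodd hunram hY hYu m _).1 hZ)
  rw [h1]
  generalize mt Y X = M
  generalize cf hodd hunram hY hYu = C
  have tr4 : ∀ N : M4 F, (M * N).trace = ∑ i, ∑ j, M i j * N j i := fun N => rfl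
  simp only [tr4, Fin.sum_univ_four]
  constructor
  · intro h
    have a := fun x y z w b c => h !![x,0,0,y; 0,b,c,0; 0,-(C.π*c),b,0; z,0,0,w] (by constructor <;> simp)
    have a1 := a 1 0 0 0 0 0; have a2 := a 0 1 0 0 0 0; have a3 := a 0 0 1 0 0 0
    have a4 := a 0 0 0 1 0 0; have a5 := a 0 0 0 0 1 0; have a6 := a 0 0 0 0 0 1
    simp at a1 a2 a3 a4 a5 a6
    refine ⟨a1, a3, a2, a4, ?_, ?_⟩
    · linear_combination a5
    · linear_combination a6
  · rintro ⟨b1, b2, b3, b4, b5, b6⟩ N ⟨a1, a2, a3, a4, a5, a6, a7, a8, a9, a10⟩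
    rw [b1, b2, b3, b4, b5, b6, a1, a2, a3, a4, a5, a6, a7, a8, a9, a10]
    ring
end UT

namespace UT
open UC UC.CF USetting
variable {F : Type u} [Field F] {T : USetting F (Fin 4 → F)} {Y : F}
def c4 : Fin 4 → ℤ := ![2, 0, 3, 4]

lemma lat (hodd) (hunram) (hY : Y ∈ T.O) (hYu) {Λ : T.LatSeq} (hΛ : T.IsLam4 Λ) (i : ℤ) (v : Fin 4 → F) :
    v ∈ Λ.L i ↔ ∀ j, v j ∈ (cf (T := T) hodd hunram hY hYu).P ((i + c4 j) / 6) := by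
  obtain ⟨-, h⟩ := hΛ
  obtain ⟨q, r, hr0, hr, rfl⟩ : ∃ q r : ℤ, 0 ≤ r ∧ r < 6 ∧ i = 6 * q + r := ⟨i / 6, i % 6, by omega, by omega, by omega⟩
  have hp := T.ϖ_ne_zero
  have z : ∀ k : ℤ, T.ϖ ^ k ≠ 0 := fun k => zpow_ne_zero _ hp
  have e1 : ∀ x, T.ϖ ^ (-q) * x ∈ T.pF ↔ T.ϖ ^ (-(q+1)) * x ∈ T.O := by
    intro x
    rw [neg_add, zpow_add₀ hp, zpow_neg_one]
    constructor
    · rintro ⟨w, hw, e⟩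
      convert hw using 1
      rw [mul_right_comm, e]; field_simp
    · intro h; exact ⟨_, h, by field_simp⟩
  have e2 : ∀ x, T.ϖ * (T.ϖ ^ (-(q+1)) * x) = T.ϖ ^ (-q) * x := by
    intro x
    rw [neg_add, zpow_add₀ hp, zpow_neg_one]; field_simp
  have key : ∀ k0 k1 k2 k3 : ℤ, (6*q+r+2)/6 = k0 → (6*q+r+0)/6 = k1 → (6*q+r+3)/6 = k2 → (6*q+r+4)/6 = k3 →
      ((∀ j, v j ∈ (cf (T := T) hodd hunram hY hYu).P ((6*q+r + c4 j) / 6)) ↔ T.ϖ ^ (-k0) * v 0 ∈ T.O ∧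
        T.ϖ ^ (-k1) * v 1 ∈ T.O ∧ T.ϖ ^ (-k2) * v 2 ∈ T.O ∧ T.ϖ ^ (-k3) * v 3 ∈ T.O) := by
    rintro _ _ _ _ rfl rfl rfl rfl
    simp only [P_iff]
    exact ⟨fun h => ⟨h 0, h 1, h 2, h 3⟩, fun ⟨a, b, c, d⟩ j => by fin_cases j <;> assumption⟩
  have sm : ∀ (k : ℤ) (N : Set (Fin 4 → F)), v ∈ T.ϖ ^ k • N ↔ T.ϖ ^ (-k) • v ∈ N := fun k N => by
    rw [Set.mem_smul_set_iff_inv_smul_mem₀ (z _), ← zpow_neg]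
  obtain ⟨l0, l1, l2, l3, l4, l5⟩ := h q
  have a4 : ∀ p : Fin 4 → Prop, (∀ j, p j) ↔ p 0 ∧ p 1 ∧ p 2 ∧ p 3 := fun p =>
    ⟨fun h => ⟨h 0, h 1, h 2, h 3⟩, fun ⟨a, b, c, d⟩ j => by fin_cases j <;> assumption⟩
  have n0 : T.ϖ ^ (-q) • v ∈ T.N0 ↔ T.ϖ ^ (-q) * v 0 ∈ T.O ∧ T.ϖ ^ (-q) * v 1 ∈ T.O ∧ T.ϖ ^ (-q) * v 2 ∈ T.O ∧ T.ϖ ^ (-q) * v 3 ∈ T.O := a4 _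
  have n0s : T.ϖ ^ (-(q+1)) • v ∈ T.N0s ↔ T.ϖ ^ (-(q+1)) * v 0 ∈ T.O ∧ T.ϖ * (T.ϖ ^ (-(q+1)) * v 1) ∈ T.O ∧ T.ϖ ^ (-(q+1)) * v 2 ∈ T.O ∧ T.ϖ ^ (-(q+1)) * v 3 ∈ T.O := Iff.rfl
  rw [e2] at n0s
  interval_cases r
  · rw [key q q q q (by omega) (by omega) (by omega) (by omega), add_zero, l0, sm, n0]
  · rw [key q q q q (by omega) (by omega) (by omega) (by omega), l1, sm, n0]
  · rw [key q q q (q+1) (by omega) (by omega) (by omega) (by omega), l2, sm, ← e1]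
    have : T.ϖ ^ (-q) • v ∈ T.N1 ↔ T.ϖ ^ (-q) • v ∈ T.N0 ∧ T.ϖ ^ (-q) * v 3 ∈ T.pF := Iff.rfl
    rw [this, n0]
    constructor
    · rintro ⟨⟨a, b, c, -⟩, d⟩; exact ⟨a, b, c, d⟩
    · rintro ⟨a, b, c, d⟩; refine ⟨⟨a, b, c, ?_⟩, d⟩
      obtain ⟨w, hw, e⟩ := d
      rw [e]; exact T.O.mul_mem T.ϖ_mem hw
  · rw [key q q (q+1) (q+1) (by omega) (by omega) (by omega) (by omega), l3, sm, ← e2 (v 0), ← e2 (v 1)]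
    exact Iff.rfl
  · rw [key (q+1) q (q+1) (q+1) (by omega) (by omega) (by omega) (by omega), l4, sm, n0s]
  · rw [key (q+1) q (q+1) (q+1) (by omega) (by omega) (by omega) (by omega), l5, sm, n0s]

lemma sc_P (hodd) (hunram) (hY : Y ∈ T.O) (hYu) (i : Fin 4) :
    sc Y i ∈ (cf (T := T) hodd hunram hY hYu).P 0 ∧ (sc Y i)⁻¹ ∈ (cf (T := T) hodd hunram hY hYu).P 0 := by
  rw [P0, P0]
  have h1 := T.O.one_mem
  have h2 := Yinv hYu
  fin_cases i <;> simp [sc] <;> first | exact h1 | exact ⟨hY, h2⟩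

lemma afil (hodd) (hunram) (hY : Y ∈ T.O) (hYu) {Λ : T.LatSeq} (hΛ : T.IsLam4 Λ) (k : ℤ) (X : Module.End F (Fin 4 → F)) :
    X ∈ T.aFil Λ k ↔ ∀ l j, mt Y X l j ∈ (cf (T := T) hodd hunram hY hYu).P ((k + 5 + c4 l - c4 j) / 6) := by
  have h0 := Yne hYu
  constructor
  · intro h l j
    have h1 := h (5 - c4 j) (Pi.single j 1) ((lat hodd hunram hY hYu hΛ _ _).2 (by
      intro i
      rw [Pi.single_apply]
      split_ifs with e
      · rw [e, sub_add_cancel]; exact one0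
      · exact (CF.P _ _).zero_mem))
    have h2 := (lat hodd hunram hY hYu hΛ _ _).1 h1 l
    have e : mt Y X l j = (sc Y l)⁻¹ * X (Pi.single j 1) l * sc Y j := by
      simp only [mt, LinearMap.toMatrix'_apply]
    rw [e]
    exact CF.mul (CF.mul (sc_P hodd hunram hY hYu l).2 h2 le_rfl) (sc_P hodd hunram hY hYu j).1 (by omega)
  · intro h i v hv
    rw [lat hodd hunram hY hYu hΛ] at hv ⊢
    intro l
    have e : X v l = ∑ j, LinearMap.toMatrix' X l j * v j := by
      conv_lhs => rw [← Matrix.toLin'_toMatrix' X]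
      rw [Matrix.toLin'_apply]; rfl
    rw [e]
    refine AddSubgroup.sum_mem _ fun j _ => ?_
    have e : LinearMap.toMatrix' X l j = sc Y l * mt Y X l j * (sc Y j)⁻¹ := by
      have := sc_ne h0 l
      have := sc_ne h0 j
      simp only [mt]; field_simp
    rw [e]
    refine CF.mul (CF.mul (CF.mul (sc_P hodd hunram hY hYu l).1 (h l j) le_rfl) (sc_P hodd hunram hY hYu j).2 le_rfl) (hv j) (by omega)

end UT

namespace UT
open UC UC.CF USetting
variable {F : Type u} [Field F] {T : USetting F (Fin 4 → F)} {Y : F}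

lemma jm_iff (C : CF F) (m : ℤ) (M : M4 F) : JM C m M ↔ ∃ A B : M4 F, M - 1 = A + B ∧
    EM C A ∧ (∀ l j, A l j ∈ C.P ((6 * m + 2 + c4 l - c4 j) / 6)) ∧
    BP C B ∧ (∀ l j, B l j ∈ C.P ((3 * m + 4 + c4 l - c4 j) / 6)) := by
  have hp := C.π_ne
  have h2 := C.two
  constructor
  · rintro ⟨h00, h03, h30, h33, c0, c3, h01, h31, h02, h32, tr, df, om, op⟩
    have zz : ∀ k, (0:F) ∈ C.P k := fun k => (C.P k).zero_mem
    have t2 : ∀ {k x}, x ∈ C.P k → x / 2 ∈ C.P k := fun h => by rw [div_eq_mul_inv]; exact CF.mul h two0 (by omega)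
    have pi : ∀ {k x}, x ∈ C.P k → x / C.π ∈ C.P (k - 1) := fun {k x} h => by
      rw [← pmul1]; convert h using 1; field_simp
    have neg : ∀ {k x}, x ∈ C.P k → -x ∈ C.P k := fun h => (C.P _).neg_mem h
    refine ⟨!![M 0 0 - 1, 0, 0, M 0 3; 0, (M 1 1 + M 2 2 - 2) / 2, (C.π * M 1 2 - M 2 1) / 2 / C.π, 0;
        0, -((C.π * M 1 2 - M 2 1) / 2), (M 1 1 + M 2 2 - 2) / 2, 0; M 3 0, 0, 0, M 3 3 - 1],
      !![0, M 0 1, M 0 2, 0; M 1 0, (M 1 1 - M 2 2) / 2, (C.π * M 1 2 + M 2 1) / 2 / C.π, M 1 3;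
        M 2 0, (C.π * M 1 2 + M 2 1) / 2, -((M 1 1 - M 2 2) / 2), M 2 3; 0, M 3 1, M 3 2, 0], ?_, ?_, ?_, ?_, ?_⟩
    · ext i j
      fin_cases i <;> fin_cases j <;> simp [Matrix.one_apply] <;> field_simp <;> ring
    · constructor <;> simp <;> field_simp
    · intro l j
      fin_cases l <;> fin_cases j <;> simp [c4, zz] <;>
      first
        | exact CF.mono h00 (by omega) | exact CF.mono h03 (by omega) | exact CF.mono h30 (by omega)
        | exact CF.mono h33 (by omega) | exact CF.mono (t2 tr) (by omega) | exact CF.mono (pi (t2 om)) (by omega)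
        | exact CF.mono (t2 om) (by omega)
    · constructor <;> simp <;> field_simp
    · intro l j
      fin_cases l <;> fin_cases j <;> simp [c4, zz] <;>
      first
        | exact CF.mono h01 (by omega) | exact CF.mono h02 (by omega) | exact CF.mono h31 (by omega)
        | exact CF.mono h32 (by omega) | exact CF.mono c0.1 (by omega) | exact CF.mono c0.2 (by omega)
        | exact CF.mono c3.1 (by omega) | exact CF.mono c3.2 (by omega)
        | exact CF.mono (t2 df) (by omega) | exact CF.mono (pi (t2 op)) (by omega)
        | exact CF.mono (t2 op) (by omega)
  · rintro ⟨A, B, e, ⟨a1, a2, a3, a4, a5, a6, a7, a8, a9, a10⟩, hA, ⟨b1, b2, b3, b4, b5, b6⟩, hB⟩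
    have E : ∀ i j, M i j = (1 : M4 F) i j + (A i j + B i j) := by
      intro i j; have := congrFun (congrFun e i) j
      simp only [Matrix.sub_apply, Matrix.add_apply] at this
      linear_combination this
    have g : ∀ (X : M4 F) (k : ℤ) (x : F) l j (t : ℤ), (∀ l j, X l j ∈ C.P ((k + c4 l - c4 j) / 6)) → x = X l j → t ≤ (k + c4 l - c4 j) / 6 → x ∈ C.P t := by
      intro X k x l j t h e i; rw [e]; exact CF.mono (h l j) i
    have g2 : ∀ (X : M4 F) (k : ℤ) (x : F) l j (t : ℤ), (∀ l j, X l j ∈ C.P ((k + c4 l - c4 j) / 6)) → x = X l j + X l j → t ≤ (k + c4 l - c4 j) / 6 → x ∈ C.P t := by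
      intro X k x l j t h e i; rw [e]; exact (C.P _).add_mem (CF.mono (h l j) i) (CF.mono (h l j) i)
    have w1 : ∀ i : Fin 4, (1 : M4 F) i i = 1 := fun i => Matrix.one_apply_eq i
    have w0 : ∀ i j : Fin 4, i ≠ j → (1 : M4 F) i j = 0 := fun i j h => Matrix.one_apply_ne h
    refine ⟨g A _ _ 0 0 _ hA ?_ ?_, g A _ _ 0 3 _ hA ?_ ?_, g A _ _ 3 0 _ hA ?_ ?_, g A _ _ 3 3 _ hA ?_ ?_,
      ⟨g B _ _ 1 0 _ hB ?_ ?_, g B _ _ 2 0 _ hB ?_ ?_⟩, ⟨g B _ _ 1 3 _ hB ?_ ?_, g B _ _ 2 3 _ hB ?_ ?_⟩,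
      g B _ _ 0 1 _ hB ?_ ?_, g B _ _ 3 1 _ hB ?_ ?_, g B _ _ 0 2 _ hB ?_ ?_, g B _ _ 3 2 _ hB ?_ ?_,
      g2 A _ _ 1 1 _ hA ?_ ?_, g2 B _ _ 1 1 _ hB ?_ ?_, ?_, g2 B _ _ 2 1 _ hB ?_ ?_⟩
    rotate_right 3
    · have : C.π * M 1 2 - M 2 1 = -(A 2 1 + A 2 1) := by
        rw [E, E, w0 _ _ (by decide), w0 _ _ (by decide), a10, b6]; ring
      rw [this]
      exact (C.P _).neg_mem (g2 A _ _ 2 1 _ hA rfl (by simp [c4]; omega))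
    all_goals first
      | (simp [c4]; omega)
      | (simp only [E, w1, a1, a2, a3, a4, a5, a6, a7, a8, a9, a10, b1, b2, b3, b4, b5, b6]
         try simp only [w0 1 2 (by decide), w0 2 1 (by decide), w0 0 1 (by decide), w0 0 2 (by decide), w0 0 3 (by decide), w0 1 0 (by decide), w0 2 0 (by decide), w0 3 0 (by decide), w0 1 3 (by decide), w0 2 3 (by decide), w0 3 1 (by decide), w0 3 2 (by decide)]
         ring)

lemma memJ_iff (hodd) (hunram) (hY : Y ∈ T.O) (hYu) {Λ : T.LatSeq} (hΛ : T.IsLam4 Λ) (m : ℤ) (g : T.GU) :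
    g ∈ T.Jplusset Λ (6 * m - 3) (Matrix.toLin' (T.betaMat m Y)) ↔ JM (cf (T := T) hodd hunram hY hYu) m (mt Y (T.toE g)) := by
  have h0 := Yne hYu
  rw [jm_iff]
  have k1 : 6 * m - 3 + 5 = 6 * m + 2 := by ring
  have k2 : (6 * m - 3) / 2 + 1 + 5 = 3 * m + 4 := by omega
  constructor
  · rintro ⟨A, ⟨hA, hA'⟩, B, ⟨hB, hB'⟩, e⟩
    rw [afil hodd hunram hY hYu hΛ, k1] at hA
    rw [afil hodd hunram hY hYu hΛ, k2] at hB
    exact ⟨mt Y A, mt Y B, by rw [← mt_add, ← e, mt_sub, mt_one h0], (cent_iff hodd hunram hY hYu m _).1 hA', hA,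
      (perp_iff hodd hunram hY hYu m _).1 hB', hB⟩
  · rintro ⟨A, B, e, hA', hA, hB', hB⟩
    refine ⟨tm Y A, ⟨?_, ?_⟩, tm Y B, ⟨?_, ?_⟩, ?_⟩
    · rw [afil hodd hunram hY hYu hΛ, k1, mt_tm h0]; exact hA
    · rw [cent_iff hodd hunram hY hYu m, mt_tm h0]; exact hA'
    · rw [afil hodd hunram hY hYu hΛ, k2, mt_tm h0]; exact hB
    · rw [perp_iff hodd hunram hY hYu m, mt_tm h0]; exact hB'
    · apply mt_inj h0
      rw [mt_add, mt_tm h0, mt_tm h0, ← e, mt_sub, mt_one h0]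
end UT

namespace UT
open UC UC.CF USetting
variable {F : Type u} [Field F] {T : USetting F (Fin 4 → F)} {Y : F}
variable (F₀ : Type w) [Field F₀] [Algebra F₀ F] [FiniteDimensional F₀ F]

lemma resid : ∀ x ∈ T.O, (Nat.card (T.O ⧸ (Ideal.span {(⟨T.ϖ, T.ϖ_mem⟩ : T.O)} : Ideal T.O)) : F) * x ∈ T.pF := by
  intro x hx
  have h := card_nsmul_eq_zero' (x := Ideal.Quotient.mk (Ideal.span {(⟨T.ϖ, T.ϖ_mem⟩ : T.O)} : Ideal T.O) ⟨x, hx⟩)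
  rw [← map_nsmul, Ideal.Quotient.eq_zero_iff_mem, Ideal.mem_span_singleton] at h
  obtain ⟨⟨z, hz⟩, e⟩ := h
  refine ⟨z, hz, ?_⟩
  have := congrArg Subtype.val e
  rw [← nsmul_eq_mul]
  exact this

def mkCG (hodd : ¬ (2 ∣ T.residueChar)) (hform : T.IsU4Form) (hunram : T.IsUnramifiedQuadratic)
    (hfix : T.FixedField F₀) (hdeg : Module.finrank F₀ F = 2)
    (ψ₀ : F₀ → ℂ) (hψ : T.IsAddCh F₀ ψ₀) (m : ℤ) (hm : 1 ≤ m) (Λ : T.LatSeq) (hΛ : T.IsLam4 Λ)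
    (hY : Y ∈ T.O) (hYu : ∃ z ∈ T.O, Y * z = 1) (Jg GE : Subgroup T.GU)
    (hJ : (Jg : Set T.GU) = T.Jplusset Λ (6 * m - 3) (Matrix.toLin' (T.betaMat m Y)))
    (hE : (GE : Set T.GU) = T.GEset (Matrix.toLin' (T.betaMat m Y))) : CG F T.GU := by
  have hadd : ∀ x y, ψ₀ (Algebra.trace F₀ F (mu T Y ^ m * (x + y))) = ψ₀ (Algebra.trace F₀ F (mu T Y ^ m * x)) * ψ₀ (Algebra.trace F₀ F (mu T Y ^ m * y)) := by
    intro x y; rw [mul_add, map_add, hψ.1]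
  have hP1 : ∀ x ∈ T.pF, ψ₀ (Algebra.trace F₀ F (mu T Y ^ m * x)) = 1 := by
    rintro _ ⟨z, hz, rfl⟩
    apply hψ.2.1
    rw [trace_eq hodd F₀ hfix hdeg]
    have hz' := T.O.mul_mem (zmem (mu_mem hY) (mu_inv hYu) m) hz
    refine ⟨_, T.O.add_mem hz' (T.conj_O _ hz'), ?_⟩
    simp only [map_mul, hunram.1]
    ring
  exact {
  toCF := cf hodd hunram hY hYu
  ψ := fun x => ψ₀ (Algebra.trace F₀ F (mu T Y ^ m * x))
  ψ_add := hadd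
  ψ_P1 := by
    intro x hx
    apply hP1
    rw [P_iff] at hx
    exact ⟨_, hx, by rw [zpow_neg_one, mul_inv_cancel_left₀ T.ϖ_ne_zero]⟩
  ψ_im := by
    intro x hx
    apply hψ.2.1
    rw [trace_eq hodd F₀ hfix hdeg, map_mul, map_zpow₀, mu_cj]
    have e : T.conj x = -x := hx
    rw [e]
    exact ⟨0, T.O.zero_mem, by ring⟩
  ψ_r := by
    obtain ⟨x, hx, hx'⟩ := hψ.2.2
    obtain ⟨y, hy, e⟩ := two_unit hodd
    have cy : T.conj y = y := by
      have := congrArg T.conj e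
      rw [map_mul, map_ofNat, map_one, ← e] at this
      have t2 : (2:F) ≠ 0 := by rintro h; rw [h] at e; simp at e
      exact mul_left_cancel₀ t2 this
    refine ⟨mu T Y ^ (-m) * (y * algebraMap F₀ F x), T.O.mul_mem (zmem (mu_mem hY) (mu_inv hYu) _) (T.O.mul_mem hy hx), ?_, ?_⟩
    · show T.conj _ = _
      rw [map_mul, map_mul, map_zpow₀, mu_cj, cy, (hfix _).2 ⟨x, rfl⟩]
    · have h1 : mu T Y ^ m * (mu T Y ^ (-m) * (y * algebraMap F₀ F x)) = y * algebraMap F₀ F x := by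
        rw [← mul_assoc, ← zpow_add₀ (mu_ne hYu)]; simp
      rw [h1]
      have h2 : Algebra.trace F₀ F (y * algebraMap F₀ F x) = x := by
        apply (algebraMap F₀ F).injective
        rw [trace_eq hodd F₀ hfix hdeg, map_mul, cy, (hfix _).2 ⟨x, rfl⟩]
        linear_combination (algebraMap F₀ F x) * e
      rwa [h2]
  ψ_norm := by
    intro x hx
    haveI := T.res_fin
    set N := Nat.card (T.O ⧸ (Ideal.span {(⟨T.ϖ, T.ϖ_mem⟩ : T.O)} : Ideal T.O)) with hN
    have hN0 : N ≠ 0 := Nat.card_pos.ne'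
    have h1 : ∀ n : ℕ, ψ₀ (Algebra.trace F₀ F (mu T Y ^ m * (n * x))) = ψ₀ (Algebra.trace F₀ F (mu T Y ^ m * x)) ^ n := by
      intro n
      induction n with
      | zero => simpa using hP1 0 ⟨0, T.O.zero_mem, by simp⟩
      | succ n ih => rw [Nat.cast_succ, add_mul, one_mul, hadd, ih, pow_succ]
    have h2 := h1 N
    rw [hP1 _ (resid x hx)] at h2
    have h3 := congrArg norm h2
    rw [norm_pow, norm_one] at h3
    exact (pow_eq_one_iff_of_nonneg (norm_nonneg _) hN0).1 h3.symm
  m := m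
  hm := hm
  mat := fun g => mt Y (T.toE g)
  mat_mul := fun a b => mt_mul (Yne hYu) _ _
  mat_one := mt_one (Yne hYu)
  mat_inj := fun a b h => Subtype.ext (Units.ext (mt_inj (Yne hYu) h))
  mat_inv := fun a => by
    rw [← sig hform]
    congr 1
    exact a.2.symm
  mat_sur := by
    intro M hM
    have h0 := Yne hYu
    rw [← mt_tm h0 M, ← sig hform, ← mt_mul h0, ← mt_one h0] at hM
    have h1 := mt_inj h0 hM
    have h2 : T.σA (tm Y M) * tm Y M = 1 := mul_eq_one_comm.1 h1
    exact ⟨⟨⟨tm Y M, T.σA (tm Y M), h1, h2⟩, rfl⟩, mt_tm h0 M⟩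
  J := Jg
  GE := GE
  memJ := fun g => by
    rw [← memJ_iff hodd hunram hY hYu hΛ, ← hJ]; rfl
  memE := fun g => by
    rw [← cent_iff hodd hunram hY hYu m]
    have : g ∈ GE ↔ g ∈ (GE : Set T.GU) := Iff.rfl
    rw [this, hE]; rfl }

def GEg (T : USetting F (Fin 4 → F)) (β : Module.End F (Fin 4 → F)) : Subgroup T.GU where
  carrier := T.GEset β
  one_mem' := by show (1 : Module.End F (Fin 4 → F)) * β = β * 1; simp
  mul_mem' := by
    intro a b ha hb
    have ha : T.toE a * β = β * T.toE a := ha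
    have hb : T.toE b * β = β * T.toE b := hb
    show (T.toE a * T.toE b) * β = β * (T.toE a * T.toE b)
    rw [mul_assoc, hb, ← mul_assoc, ha, mul_assoc]
  inv_mem' := by
    intro a ha
    have ha : T.toE a * β = β * T.toE a := ha
    show T.toE a⁻¹ * β = β * T.toE a⁻¹
    have h1 : T.toE a⁻¹ * T.toE a = 1 := a.1.inv_mul
    have h2 : T.toE a * T.toE a⁻¹ = 1 := a.1.mul_inv
    calc T.toE a⁻¹ * β = T.toE a⁻¹ * β * (T.toE a * T.toE a⁻¹) := by rw [h2, mul_one]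
      _ = T.toE a⁻¹ * (β * T.toE a) * T.toE a⁻¹ := by simp only [mul_assoc]
      _ = _ := by rw [← ha, ← mul_assoc, h1, one_mul]
end UT

namespace UT
open UC UC.CF USetting
variable {F : Type u} [Field F] {T : USetting F (Fin 4 → F)} {Y : F}
variable (F₀ : Type w) [Field F₀] [Algebra F₀ F] [FiniteDimensional F₀ F]

lemma tau_eq (hunram : T.IsUnramifiedQuadratic) (hYu : ∃ z ∈ T.O, Y * z = 1) (m : ℤ) (g : T.GU) :
    trA0 F₀ (Matrix.toLin' (T.betaMat m Y) * (T.toE g - 1)) = Algebra.trace F₀ F (mu T Y ^ m *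
      ((T.ϖ * mu T Y) ^ (-m) * (mt Y (T.toE g) 2 1 - (T.ϖ * mu T Y) * mt Y (T.toE g) 1 2))) := by
  have h0 := Yne hYu
  have h1 := mu_ne hYu
  unfold trA0
  congr 1
  rw [mt_tr h0, mt_mul h0, mt_sub, mt_one h0, mt_beta hunram hYu]
  have tr4 : ∀ M N : M4 F, (M * N).trace = ∑ i, ∑ j, M i j * N j i := fun M N => rfl
  have e : ∀ z, mu T Y ^ m * ((T.ϖ * mu T Y) ^ (-m) * z) = T.ϖ ^ (-m) * z := by
    intro z
    rw [mul_zpow, zpow_neg (mu T Y)]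
    have := zpow_ne_zero m h1
    field_simp
  rw [tr4, e]
  simp [Fin.sum_univ_four]
  ring
end UT

open USetting in
/-- **Theorem 6.3.** For the non quasi-split unramified `U(4)`,
`Λ = Λ₄`, `n = 6m - 3`, `β = ϖ^{-m}(Y E₂₃ - ϖ Ȳ E₃₂)` with `Y ∈ o_F^×`,
`J = J₊ = (1 + 𝔍₊) ∩ G`, `Ψ = Ψ_β`, `G_E = G ∩ B`, `J' = G_E ∩ J`:
there is a support-preserving `*`-isomorphism
`η : H(G_E//J', Ψ) → H(G//J, Ψ)` with
`η(e_g) = (vol(J'gJ')/vol(JgJ))^{1/2} f_g` for `g ∈ G_E`. -/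
theorem statement_19
    {F : Type u} [Field F] (T : USetting F (Fin 4 → F))
    (hodd : ¬ (2 ∣ T.residueChar))
    (hform : T.IsU4Form) (hunram : T.IsUnramifiedQuadratic)
    (F₀ : Type w) [Field F₀] [Algebra F₀ F] [FiniteDimensional F₀ F]
    (hfix : T.FixedField F₀) (hdeg : Module.finrank F₀ F = 2)
    (ψ₀ : F₀ → ℂ) (hψ : T.IsAddCh F₀ ψ₀)
    -- the stratum data
    (m : ℤ) (hm : 1 ≤ m) (n : ℤ) (hn : n = 6 * m - 3)
    (Λ : T.LatSeq) (hΛ : T.IsLam4 Λ)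
    (Y : F) (hY : Y ∈ T.O) (hYu : ∃ z ∈ T.O, Y * z = 1)
    (β : Module.End F (Fin 4 → F)) (hβ : β = Matrix.toLin' (T.betaMat m Y))
    -- `J = J₊ = (1 + 𝔍₊) ∩ G` and `J' = G_E ∩ J` as subgroups
    (Jgrp J'grp : Subgroup T.GU)
    (hJgrp : (Jgrp : Set T.GU) = T.Jplusset Λ n β)
    (hJ'grp : (J'grp : Set T.GU) = T.GEset β ∩ T.Jplusset Λ n β)
    -- the Hecke algebras `H(G_E//J', Ψ)` and `H(G//J, Ψ)`
    (HE HG : Set (T.GU → ℂ))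
    (hHE : HE = {e | T.IsHecke J'grp (T.GEset β) (fun x => (T.psiCh F₀ ψ₀ β x)⁻¹) e})
    (hHG : HG = {f | T.IsHecke Jgrp Set.univ (fun x => (T.psiCh F₀ ψ₀ β x)⁻¹) f}) :
    ∃ η : (T.GU → ℂ) → (T.GU → ℂ),
      -- bijective from `H(G_E//J', Ψ)` onto `H(G//J, Ψ)`
      Set.InjOn η HE ∧ η '' HE = HG ∧
      -- `ℂ`-algebra homomorphism (additive, `ℂ`-linear, convolution-multiplicative)
      (∀ e₁ ∈ HE, ∀ e₂ ∈ HE, η (e₁ + e₂) = η e₁ + η e₂) ∧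
      (∀ (c : ℂ), ∀ e ∈ HE, η (c • e) = c • η e) ∧
      (∀ e₁ ∈ HE, ∀ e₂ ∈ HE, η (T.hConv J'grp e₁ e₂) = T.hConv Jgrp (η e₁) (η e₂)) ∧
      -- `*`-preserving
      (∀ e ∈ HE, η (fun g => star (e g⁻¹)) = fun g => star (η e g⁻¹)) ∧
      -- support-preserving
      (∀ e ∈ HE, ∀ g₀ ∈ T.GEset β, Function.support e ⊆ T.dCoset J'grp g₀ →
        Function.support (η e) ⊆ T.dCoset Jgrp g₀) ∧
      -- explicitly, `η(e_g) = (vol(J'gJ')/vol(JgJ))^{1/2} • f_g` for `g ∈ G_E`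
      (∀ g₀ ∈ T.GEset β, ∀ e ∈ HE, Function.support e ⊆ T.dCoset J'grp g₀ →
        e g₀ = 1 →
        ∀ f ∈ HG, Function.support f ⊆ T.dCoset Jgrp g₀ → f g₀ = 1 →
        η e = (Real.sqrt ((T.dcIndex J'grp g₀ : ℝ) / (T.dcIndex Jgrp g₀ : ℝ)) : ℂ) • f) := by

  subst hn hβ hHE hHG
  let GE := UT.GEg T (Matrix.toLin' (T.betaMat m Y))
  let U := UT.mkCG F₀ hodd hform hunram hfix hdeg ψ₀ hψ m hm Λ hΛ hY hYu Jgrp GE hJgrp rfl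
  haveI := T.res_fin
  let f : (T.O ⧸ (Ideal.span {(⟨T.ϖ, T.ϖ_mem⟩ : T.O)} : Ideal T.O)) → F := fun q => (Quotient.out q : T.O)
  have hf : ∀ x ∈ U.P 0, ∃ s, x - f s ∈ U.P 1 := by
    intro x hx
    have hx : x ∈ T.O := UC.CF.P0.1 hx
    refine ⟨Ideal.Quotient.mk _ ⟨x, hx⟩, ?_⟩
    have h1 : Ideal.Quotient.mk (Ideal.span {(⟨T.ϖ, T.ϖ_mem⟩ : T.O)} : Ideal T.O)
        (Quotient.out (Ideal.Quotient.mk (Ideal.span {(⟨T.ϖ, T.ϖ_mem⟩ : T.O)} : Ideal T.O) ⟨x, hx⟩) : T.O) = Ideal.Quotient.mk _ ⟨x, hx⟩ := Quotient.out_eq _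
    rw [eq_comm, Ideal.Quotient.eq, Ideal.mem_span_singleton] at h1
    obtain ⟨z, e⟩ := h1
    have e' := congrArg Subtype.val e
    refine (UT.P_iff hodd hunram hY hYu 1 _).2 ?_
    have e2 : x - f (Ideal.Quotient.mk _ ⟨x, hx⟩) = T.ϖ * z := e'
    rw [e2, zpow_neg_one, inv_mul_cancel_left₀ T.ϖ_ne_zero]
    exact z.2
  haveI := UC.CG.finR f hf
  haveI := UC.CG.finZ f hf
  haveI := Fintype.ofFinite U.RT
  haveI := Fintype.ofFinite U.ZT
  let H := UC.CG.HDof (UC.CG.famOf U)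
  have hJ' : J'grp = H.J' := by
    apply SetLike.coe_injective
    rw [hJ'grp, ← hJgrp, Set.inter_comm]; rfl
  have hτ : (fun x => (T.psiCh F₀ ψ₀ (Matrix.toLin' (T.betaMat m Y)) x)⁻¹) = H.τ := by
    funext g
    show (ψ₀ _)⁻¹ = _
    rw [UT.tau_eq F₀ hunram hYu]; rfl
  rw [hJ', hτ]
  have hu : (Set.univ : Set T.GU) = ((⊤ : Subgroup T.GU) : Set T.GU) := rfl
  refine ⟨H.eta, H.eta_inj, ?_, fun e₁ _ e₂ _ => H.eta_add _ _, fun c e _ => H.eta_smul _ _,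
    fun e₁ h₁ e₂ h₂ => H.eta_mul e₁ e₂ h₁ h₂, fun e he => H.eta_star e he (H.star_HE e he),
    fun e _ g₀ _ h => H.eta_supp e g₀ h, fun g₀ hg e he hs h1 f hf hfs hf1 =>
      H.explicit g₀ hg e he hs h1 f hf hfs hf1⟩
  ext φ
  constructor
  · rintro ⟨e, he, rfl⟩; exact H.eta_HG e he
  · intro h; exact H.eta_surj φ h
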